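/- Let R be a local Gorenstein ring with infinite residue field, let I be a perfect R-ideal of height two and analytic spread ℓ satisfying G_ℓ, and let φ be a matrix with n rows presenting I. Then the reduction number of I is at most ℓ − 1 if and only if core(I) = I_{n−ℓ}(φ)·I. Moreover, if either condition holds and R and I are normal, then I_{n−ℓ}(φ) and core(I) are integrally closed. -/

import Mathlib

open IsLocalRing

universe u v

namespace CPU

section Defs

variable {R : Type u} [CommRing R]

/-- The minimal number of generators of a submodule, as an extended natural number. -/
noncomputable def muE {M : Type v} [AddCommGroup M] [Module R M] (N : Submodule R M) : ℕ∞ :=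
  sInf {n : ℕ∞ | ∃ s : Finset M, (s.card : ℕ∞) = n ∧ Submodule.span R (s : Set M) = N}

/-- The Krull dimension of a ring, valued in `WithBot ℕ∞`. -/
noncomputable def rDim (S : Type v) [CommRing S] : WithBot ℕ∞ :=
  ringKrullDim S

/-- `J` is a reduction of `I`. -/
def IsReduction (J I : Ideal R) : Prop :=
  J ≤ I ∧ ∃ r : ℕ, I ^ (r + 1) = J * I ^ r

/-- `J` is a minimal reduction of `I`. -/
def IsMinimalReduction (J I : Ideal R) : Prop :=
  IsReduction J I ∧ ∀ J' : Ideal R, IsReduction J' I → J' ≤ J → J' = J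

/-- The core of an ideal: the intersection of all of its minimal reductions. -/
noncomputable def core (I : Ideal R) : Ideal R :=
  sInf {J : Ideal R | IsMinimalReduction J I}

/-- The reduction number of `I`. -/
noncomputable def reductionNumber (I : Ideal R) : ℕ∞ :=
  sInf {n : ℕ∞ | ∃ r : ℕ, (r : ℕ∞) = n ∧ ∃ J : Ideal R,
    IsMinimalReduction J I ∧ I ^ (r + 1) = J * I ^ r}

/-- `γ(I)`: the least number of minimal reductions whose intersection is the core. -/
noncomputable def gamma (I : Ideal R) : ℕ∞ :=
  sInf {n : ℕ∞ | ∃ t : ℕ, (t : ℕ∞) = n ∧ ∃ Js : Fin t → Ideal R,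
    (∀ i, IsMinimalReduction (Js i) I) ∧ core I = ⨅ i, Js i}

/-- The height of an ideal. -/
noncomputable def ht (I : Ideal R) : WithBot ℕ∞ :=
  ⨅ (p : PrimeSpectrum R) (_ : I ≤ p.asIdeal),
    rDim (Localization.AtPrime p.asIdeal)

/-- The Krull dimension of the special fiber ring of `I`,
i.e. the analytic spread of `I`. -/
noncomputable def fiberDim [IsLocalRing R] (I : Ideal R) : WithBot ℕ∞ :=
  rDim (↥(reesAlgebra I) ⧸
    (Ideal.map (algebraMap R ↥(reesAlgebra I)) (maximalIdeal R)))

/-- The condition `G_s`. -/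
def Gcond (I : Ideal R) (s : ℕ) : Prop :=
  ∀ p : PrimeSpectrum R, I ≤ p.asIdeal →
    rDim (Localization.AtPrime p.asIdeal) < (s : WithBot ℕ∞) →
    (muE (Ideal.map (algebraMap R (Localization.AtPrime p.asIdeal)) I) : WithBot ℕ∞) ≤
      rDim (Localization.AtPrime p.asIdeal)

/-- Depth of a module over a local ring, via lengths of regular sequences in the
maximal ideal. -/
noncomputable def mDepth (R : Type u) [CommRing R] [IsLocalRing R]
    (M : Type v) [AddCommGroup M] [Module R M] : ℕ∞ :=
  sSup {n : ℕ∞ | ∃ rs : List R, (∀ x ∈ rs, x ∈ maximalIdeal R) ∧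
    RingTheory.Sequence.IsRegular M rs ∧ (rs.length : ℕ∞) = n}

/-- Depth of the quotient `R/K` of a local ring `R`. -/
noncomputable def qDepth (R : Type u) [CommRing R] [IsLocalRing R] (K : Ideal R) : ℕ∞ :=
  mDepth R (R ⧸ K)

/-- The socle of `R/K`, for `R` local. -/
noncomputable def socle (R : Type u) [CommRing R] [IsLocalRing R] (K : Ideal R) :
    Ideal (R ⧸ K) :=
  Submodule.colon (⊥ : Ideal (R ⧸ K)) (Ideal.map (Ideal.Quotient.mk K) (maximalIdeal R))

/-- The Cohen–Macaulay type of the quotient `R/K` of a local ring `R`. -/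
noncomputable def qType (R : Type u) [CommRing R] [IsLocalRing R] (K : Ideal R) : ℕ∞ :=
  sInf {n : ℕ∞ | ∃ rs : List R, (∀ x ∈ rs, x ∈ maximalIdeal R) ∧
    RingTheory.Sequence.IsRegular (R ⧸ K) rs ∧ (rs.length : ℕ∞) = qDepth R K ∧
    muE (socle R (K ⊔ Ideal.ofList rs)) = n}

/-- Cohen–Macaulayness for a quotient `R/K` of a local ring `R`. -/
def IsCMQuot (R : Type u) [CommRing R] [IsLocalRing R] (K : Ideal R) : Prop :=
  rDim (R ⧸ K) = (qDepth R K : WithBot ℕ∞)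

/-- A Cohen–Macaulay local ring: depth equals Krull dimension. -/
def IsCMLocalRing (R : Type u) [CommRing R] [IsLocalRing R] : Prop :=
  rDim R = (qDepth R (⊥ : Ideal R) : WithBot ℕ∞)

/-- A Gorenstein local ring: Cohen–Macaulay of type one. -/
def IsGorensteinLocalRing (R : Type u) [CommRing R] [IsLocalRing R] : Prop :=
  IsCMLocalRing R ∧ qType R (⊥ : Ideal R) = 1

/-- Gorensteinness of the quotient ring `R/K` of a local ring. -/
def IsGorQuot (R : Type u) [CommRing R] [IsLocalRing R] (K : Ideal R) : Prop :=
  IsCMQuot R K ∧ qType R K = 1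

/-- A regular local ring: the maximal ideal is generated by `dim R` elements. -/
def IsRegularLocal (R : Type u) [CommRing R] [IsLocalRing R] : Prop :=
  IsNoetherianRing R ∧ (muE (maximalIdeal R) : WithBot ℕ∞) = rDim R

/-- Serre's condition `S₂` for the quotient ring `R/K`. -/
def QuotS2 (K : Ideal R) : Prop :=
  ∀ (q : Ideal R) (hq : q.IsPrime), K ≤ q →
    letI := hq
    min 2 (rDim ((Localization.AtPrime q) ⧸
        (Ideal.map (algebraMap R (Localization.AtPrime q)) K)))
      ≤ (qDepth (Localization.AtPrime q)
          (Ideal.map (algebraMap R (Localization.AtPrime q)) K) : WithBot ℕ∞)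

/-- `K` is an `s`-residual intersection of `I`. -/
def IsResidualIntersection (I K : Ideal R) (s : ℕ) : Prop :=
  K ≠ ⊤ ∧ ht I ≤ (s : WithBot ℕ∞) ∧ (s : WithBot ℕ∞) ≤ ht K ∧
    ∃ a : Ideal R, a ≤ I ∧ (∃ f : Finset R, f.card ≤ s ∧ Ideal.span (f : Set R) = a) ∧
      K = Submodule.colon a I

/-- `K` is a geometric `s`-residual intersection of `I`. -/
def IsGeometricRI (I K : Ideal R) (s : ℕ) : Prop :=
  IsResidualIntersection I K s ∧ (s : WithBot ℕ∞) + 1 ≤ ht (I ⊔ K)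

/-- `I` is weakly `s`-residually `S₂`. -/
def WeaklyResS2 (I : Ideal R) (s : ℕ) : Prop :=
  ∀ i ≤ s, ∀ K : Ideal R, IsGeometricRI I K i → QuotS2 K

/-- The condition `AN_s` for `I`. -/
def ANcond [IsLocalRing R] (I : Ideal R) (s : ℕ) : Prop :=
  ∀ i ≤ s, ∀ K : Ideal R, IsResidualIntersection I K i → IsCMQuot R K

/-- The condition `AN_s⁻` for `I`. -/
def ANminus [IsLocalRing R] (I : Ideal R) (s : ℕ) : Prop :=
  ∀ i ≤ s, ∀ K : Ideal R, IsGeometricRI I K i → IsCMQuot R K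

/-- `I` is universally weakly `s`-residually `S₂`: for every finite set of
variables, the extension of `I` to `R(x₁, …, x_n)` is weakly `s`-residually `S₂`. -/
def UnivWeaklyResS2 [IsLocalRing R] (I : Ideal R) (s : ℕ) : Prop :=
  ∀ (n : ℕ)
    (hP : (Ideal.map (MvPolynomial.C (σ := Fin n)) (maximalIdeal R)).IsPrime),
    letI := hP
    WeaklyResS2 (Ideal.map
      ((algebraMap (MvPolynomial (Fin n) R)
        (Localization.AtPrime
          (Ideal.map (MvPolynomial.C (σ := Fin n)) (maximalIdeal R)))).comp
        (MvPolynomial.C)) I) s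

/-- The `j`-th Fitting ideal of (the module) `I`. -/
noncomputable def fittingIdeal (I : Ideal R) (j : ℕ) : Ideal R :=
  ⨆ (n : ℕ) (π : (Fin n → R) →ₗ[R] R) (_ : LinearMap.range π = I),
    Ideal.span {d : R | ∃ (v : Fin (n - j) → (Fin n → R)) (r : Fin (n - j) → Fin n),
      (∀ k, π (v k) = 0) ∧ d = Matrix.det (Matrix.of fun i k => v k (r i))}

/-- The set `Q(I)` of primes containing `Fitt_ℓ(I)` at which `R` has dimension `ℓ`
and `I` has analytic spread `ℓ`. -/
def QSet [IsLocalRing R] (I : Ideal R) (l : ℕ) : Set (PrimeSpectrum R) :=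
  {p | fittingIdeal I l ≤ p.asIdeal ∧
    rDim (Localization.AtPrime p.asIdeal) = (l : WithBot ℕ∞) ∧
    fiberDim (Ideal.map (algebraMap R (Localization.AtPrime p.asIdeal)) I)
      = (l : WithBot ℕ∞)}

/-- An ideal is integrally closed if it admits no larger ideal of which it is a
reduction. -/
def IsIntClosedIdeal (I : Ideal R) : Prop :=
  ∀ J : Ideal R, IsReduction I J → J = I

/-- A normal ideal: all powers are integrally closed. -/
def IsNormalIdeal (I : Ideal R) : Prop :=
  ∀ j : ℕ, IsIntClosedIdeal (I ^ j)

/-- `φ` is a presentation matrix of the ideal `I` (with `n = μ(I)` rows). -/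
def Presents {n m : ℕ} (φ : Matrix (Fin n) (Fin m) R) (I : Ideal R) : Prop :=
  muE I = (n : ℕ∞) ∧ ∃ π : (Fin n → R) →ₗ[R] R, LinearMap.range π = I ∧
    LinearMap.range (Matrix.toLin' φ) = LinearMap.ker π

/-- The ideal of `t × t` minors of a matrix. -/
noncomputable def minorsIdeal {n m : ℕ} (t : ℕ) (φ : Matrix (Fin n) (Fin m) R) : Ideal R :=
  Ideal.span {d : R | ∃ (r : Fin t → Fin n) (c : Fin t → Fin m),
    d = (φ.submatrix r c).det}

/-- The grade of an ideal: the supremum of lengths of regular sequences contained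
in it. -/
noncomputable def grade (I : Ideal R) : ℕ∞ :=
  sSup {n : ℕ∞ | ∃ rs : List R, (∀ x ∈ rs, x ∈ I) ∧
    RingTheory.Sequence.IsRegular R rs ∧ (rs.length : ℕ∞) = n}

end Defs

/-- `M` has projective dimension at most `n` over `R`. -/
def ProjDimLE (R : Type u) [CommRing R] :
    (n : ℕ) → (M : Type u) → [AddCommGroup M] → [Module R M] → Prop
  | 0, M, _, _ => Module.Projective R M
  | n + 1, M, _, _ => ∃ (k : ℕ) (f : (Fin k → R) →ₗ[R] M), Function.Surjective f ∧
      ProjDimLE R n ↥(LinearMap.ker f)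

section Defs2

variable {R : Type u} [CommRing R]

/-- `M` has projective dimension exactly `n` over `R`. -/
def ProjDimEq (R : Type u) [CommRing R] (M : Type u) [AddCommGroup M] [Module R M]
    (n : ℕ) : Prop :=
  ProjDimLE R n M ∧ ∀ m : ℕ, ProjDimLE R m M → n ≤ m

/-- A perfect ideal: the projective dimension of `R/I` equals the grade of `I`. -/
def IsPerfectIdeal (I : Ideal R) : Prop :=
  ∃ g : ℕ, grade I = (g : ℕ∞) ∧ ProjDimEq R (R ⧸ I) g

/-- The multiplicative set which is the complement of the union of the associated
primes of `R/H`. -/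
def assComplement (H : Ideal R) : Submonoid R where
  carrier := {r : R | ∀ p ∈ associatedPrimes R (R ⧸ H), r ∉ p}
  one_mem' := fun p hp => (Ideal.ne_top_iff_one p).mp hp.1.ne_top
  mul_mem' := fun {a b} ha hb p hp hab =>
    (hp.1.mem_or_mem hab).elim (ha p hp) (hb p hp)

/-- The `j`-th symbolic power of `H`. -/
noncomputable def symbolicPower (H : Ideal R) (j : ℕ) : Ideal R :=
  Ideal.comap (algebraMap R (Localization (assComplement H)))
    (Ideal.map (algebraMap R (Localization (assComplement H))) (H ^ j))

/-- Serre's condition `S₂` for a module. -/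
def ModuleS2 (S : Type u) [CommRing S] (M : Type v) [AddCommGroup M] [Module S M] : Prop :=
  ∀ (q : Ideal S) (hq : q.IsPrime),
    letI := hq
    min 2 (rDim ((Localization.AtPrime q) ⧸
        (Module.annihilator (Localization.AtPrime q) (LocalizedModule q.primeCompl M))))
      ≤ (mDepth (Localization.AtPrime q) (LocalizedModule q.primeCompl M) : WithBot ℕ∞)

/-- `M` is a maximal Cohen–Macaulay `S`-module. -/
def IsMCM (S : Type u) [CommRing S] (M : Type v) [AddCommGroup M] [Module S M] : Prop :=
  ∀ (q : Ideal S) (hq : q.IsMaximal),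
    letI := hq.isPrime
    (mDepth (Localization.AtPrime q) (LocalizedModule q.primeCompl M) : WithBot ℕ∞) =
      rDim (Localization.AtPrime q)

end Defs2


section
open RingTheory.Sequence

universe w

section Cx

variable {R : Type u} [CommRing R]

/-- cycles of a complex -/
def IsCyc {C : ℕ → Type w} [∀ i, AddCommGroup (C i)] [∀ i, Module R (C i)]
    (d : ∀ i, C (i + 1) →ₗ[R] C i) : ∀ i, C i → Prop
  | 0, _ => True
  | i + 1, z => d i z = 0

/-- multiplication by `y` is null-homotopic -/
def NullHtpy {C : ℕ → Type w} [∀ i, AddCommGroup (C i)] [∀ i, Module R (C i)]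
    (d : ∀ i, C (i + 1) →ₗ[R] C i) (y : R) : Prop :=
  ∃ s : ∀ i, C i →ₗ[R] C (i + 1), (∀ x, d 0 (s 0 x) = y • x) ∧
    ∀ i x, d (i + 1) (s (i + 1) x) + s i (d i x) = y • x

lemma NullHtpy.cyc {C : ℕ → Type w} [∀ i, AddCommGroup (C i)] [∀ i, Module R (C i)]
    {d : ∀ i, C (i + 1) →ₗ[R] C i} {y : R} {s : ∀ i, C i →ₗ[R] C (i + 1)}
    (h0 : ∀ x, d 0 (s 0 x) = y • x)
    (h1 : ∀ i x, d (i + 1) (s (i + 1) x) + s i (d i x) = y • x) (i : ℕ) (z : C i)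
    (hz : IsCyc d i z) : d i (s i z) = y • z := by
  cases i with
  | zero => exact h0 z
  | succ k => have := h1 k z; rw [show d k z = 0 from hz] at this; simpa using this

lemma NullHtpy.quot {C : ℕ → Type w} [∀ i, AddCommGroup (C i)] [∀ i, Module R (C i)]
    {d : ∀ i, C (i + 1) →ₗ[R] C i} {y : R} (x : R) (h : NullHtpy d y) :
    NullHtpy (C := fun i => QuotSMulTop x (C i)) (fun i => QuotSMulTop.map x (d i)) y := by
  obtain ⟨s, h0, h1⟩ := h
  refine ⟨fun i => QuotSMulTop.map x (s i), ?_, ?_⟩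
  · intro z
    obtain ⟨z, rfl⟩ := Submodule.Quotient.mk_surjective _ z
    simp only [QuotSMulTop.map_apply_mk, h0]; rfl
  · intro i z
    obtain ⟨z, rfl⟩ := Submodule.Quotient.mk_surjective _ z
    simp only [QuotSMulTop.map_apply_mk]
    rw [← Submodule.Quotient.mk_add, h1]; rfl

lemma mk_eq_zero_iff {M : Type w} [AddCommGroup M] [Module R M] (x : R) (z : M) :
    (Submodule.Quotient.mk z : QuotSMulTop x M) = 0 ↔ ∃ v, z = x • v := by
  rw [Submodule.Quotient.mk_eq_zero, Submodule.mem_smul_pointwise_iff_exists]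
  constructor
  · rintro ⟨v, -, h⟩; exact ⟨v, h.symm⟩
  · rintro ⟨v, h⟩; exact ⟨v, trivial, h.symm⟩

lemma mk_eq_iff {M : Type w} [AddCommGroup M] [Module R M] (x : R) (z z' : M) :
    (Submodule.Quotient.mk z : QuotSMulTop x M) = Submodule.Quotient.mk z' ↔
      ∃ v, z = z' + x • v := by
  rw [← sub_eq_zero, ← Submodule.Quotient.mk_sub, mk_eq_zero_iff]
  constructor
  · rintro ⟨v, h⟩; exact ⟨v, by rw [← h]; abel⟩
  · rintro ⟨v, h⟩; exact ⟨v, by rw [h]; abel⟩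

/-- Lemma X -/
theorem exact_of_nullHtpy (h : ℕ) (ys : List R) :
    ∀ (C : ℕ → Type w) [∀ i, AddCommGroup (C i)] [∀ i, Module R (C i)]
    (d : ∀ i, C (i + 1) →ₗ[R] C i) (_ : ∀ i x, d i (d (i + 1) x) = 0)
    (_ : ∀ i, IsWeaklyRegular (C i) ys) (_ : ∀ y ∈ ys, NullHtpy d y)
    (_ : ∀ i, h < i → Subsingleton (C i)) (i : ℕ) (_ : h < i + ys.length) (z : C i)
    (_ : IsCyc d i z), ∃ w, d i w = z := by
  induction ys with
  | nil =>
    intro C _ _ d dd hreg hnull hsub i hi z hz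
    have := hsub i (by simpa using hi)
    exact ⟨0, Subsingleton.elim _ _⟩
  | cons y ys ih =>
    intro C _ _ d dd hreg hnull hsub i hi z hz
    have hr : ∀ i, IsSMulRegular (C i) y ∧ IsWeaklyRegular (QuotSMulTop y (C i)) ys :=
      fun i => (isWeaklyRegular_cons_iff _ _ _).1 (hreg i)
    obtain ⟨s, h0, h1⟩ := hnull y (by simp)
    have hz' := NullHtpy.cyc h0 h1 i z hz
    obtain ⟨w, hw⟩ := ih (fun i => QuotSMulTop y (C i)) (fun i => QuotSMulTop.map y (d i))
      (by
        intro i x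
        obtain ⟨x, rfl⟩ := Submodule.Quotient.mk_surjective _ x
        simp only [QuotSMulTop.map_apply_mk, dd]; rfl)
      (fun i => (hr i).2) (fun x hx => (hnull x (by simp [hx])).quot y)
      (by
        intro i hi
        have := hsub i hi
        exact Quot.Subsingleton)
      (i + 1) (by simp at hi; omega) (Submodule.Quotient.mk (s i z))
      (by
        show QuotSMulTop.map y (d i) _ = 0
        rw [QuotSMulTop.map_apply_mk, hz', mk_eq_zero_iff]
        exact ⟨z, rfl⟩)
    obtain ⟨w, rfl⟩ := Submodule.Quotient.mk_surjective _ w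
    rw [QuotSMulTop.map_apply_mk, mk_eq_iff] at hw
    obtain ⟨v, hv⟩ := hw
    refine ⟨-v, (hr i).1 ?_⟩
    have : d i (d (i+1) w) = d i (s i z + y • v) := by rw [hv]
    rw [dd, map_add, hz', map_smul] at this
    show y • d i (-v) = y • z
    rw [map_neg, smul_neg]
    exact (eq_neg_of_add_eq_zero_left this.symm).symm

/-- Lemma X*: dual exactness -/
theorem dual_exact {C : ℕ → Type w} [∀ i, AddCommGroup (C i)] [∀ i, Module R (C i)]
    [∀ i, Module.Projective R (C i)]
    (d : ∀ i, C (i + 1) →ₗ[R] C i) (dd : ∀ i x, d i (d (i + 1) x) = 0) (ys : List R)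
    (hnull : ∀ y ∈ ys, NullHtpy d y) :
    ∀ (X : Type w) [AddCommGroup X] [Module R X], IsWeaklyRegular X ys →
      (∀ c : C 0 →ₗ[R] X, 0 < ys.length → c ∘ₗ d 0 = 0 → c = 0) ∧
      (∀ (i : ℕ) (c : C (i + 1) →ₗ[R] X), i + 1 < ys.length → c ∘ₗ d (i + 1) = 0 →
        ∃ b : C i →ₗ[R] X, c = b ∘ₗ d i) := by
  induction ys with
  | nil => intro X _ _ _; simp
  | cons y ys ih =>
    intro X _ _ hX
    obtain ⟨hy, hX'⟩ := (isWeaklyRegular_cons_iff _ _ _).1 hX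
    obtain ⟨s, h0, h1⟩ := hnull y (by simp)
    obtain ⟨ih0, ih1⟩ := ih (fun x hx => hnull x (by simp [hx])) (QuotSMulTop y X) hX'
    constructor
    · intro c _ hc
      ext z
      apply hy
      show y • c z = y • (0 : C 0 →ₗ[R] X) z
      rw [← map_smul, ← h0 z]
      have := LinearMap.congr_fun hc (s 0 z)
      simpa using this
    · intro i c hi hc
      have key : ∀ z, c (s i (d i z)) = y • c z := by
        intro z
        have := congrArg c (h1 i z)
        rw [map_add, map_smul] at this
        have h2 := LinearMap.congr_fun hc (s (i+1) z)
        simp only [LinearMap.comp_apply, LinearMap.zero_apply] at h2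
        rwa [h2, zero_add] at this
      let mk : X →ₗ[R] QuotSMulTop y X := Submodule.mkQ _
      have hmk : Function.Surjective mk := Submodule.mkQ_surjective _
      -- the reduction of `c ∘ s i` mod `y` lifts
      have hb : ∃ e : C i →ₗ[R] X, (e ∘ₗ d i = 0) ∧ mk ∘ₗ e = mk ∘ₗ (c ∘ₗ s i) := by
        have hcoc : (mk ∘ₗ (c ∘ₗ s i)) ∘ₗ d i = 0 := by
          ext z
          simp only [LinearMap.comp_apply, key, LinearMap.zero_apply]
          exact (mk_eq_zero_iff _ _).2 ⟨_, rfl⟩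
        cases i with
        | zero =>
          refine ⟨0, by simp, ?_⟩
          rw [ih0 _ (by simp at hi; omega) hcoc]; simp
        | succ k =>
          obtain ⟨b, hb⟩ := ih1 k _ (by simp at hi; omega) hcoc
          obtain ⟨b', hb'⟩ := Module.projective_lifting_property mk b hmk
          refine ⟨b' ∘ₗ d k, ?_, ?_⟩
          · ext z; simp [dd]
          · rw [hb, ← LinearMap.comp_assoc, hb']
      obtain ⟨e, he, he'⟩ := hb
      let my : X →ₗ[R] X := LinearMap.lsmul R X y
      have hin : ∀ z, ∃ v, (c ∘ₗ s i - e) z = y • v := by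
        intro z
        rw [← mk_eq_zero_iff]
        have := LinearMap.congr_fun he' z
        simp only [LinearMap.comp_apply] at this
        change mk ((c ∘ₗ s i - e) z) = 0
        rw [LinearMap.sub_apply, map_sub, this]; simp
      obtain ⟨b, hb⟩ := Module.projective_lifting_property (my.rangeRestrict)
        (LinearMap.codRestrict (LinearMap.range my) (c ∘ₗ s i - e) (by
          intro z
          obtain ⟨v, hv⟩ := hin z
          exact ⟨v, hv.symm⟩)) (LinearMap.surjective_rangeRestrict _)
      refine ⟨b, ?_⟩
      ext z
      apply hy
      show y • c z = y • b (d i z)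
      have h3 := congrArg Subtype.val (LinearMap.congr_fun hb (d i z))
      have h4 : y • b (d i z) = (c ∘ₗ s i - e) (d i z) := h3
      rw [h4, LinearMap.sub_apply, LinearMap.comp_apply, key]
      have := LinearMap.congr_fun he z
      simp only [LinearMap.comp_apply, LinearMap.zero_apply] at this
      rw [this, sub_zero]

/-- torsion lemma -/
theorem torsion_lemma (ys : List R) :
    ∀ (C : ℕ → Type w) [∀ i, AddCommGroup (C i)] [∀ i, Module R (C i)]
    (d : ∀ i, C (i + 1) →ₗ[R] C i) (_ : ∀ i x, d i (d (i + 1) x) = 0)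
    (_ : ∀ i, IsWeaklyRegular (C i) ys)
    (_ : ∀ i, ys.length ≤ i → Subsingleton (C i))
    (_ : ∀ i (z : C (i + 1)), d i z = 0 → ∃ w, d (i + 1) w = z)
    (z : C 0) (_ : ∀ y ∈ ys, ∃ w, d 0 w = y • z), ∃ w, d 0 w = z := by
  induction ys with
  | nil =>
    intro C _ _ d dd hreg hsub hex z hz
    have := hsub 0 (by simp)
    exact ⟨0, Subsingleton.elim _ _⟩
  | cons y ys ih =>
    intro C _ _ d dd hreg hsub hex z hz
    have hr : ∀ i, IsSMulRegular (C i) y ∧ IsWeaklyRegular (QuotSMulTop y (C i)) ys :=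
      fun i => (isWeaklyRegular_cons_iff _ _ _).1 (hreg i)
    obtain ⟨w, hw⟩ := hz y (by simp)
    obtain ⟨u, hu⟩ := ih (fun i => QuotSMulTop y (C (i + 1)))
      (fun i => QuotSMulTop.map y (d (i + 1)))
      (by
        intro i x
        obtain ⟨x, rfl⟩ := Submodule.Quotient.mk_surjective _ x
        simp only [QuotSMulTop.map_apply_mk, dd]; rfl)
      (fun i => (hr _).2)
      (by
        intro i hi
        have := hsub (i + 1) (by simp; omega)
        exact Quot.Subsingleton)
      (by
        intro i x hx
        obtain ⟨x, rfl⟩ := Submodule.Quotient.mk_surjective _ x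
        simp only [QuotSMulTop.map_apply_mk, mk_eq_zero_iff] at hx
        obtain ⟨v, hv⟩ := hx
        have hdv : d i v = 0 := by
          apply (hr i).1
          show y • d i v = y • 0
          rw [← map_smul, ← hv, dd, smul_zero]
        obtain ⟨v', rfl⟩ := hex i v hdv
        obtain ⟨w', hw'⟩ := hex (i + 1) (x - y • v') (by rw [map_sub, hv, map_smul, sub_self])
        refine ⟨Submodule.Quotient.mk w', ?_⟩
        rw [QuotSMulTop.map_apply_mk, hw', mk_eq_iff]
        exact ⟨-v', by simp [sub_eq_add_neg]⟩)
      (Submodule.Quotient.mk w)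
      (by
        intro y' hy'
        obtain ⟨w', hw'⟩ := hz y' (by simp [hy'])
        obtain ⟨u, hu⟩ := hex 0 (y' • w - y • w') (by
          rw [map_sub, map_smul, map_smul, hw, hw', smul_comm, sub_self])
        refine ⟨Submodule.Quotient.mk u, ?_⟩
        rw [QuotSMulTop.map_apply_mk, hu, ← Submodule.Quotient.mk_smul, mk_eq_iff]
        exact ⟨-w', by simp [sub_eq_add_neg]⟩)
    obtain ⟨u, rfl⟩ := Submodule.Quotient.mk_surjective _ u
    rw [QuotSMulTop.map_apply_mk, mk_eq_iff] at hu
    obtain ⟨v, hv⟩ := hu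
    refine ⟨-v, (hr 0).1 ?_⟩
    show y • d 0 (-v) = y • z
    rw [← hw, ← map_smul]
    have := congrArg (d 0) hv
    rw [dd, map_add] at this
    rw [smul_neg, map_neg]
    exact (eq_neg_of_add_eq_zero_left this.symm).symm

/-- null-homotopy from projective to exact -/
theorem exists_htpy {B C : ℕ → Type w} [∀ i, AddCommGroup (C i)] [∀ i, Module R (C i)]
    [∀ i, AddCommGroup (B i)] [∀ i, Module R (B i)] [∀ i, Module.Projective R (B i)]
    (dB : ∀ i, B (i + 1) →ₗ[R] B i) (ddB : ∀ i x, dB i (dB (i + 1) x) = 0)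
    (d : ∀ i, C (i + 1) →ₗ[R] C i)
    (hex : ∀ i (z : C (i + 1)), d i z = 0 → ∃ w, d (i + 1) w = z)
    (α : ∀ i, B i →ₗ[R] C i) (hα : ∀ i x, d i (α (i + 1) x) = α i (dB i x))
    (h0 : ∀ x, ∃ w, d 0 w = α 0 x) :
    ∃ s : ∀ i, B i →ₗ[R] C (i + 1), (∀ x, d 0 (s 0 x) = α 0 x) ∧
      ∀ i x, d (i + 1) (s (i + 1) x) + s i (dB i x) = α (i + 1) x := by
  have lift : ∀ i (P : Type w) [AddCommGroup P] [Module R P] [Module.Projective R P]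
      (c : P →ₗ[R] C i), (∀ x, ∃ w, d i w = c x) → ∃ s : P →ₗ[R] C (i + 1), ∀ x, d i (s x) = c x := by
    intro i P _ _ _ c hc
    obtain ⟨b, hb⟩ := Module.projective_lifting_property ((d i).rangeRestrict)
        (LinearMap.codRestrict (LinearMap.range (d i)) c (by
          intro z
          obtain ⟨v, hv⟩ := hc z
          exact ⟨v, hv⟩)) (LinearMap.surjective_rangeRestrict _)
    exact ⟨b, fun x => congrArg Subtype.val (LinearMap.congr_fun hb x)⟩
  let Q : ∀ i, (B i →ₗ[R] C (i + 1)) → Prop := fun i s =>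
    ∀ x, d i (s (dB i x)) = d i (α (i + 1) x)
  have step : ∀ i (s : B i →ₗ[R] C (i + 1)), Q i s → ∃ s' : B (i + 1) →ₗ[R] C (i + 2),
      Q (i + 1) s' ∧ ∀ x, d (i + 1) (s' x) + s (dB i x) = α (i + 1) x := by
    intro i s hs
    obtain ⟨s', hs'⟩ := lift (i + 1) (B (i + 1)) (α (i + 1) - s ∘ₗ dB i) (by
      intro x
      apply hex
      have := hs x
      simp [this])
    refine ⟨s', ?_, ?_⟩
    · intro x
      rw [hs', hα]
      simp [ddB]
    · intro x; rw [hs']; simp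
  obtain ⟨s0, hs0⟩ := lift 0 (B 0) (α 0) h0
  have hQ0 : Q 0 s0 := by intro x; rw [hs0, hα]
  let F : ∀ i, {s : B i →ₗ[R] C (i + 1) // Q i s} := fun i =>
    Nat.rec ⟨s0, hQ0⟩ (fun i s => ⟨(step i s.1 s.2).choose, (step i s.1 s.2).choose_spec.1⟩) i
  refine ⟨fun i => (F i).1, hs0, fun i x => ?_⟩
  exact (step i (F i).1 (F i).2).choose_spec.2 x

end Cx
end

section
open RingTheory.Sequence

universe w

section Cx2

variable {R : Type u} [CommRing R]

/-- descending extension of chain maps together with a homotopy -/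
theorem descend {B C E : ℕ → Type w} [∀ i, AddCommGroup (B i)] [∀ i, Module R (B i)]
    [∀ i, AddCommGroup (C i)] [∀ i, Module R (C i)]
    [∀ i, AddCommGroup (E i)] [∀ i, Module R (E i)] [∀ i, Module.Projective R (B i)]
    (dB : ∀ i, B (i + 1) →ₗ[R] B i) (ddB : ∀ i x, dB i (dB (i + 1) x) = 0)
    (dC : ∀ i, C (i + 1) →ₗ[R] C i) (ddC : ∀ i x, dC i (dC (i + 1) x) = 0)
    (dE : ∀ i, E (i + 1) →ₗ[R] E i) (ddE : ∀ i x, dE i (dE (i + 1) x) = 0)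
    (q : ∀ i, C i →ₗ[R] E i) (hq : ∀ i x, dE i (q (i + 1) x) = q i (dC i x))
    (τ : ∀ i, B i →ₗ[R] E i) (hτ : ∀ i x, dE i (τ (i + 1) x) = τ i (dB i x))
    (ys : List R) (hnull : ∀ y ∈ ys, NullHtpy dB y)
    (hC : ∀ i, IsWeaklyRegular (C i) ys) (hE : ∀ i, IsWeaklyRegular (E i) ys)
    (N : ℕ) : N < ys.length → ∀ (t : B N →ₗ[R] C N) (t' : B (N + 1) →ₗ[R] C (N + 1))
    (s : B N →ₗ[R] E (N + 1)) (s' : B (N + 1) →ₗ[R] E (N + 2)),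
    (∀ x, dC N (t' x) = t (dB N x)) →
    (∀ x, q (N + 1) (t' x) - τ (N + 1) x = dE (N + 1) (s' x) + s (dB N x)) →
    ∃ t0 : B 0 →ₗ[R] C 0, (∀ x, ∃ w, dE 0 w = τ 0 x - q 0 (t0 x)) ∧
      ∀ x, ∃ w, dC 0 w = t0 (dB 0 x) := by
  induction N with
  | zero =>
    intro hN t t' s s' ht hs
    refine ⟨t, fun x => ⟨-s x, ?_⟩, fun x => ⟨t' x, ht x⟩⟩
    have h := (dual_exact dB ddB ys hnull (E 0) (hE 0)).1 (q 0 ∘ₗ t - τ 0 - dE 0 ∘ₗ s) hN (by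
      ext z
      simp only [LinearMap.comp_apply, LinearMap.sub_apply, LinearMap.zero_apply]
      rw [← ht, ← hq, ← hτ, ← map_sub, hs, map_add, ddE]; simp)
    have h' := LinearMap.congr_fun h x
    simp only [LinearMap.comp_apply, LinearMap.sub_apply, LinearMap.zero_apply] at h'
    rw [map_neg, ← sub_eq_zero.1 h']; abel
  | succ N ih =>
    intro hN t t' s s' ht hs
    obtain ⟨t2, ht2⟩ := (dual_exact dB ddB ys hnull (C N) (hC N)).2 N (dC N ∘ₗ t) hN (by
      ext z
      simp only [LinearMap.comp_apply, LinearMap.zero_apply]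
      rw [← ht, ddC])
    obtain ⟨s2, hs2⟩ := (dual_exact dB ddB ys hnull (E (N + 1)) (hE (N + 1))).2 N
      (q (N + 1) ∘ₗ t - τ (N + 1) - dE (N + 1) ∘ₗ s) hN (by
      ext z
      simp only [LinearMap.comp_apply, LinearMap.sub_apply, LinearMap.zero_apply]
      rw [← ht, ← hq, ← hτ, ← map_sub, hs, map_add, ddE]; simp)
    refine ih (by omega) t2 t s2 s ?_ ?_
    · intro x; exact LinearMap.congr_fun ht2 x
    · intro x
      have := LinearMap.congr_fun hs2 x
      simp only [LinearMap.comp_apply, LinearMap.sub_apply] at this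
      rw [← this]; abel

/-- a graded complex inside a total module -/
structure GCx (R : Type u) [CommRing R] (M : Type w) [AddCommGroup M] [Module R M] where
  dl : M →ₗ[R] M
  pr : ℕ → M →ₗ[R] M
  idem : ∀ i x, pr i (pr i x) = pr i x
  dl_pr : ∀ i x, pr i (dl (pr (i + 1) x)) = dl (pr (i + 1) x)
  dl_zero : ∀ x, dl (pr 0 x) = 0
  dl_dl : ∀ x, dl (dl x) = 0

variable {M : Type w} [AddCommGroup M] [Module R M]

namespace GCx

/-- the i-th module -/
abbrev X (G : GCx R M) (i : ℕ) : Type w := ↥(LinearMap.range (G.pr i))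

lemma mem_iff (G : GCx R M) (i : ℕ) (x : M) : x ∈ LinearMap.range (G.pr i) ↔ G.pr i x = x :=
  ⟨by rintro ⟨y, rfl⟩; exact G.idem i y, fun h => ⟨x, h⟩⟩

/-- restriction of a map of total modules -/
noncomputable def res {M' : Type w} [AddCommGroup M'] [Module R M'] (f : M →ₗ[R] M')
    (p : M →ₗ[R] M) (p' : M' →ₗ[R] M') (h : ∀ x, p' (f (p x)) = f (p x)) :
    ↥(LinearMap.range p) →ₗ[R] ↥(LinearMap.range p') :=
  LinearMap.restrict f (by rintro _ ⟨x, rfl⟩; exact ⟨_, h x⟩)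

@[simp] lemma res_coe {M' : Type w} [AddCommGroup M'] [Module R M'] (f : M →ₗ[R] M')
    (p : M →ₗ[R] M) (p' : M' →ₗ[R] M') (h : ∀ x, p' (f (p x)) = f (p x))
    (x : ↥(LinearMap.range p)) : (res f p p' h x : M') = f x := rfl

/-- the differential -/
noncomputable def d (G : GCx R M) (i : ℕ) : G.X (i + 1) →ₗ[R] G.X i :=
  res G.dl (G.pr (i + 1)) (G.pr i) (G.dl_pr i)

@[simp] lemma d_coe (G : GCx R M) (i : ℕ) (x : G.X (i + 1)) : (G.d i x : M) = G.dl x := rfl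

lemma dd (G : GCx R M) (i : ℕ) (x : G.X (i + 2)) : G.d i (G.d (i + 1) x) = 0 := by
  ext; simp [G.dl_dl]

lemma pr_coe (G : GCx R M) (i : ℕ) (x : G.X i) : G.pr i x = x := (G.mem_iff i _).1 x.2

instance proj (G : GCx R M) [Module.Projective R M] (i : ℕ) : Module.Projective R (G.X i) := by
  refine Module.Projective.of_split (LinearMap.range (G.pr i)).subtype (G.pr i).rangeRestrict ?_
  ext x
  simp [G.pr_coe]

lemma nullHtpy (G : GCx R M) (y : R) (h : M →ₗ[R] M)
    (h1 : ∀ i x, G.pr (i + 1) (h (G.pr i x)) = h (G.pr i x))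
    (h2 : ∀ i x, G.dl (h (G.pr i x)) + h (G.dl (G.pr i x)) = y • G.pr i x) :
    NullHtpy G.d y := by
  refine ⟨fun i => res h (G.pr i) (G.pr (i + 1)) (h1 i), ?_, ?_⟩
  · intro x
    ext
    have := h2 0 x
    rw [G.dl_zero, G.pr_coe] at this
    simpa using this
  · intro i x
    ext
    have := h2 (i + 1) x
    rw [G.pr_coe] at this
    simpa using this

end GCx

lemma isWeaklyRegular_of_projective {ys : List R} (h : IsWeaklyRegular R ys) (P : Type w)
    [AddCommGroup P] [Module R P] [Module.Projective R P] : IsWeaklyRegular P ys :=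
  ((TensorProduct.rid R P).isWeaklyRegular_congr ys).1 (h.isWeaklyRegular_lTensor (M₂ := P))

lemma nullHtpy_ideal {C : ℕ → Type w} [∀ i, AddCommGroup (C i)] [∀ i, Module R (C i)]
    (d : ∀ i, C (i + 1) →ₗ[R] C i) (s : Set R) (hs : ∀ y ∈ s, NullHtpy d y) :
    ∀ y ∈ Ideal.span s, NullHtpy d y := by
  intro y hy
  induction hy using Submodule.span_induction with
  | mem x h => exact hs x h
  | zero => exact ⟨fun i => 0, by simp, by simp⟩
  | add x y _ _ hx hy =>
    obtain ⟨s, h0, h1⟩ := hx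
    obtain ⟨s', h0', h1'⟩ := hy
    refine ⟨fun i => s i + s' i, fun x => by simp [h0, h0', add_smul], fun i x => ?_⟩
    simp only [LinearMap.add_apply, map_add, add_smul, ← h1, ← h1']; abel
  | smul a x _ hx =>
    obtain ⟨s, h0, h1⟩ := hx
    refine ⟨fun i => a • s i, fun x => by simp [h0, mul_smul], fun i x => ?_⟩
    simp only [LinearMap.smul_apply, map_smul, ← smul_add, h1, smul_eq_mul, mul_smul]

end Cx2
end

section
open ExteriorAlgebra

section Ext

variable (R : Type u) [CommRing R] (f : ℕ)

/-- the exterior algebra on `R^f` -/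
abbrev Lam : Type u := ExteriorAlgebra R (Fin f → R)

variable {R f}

/-- contraction -/
noncomputable def Dc (α : Module.Dual R (Fin f → R)) : Module.End R (Lam R f) :=
  CliffordAlgebra.contractLeft α

/-- wedge -/
noncomputable def Uw (w : Fin f → R) : Module.End R (Lam R f) :=
  LinearMap.mulLeft R (ι R w)

lemma Uw_apply (w : Fin f → R) (x : Lam R f) : Uw w x = ι R w * x := rfl

lemma Dc_Uw (α : Module.Dual R (Fin f → R)) (w : Fin f → R) (x : Lam R f) :
    Dc α (Uw w x) = α w • x - Uw w (Dc α x) :=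
  CliffordAlgebra.contractLeft_ι_mul α w x

lemma Dc_comm (α β : Module.Dual R (Fin f → R)) (x : Lam R f) :
    Dc α (Dc β x) = - Dc β (Dc α x) := CliffordAlgebra.contractLeft_comm _ _ _

lemma Dc_Dc (α : Module.Dual R (Fin f → R)) (x : Lam R f) :
    Dc α (Dc α x) = 0 := CliffordAlgebra.contractLeft_contractLeft _ _

lemma Dc_add (α β : Module.Dual R (Fin f → R)) (x : Lam R f) :
    Dc (α + β) x = Dc α x + Dc β x := by simp [Dc]

lemma Dc_smul (r : R) (α : Module.Dual R (Fin f → R)) (x : Lam R f) :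
    Dc (r • α) x = r • Dc α x := by simp [Dc]

lemma Uw_mem (w : Fin f → R) (i : ℕ) (x : Lam R f) (hx : x ∈ ⋀[R]^i (Fin f → R)) :
    Uw w x ∈ ⋀[R]^(i + 1) (Fin f → R) := by
  show ι R w * x ∈ LinearMap.range (ι R) ^ (i + 1)
  rw [pow_succ']
  exact Submodule.mul_mem_mul ⟨w, rfl⟩ hx

lemma Dc_zero (α : Module.Dual R (Fin f → R)) (x : Lam R f)
    (hx : x ∈ ⋀[R]^0 (Fin f → R)) : Dc α x = 0 := by
  have : x ∈ LinearMap.range (ι R : (Fin f → R) →ₗ[R] Lam R f) ^ 0 := hx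
  rw [pow_zero, Submodule.mem_one] at this
  obtain ⟨r, rfl⟩ := this
  exact CliffordAlgebra.contractLeft_algebraMap (Q := 0) α r

lemma Dc_mem (α : Module.Dual R (Fin f → R)) (i : ℕ) : ∀ (x : Lam R f)
    (_ : x ∈ ⋀[R]^(i + 1) (Fin f → R)), Dc α x ∈ ⋀[R]^i (Fin f → R) := by
  induction i with
  | zero =>
    intro x hx
    have : x ∈ LinearMap.range (ι R : (Fin f → R) →ₗ[R] Lam R f) ^ 1 := hx
    rw [pow_one] at this
    obtain ⟨w, rfl⟩ := this
    show _ ∈ LinearMap.range (ι R : (Fin f → R) →ₗ[R] Lam R f) ^ 0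
    rw [pow_zero, Submodule.mem_one]
    exact ⟨α w, (CliffordAlgebra.contractLeft_ι (Q := 0) α w).symm⟩
  | succ i ih =>
    intro x hx
    have : x ∈ LinearMap.range (ι R : (Fin f → R) →ₗ[R] Lam R f) ^ (i + 1 + 1) := hx
    rw [pow_succ'] at this
    clear hx
    induction this using Submodule.mul_induction_on' with
    | mem_mul_mem m hm n hn =>
      obtain ⟨w, rfl⟩ := hm
      have := Dc_Uw α w n
      rw [Uw_apply] at this
      rw [this]
      exact Submodule.sub_mem _ (Submodule.smul_mem _ _ hn) (Uw_mem w i _ (ih n hn))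
    | add x hx y hy hx' hy' =>
      rw [map_add]
      exact Submodule.add_mem _ hx' hy'

/-- graded projection -/
noncomputable def eps (i : ℕ) : Lam R f →ₗ[R] Lam R f :=
  GradedAlgebra.proj (fun i : ℕ => ⋀[R]^i (Fin f → R)) i

lemma eps_mem (i : ℕ) (x : Lam R f) : eps i x ∈ ⋀[R]^i (Fin f → R) := by
  rw [eps, GradedAlgebra.proj_apply]; exact SetLike.coe_mem _

lemma eps_of_mem {i : ℕ} {x : Lam R f} (hx : x ∈ ⋀[R]^i (Fin f → R)) : eps i x = x := by
  rw [eps, GradedAlgebra.proj_apply]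
  exact DirectSum.decompose_of_mem_same _ hx

lemma eps_of_mem_ne {i j : ℕ} {x : Lam R f} (hx : x ∈ ⋀[R]^i (Fin f → R)) (h : i ≠ j) :
    eps j x = 0 := by
  rw [eps, GradedAlgebra.proj_apply]
  exact DirectSum.decompose_of_mem_ne _ hx h

instance lam_free : Module.Free R (Lam R f) := by
  let e := DirectSum.decomposeLinearEquiv (fun i : ℕ => ⋀[R]^i (Fin f → R))
  exact Module.Free.of_equiv e.symm

lemma lam_eq_zero {i : ℕ} (hi : f < i) {x : Lam R f} (hx : x ∈ ⋀[R]^i (Fin f → R)) : x = 0 := by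
  have h : (ιMulti R i : (Fin f → R) [⋀^Fin i]→ₗ[R] Lam R f) = 0 := by
    refine Module.Basis.ext_alternating (Pi.basisFun R (Fin f)) fun v hv => ?_
    have := Fintype.card_le_of_injective v hv
    simp at this; omega
  rw [← ιMulti_span_fixedDegree, h] at hx
  induction hx using Submodule.span_induction with
  | mem x h => obtain ⟨v, rfl⟩ := h; rfl
  | zero => rfl
  | add x y _ _ hx hy => rw [hx, hy, add_zero]
  | smul a x _ hx => rw [hx, smul_zero]

variable (R f) in
/-- top form -/
noncomputable def om : Lam R f := ιMulti R f (fun i => Pi.single i 1)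

lemma om_mem : om R f ∈ ⋀[R]^f (Fin f → R) := by
  rw [← ιMulti_span_fixedDegree]; exact Submodule.subset_span ⟨_, rfl⟩

variable (R f) in
/-- coefficient of the top form -/
noncomputable def topc : Lam R f →ₗ[R] R :=
  liftAlternating (fun i => if h : f = i then
    ((Pi.basisFun R (Fin f)).det.domDomCongr (finCongr h)) else 0)

lemma topc_ιMulti (v : Fin f → Fin f → R) : topc R f (ιMulti R f v) = (Pi.basisFun R (Fin f)).det v := by
  rw [topc, liftAlternating_apply_ιMulti]
  simp

lemma topc_om : topc R f (om R f) = 1 := by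
  rw [om, topc_ιMulti]
  have := (Pi.basisFun R (Fin f)).det_self
  convert this using 2
  ext i j; simp

lemma eq_topc {x : Lam R f} (hx : x ∈ ⋀[R]^f (Fin f → R)) : x = topc R f x • om R f := by
  have h : (ιMulti R f : (Fin f → R) [⋀^Fin f]→ₗ[R] Lam R f) =
      (LinearMap.toSpanSingleton R _ (om R f)).compAlternatingMap (Pi.basisFun R (Fin f)).det := by
    refine Module.Basis.ext_alternating (Pi.basisFun R (Fin f)) fun v hv => ?_
    have hb : Function.Bijective v := (Finite.injective_iff_bijective).1 hv
    let p : Equiv.Perm (Fin f) := Equiv.ofBijective v hb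
    have h1 : (fun i => (Pi.basisFun R (Fin f)) (v i)) = (fun i => (Pi.basisFun R (Fin f)) i) ∘ p := rfl
    rw [h1, AlternatingMap.map_perm, AlternatingMap.map_perm]
    congr 1
    simp only [LinearMap.compAlternatingMap_apply, LinearMap.toSpanSingleton_apply]
    rw [show (fun i => (Pi.basisFun R (Fin f)) i) = (Pi.basisFun R (Fin f)) from rfl,
      Module.Basis.det_self, one_smul, om]
    congr 1
    ext i j; simp
  rw [← ιMulti_span_fixedDegree] at hx
  induction hx using Submodule.span_induction with
  | mem x hx =>
    obtain ⟨v, rfl⟩ := hx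
    rw [topc_ιMulti]
    exact congrArg (fun g => g v) h
  | zero => simp
  | add x y _ _ hx hy => rw [map_add, add_smul, ← hx, ← hy]
  | smul a x _ hx => rw [map_smul, smul_assoc, ← hx]

/-- iterated contraction -/
noncomputable def DL (L : List (Module.Dual R (Fin f → R))) : Module.End R (Lam R f) :=
  (L.map Dc).prod

/-- iterated wedge -/
noncomputable def UL (L : List (Fin f → R)) : Module.End R (Lam R f) := (L.map Uw).prod

@[simp] lemma DL_nil (x : Lam R f) : DL [] x = x := rfl
@[simp] lemma DL_cons (α : Module.Dual R (Fin f → R)) (L) (x : Lam R f) :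
    DL (α :: L) x = Dc α (DL L x) := by simp [DL]
@[simp] lemma UL_nil (x : Lam R f) : UL [] x = x := rfl
@[simp] lemma UL_cons (w : Fin f → R) (L) (x : Lam R f) :
    UL (w :: L) x = Uw w (UL L x) := by simp [UL]

lemma UL_mem (L : List (Fin f → R)) (i : ℕ) (x : Lam R f) (hx : x ∈ ⋀[R]^i (Fin f → R)) :
    UL L x ∈ ⋀[R]^(i + L.length) (Fin f → R) := by
  induction L with
  | nil => simpa using hx
  | cons w L ih => rw [UL_cons]; exact Uw_mem _ _ _ ih

lemma DL_mem (L : List (Module.Dual R (Fin f → R))) : ∀ (i : ℕ) (x : Lam R f)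
    (_ : x ∈ ⋀[R]^(i + L.length) (Fin f → R)), DL L x ∈ ⋀[R]^i (Fin f → R) := by
  induction L with
  | nil => intro i x hx; simpa using hx
  | cons w L ih =>
    intro i x hx
    rw [DL_cons]; apply Dc_mem; apply ih
    rw [List.length_cons] at hx
    rwa [show i + 1 + L.length = i + (L.length + 1) by omega]

lemma Dc_DL (α : Module.Dual R (Fin f → R)) (L) (x : Lam R f) :
    Dc α (DL L x) = (-1 : R) ^ L.length • DL L (Dc α x) := by
  induction L with
  | nil => simp
  | cons w L ih => rw [DL_cons, Dc_comm, ih]; simp [pow_succ]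

lemma Dc_DL_of_mem {α : Module.Dual R (Fin f → R)} {L} (h : α ∈ L) (x : Lam R f) :
    Dc α (DL L x) = 0 := by
  induction L with
  | nil => simp at h
  | cons w L ih =>
    rw [DL_cons]
    rcases List.mem_cons.1 h with rfl | h
    · exact Dc_Dc _ _
    · rw [Dc_comm, ih h]; simp

lemma Uw_DL (w : Fin f → R) (L : List (Module.Dual R (Fin f → R))) (h : ∀ α ∈ L, α w = 0)
    (x : Lam R f) : Uw w (DL L x) = (-1 : R) ^ L.length • DL L (Uw w x) := by
  induction L with
  | nil => simp
  | cons α L ih =>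
    have := Dc_Uw α w (DL L x)
    rw [h α (by simp), zero_smul, zero_sub, ih (fun α hα => h α (by simp [hα]))] at this
    rw [DL_cons, DL_cons, ← neg_eq_iff_eq_neg.2 this]
    simp [pow_succ]

lemma Uw_om (w : Fin f → R) : Uw w (om R f) = 0 :=
  lam_eq_zero (Nat.lt_succ_self f) (Uw_mem w f _ om_mem)

/-- linear functionals of iterated contractions lie in the ideal of minors -/
lemma DL_minor {d : ℕ} (v : Fin d → Module.Dual R (Fin f → R)) (x : Lam R f)
    (s : Lam R f →ₗ[R] R) (K : Ideal R)
    (hK : ∀ c : Fin d → Fin f, (Matrix.of fun i j => v i (Pi.single (c j) 1)).det ∈ K) :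
    s (DL (List.ofFn v) x) ∈ K := by
  let A : ExteriorAlgebra R (Module.Dual R (Fin f → R)) →ₐ[R] Module.End R (Lam R f) :=
    ExteriorAlgebra.lift R ⟨CliffordAlgebra.contractLeft, fun m => by
      exact LinearMap.ext fun x => Dc_Dc m x⟩
  let F : ExteriorAlgebra R (Module.Dual R (Fin f → R)) →ₗ[R] R :=
    s ∘ₗ (LinearMap.applyₗ x) ∘ₗ A.toLinearMap
  have h1 : s (DL (List.ofFn v) x) = F (ιMulti R d v) := by
    simp only [F, LinearMap.comp_apply, AlgHom.toLinearMap_apply, ιMulti_apply, map_list_prod,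
      List.map_ofFn, LinearMap.applyₗ_apply_apply, DL]
    congr 4
    ext i
    simp [A, Dc]
  let b := (Pi.basisFun R (Fin f)).dualBasis
  have h2 := ((b.exteriorPower d).sum_repr (exteriorPower.ιMulti R d v)).symm
  have h3 : ιMulti R d v = ∑ i, ((b.exteriorPower d).repr (exteriorPower.ιMulti R d v) i) •
      ((b.exteriorPower d) i : ExteriorAlgebra R (Module.Dual R (Fin f → R))) := by
    have := congrArg Subtype.val h2
    simpa using this
  rw [h1, h3, map_sum]
  refine Ideal.sum_mem _ fun i _ => ?_
  rw [map_smul, smul_eq_mul]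
  apply Ideal.mul_mem_right
  rw [← Module.Basis.coord_apply, exteriorPower.basis_coord, exteriorPower.ιMultiDual_apply_ιMulti]
  convert hK (fun j => Set.powersetCard.ofFinEmbEquiv.symm i j) using 5 with a c
  simp [b]

end Ext
end

section
open ExteriorAlgebra TensorProduct MvPolynomial

set_option linter.unusedSectionVars false
section Kos

variable {R : Type u} [CommRing R] {f : ℕ} {σ : Type} [Fintype σ] [DecidableEq σ]

variable (R f σ) in
/-- total module of the Koszul complex -/
abbrev KM : Type u := MvPolynomial σ R ⊗[R] Lam R f

/-- Koszul differential -/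
noncomputable def kdl (ψ : σ → Module.Dual R (Fin f → R)) : KM R f σ →ₗ[R] KM R f σ :=
  ∑ k, TensorProduct.map (LinearMap.mulLeft R (X k)) (Dc (ψ k))

lemma kdl_tmul (ψ : σ → Module.Dual R (Fin f → R)) (p : MvPolynomial σ R) (y : Lam R f) :
    kdl ψ (p ⊗ₜ y) = ∑ k, (X k * p) ⊗ₜ[R] (Dc (ψ k) y) := by
  simp [kdl, LinearMap.sum_apply]

lemma kdl_kdl (ψ : σ → Module.Dual R (Fin f → R)) (x : KM R f σ) : kdl ψ (kdl ψ x) = 0 := by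
  induction x using TensorProduct.induction_on with
  | zero => simp
  | add x y hx hy => simp [hx, hy]
  | tmul p y =>
    rw [kdl_tmul, map_sum]
    simp only [kdl_tmul]
    rw [← Finset.sum_product' (Finset.univ : Finset σ) (Finset.univ : Finset σ)
      (fun a b : σ => (X b * (X a * p)) ⊗ₜ[R] (Dc (ψ b) (Dc (ψ a) y)))]
    refine Finset.sum_involution (fun a _ => (a.2, a.1)) ?_ ?_ ?_ ?_
    · rintro ⟨a, b⟩ _
      simp only
      rw [Dc_comm, mul_left_comm, TensorProduct.tmul_neg, neg_add_cancel]
    · rintro ⟨a, b⟩ _ h he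
      simp only [Prod.mk.injEq] at he
      obtain rfl := he.1
      exact h (by simp [Dc_Dc])
    · simp
    · simp

/-- bigraded projection -/
noncomputable def kpr (j i : ℕ) : KM R f σ →ₗ[R] KM R f σ :=
  if i ≤ j then TensorProduct.map (homogeneousComponent (j - i)) (eps i) else 0

lemma kpr_tmul {j i : ℕ} (h : i ≤ j) (p : MvPolynomial σ R) (y : Lam R f) :
    kpr j i (p ⊗ₜ[R] y) = homogeneousComponent (j - i) p ⊗ₜ eps i y := by
  simp [kpr, h]

lemma kpr_of_lt {j i : ℕ} (h : j < i) : (kpr j i : KM R f σ →ₗ[R] KM R f σ) = 0 := by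
  simp [kpr, not_le.2 h]

lemma kpr_of_mem {j i : ℕ} (h : i ≤ j) {p : MvPolynomial σ R} {y : Lam R f}
    (hp : p.IsHomogeneous (j - i)) (hy : y ∈ ⋀[R]^i (Fin f → R)) :
    kpr j i (p ⊗ₜ[R] y) = p ⊗ₜ y := by
  rw [kpr_tmul h, homogeneousComponent_eq_self hp, eps_of_mem hy]

/-- to check a linear condition on the range of `kpr` -/
lemma kpr_ind {N : Type u} [AddCommGroup N] [Module R N] (F G : KM R f σ →ₗ[R] N) (j i : ℕ)
    (h : ∀ (_ : i ≤ j) (p : MvPolynomial σ R) (_ : p.IsHomogeneous (j - i))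
      (y : Lam R f) (_ : y ∈ ⋀[R]^i (Fin f → R)), F (p ⊗ₜ y) = G (p ⊗ₜ y)) (x : KM R f σ) :
    F (kpr j i x) = G (kpr j i x) := by
  by_cases hij : i ≤ j
  · induction x using TensorProduct.induction_on with
    | zero => simp
    | add x y hx hy => rw [map_add, map_add, map_add, hx, hy]
    | tmul p y =>
      rw [kpr_tmul hij]
      exact h hij _ (homogeneousComponent_isHomogeneous _ _) _ (eps_mem _ _)
  · rw [kpr_of_lt (not_le.1 hij)]; simp

/-- strand `j` of the Koszul complex -/
noncomputable def strand (ψ : σ → Module.Dual R (Fin f → R)) (j : ℕ) : GCx R (KM R f σ) where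
  dl := kdl ψ
  pr := kpr j
  idem i x := kpr_ind (kpr j i) LinearMap.id j i (fun h p hp y hy => kpr_of_mem h hp hy) x
  dl_pr i x := kpr_ind (kpr j i ∘ₗ kdl ψ) (kdl ψ) j (i + 1) (fun h p hp y hy => by
    simp only [LinearMap.comp_apply]
    rw [kdl_tmul, map_sum]
    refine Finset.sum_congr rfl fun k _ => kpr_of_mem (by omega) ?_ (Dc_mem _ _ _ hy)
    have := (isHomogeneous_X R k).mul hp
    rwa [show 1 + (j - (i + 1)) = j - i by omega] at this) x
  dl_zero x := kpr_ind (kdl ψ) 0 j 0 (fun h p hp y hy => by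
    rw [kdl_tmul]
    simp [Dc_zero _ _ hy]) x
  dl_dl := kdl_kdl ψ

/-- division by a variable -/
noncomputable def qdiv (r : σ) : MvPolynomial σ R →ₗ[R] MvPolynomial σ R where
  toFun p := p.divMonomial (Finsupp.single r 1)
  map_add' x y := add_divMonomial _ _ _
  map_smul' a x := by ext s; simp [coeff_divMonomial]

lemma qdiv_X_self (r : σ) (p : MvPolynomial σ R) : qdiv r (X r * p) = p :=
  X_mul_divMonomial r p

lemma qdiv_X_ne {r k : σ} (h : k ≠ r) (p : MvPolynomial σ R) : qdiv r (X k * p) = X k * qdiv r p := by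
  ext s
  simp only [qdiv, LinearMap.coe_mk, AddHom.coe_mk, coeff_divMonomial, coeff_X_mul']
  have h1 : k ∈ (Finsupp.single r 1 + s).support ↔ k ∈ s.support := by
    simp [Finsupp.single_apply, h.symm]
  simp only [h1]
  split_ifs with hk
  · congr 1
    ext m
    simp only [Finsupp.coe_tsub, Finsupp.coe_add, Pi.sub_apply, Pi.add_apply, Finsupp.single_apply]
    have : s k ≠ 0 := by simpa using hk
    by_cases hm : k = m
    · subst hm; simp [h.symm]
    · simp [hm]
  · rfl

lemma qdiv_hom (r : σ) {p : MvPolynomial σ R} {n : ℕ} (h : p.IsHomogeneous n) :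
    (n = 0 → qdiv r p = 0) ∧ (qdiv r p).IsHomogeneous (n - 1) := by
  constructor
  · rintro rfl
    ext s
    simp only [qdiv, LinearMap.coe_mk, AddHom.coe_mk, coeff_divMonomial, coeff_zero]
    by_contra hne
    have := h hne
    simp [map_add, Finsupp.weight_single] at this
  · intro s hs
    simp only [qdiv, LinearMap.coe_mk, AddHom.coe_mk, coeff_divMonomial] at hs
    have := h hs
    simp [map_add, Finsupp.weight_single] at this
    omega

/-- evaluation of a variable at zero -/
noncomputable def evz (r : σ) : MvPolynomial σ R →ₗ[R] MvPolynomial σ R :=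
  LinearMap.id - LinearMap.mulLeft R (X r) ∘ₗ qdiv r

lemma evz_apply (r : σ) (p : MvPolynomial σ R) : evz r p = p - X r * qdiv r p := rfl

lemma coeff_evz (r : σ) (p : MvPolynomial σ R) (s : σ →₀ ℕ) :
    coeff s (evz r p) = if s r = 0 then coeff s p else 0 := by
  rw [evz_apply, coeff_sub, coeff_X_mul']
  simp only [qdiv, LinearMap.coe_mk, AddHom.coe_mk, coeff_divMonomial]
  by_cases h : s r = 0
  · simp [h]
  · have : Finsupp.single r 1 + (s - Finsupp.single r 1) = s := by
      apply add_tsub_cancel_of_le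
      rw [Finsupp.single_le_iff]; omega
    simp [h, this]

lemma evz_hom (r : σ) {p : MvPolynomial σ R} {n : ℕ} (h : p.IsHomogeneous n) :
    (evz r p).IsHomogeneous n := by
  intro s hs
  apply h
  rw [coeff_evz] at hs
  split_ifs at hs with h1
  · exact hs
  · exact absurd rfl hs

/-- homotopy piece -/
noncomputable def hpc (u : σ → Fin f → R) (r : σ) : KM R f σ →ₗ[R] KM R f σ :=
  TensorProduct.map (qdiv r) (Uw (u r))

/-- idempotent-like piece -/
noncomputable def epc (ψ : σ → Module.Dual R (Fin f → R)) (u : σ → Fin f → R) (r : σ) :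
    KM R f σ →ₗ[R] KM R f σ :=
  TensorProduct.map (evz r) (Dc (ψ r) ∘ₗ Uw (u r))

lemma hpc_htpy (ψ : σ → Module.Dual R (Fin f → R)) (u : σ → Fin f → R) (δ : R)
    (hu : ∀ k r, ψ k (u r) = if k = r then δ else 0) (r : σ) (x : KM R f σ) :
    kdl ψ (hpc u r x) + hpc u r (kdl ψ x) = δ • x - epc ψ u r x := by
  induction x using TensorProduct.induction_on with
  | zero => simp
  | add x y hx hy =>
    simp only [map_add, smul_add]
    rw [add_add_add_comm, hx, hy]; abel
  | tmul p y =>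
    simp only [hpc, epc, TensorProduct.map_tmul, kdl_tmul, map_sum]
    rw [← Finset.sum_add_distrib]
    rw [Finset.sum_eq_single r]
    · rw [qdiv_X_self, LinearMap.comp_apply, Dc_Uw, hu, if_pos rfl, evz_apply]
      simp only [TensorProduct.sub_tmul, TensorProduct.tmul_sub, ← TensorProduct.smul_tmul',
        TensorProduct.tmul_smul, smul_sub]
      abel
    · intro k _ hk
      rw [qdiv_X_ne hk, Dc_Uw, hu, if_neg hk, ← TensorProduct.tmul_add]
      simp
    · simp

lemma hpc_deg (u : σ → Fin f → R) (r : σ) (j i : ℕ) (x : KM R f σ) :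
    kpr j (i + 1) (hpc u r (kpr j i x)) = hpc u r (kpr j i x) := by
  refine kpr_ind (kpr j (i + 1) ∘ₗ hpc u r) (hpc u r) j i (fun h p hp y hy => ?_) x
  simp only [LinearMap.comp_apply, hpc, TensorProduct.map_tmul]
  have hq := qdiv_hom r hp
  rcases h.lt_or_eq with h | rfl
  · refine kpr_of_mem (by omega) ?_ (Uw_mem _ _ _ hy)
    rw [show j - (i + 1) = j - i - 1 by omega]; exact hq.2
  · rw [hq.1 (by simp)]; simp

lemma epc_deg (ψ : σ → Module.Dual R (Fin f → R)) (u : σ → Fin f → R) (r : σ) (j i : ℕ)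
    (x : KM R f σ) :
    kpr j i (epc ψ u r (kpr j i x)) = epc ψ u r (kpr j i x) := by
  refine kpr_ind (kpr j i ∘ₗ epc ψ u r) (epc ψ u r) j i (fun h p hp y hy => ?_) x
  simp only [LinearMap.comp_apply, epc, TensorProduct.map_tmul]
  exact kpr_of_mem h (evz_hom r hp) (Dc_mem _ _ _ (Uw_mem _ _ _ hy))

lemma epc_comm (ψ : σ → Module.Dual R (Fin f → R)) (u : σ → Fin f → R) (δ : R)
    (hu : ∀ k r, ψ k (u r) = if k = r then δ else 0) (r : σ) (x : KM R f σ) :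
    kdl ψ (epc ψ u r x) = epc ψ u r (kdl ψ x) := by
  have h1 := hpc_htpy ψ u δ hu r x
  have h2 := hpc_htpy ψ u δ hu r (kdl ψ x)
  have h3 := congrArg (kdl ψ) h1
  rw [kdl_kdl, map_zero, add_zero] at h2
  rw [map_add, kdl_kdl, zero_add, map_sub, map_smul, h2] at h3
  exact (sub_right_inj.1 h3).symm

/-- product of the pieces over a list -/
noncomputable def EL (ψ : σ → Module.Dual R (Fin f → R)) (u : σ → Fin f → R) (L : List σ) :
    Module.End R (KM R f σ) := (L.map (epc ψ u)).prod

lemma EL_cons (ψ : σ → Module.Dual R (Fin f → R)) (u : σ → Fin f → R) (r : σ) (L : List σ)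
    (x : KM R f σ) : EL ψ u (r :: L) x = epc ψ u r (EL ψ u L x) := by simp [EL]

lemma EL_comm (ψ : σ → Module.Dual R (Fin f → R)) (u : σ → Fin f → R) (δ : R)
    (hu : ∀ k r, ψ k (u r) = if k = r then δ else 0) (L : List σ) (x : KM R f σ) :
    kdl ψ (EL ψ u L x) = EL ψ u L (kdl ψ x) := by
  induction L with
  | nil => rfl
  | cons r L ih => rw [EL_cons, EL_cons, epc_comm ψ u δ hu, ih]

lemma EL_deg (ψ : σ → Module.Dual R (Fin f → R)) (u : σ → Fin f → R) (L : List σ) (j i : ℕ)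
    (x : KM R f σ) :
    kpr j i (EL ψ u L (kpr j i x)) = EL ψ u L (kpr j i x) := by
  induction L with
  | nil => exact (strand ψ j).idem i x
  | cons r L ih => rw [EL_cons, ← ih, epc_deg, ih]

lemma EL_htpy (ψ : σ → Module.Dual R (Fin f → R)) (u : σ → Fin f → R) (δ : R)
    (hu : ∀ k r, ψ k (u r) = if k = r then δ else 0) (L : List σ) :
    ∃ H : KM R f σ →ₗ[R] KM R f σ,
      (∀ j i x, kpr j (i + 1) (H (kpr j i x)) = H (kpr j i x)) ∧
      ∀ x, kdl ψ (H x) + H (kdl ψ x) = δ ^ L.length • x - EL ψ u L x := by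
  induction L with
  | nil => exact ⟨0, by simp, by intro x; simp [EL]⟩
  | cons r L ih =>
    obtain ⟨H, h1, h2⟩ := ih
    refine ⟨δ • H + hpc u r ∘ₗ EL ψ u L, ?_, ?_⟩
    · intro j i x
      simp only [LinearMap.add_apply, LinearMap.smul_apply, LinearMap.comp_apply, map_add,
        map_smul, h1]
      rw [← EL_deg ψ u L j i x, hpc_deg]
    · intro x
      have h3 := hpc_htpy ψ u δ hu r (EL ψ u L x)
      have h4 := h2 x
      rw [EL_comm ψ u δ hu] at h3
      simp only [LinearMap.add_apply, LinearMap.smul_apply, LinearMap.comp_apply, map_add,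
        map_smul]
      rw [add_add_add_comm, h3, ← smul_add, h4, EL_cons, List.length_cons, pow_succ', mul_smul,
        smul_sub]
      abel

lemma EL_tmul (ψ : σ → Module.Dual R (Fin f → R)) (u : σ → Fin f → R) (δ : R)
    (hu : ∀ k r, ψ k (u r) = if k = r then δ else 0) (L : List σ) (hL : L.Nodup)
    (p : MvPolynomial σ R) (y : Lam R f) : EL ψ u L (p ⊗ₜ y) =
      ((L.map evz).prod p) ⊗ₜ[R] ((-1 : R) ^ (L.length.choose 2) •
        DL (L.map ψ) (UL (L.map u) y)) := by
  induction L with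
  | nil => simp [EL]
  | cons r L ih =>
    rw [EL_cons, ih hL.of_cons, epc, TensorProduct.map_tmul]
    simp only [List.map_cons, List.prod_cons, Module.End.mul_apply, DL_cons, UL_cons,
      LinearMap.comp_apply, map_smul, List.length_cons, Nat.choose_succ_succ' L.length 1,
      Nat.choose_one_right, pow_add]
    rw [Uw_DL, List.length_map, map_smul, mul_smul, smul_comm]
    intro α hα
    obtain ⟨k, hk, rfl⟩ := List.mem_map.1 hα
    rw [hu, if_neg]
    rintro rfl
    exact (List.nodup_cons.1 hL).1 hk

lemma UL_Dc (α : Module.Dual R (Fin f → R)) (L : List (Fin f → R)) (h : ∀ w ∈ L, α w = 0)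
    (x : Lam R f) : UL L (Dc α x) = (-1 : R) ^ L.length • Dc α (UL L x) := by
  induction L with
  | nil => simp
  | cons w L ih =>
    have := Dc_Uw α w (UL L x)
    rw [h w (by simp), zero_smul, zero_sub] at this
    rw [UL_cons, ih (fun w hw => h w (by simp [hw])), UL_cons, map_smul, List.length_cons,
      pow_succ, mul_smul, this]
    simp

lemma UL_DL_om (ψ : σ → Module.Dual R (Fin f → R)) (u : σ → Fin f → R) (δ : R)
    (hu : ∀ k r, ψ k (u r) = if k = r then δ else 0) (L : List σ) (hL : L.Nodup) :
    (-1 : R) ^ (L.length.choose 2) • UL (L.map u) (DL (L.map ψ) (om R f)) =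
      δ ^ L.length • om R f := by
  induction L with
  | nil => simp
  | cons r L ih =>
    have h1 : ∀ w ∈ L.map u, ψ r w = 0 := by
      intro w hw
      obtain ⟨k, hk, rfl⟩ := List.mem_map.1 hw
      rw [hu, if_neg]
      rintro rfl
      exact (List.nodup_cons.1 hL).1 hk
    have h2 := Dc_Uw (ψ r) (u r) (om R f)
    rw [Uw_om, map_zero, hu, if_pos rfl, eq_comm, sub_eq_zero] at h2
    simp only [List.map_cons, DL_cons, UL_cons, List.length_cons,
      Nat.choose_succ_succ' L.length 1, Nat.choose_one_right, pow_add]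
    rw [UL_Dc _ _ h1, List.length_map, map_smul, smul_smul, mul_right_comm, ← mul_pow]
    simp only [mul_neg, mul_one, neg_neg, one_pow, one_mul]
    rw [← map_smul, ← map_smul, ih hL.of_cons, map_smul, map_smul, ← h2, smul_smul, pow_one]

lemma evz_prod (L : List σ) (hL : ∀ k, k ∈ L) (p : MvPolynomial σ R) :
    (L.map (evz (R := R))).prod p = C (coeff 0 p) := by
  have : ∀ L : List σ, ∀ s, coeff s ((L.map (evz (R := R))).prod p) =
      if ∀ k ∈ L, s k = 0 then coeff s p else 0 := by
    intro L s
    induction L with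
    | nil => simp
    | cons r L ih =>
      simp only [List.map_cons, List.prod_cons, Module.End.mul_apply, coeff_evz, ih]
      by_cases h : s r = 0 <;> simp [h]
  ext s
  rw [this, coeff_C]
  by_cases hs : 0 = s
  · subst hs; simp
  · rw [if_neg hs, if_neg]
    intro h
    exact hs (by ext k; simp [h k (hL k)])

end Kos
end

section
open ExteriorAlgebra TensorProduct MvPolynomial RingTheory.Sequence

set_option linter.unusedSectionVars false
section Kos5

variable {R : Type u} [CommRing R] {f : ℕ} {σ : Type} [Fintype σ] [DecidableEq σ]

/-- The ideal of powers of maximal minors (elements with a cofactor system). -/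
def hid (ψ : σ → Module.Dual R (Fin f → R)) : Ideal R :=
  Ideal.span {y | ∃ (δ : R) (u : σ → Fin f → R),
    (∀ k r, ψ k (u r) = if k = r then δ else 0) ∧ y = δ ^ Fintype.card σ}

/-- linear forms attached to the columns -/
noncomputable def gform (ψ : σ → Module.Dual R (Fin f → R)) (v : Fin f → R) : MvPolynomial σ R :=
  ∑ k, ψ k v • X k

/-- ideal generated by the linear forms -/
noncomputable def gI (ψ : σ → Module.Dual R (Fin f → R)) : Ideal (MvPolynomial σ R) :=
  Ideal.span (Set.range (gform ψ))

lemma gform_hom (ψ : σ → Module.Dual R (Fin f → R)) (v : Fin f → R) :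
    (gform ψ v).IsHomogeneous 1 := by
  unfold gform
  refine IsHomogeneous.sum _ _ _ fun k _ => ?_
  rw [smul_eq_C_mul]
  simpa using (isHomogeneous_C σ (ψ k v)).mul (isHomogeneous_X R k)

/-- augmentation -/
noncomputable def aug : KM R f σ →ₗ[R] MvPolynomial σ R :=
  TensorProduct.lift ((LinearMap.mul R (MvPolynomial σ R)).compl₂
    (Algebra.linearMap R (MvPolynomial σ R) ∘ₗ (algebraMapInv (R := R) (M := Fin f → R)).toLinearMap))

lemma aug_tmul (p : MvPolynomial σ R) (y : Lam R f) :
    aug (p ⊗ₜ[R] y) = algebraMapInv y • p := by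
  simp only [aug, TensorProduct.lift.tmul, LinearMap.compl₂_apply, LinearMap.comp_apply,
    LinearMap.mul_apply', Algebra.linearMap_apply, AlgHom.toLinearMap_apply]
  rw [mul_comm, Algebra.smul_def]

lemma aug_one (p : MvPolynomial σ R) : aug (p ⊗ₜ[R] (1 : Lam R f)) = p := by
  rw [aug_tmul, map_one, one_smul]

lemma kpr_zero (j : ℕ) (x : KM R f σ) : kpr j 0 x = aug (kpr j 0 x) ⊗ₜ[R] (1 : Lam R f) := by
  refine kpr_ind LinearMap.id ((TensorProduct.mk R _ _).flip 1 ∘ₗ aug) j 0 (fun h p hp y hy => ?_) x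
  have hy' : y ∈ LinearMap.range (ι R : (Fin f → R) →ₗ[R] Lam R f) ^ 0 := hy
  rw [pow_zero, Submodule.mem_one] at hy'
  obtain ⟨r, rfl⟩ := hy'
  simp only [LinearMap.id_apply, LinearMap.comp_apply, LinearMap.flip_apply, TensorProduct.mk_apply,
    aug_tmul]
  rw [algebraMap_leftInverse, Algebra.algebraMap_eq_smul_one, TensorProduct.tmul_smul,
    TensorProduct.smul_tmul']

lemma aug_kpr_hom (j : ℕ) (x : KM R f σ) : (aug (kpr j 0 x)).IsHomogeneous j := by
  induction x using TensorProduct.induction_on with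
  | zero => simp only [map_zero]; exact isHomogeneous_zero _ _ _
  | add x y hx hy => rw [map_add, map_add]; exact hx.add hy
  | tmul p y =>
    rw [kpr_tmul (Nat.zero_le _), aug_tmul, smul_eq_C_mul]
    simpa using (isHomogeneous_C σ _).mul (homogeneousComponent_isHomogeneous j p)

lemma one_mem0 : (1 : Lam R f) ∈ ⋀[R]^0 (Fin f → R) := by
  show (1 : Lam R f) ∈ LinearMap.range (ι R : (Fin f → R) →ₗ[R] Lam R f) ^ 0
  rw [pow_zero]; exact Submodule.one_le.1 le_rfl

lemma kpr_one {j : ℕ} {p : MvPolynomial σ R} (hp : p.IsHomogeneous j) :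
    kpr j 0 (p ⊗ₜ[R] (1 : Lam R f)) = p ⊗ₜ 1 :=
  kpr_of_mem (Nat.zero_le _) hp one_mem0

lemma aug_kdl (ψ : σ → Module.Dual R (Fin f → R)) (j : ℕ) (x : KM R f σ) :
    aug (kdl ψ (kpr j 1 x)) ∈ gI ψ := by
  by_cases hj : 1 ≤ j
  swap
  · rw [kpr_of_lt (by omega)]; simp
  induction x using TensorProduct.induction_on with
  | zero => simp
  | add x y hx hy => simp only [map_add]; exact add_mem hx hy
  | tmul p y =>
    rw [kpr_tmul hj]
    have h := eps_mem 1 y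
    have h' : eps 1 y ∈ LinearMap.range (ι R : (Fin f → R) →ₗ[R] Lam R f) ^ 1 := h
    rw [pow_one] at h'
    obtain ⟨v, hv⟩ := h'
    rw [← hv, kdl_tmul, map_sum]
    have : ∑ k, aug ((X k * homogeneousComponent (j - 1) p) ⊗ₜ[R] Dc (ψ k) (ι R v : Lam R f)) =
        homogeneousComponent (j - 1) p * gform ψ v := by
      rw [gform, Finset.mul_sum]
      refine Finset.sum_congr rfl fun k _ => ?_
      have : Dc (ψ k) (ι R v : Lam R f) = algebraMap R _ (ψ k v) :=
        CliffordAlgebra.contractLeft_ι (Q := 0) (ψ k) v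
      rw [this, aug_tmul, algebraMap_leftInverse, mul_smul_comm, mul_comm (X k)]
    rw [this]
    exact Ideal.mul_mem_left _ _ (Ideal.subset_span ⟨v, rfl⟩)

lemma homComp_mul {g : MvPolynomial σ R} {m : ℕ} (hg : g.IsHomogeneous m) (q : MvPolynomial σ R)
    (j : ℕ) : homogeneousComponent j (q * g) =
      if m ≤ j then homogeneousComponent (j - m) q * g else 0 := by
  conv_lhs => rw [← sum_homogeneousComponent q, Finset.sum_mul, map_sum]
  have h : ∀ i, homogeneousComponent j (homogeneousComponent i q * g) =
      if j = i + m then homogeneousComponent i q * g else 0 := fun i =>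
    homogeneousComponent_of_mem ((mem_homogeneousSubmodule _ _).2
      ((homogeneousComponent_isHomogeneous i q).mul hg))
  simp only [h]
  split_ifs with hm
  · by_cases hd : j - m < q.totalDegree + 1
    · rw [Finset.sum_eq_single (j - m), if_pos (by omega)]
      · intro b _ hb; rw [if_neg (by omega)]
      · intro hn; exact absurd (Finset.mem_range.2 hd) hn
    · rw [homogeneousComponent_eq_zero (j - m) q (by omega), zero_mul]
      refine Finset.sum_eq_zero fun i hi => ?_
      have := Finset.mem_range.1 hi
      rw [if_neg (by omega)]
  · exact Finset.sum_eq_zero fun i _ => if_neg (by omega)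

lemma homComp_gI (ψ : σ → Module.Dual R (Fin f → R)) (j : ℕ) (h : MvPolynomial σ R)
    (hh : h ∈ gI ψ) : ∃ w : KM R f σ, kdl ψ (kpr j 1 w) = homogeneousComponent j h ⊗ₜ 1 := by
  suffices H : ∀ q : MvPolynomial σ R, ∃ w : KM R f σ,
      kdl ψ (kpr j 1 w) = homogeneousComponent j (q * h) ⊗ₜ 1 by simpa using H 1
  induction hh using Submodule.span_induction with
  | zero => exact fun q => ⟨0, by simp⟩
  | add x y _ _ hx hy =>
    intro q
    obtain ⟨a, ha⟩ := hx q
    obtain ⟨b, hb⟩ := hy q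
    exact ⟨a + b, by simp only [map_add, ha, hb, TensorProduct.add_tmul, mul_add]⟩
  | mem x hx =>
    intro q
    obtain ⟨v, rfl⟩ := hx
    rw [homComp_mul (gform_hom ψ v)]
    split_ifs with hj
    · refine ⟨homogeneousComponent (j - 1) q ⊗ₜ ι R v, ?_⟩
      have h1 : (ι R v : Lam R f) ∈ ⋀[R]^1 (Fin f → R) := by
        show (ι R v : Lam R f) ∈ LinearMap.range (ι R : (Fin f → R) →ₗ[R] Lam R f) ^ 1
        rw [pow_one]; exact ⟨v, rfl⟩
      rw [kpr_of_mem hj (homogeneousComponent_isHomogeneous _ _) h1, kdl_tmul, gform,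
        Finset.mul_sum, TensorProduct.sum_tmul]
      refine Finset.sum_congr rfl fun k _ => ?_
      have : Dc (ψ k) (ι R v : Lam R f) = algebraMap R _ (ψ k v) :=
        CliffordAlgebra.contractLeft_ι (Q := 0) (ψ k) v
      rw [this, Algebra.algebraMap_eq_smul_one, TensorProduct.tmul_smul, TensorProduct.smul_tmul',
        mul_smul_comm, mul_comm]
    · exact ⟨0, by simp⟩
  | smul p x hx hx' =>
    intro q
    rw [smul_eq_mul, ← mul_assoc]
    exact hx' _

/-- the homotopy for the full list -/
lemma full_htpy (ψ : σ → Module.Dual R (Fin f → R)) (u : σ → Fin f → R) (δ : R)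
    (hu : ∀ k r, ψ k (u r) = if k = r then δ else 0) (L : List σ) (hL : L.Nodup)
    (hL' : ∀ k, k ∈ L) :
    ∃ H : KM R f σ →ₗ[R] KM R f σ,
      (∀ j i x, kpr j (i + 1) (H (kpr j i x)) = H (kpr j i x)) ∧
      (∀ x, kdl ψ (H x) + H (kdl ψ x) = δ ^ L.length • x - EL ψ u L x) ∧
      ∀ (p : MvPolynomial σ R) (y : Lam R f), EL ψ u L (p ⊗ₜ y) =
      (1 : MvPolynomial σ R) ⊗ₜ[R] ((coeff 0 p * (-1 : R) ^ (L.length.choose 2)) •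
        DL (L.map ψ) (UL (L.map u) y)) := by
  obtain ⟨H, h1, h2⟩ := EL_htpy ψ u δ hu L
  refine ⟨H, h1, h2, fun p y => ?_⟩
  rw [EL_tmul ψ u δ hu L hL, evz_prod L hL', C_eq_smul_one, mul_smul, TensorProduct.tmul_smul _ _ (_ • _),
    TensorProduct.smul_tmul']

lemma coeff_zero_hom {p : MvPolynomial σ R} {m : ℕ} (hp : p.IsHomogeneous m) (hm : m ≠ 0) :
    coeff 0 p = 0 := by
  by_contra h
  exact hm (by simpa using (hp h).symm)

lemma length_eq_card {L : List σ} (hL : L.Nodup) (hL' : ∀ k, k ∈ L) : L.length = Fintype.card σ := by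
  rw [← List.toFinset_card_of_nodup hL, ← Finset.card_univ]
  congr 1; ext k; simp [hL' k]

lemma strand_null (ψ : σ → Module.Dual R (Fin f → R)) (j : ℕ) (hj : f < j + Fintype.card σ) :
    ∀ y ∈ hid ψ, NullHtpy (strand ψ j).d y := by
  refine nullHtpy_ideal _ _ ?_
  rintro _ ⟨δ, u, hu, rfl⟩
  have hL := Finset.nodup_toList (Finset.univ : Finset σ)
  have hL' : ∀ k, k ∈ (Finset.univ : Finset σ).toList := by simp
  obtain ⟨H, h1, h2, h3⟩ := full_htpy ψ u δ hu _ hL hL'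
  rw [length_eq_card hL hL'] at h2 h3
  refine (strand ψ j).nullHtpy _ H (h1 j) fun i x => ?_
  show kdl ψ (H (kpr j i x)) + H (kdl ψ (kpr j i x)) = _ • kpr j i x
  rw [h2, sub_eq_self]
  refine kpr_ind (EL ψ u _) 0 j i (fun hij p hp y hy => ?_) x
  rw [h3]
  rcases hij.lt_or_eq with h | rfl
  · rw [coeff_zero_hom hp (by omega)]; simp
  · have := UL_mem ((Finset.univ : Finset σ).toList.map u) i y hy
    rw [List.length_map, length_eq_card hL hL'] at this
    rw [lam_eq_zero hj this]; simp

end Kos5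
end

section
open ExteriorAlgebra TensorProduct MvPolynomial RingTheory.Sequence

set_option linter.unusedSectionVars false
section Kos6

variable {R : Type u} [CommRing R] {f : ℕ} {σ : Type} [Fintype σ] [DecidableEq σ]

lemma smul_tmul_one (z : R) (p : MvPolynomial σ R) :
    z • (p ⊗ₜ[R] (1 : Lam R f)) = (C z * p) ⊗ₜ 1 := by
  rw [TensorProduct.smul_tmul', smul_eq_C_mul]

/-- degree zero element of a strand -/
noncomputable def el0 (ψ : σ → Module.Dual R (Fin f → R)) {j : ℕ} {p : MvPolynomial σ R}
    (hp : p.IsHomogeneous j) : (strand ψ j).X 0 :=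
  ⟨p ⊗ₜ 1, ((strand ψ j).mem_iff 0 _).2 (kpr_one hp)⟩

lemma bdry_iff (ψ : σ → Module.Dual R (Fin f → R)) {j : ℕ} {p : MvPolynomial σ R}
    (hp : p.IsHomogeneous j) : p ∈ gI ψ ↔ ∃ w, (strand ψ j).d 0 w = el0 ψ hp := by
  constructor
  · intro h
    obtain ⟨w, hw⟩ := homComp_gI ψ j p h
    rw [homogeneousComponent_eq_self hp] at hw
    exact ⟨⟨kpr j 1 w, w, rfl⟩, Subtype.ext hw⟩
  · rintro ⟨⟨_, w, rfl⟩, hw⟩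
    have h1 : kdl ψ (kpr j 1 w) = p ⊗ₜ 1 := congrArg Subtype.val hw
    rw [← aug_one (f := f) p, ← h1]
    exact aug_kdl ψ j w

instance KM_proj : Module.Projective R (KM R f σ) := inferInstance

lemma strand_sub (ψ : σ → Module.Dual R (Fin f → R)) {j i : ℕ} (h : j < i) :
    Subsingleton ((strand ψ j).X i) := by
  refine ⟨fun a b => ?_⟩
  have : ∀ a : (strand ψ j).X i, a = 0 := by
    rintro ⟨_, w, rfl⟩
    ext
    show kpr j i w = 0
    rw [kpr_of_lt h]; rfl
  rw [this a, this b]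

lemma strand_exact (ψ : σ → Module.Dual R (Fin f → R)) (j : ℕ) (hj : f < j + Fintype.card σ)
    (ys : List R) (hys : IsWeaklyRegular R ys) (hy : ∀ y ∈ ys, y ∈ hid ψ) (hlen : j ≤ ys.length)
    (i : ℕ) (z : (strand ψ j).X (i + 1)) (hz : (strand ψ j).d i z = 0) :
    ∃ w, (strand ψ j).d (i + 1) w = z :=
  exact_of_nullHtpy j ys _ (strand ψ j).d (strand ψ j).dd
    (fun _ => isWeaklyRegular_of_projective hys _)
    (fun y h => strand_null ψ j hj y (hy y h)) (fun _ h => strand_sub ψ h) (i + 1) (by omega) z hz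

/-- torsion statement for strands -/
theorem K1 (ψ : σ → Module.Dual R (Fin f → R)) (j : ℕ) (hj : f < j + Fintype.card σ)
    (ys : List R) (hys : IsWeaklyRegular R ys) (hy : ∀ y ∈ ys, y ∈ hid ψ) (hlen : j ≤ ys.length)
    (zs : List R) (hzs : IsWeaklyRegular R zs) (hlen' : j < zs.length)
    (p : MvPolynomial σ R) (hp : p.IsHomogeneous j) (h : ∀ z ∈ zs, C z * p ∈ gI ψ) :
    p ∈ gI ψ := by
  rw [bdry_iff ψ hp]
  refine torsion_lemma zs _ (strand ψ j).d (strand ψ j).dd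
    (fun _ => isWeaklyRegular_of_projective hzs _) (fun i hi => strand_sub ψ (by omega))
    (strand_exact ψ j hj ys hys hy hlen) _ fun z hz => ?_
  have hp' : (C z * p).IsHomogeneous j := by
    simpa using (isHomogeneous_C σ z).mul hp
  obtain ⟨w, hw⟩ := (bdry_iff ψ hp').1 (h z hz)
  refine ⟨w, hw.trans (Subtype.ext ?_)⟩
  exact (smul_tmul_one z p).symm

/-- top contraction -/
noncomputable def Psi (ψ : σ → Module.Dual R (Fin f → R)) (L : List σ) : Lam R f :=
  DL (L.map ψ) (om R f)

lemma Psi_mem (ψ : σ → Module.Dual R (Fin f → R)) (L : List σ) {N : ℕ} (hN : N + L.length = f) :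
    Psi ψ L ∈ ⋀[R]^N (Fin f → R) := by
  refine DL_mem _ _ _ ?_
  rw [List.length_map]
  have := om_mem (R := R) (f := f)
  rwa [← hN] at this ⊢

lemma kdl_Psi (ψ : σ → Module.Dual R (Fin f → R)) (L : List σ) (hL' : ∀ k, k ∈ L) :
    kdl ψ ((1 : MvPolynomial σ R) ⊗ₜ[R] Psi ψ L) = 0 := by
  rw [kdl_tmul]
  refine Finset.sum_eq_zero fun k _ => ?_
  rw [Psi, Dc_DL_of_mem (List.mem_map.2 ⟨k, hL' k, rfl⟩), TensorProduct.tmul_zero]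

lemma kpr_Psi (ψ : σ → Module.Dual R (Fin f → R)) (L : List σ) {N : ℕ} (hN : N + L.length = f) :
    kpr N N ((1 : MvPolynomial σ R) ⊗ₜ[R] Psi ψ L : KM R f σ) = 1 ⊗ₜ Psi ψ L :=
  kpr_of_mem le_rfl (by simpa using isHomogeneous_one σ R) (Psi_mem ψ L hN)

/-- a strand extended by one more module `V` in degree `N + 1` -/
noncomputable def extCx {V : Type u} [AddCommGroup V] [Module R V]
    (ψ : σ → Module.Dual R (Fin f → R)) (N : ℕ) (a : V →ₗ[R] KM R f σ)
    (ha : ∀ v, kpr N N (a v) = a v) (ha' : ∀ v, kdl ψ (a v) = 0) :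
    GCx R (KM R f σ × V) where
  dl := LinearMap.inl R _ _ ∘ₗ (kdl ψ ∘ₗ LinearMap.fst R _ _ + a ∘ₗ LinearMap.snd R _ _)
  pr i := LinearMap.prodMap (kpr N i) (if i = N + 1 then LinearMap.id else 0)
  idem i x := by
    refine Prod.ext ((strand ψ N).idem i x.1) ?_
    simp only [LinearMap.prodMap_apply]
    split_ifs <;> rfl
  dl_pr i x := by
    refine Prod.ext ?_ ?_
    · show kpr N i (kdl ψ (kpr N (i + 1) x.1) + a _) = kdl ψ (kpr N (i + 1) x.1) + a _
      rw [map_add]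
      congr 1
      · exact (strand ψ N).dl_pr i x.1
      · by_cases h : i = N
        · subst h; exact ha _
        · simp [h]
    · show (if i = N + 1 then LinearMap.id else 0 : V →ₗ[R] V) 0 = 0
      simp
  dl_zero x := by
    refine Prod.ext ?_ rfl
    show kdl ψ (kpr N 0 x.1) + a _ = 0
    rw [show kdl ψ (kpr N 0 x.1) = 0 from (strand ψ N).dl_zero x.1]
    simp
  dl_dl x := by
    refine Prod.ext ?_ rfl
    show kdl ψ (kdl ψ x.1 + a x.2) + a 0 = 0
    rw [map_add, kdl_kdl, ha']; simp

/-- the Buchsbaum-Rim type complex -/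
noncomputable def bcx (ψ : σ → Module.Dual R (Fin f → R)) (L : List σ) (hL' : ∀ k, k ∈ L)
    (N : ℕ) (hN : N + L.length = f) : GCx R (KM R f σ × R) :=
  extCx ψ N (LinearMap.toSpanSingleton R _ ((1 : MvPolynomial σ R) ⊗ₜ[R] Psi ψ L))
    (fun v => by simp [kpr_Psi ψ L hN]) (fun v => by simp [kdl_Psi ψ L hL'])

lemma bcx_null (ψ : σ → Module.Dual R (Fin f → R)) (L : List σ) (hL : L.Nodup)
    (hL' : ∀ k, k ∈ L) (N : ℕ) (hN : N + L.length = f) :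
    ∀ y ∈ hid ψ, NullHtpy (bcx ψ L hL' N hN).d y := by
  refine nullHtpy_ideal _ _ ?_
  rintro _ ⟨δ, u, hu, rfl⟩
  obtain ⟨H, h1, h2, h3⟩ := full_htpy ψ u δ hu L hL hL'
  have h4 := UL_DL_om ψ u δ hu L hL
  rw [← length_eq_card hL hL']
  let κ : KM R f σ →ₗ[R] R := TensorProduct.lift ((LinearMap.mul R R).compl₁₂
    (lcoeff R (0 : σ →₀ ℕ)) (((-1 : R) ^ (L.length.choose 2)) • (topc R f ∘ₗ UL (L.map u))))
  have hκ : ∀ p y, κ (p ⊗ₜ y) = coeff 0 p * ((-1 : R) ^ (L.length.choose 2) *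
      topc R f (UL (L.map u) y)) := by
    intro p y; simp [κ, lcoeff]
  refine (bcx ψ L hL' N hN).nullHtpy _ (LinearMap.prod (H ∘ₗ LinearMap.fst R _ _)
    (κ ∘ₗ LinearMap.fst R _ _)) (fun i x => ?_) fun i x => ?_
  · refine Prod.ext (h1 N i x.1) ?_
    show (if i + 1 = N + 1 then LinearMap.id else 0 : R →ₗ[R] R) (κ (kpr N i x.1)) = κ (kpr N i x.1)
    by_cases hi : i = N
    · simp [hi]
    · have : κ (kpr N i x.1) = 0 := by
        refine kpr_ind (N := R) κ 0 N i (fun hij p hp y hy => ?_) x.1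
        rw [hκ, coeff_zero_hom hp (by omega)]; simp
      rw [this, map_zero]
  · refine Prod.ext ?_ ?_
    · show kdl ψ (H (kpr N i x.1)) + κ (kpr N i x.1) • ((1 : MvPolynomial σ R) ⊗ₜ[R] Psi ψ L) +
        H (kdl ψ (kpr N i x.1) +
        ((if i = N + 1 then LinearMap.id else 0 : R →ₗ[R] R) x.2) • ((1 : MvPolynomial σ R) ⊗ₜ[R] Psi ψ L)) = δ ^ L.length • kpr N i x.1
      have h5 : H ((1 : MvPolynomial σ R) ⊗ₜ[R] Psi ψ L) = 0 := by
        have := h1 N N ((1 : MvPolynomial σ R) ⊗ₜ[R] Psi ψ L)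
        rw [kpr_Psi ψ L hN, kpr_of_lt (Nat.lt_succ_self N)] at this
        exact this.symm
      have h6 : EL ψ u L (kpr N i x.1) = κ (kpr N i x.1) • ((1 : MvPolynomial σ R) ⊗ₜ[R] Psi ψ L) := by
        refine kpr_ind (EL ψ u L) (LinearMap.toSpanSingleton R _ ((1 : MvPolynomial σ R) ⊗ₜ[R] Psi ψ L) ∘ₗ κ) N i
          (fun hij p hp y hy => ?_) x.1
        rw [h3, LinearMap.comp_apply, LinearMap.toSpanSingleton_apply, hκ]
        rcases hij.lt_or_eq with h | rfl
        · rw [coeff_zero_hom hp (by omega)]; simp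
        · have := UL_mem (L.map u) i y hy
          rw [List.length_map, hN] at this
          rw [eq_topc this, map_smul, ← Psi, ← TensorProduct.tmul_smul, smul_smul]
          simp only [map_smul, topc_om, smul_eq_mul, mul_one, mul_assoc]
      rw [map_add, map_smul, h5, smul_zero, add_zero, ← h6, add_right_comm, h2]
      abel
    · show 0 + κ (kdl ψ (kpr N i x.1) +
        ((if i = N + 1 then LinearMap.id else 0 : R →ₗ[R] R) x.2) • ((1 : MvPolynomial σ R) ⊗ₜ[R] Psi ψ L)) =
        δ ^ L.length * ((if i = N + 1 then LinearMap.id else 0 : R →ₗ[R] R) x.2)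
      have h5 : ∀ z, κ (kdl ψ z) = 0 := by
        intro z
        induction z using TensorProduct.induction_on with
        | zero => simp
        | add x y hx hy => simp only [map_add, hx, hy, add_zero]
        | tmul p y =>
          rw [kdl_tmul, map_sum]
          refine Finset.sum_eq_zero fun k _ => ?_
          rw [hκ, coeff_X_mul', if_neg (by simp), zero_mul]
      have h6 : κ ((1 : MvPolynomial σ R) ⊗ₜ[R] Psi ψ L) = δ ^ L.length := by
        have := congrArg (topc R f) h4
        rw [map_smul, map_smul, topc_om, smul_eq_mul, smul_eq_mul, mul_one] at this
        rw [hκ, ← this]; simp [Psi]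
      rw [map_add, h5, map_smul, h6, zero_add, zero_add, smul_eq_mul, mul_comm]

lemma bcx_sub (ψ : σ → Module.Dual R (Fin f → R)) (L : List σ)
    (hL' : ∀ k, k ∈ L) (N : ℕ) (hN : N + L.length = f) {i : ℕ} (h : N + 1 < i) :
    Subsingleton ((bcx ψ L hL' N hN).X i) := by
  have : ∀ a : (bcx ψ L hL' N hN).X i, a = 0 := by
    rintro ⟨_, w, rfl⟩
    refine Subtype.ext (Prod.ext ?_ ?_)
    · show kpr N i w.1 = 0
      rw [kpr_of_lt (by omega)]; rfl
    · show (if i = N + 1 then LinearMap.id else 0 : R →ₗ[R] R) w.2 = 0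
      rw [if_neg (by omega)]; rfl
  exact ⟨fun a b => by rw [this a, this b]⟩

lemma bcx_exact (ψ : σ → Module.Dual R (Fin f → R)) (L : List σ) (hL : L.Nodup)
    (hL' : ∀ k, k ∈ L) (N : ℕ) (hN : N + L.length = f)
    (ys : List R) (hys : IsWeaklyRegular R ys) (hy : ∀ y ∈ ys, y ∈ hid ψ) (hlen : N + 1 ≤ ys.length)
    (i : ℕ) (z : (bcx ψ L hL' N hN).X (i + 1)) (hz : (bcx ψ L hL' N hN).d i z = 0) :
    ∃ w, (bcx ψ L hL' N hN).d (i + 1) w = z :=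
  exact_of_nullHtpy (N + 1) ys _ (bcx ψ L hL' N hN).d (bcx ψ L hL' N hN).dd
    (fun _ => isWeaklyRegular_of_projective hys _)
    (fun y h => bcx_null ψ L hL hL' N hN y (hy y h)) (fun _ h => bcx_sub ψ L hL' N hN h) (i + 1)
    (by omega) z hz

/-- degree zero element of an extended strand -/
noncomputable def el0' (ψ : σ → Module.Dual R (Fin f → R)) (L : List σ)
    (hL' : ∀ k, k ∈ L) (N : ℕ) (hN : N + L.length = f) {p : MvPolynomial σ R}
    (hp : p.IsHomogeneous N) : (bcx ψ L hL' N hN).X 0 :=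
  ⟨(p ⊗ₜ 1, 0), ((bcx ψ L hL' N hN).mem_iff 0 _).2 (Prod.ext (kpr_one hp) rfl)⟩

lemma bdry_iff' (ψ : σ → Module.Dual R (Fin f → R)) (L : List σ)
    (hL' : ∀ k, k ∈ L) (N : ℕ) (hN : N + L.length = f) (hN0 : N ≠ 0) {p : MvPolynomial σ R}
    (hp : p.IsHomogeneous N) : p ∈ gI ψ ↔ ∃ w, (bcx ψ L hL' N hN).d 0 w = el0' ψ L hL' N hN hp := by
  constructor
  · intro h
    obtain ⟨w, hw⟩ := homComp_gI ψ N p h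
    rw [homogeneousComponent_eq_self hp] at hw
    refine ⟨⟨(kpr N 1 w, 0), (w, 0), Prod.ext rfl ?_⟩, Subtype.ext (Prod.ext ?_ rfl)⟩
    · show (if 1 = N + 1 then LinearMap.id else 0 : R →ₗ[R] R) 0 = 0
      exact map_zero _
    · show kdl ψ (kpr N 1 w) + (0 : R) • ((1 : MvPolynomial σ R) ⊗ₜ[R] Psi ψ L) = p ⊗ₜ 1
      rw [hw]; simp
  · rintro ⟨⟨_, w, rfl⟩, hw⟩
    have h1 : kdl ψ (kpr N 1 w.1) + (if 1 = N + 1 then LinearMap.id else 0 : R →ₗ[R] R) w.2 • ((1 : MvPolynomial σ R) ⊗ₜ[R] Psi ψ L) =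
      p ⊗ₜ 1 := congrArg (fun x => (Subtype.val x).1) hw
    rw [if_neg (by omega), LinearMap.zero_apply, zero_smul, add_zero] at h1
    rw [← aug_one (f := f) p, ← h1]
    exact aug_kdl ψ N w.1

/-- torsion statement for the extended strand -/
theorem K2 (ψ : σ → Module.Dual R (Fin f → R)) (N : ℕ) (hN : N + Fintype.card σ = f) (hN0 : N ≠ 0)
    (ys : List R) (hys : IsWeaklyRegular R ys) (hy : ∀ y ∈ ys, y ∈ hid ψ) (hlen : N + 1 ≤ ys.length)
    (zs : List R) (hzs : IsWeaklyRegular R zs) (hlen' : N + 1 < zs.length)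
    (p : MvPolynomial σ R) (hp : p.IsHomogeneous N) (h : ∀ z ∈ zs, C z * p ∈ gI ψ) :
    p ∈ gI ψ := by
  have hL := Finset.nodup_toList (Finset.univ : Finset σ)
  have hL' : ∀ k, k ∈ (Finset.univ : Finset σ).toList := by simp
  rw [← length_eq_card hL hL'] at hN
  rw [bdry_iff' ψ _ hL' N hN hN0 hp]
  refine torsion_lemma zs _ (bcx ψ _ hL' N hN).d (bcx ψ _ hL' N hN).dd
    (fun _ => isWeaklyRegular_of_projective hzs _) (fun i hi => bcx_sub ψ _ hL' N hN (by omega))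
    (bcx_exact ψ _ hL hL' N hN ys hys hy hlen) _ fun z hz => ?_
  have hp' : (C z * p).IsHomogeneous N := by
    simpa using (isHomogeneous_C σ z).mul hp
  obtain ⟨w, hw⟩ := (bdry_iff' ψ _ hL' N hN hN0 hp').1 (h z hz)
  refine ⟨w, hw.trans (Subtype.ext (Prod.ext ?_ ?_))⟩
  · exact (smul_tmul_one z p).symm
  · exact (smul_zero z).symm

/-- (★) -/
theorem Kstar (ψ : σ → Module.Dual R (Fin f → R)) (L : List σ) (hL : L.Nodup)
    (hL' : ∀ k, k ∈ L) (N : ℕ) (hN : N + L.length = f) (hN0 : N ≠ 0)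
    (ys : List R) (hys : IsWeaklyRegular R ys) (hy : ∀ y ∈ ys, y ∈ hid ψ) (hlen : N + 1 ≤ ys.length)
    (x : R) (h : ∀ p : MvPolynomial σ R, p.IsHomogeneous N → C x * p ∈ gI ψ) :
    ∃ s : Lam R f →ₗ[R] R, x = s (Psi ψ L) := by
  set G := bcx ψ L hL' N hN with hG
  obtain ⟨s, h0, h1⟩ := exists_htpy G.d G.dd G.d (bcx_exact ψ L hL hL' N hN ys hys hy hlen)
    (fun i => x • LinearMap.id) (fun i z => by simp) (by
      rintro ⟨_, z, rfl⟩
      have hp := aug_kpr_hom N z.1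
      have hp' : (C x * aug (kpr N 0 z.1)).IsHomogeneous N := by
        simpa using (isHomogeneous_C σ x).mul hp
      obtain ⟨w, hw⟩ := (bdry_iff' ψ _ hL' N hN hN0 hp').1 (h _ hp)
      refine ⟨w, hw.trans (Subtype.ext (Prod.ext ?_ ?_))⟩
      · show (C x * aug (kpr N 0 z.1)) ⊗ₜ[R] (1 : Lam R f) = x • kpr N 0 z.1
        rw [← smul_tmul_one, ← kpr_zero]
      · exact (smul_zero x).symm)
  let one : G.X (N + 1) := ⟨(0, 1), (0, 1), Prod.ext (map_zero (kpr N (N + 1))) (by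
    show (if N + 1 = N + 1 then LinearMap.id else 0 : R →ₗ[R] R) 1 = 1
    simp)⟩
  have h2 := h1 N one
  have hs : Subsingleton (G.X (N + 2)) := bcx_sub ψ L hL' N hN (by omega)
  rw [Subsingleton.elim (s (N + 1) one) 0, map_zero, zero_add] at h2
  refine ⟨LinearMap.snd R _ _ ∘ₗ (LinearMap.range (G.pr (N + 1))).subtype ∘ₗ s N ∘ₗ (G.pr N).rangeRestrict ∘ₗ
    LinearMap.inl R _ _ ∘ₗ TensorProduct.mk R _ _ 1, ?_⟩
  have h3 : (G.pr N).rangeRestrict (((1 : MvPolynomial σ R) ⊗ₜ[R] Psi ψ L), 0) = G.d N one := by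
    refine Subtype.ext (Prod.ext ?_ ?_)
    · show kpr N N ((1 : MvPolynomial σ R) ⊗ₜ[R] Psi ψ L) = kdl ψ 0 + (1 : R) • ((1 : MvPolynomial σ R) ⊗ₜ[R] Psi ψ L)
      rw [kpr_Psi ψ L hN]; simp
    · show (if N = N + 1 then LinearMap.id else 0 : R →ₗ[R] R) 0 = 0
      exact map_zero _
  have h4 := congrArg (fun x => (Subtype.val x).2) h2
  simp only [LinearMap.comp_apply, LinearMap.inl_apply, TensorProduct.mk_apply, h3]
  refine Eq.trans ?_ h4.symm
  show x = x * 1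
  simp

end Kos6
end

section
open ExteriorAlgebra TensorProduct MvPolynomial RingTheory.Sequence

set_option linter.unusedSectionVars false
section Kos7

variable {R : Type u} [CommRing R] {f : ℕ} {σ : Type} [Fintype σ] [DecidableEq σ]

/-- contraction as a linear function of the functional -/
noncomputable def Dlin (x : Lam R f) : Module.Dual R (Fin f → R) →ₗ[R] Lam R f :=
  (CliffordAlgebra.contractLeft (Q := (0 : QuadraticForm R (Fin f → R)))).flip x

lemma Dlin_apply (x : Lam R f) (α : Module.Dual R (Fin f → R)) : Dlin x α = Dc α x := rfl

lemma Dc_erase (ψ : σ → Module.Dual R (Fin f → R)) (L : List σ) (i : σ) (hi : i ∈ L) (x : Lam R f) :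
    ∃ e : R, e * e = 1 ∧ Dc (ψ i) (DL ((L.erase i).map ψ) x) = e • DL (L.map ψ) x := by
  induction L with
  | nil => simp at hi
  | cons r L ih =>
    by_cases h : r = i
    · subst h
      exact ⟨1, by simp, by simp⟩
    · obtain ⟨e, he, h2⟩ := ih (by simpa [Ne.symm h] using hi)
      refine ⟨-e, by simpa using he, ?_⟩
      rw [List.erase_cons_tail (by simpa using h)]
      simp only [List.map_cons, DL_cons]
      rw [Dc_comm, h2, map_smul, neg_smul]

lemma exists_theta (ψ : σ → Module.Dual R (Fin f → R)) (L : List σ) (hL : L.Nodup)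
    (hL' : ∀ k, k ∈ L) (N : ℕ) (hN : N + L.length = f) :
    ∃ Θ : σ → Lam R f, (∀ i, Θ i ∈ ⋀[R]^(N + 1) (Fin f → R)) ∧
      (∀ k i, Dc (ψ k) (Θ i) = if k = i then Psi ψ L else 0) ∧
      ∀ i, ∃ e : R, Θ i = e • DL ((L.erase i).map ψ) (om R f) := by
  choose e he h using fun i => Dc_erase ψ L i (hL' i) (om R f)
  refine ⟨fun i => e i • DL ((L.erase i).map ψ) (om R f), fun i => ?_, fun k i => ?_,
    fun i => ⟨e i, rfl⟩⟩
  · refine Submodule.smul_mem _ _ (DL_mem _ _ _ ?_)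
    rw [List.length_map, List.length_erase_of_mem (hL' i)]
    have h1 : 0 < L.length := List.length_pos_of_mem (hL' i)
    have := om_mem (R := R) (f := f)
    rwa [show N + 1 + (L.length - 1) = f by omega]
  · rw [map_smul]
    split_ifs with hk
    · subst hk; rw [h, smul_smul, he, one_smul]; rfl
    · rw [Dc_DL_of_mem, smul_zero]
      exact List.mem_map.2 ⟨k, (List.mem_erase_of_ne hk).2 (hL' k), rfl⟩

/-- multiplication by a polynomial on the first factor -/
noncomputable def kmul (q : MvPolynomial σ R) : KM R f σ →ₗ[R] KM R f σ :=
  TensorProduct.map (LinearMap.mulLeft R q) LinearMap.id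

lemma kmul_tmul (q p : MvPolynomial σ R) (y : Lam R f) :
    kmul q (p ⊗ₜ[R] y) = (q * p) ⊗ₜ y := rfl

lemma kdl_kmul (ψ : σ → Module.Dual R (Fin f → R)) (q : MvPolynomial σ R) (x : KM R f σ) :
    kdl ψ (kmul q x) = kmul q (kdl ψ x) := by
  induction x using TensorProduct.induction_on with
  | zero => simp
  | add x y hx hy => simp only [map_add, hx, hy]
  | tmul p y =>
    rw [kmul_tmul, kdl_tmul, kdl_tmul, map_sum]
    exact Finset.sum_congr rfl fun k _ => by rw [kmul_tmul, mul_left_comm]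

lemma kpr_kmul {q : MvPolynomial σ R} {m : ℕ} (hq : q.IsHomogeneous m) (j i : ℕ) (x : KM R f σ) :
    kpr (j + m) i (kmul q (kpr j i x)) = kmul q (kpr j i x) := by
  refine kpr_ind (kpr (j + m) i ∘ₗ kmul q) (kmul q) j i (fun h p hp y hy => ?_) x
  rw [LinearMap.comp_apply, kmul_tmul]
  refine kpr_of_mem (by omega) ?_ hy
  rw [show j + m - i = m + (j - i) by omega]
  exact hq.mul hp

lemma dual_eval (s : Module.Dual R (Fin f → R) →ₗ[R] R) : ∃ v : Fin f → R, ∀ α, s α = α v := by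
  refine ⟨fun i => s (LinearMap.proj i), fun α => ?_⟩
  have h : α = ∑ i, α (Pi.single i 1) • (LinearMap.proj i : (Fin f → R) →ₗ[R] R) := by
    ext i
    simp [LinearMap.sum_apply, Pi.single_apply]
  conv_lhs => rw [h]
  rw [map_sum]
  rw [LinearMap.pi_apply_eq_sum_univ α]
  refine Finset.sum_congr rfl fun i _ => ?_
  rw [map_smul, smul_eq_mul, smul_eq_mul, mul_comm]
  congr 2
  ext j; simp [Pi.single_apply, eq_comm]

/-- the y-lemma -/
theorem Kylem (ψ : σ → Module.Dual R (Fin f → R)) (M : ℕ) (hN : M + 1 + Fintype.card σ = f)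
    (ys : List R) (hys : IsWeaklyRegular R ys) (hy : ∀ y ∈ ys, y ∈ hid ψ) (hlen : M + 2 ≤ ys.length)
    (y : σ → R) (h : ∀ p : MvPolynomial σ R, p.IsHomogeneous M → (∑ k, y k • X k) * p ∈ gI ψ) :
    ∃ v, ∀ k, y k = ψ k v := by
  set L := (Finset.univ : Finset σ).toList with hLdef
  have hL : L.Nodup := Finset.nodup_toList (Finset.univ : Finset σ)
  have hL' : ∀ k, k ∈ L := by simp [hLdef]
  rw [← length_eq_card hL hL'] at hN
  set Y : MvPolynomial σ R := ∑ k, y k • X k with hY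
  have hYh : Y.IsHomogeneous 1 := by
    refine IsHomogeneous.sum _ _ _ fun k _ => ?_
    rw [smul_eq_C_mul]
    simpa using (isHomogeneous_C σ (y k)).mul (isHomogeneous_X R k)
  obtain ⟨Θ, hΘ, hΘD, -⟩ := exists_theta ψ L hL hL' (M + 1) hN
  have hex := bcx_exact ψ L hL hL' (M + 1) hN ys hys hy hlen
  have hsub : Subsingleton ((bcx ψ L hL' (M + 1) hN).X (M + 3)) :=
    bcx_sub ψ L hL' (M + 1) hN (by omega)
  let a : Module.Dual R (Fin f → R) →ₗ[R] KM R f σ :=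
    TensorProduct.mk R _ _ 1 ∘ₗ Dlin (Psi ψ L)
  have ha : ∀ v, a v = (1 : MvPolynomial σ R) ⊗ₜ[R] Dc v (Psi ψ L) := fun _ => rfl
  let B := extCx ψ M a (fun v => by
      rw [ha]
      exact kpr_of_mem le_rfl (by simpa using isHomogeneous_one σ R)
        (Dc_mem _ _ _ (Psi_mem ψ L hN)))
    (fun v => by
      rw [ha, kdl_tmul]
      refine Finset.sum_eq_zero fun k _ => ?_
      rw [Dc_comm, Psi, Dc_DL_of_mem (List.mem_map.2 ⟨k, hL' k, rfl⟩)]; simp)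
  let b : Module.Dual R (Fin f → R) →ₗ[R] KM R f σ :=
    TensorProduct.mk R _ _ 1 ∘ₗ Dlin (∑ i, y i • Θ i)
  have hb : ∀ v, b v = (1 : MvPolynomial σ R) ⊗ₜ[R] Dc v (∑ i, y i • Θ i) := fun _ => rfl
  have hbk : ∀ k v, Dc (ψ k) (Dc v (∑ i, y i • Θ i)) = - (y k • Dc v (Psi ψ L)) := by
    intro k v
    rw [Dc_comm, map_sum]
    simp only [map_smul, hΘD]
    rw [Finset.sum_eq_single k]
    · simp
    · intro i _ hi; rw [if_neg (Ne.symm hi), smul_zero]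
    · simp
  let A : KM R f σ × Module.Dual R (Fin f → R) →ₗ[R] KM R f σ × R :=
    LinearMap.inl R _ _ ∘ₗ (kmul Y ∘ₗ LinearMap.fst R _ _ - b ∘ₗ LinearMap.snd R _ _)
  have hA : ∀ x, A x = (kmul Y x.1 - b x.2, 0) := fun x => rfl
  set G := bcx ψ L hL' (M + 1) hN with hG
  obtain ⟨s, h0, h1⟩ := exists_htpy B.d B.dd G.d hex
    (fun i => GCx.res A (B.pr i) (G.pr i) (fun x => by
      refine Prod.ext ?_ ?_
      · show kpr (M + 1) i (kmul Y (kpr M i x.1) - b _) = kmul Y (kpr M i x.1) - b _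
        rw [map_sub, kpr_kmul hYh]
        congr 1
        by_cases hi : i = M + 1
        · subst hi
          exact kpr_of_mem le_rfl (by simpa using isHomogeneous_one σ R)
            (Dc_mem _ _ _ (Submodule.sum_mem _ fun i _ => Submodule.smul_mem _ _ (hΘ i)))
        · have h0 : ((B.pr i) x).2 = 0 := by
            show (if i = M + 1 then LinearMap.id else 0 :
              Module.Dual R (Fin f → R) →ₗ[R] Module.Dual R (Fin f → R)) x.2 = 0
            rw [if_neg hi]; rfl
          have h0' : LinearMap.snd R (KM R f σ) (Module.Dual R (Fin f → R)) ((B.pr i) x) = 0 := h0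
          rw [h0']; simp
      · show (if i = M + 1 + 1 then LinearMap.id else 0 : R →ₗ[R] R) 0 = 0
        exact map_zero _))
    (fun i x => by
      refine Subtype.ext (Prod.ext ?_ rfl)
      show kdl ψ (kmul Y x.1.1 - b x.1.2) + (0 : R) • ((1 : MvPolynomial σ R) ⊗ₜ[R] Psi ψ L) = kmul Y (kdl ψ x.1.1 + a x.1.2) - b 0
      rw [map_sub, kdl_kmul, map_add, zero_smul, map_zero, add_zero, sub_zero, sub_eq_add_neg]
      congr 1
      rw [ha, hb, kmul_tmul, kdl_tmul, ← Finset.sum_neg_distrib, hY, mul_one,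
        TensorProduct.sum_tmul]
      refine Finset.sum_congr rfl fun k _ => ?_
      rw [hbk, mul_one, TensorProduct.tmul_neg, neg_neg, TensorProduct.tmul_smul,
        TensorProduct.smul_tmul'])
    (by
      rintro ⟨_, z, rfl⟩
      have hp := aug_kpr_hom M z.1
      have hp' : (Y * aug (kpr M 0 z.1)).IsHomogeneous (M + 1) := by
        rw [add_comm]; exact hYh.mul hp
      obtain ⟨w, hw⟩ := (bdry_iff' ψ _ hL' (M + 1) hN (by omega) hp').1 (h _ hp)
      refine ⟨w, hw.trans (Subtype.ext (Prod.ext ?_ rfl))⟩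
      show (Y * aug (kpr M 0 z.1)) ⊗ₜ[R] (1 : Lam R f) = kmul Y (kpr M 0 z.1) - b 0
      rw [map_zero, sub_zero, kpr_zero, kmul_tmul, aug_one])
  let emb : Module.Dual R (Fin f → R) →ₗ[R] B.X (M + 1) :=
    (B.pr (M + 1)).rangeRestrict ∘ₗ LinearMap.inr R _ _
  have hemb : ∀ v, (emb v : KM R f σ × Module.Dual R (Fin f → R)) = (0, v) := by
    intro v
    refine Prod.ext (map_zero (kpr M (M + 1))) ?_
    show (if M + 1 = M + 1 then LinearMap.id else 0 :
      Module.Dual R (Fin f → R) →ₗ[R] Module.Dual R (Fin f → R)) v = v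
    simp
  let sV : Module.Dual R (Fin f → R) →ₗ[R] R :=
    LinearMap.snd R _ _ ∘ₗ (LinearMap.range (G.pr (M + 2))).subtype ∘ₗ s (M + 1) ∘ₗ emb
  obtain ⟨v, hv⟩ := dual_eval sV
  refine ⟨-v, fun k => ?_⟩
  rw [map_neg, ← hv]
  have h2 := h1 M (emb (ψ k))
  have h3 : B.d M (emb (ψ k)) = 0 := by
    refine Subtype.ext ?_
    rw [GCx.d_coe, hemb]
    refine Prod.ext ?_ rfl
    show kdl ψ 0 + a (ψ k) = 0
    rw [ha, Psi, Dc_DL_of_mem (List.mem_map.2 ⟨k, hL' k, rfl⟩)]; simp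
  rw [h3, map_zero, add_zero] at h2
  have h4 := congrArg (fun x => (Subtype.val x).1) h2
  have h5 : kdl ψ ((s (M + 1) (emb (ψ k))).1).1 + sV (ψ k) • ((1 : MvPolynomial σ R) ⊗ₜ[R] Psi ψ L) =
      kmul Y (emb (ψ k)).1.1 - b (emb (ψ k)).1.2 := h4
  have h6 : ((s (M + 1) (emb (ψ k))).1).1 = 0 := by
    have := congrArg Prod.fst (G.pr_coe _ (s (M + 1) (emb (ψ k))))
    rw [← this]
    show kpr (M + 1) (M + 2) _ = 0
    rw [kpr_of_lt (by omega)]; rfl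
  rw [h6, hemb, map_zero, map_zero, zero_add, zero_sub, hb, map_sum] at h5
  simp only [map_smul, hΘD] at h5
  rw [Finset.sum_eq_single k (fun i _ hi => by rw [if_neg (Ne.symm hi), smul_zero]) (by simp),
    if_pos rfl, TensorProduct.tmul_smul, eq_neg_iff_add_eq_zero, ← add_smul] at h5
  let o : G.X (M + 2) := ⟨(0, sV (ψ k) + y k), (0, sV (ψ k) + y k),
    Prod.ext (map_zero (kpr (M + 1) (M + 2))) (by
      show (if M + 1 + 1 = M + 1 + 1 then LinearMap.id else 0 : R →ₗ[R] R) _ = _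
      simp)⟩
  obtain ⟨w, hw⟩ := hex (M + 1) o (by
    refine Subtype.ext (Prod.ext ?_ rfl)
    show kdl ψ 0 + (sV (ψ k) + y k) • ((1 : MvPolynomial σ R) ⊗ₜ[R] Psi ψ L) = 0
    rw [h5]; simp)
  rw [Subsingleton.elim w 0, map_zero] at hw
  have h7 : 0 = sV (ψ k) + y k := congrArg (fun x => (Subtype.val x).2) hw
  linear_combination -h7

end Kos7
end

section
open ExteriorAlgebra TensorProduct MvPolynomial RingTheory.Sequence

set_option linter.unusedSectionVars false
section Kos8

variable {R : Type u} [CommRing R] {f : ℕ} {ρ τ : Type} [Fintype ρ] [DecidableEq ρ]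
  [Fintype τ] [DecidableEq τ]

lemma lin_of_content (P D : Lam R f) (h : ∀ s : Lam R f →ₗ[R] R, ∃ s' : Lam R f →ₗ[R] R, s D = s' P) :
    ∃ T : Lam R f →ₗ[R] Lam R f, T P = D := by
  let b := Module.Free.chooseBasis R (Lam R f)
  choose s' hs' using h
  refine ⟨∑ k ∈ (b.repr D).support, (s' (b.coord k)).smulRight (b k), ?_⟩
  rw [LinearMap.sum_apply]
  conv_rhs => rw [← b.linearCombination_repr D, Finsupp.linearCombination_apply, Finsupp.sum]
  refine Finset.sum_congr rfl fun k _ => ?_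
  rw [LinearMap.smulRight_apply, ← hs']; rfl

/-- killing the second group of variables -/
noncomputable def qp : MvPolynomial (ρ ⊕ τ) R →ₐ[R] MvPolynomial ρ R :=
  aeval (Sum.elim X fun _ => 0)

lemma qp_inl (i : ρ) : qp (X (Sum.inl i) : MvPolynomial (ρ ⊕ τ) R) = X i := by simp [qp]
lemma qp_inr (i : τ) : qp (X (Sum.inr i) : MvPolynomial (ρ ⊕ τ) R) = 0 := by simp [qp]

lemma qp_hom {p : MvPolynomial (ρ ⊕ τ) R} {m : ℕ} (hp : p.IsHomogeneous m) :
    (qp p : MvPolynomial ρ R).IsHomogeneous m := by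
  have := hp.aeval (Sum.elim X fun _ => 0 : ρ ⊕ τ → MvPolynomial ρ R) (n := 1) (by
    rintro (i | i)
    · exact isHomogeneous_X R i
    · exact isHomogeneous_zero _ _ _)
  rw [one_mul] at this
  exact this

/-- the induced map on Koszul modules -/
noncomputable def qk : KM R f (ρ ⊕ τ) →ₗ[R] KM R f ρ :=
  TensorProduct.map (qp : MvPolynomial (ρ ⊕ τ) R →ₐ[R] MvPolynomial ρ R).toLinearMap LinearMap.id

lemma qk_tmul (p : MvPolynomial (ρ ⊕ τ) R) (y : Lam R f) : qk (p ⊗ₜ[R] y) = qp p ⊗ₜ y := rfl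

lemma kdl_qk (φ : ρ ⊕ τ → Module.Dual R (Fin f → R)) (x : KM R f (ρ ⊕ τ)) :
    kdl (fun r => φ (Sum.inl r)) (qk x) = qk (kdl φ x) := by
  induction x using TensorProduct.induction_on with
  | zero => simp
  | add x y hx hy => simp only [map_add, hx, hy]
  | tmul p y =>
    rw [qk_tmul, kdl_tmul, kdl_tmul, map_sum, Fintype.sum_sum_type]
    simp only [qk_tmul, map_mul, qp_inl, qp_inr, zero_mul, TensorProduct.zero_tmul,
      Finset.sum_const_zero, add_zero]

lemma kpr_qk (j i : ℕ) (x : KM R f (ρ ⊕ τ)) : kpr j i (qk (kpr j i x)) = qk (kpr j i x) := by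
  refine kpr_ind (kpr j i ∘ₗ qk) qk j i (fun h p hp y hy => ?_) x
  rw [LinearMap.comp_apply, qk_tmul]
  exact kpr_of_mem h (qp_hom hp) hy

theorem KB0 (φ : ρ ⊕ τ → Module.Dual R (Fin f → R)) (L : List ρ) (hL : L.Nodup)
    (hL' : ∀ k, k ∈ L) (N : ℕ) (hN : N + L.length = f)
    (ys : List R) (hys : IsWeaklyRegular R ys) (hy : ∀ y ∈ ys, y ∈ hid fun r => φ (Sum.inl r))
    (hlen : N + 1 ≤ ys.length) (i : ρ)
    (hc : ∀ j, ∀ s : Lam R f →ₗ[R] R, ∃ s' : Lam R f →ₗ[R] R,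
      s (Dc (φ (Sum.inr j)) (DL ((L.erase i).map fun r => φ (Sum.inl r)) (om R f))) =
        s' (Psi (fun r => φ (Sum.inl r)) L))
    (x : ρ ⊕ τ → R) (hx : ∀ v, ∑ k, φ k v * x k = 0)
    (h : MvPolynomial ρ R) (hh : h.IsHomogeneous N) :
    ∃ P : MvPolynomial (ρ ⊕ τ) R, P.IsHomogeneous (N + 1) ∧ aeval x P = 0 ∧
      X i * h - qp P ∈ gI fun r => φ (Sum.inl r) := by
  set ψ : ρ → Module.Dual R (Fin f → R) := fun r => φ (Sum.inl r) with hψ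
  obtain ⟨Θ, hΘ, hΘD, hΘe⟩ := exists_theta ψ L hL hL' N hN
  have hT : ∀ j, ∃ T : Lam R f →ₗ[R] Lam R f, T (Psi ψ L) = Dc (φ (Sum.inr j)) (Θ i) := by
    intro j
    refine lin_of_content _ _ fun s => ?_
    obtain ⟨e, he⟩ := hΘe i
    obtain ⟨s', hs'⟩ := hc j s
    exact ⟨e • s', by rw [he, map_smul, map_smul, hs']; rfl⟩
  choose T hT using hT
  set B := bcx ψ L hL' N hN with hB
  let A : KM R f ρ × R →ₗ[R] KM R f ρ := kmul (X i) ∘ₗ LinearMap.fst R _ _ +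
    LinearMap.toSpanSingleton R _ ((1 : MvPolynomial ρ R) ⊗ₜ[R] Θ i) ∘ₗ LinearMap.snd R _ _
  have hA : ∀ x, A x = kmul (X i) x.1 + x.2 • ((1 : MvPolynomial ρ R) ⊗ₜ[R] Θ i) := fun _ => rfl
  let t' : KM R f ρ × R →ₗ[R] KM R f (ρ ⊕ τ) :=
    LinearMap.toSpanSingleton R _ ((1 : MvPolynomial (ρ ⊕ τ) R) ⊗ₜ[R] Θ i) ∘ₗ LinearMap.snd R _ _
  have ht' : ∀ x, t' x = x.2 • ((1 : MvPolynomial (ρ ⊕ τ) R) ⊗ₜ[R] Θ i) := fun _ => rfl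
  let t1 : Lam R f →ₗ[R] KM R f (ρ ⊕ τ) := TensorProduct.mk R _ _ (X (Sum.inl i)) +
    ∑ j, TensorProduct.mk R _ _ (X (Sum.inr j)) ∘ₗ eps N ∘ₗ T j
  have ht1 : ∀ y, t1 y = X (Sum.inl i) ⊗ₜ[R] y + ∑ j, X (Sum.inr j) ⊗ₜ[R] eps N (T j y) := by
    intro y; simp [t1, LinearMap.sum_apply]
  let t2 : KM R f ρ →ₗ[R] KM R f (ρ ⊕ τ) := TensorProduct.lift
    ((LinearMap.lsmul R (Lam R f →ₗ[R] KM R f (ρ ⊕ τ))).flip t1 ∘ₗ lcoeff R (0 : ρ →₀ ℕ))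
  have ht2 : ∀ p y, t2 (p ⊗ₜ y) = coeff 0 p • t1 y := by intro p y; simp [t2, lcoeff]
  let t : KM R f ρ × R →ₗ[R] KM R f (ρ ⊕ τ) := t2 ∘ₗ LinearMap.fst R _ _
  have hkt1 : ∀ y, y ∈ ⋀[R]^N (Fin f → R) → kpr (N + 1) N (t1 y) = t1 y := by
    intro y hy
    have h1 : ∀ k : ρ ⊕ τ, (X k : MvPolynomial (ρ ⊕ τ) R).IsHomogeneous (N + 1 - N) := by
      intro k; rw [show N + 1 - N = 1 by omega]; exact isHomogeneous_X R k
    rw [ht1, map_add, map_sum, kpr_of_mem (by omega) (h1 _) hy]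
    congr 1
    exact Finset.sum_congr rfl fun j _ => kpr_of_mem (by omega) (h1 _) (eps_mem N _)
  have hk1 : ∀ x : KM R f ρ × R, kpr (N + 1) N (t (B.pr N x)) = t (B.pr N x) := by
    intro x
    refine kpr_ind (kpr (N + 1) N ∘ₗ t2) t2 N N (fun hij p hp y hy => ?_) x.1
    rw [LinearMap.comp_apply, ht2, map_smul, hkt1 y hy]
  have hz : ∀ x : B.X (N + 1), x.1.1 = 0 := by
    intro x
    have := congrArg Prod.fst (B.pr_coe _ x)
    rw [← this]
    show kpr N (N + 1) _ = 0
    rw [kpr_of_lt (by omega)]; rfl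
  obtain ⟨t0, h0, h1⟩ := descend B.d B.dd (strand φ (N + 1)).d (strand φ (N + 1)).dd
    (strand ψ (N + 1)).d (strand ψ (N + 1)).dd
    (fun i => GCx.res qk ((strand φ (N + 1)).pr i) ((strand ψ (N + 1)).pr i) (kpr_qk (N + 1) i))
    (fun i x => Subtype.ext (kdl_qk φ x.1))
    (fun k => GCx.res A (B.pr k) ((strand ψ (N + 1)).pr k) (fun x => by
      show kpr (N + 1) k (kmul (X i) (kpr N k x.1) +
        ((if k = N + 1 then LinearMap.id else 0 : R →ₗ[R] R) x.2) • ((1 : MvPolynomial ρ R) ⊗ₜ[R] Θ i)) =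
        kmul (X i) (kpr N k x.1) +
        ((if k = N + 1 then LinearMap.id else 0 : R →ₗ[R] R) x.2) • ((1 : MvPolynomial ρ R) ⊗ₜ[R] Θ i)
      rw [map_add, kpr_kmul (isHomogeneous_X R i)]
      congr 1
      by_cases hk : k = N + 1
      · subst hk
        rw [map_smul, kpr_of_mem le_rfl (by simpa using isHomogeneous_one ρ R) (hΘ i)]
      · rw [if_neg hk]; simp))
    (fun k x => by
      refine Subtype.ext ?_
      show kdl ψ (kmul (X i) x.1.1 + x.1.2 • ((1 : MvPolynomial ρ R) ⊗ₜ[R] Θ i)) =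
        kmul (X i) (kdl ψ x.1.1 + x.1.2 • ((1 : MvPolynomial ρ R) ⊗ₜ[R] Psi ψ L)) +
          (0 : R) • ((1 : MvPolynomial ρ R) ⊗ₜ[R] Θ i)
      rw [zero_smul, add_zero, map_add, map_add, kdl_kmul, map_smul, map_smul, kmul_tmul, kdl_tmul]
      congr 2
      simp only [hΘD]
      rw [Finset.sum_eq_single i (fun k _ hk => by rw [if_neg hk, TensorProduct.tmul_zero])
        (by simp), if_pos rfl])
    ys (fun y h => bcx_null ψ L hL hL' N hN y (hy y h))
    (fun i => isWeaklyRegular_of_projective hys _) (fun i => isWeaklyRegular_of_projective hys _)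
    N (by omega)
    (GCx.res t (B.pr N) ((strand φ (N + 1)).pr N) hk1)
    (GCx.res t' (B.pr (N + 1)) ((strand φ (N + 1)).pr (N + 1)) (fun x => by
      rw [ht']
      show kpr (N + 1) (N + 1) ((B.pr (N + 1) x).2 • ((1 : MvPolynomial (ρ ⊕ τ) R) ⊗ₜ[R] Θ i)) =
        (B.pr (N + 1) x).2 • ((1 : MvPolynomial (ρ ⊕ τ) R) ⊗ₜ[R] Θ i)
      rw [map_smul, kpr_of_mem le_rfl (by simpa using isHomogeneous_one (ρ ⊕ τ) R) (hΘ i)]))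
    0 0
    (fun x => by
      refine Subtype.ext ?_
      show kdl φ (x.1.2 • ((1 : MvPolynomial (ρ ⊕ τ) R) ⊗ₜ[R] Θ i)) =
        t2 (kdl ψ x.1.1 + x.1.2 • ((1 : MvPolynomial ρ R) ⊗ₜ[R] Psi ψ L))
      rw [hz, map_zero, zero_add, map_smul, map_smul, ht2, ht1, kdl_tmul, Fintype.sum_sum_type]
      congr 1
      rw [show coeff 0 (1 : MvPolynomial ρ R) = 1 by simp, one_smul]
      simp only [mul_one]
      congr 1
      · rw [Finset.sum_eq_single i (fun k _ hk => by
          rw [show φ (Sum.inl k) = ψ k from rfl, hΘD, if_neg hk, TensorProduct.tmul_zero])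
          (by simp), show φ (Sum.inl i) = ψ i from rfl, hΘD, if_pos rfl]
      · refine Finset.sum_congr rfl fun j _ => ?_
        rw [hT, eps_of_mem (Dc_mem _ _ _ (hΘ i))])
    (fun x => by
      refine Subtype.ext ?_
      show qk (x.1.2 • ((1 : MvPolynomial (ρ ⊕ τ) R) ⊗ₜ[R] Θ i)) -
        (kmul (X i) x.1.1 + x.1.2 • ((1 : MvPolynomial ρ R) ⊗ₜ[R] Θ i)) = kdl ψ 0 + 0
      rw [hz, map_smul, qk_tmul, map_one]; simp)
  set e := el0' ψ L hL' N hN hh with he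
  have hPdef := kpr_zero (N + 1) (t0 e).1
  have hPk : kpr (N + 1) 0 (t0 e).1 = (t0 e).1 := (strand φ (N + 1)).pr_coe 0 (t0 e)
  rw [hPk] at hPdef
  have hPh := aug_kpr_hom (N + 1) (t0 e).1
  rw [hPk] at hPh
  set P := aug (t0 e).1 with hP
  refine ⟨P, hPh, ?_, ?_⟩
  · match ys, hlen, hys, hy with
    | y :: ys, _, hys, hy =>
      have hyr : IsSMulRegular R y := ((isWeaklyRegular_cons_iff R y ys).1 hys).1
      obtain ⟨s, hs, -⟩ := bcx_null ψ L hL hL' N hN y (hy y (by simp))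
      obtain ⟨w, hw⟩ := h1 (s 0 e)
      rw [hs] at hw
      have h3 : kdl φ w.1 = t0 (y • e) := congrArg Subtype.val hw
      obtain ⟨w', hw'⟩ := w.2
      have h4 := aug_kdl φ (N + 1) w'
      rw [show kpr (N + 1) 1 w' = w.1 from hw', h3, map_smul, Submodule.coe_smul, map_smul, ← hP] at h4
      have h5 : ∀ p ∈ gI φ, aeval x p = 0 := by
        intro p hp
        have : gI φ ≤ RingHom.ker (aeval x : MvPolynomial (ρ ⊕ τ) R →ₐ[R] R) := by
          refine Ideal.span_le.2 ?_
          rintro _ ⟨v, rfl⟩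
          show aeval x (gform φ v) = 0
          rw [gform, map_sum, ← hx v]
          exact Finset.sum_congr rfl fun k _ => by rw [map_smul, aeval_X, smul_eq_mul]
        exact this hp
      have h6 := h5 _ h4
      rw [map_smul] at h6
      exact hyr (by simpa using h6)
  · obtain ⟨w, hw⟩ := h0 e
    have h3 : kdl ψ w.1 = A e.1 - qk (t0 e).1 := congrArg Subtype.val hw
    obtain ⟨w', hw'⟩ := w.2
    have h4 := aug_kdl ψ (N + 1) w'
    rw [show kpr (N + 1) 1 w' = w.1 from hw', h3, hPdef, hA] at h4
    have h5 : kmul (X i) e.1.1 + e.1.2 • ((1 : MvPolynomial ρ R) ⊗ₜ[R] Θ i) =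
      (X i * h) ⊗ₜ[R] (1 : Lam R f) := by
      show kmul (X i) (h ⊗ₜ[R] (1 : Lam R f)) + (0 : R) • ((1 : MvPolynomial ρ R) ⊗ₜ[R] Θ i) = _
      rw [zero_smul, add_zero, kmul_tmul]
    rw [h5, qk_tmul, map_sub, aug_one, aug_one] at h4
    exact h4

end Kos8
end

section
open RingTheory.Sequence IsLocalRing Pointwise

set_option linter.unusedSectionVars false
section CM

variable {R : Type u} [CommRing R] [IsNoetherianRing R] [IsLocalRing R]

/-- there is a weakly regular sequence of length `N` in the maximal ideal -/
def DepthGE (M : Type u) [AddCommGroup M] [Module R M] (N : ℕ) : Prop :=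
  ∃ ys : List R, ys.length = N ∧ (∀ y ∈ ys, y ∈ maximalIdeal R) ∧ IsWeaklyRegular M ys

lemma DepthGE.congr {M M' : Type u} [AddCommGroup M] [Module R M] [AddCommGroup M'] [Module R M']
    (e : M ≃ₗ[R] M') {N : ℕ} (h : DepthGE (R := R) M N) : DepthGE (R := R) M' N := by
  obtain ⟨ys, h1, h2, h3⟩ := h
  exact ⟨ys, h1, h2, (e.isWeaklyRegular_congr ys).1 h3⟩

lemma DepthGE.cons {M : Type u} [AddCommGroup M] [Module R M] {y : R} (hy : y ∈ maximalIdeal R)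
    (hr : IsSMulRegular M y) {N : ℕ} (h : DepthGE (R := R) (QuotSMulTop y M) N) :
    DepthGE (R := R) M (N + 1) := by
  obtain ⟨ys, h1, h2, h3⟩ := h
  exact ⟨y :: ys, by simp [h1], by simpa using ⟨hy, h2⟩, h3.cons hr⟩

/-- swapping two quotients -/
noncomputable def swapQ (M : Type u) [AddCommGroup M] [Module R M] (a b : R) :
    QuotSMulTop a (QuotSMulTop b M) ≃ₗ[R] QuotSMulTop b (QuotSMulTop a M) :=
  QuotSMulTop.equivQuotTensor a _ ≪≫ₗ
  TensorProduct.congr (LinearEquiv.refl R _) (QuotSMulTop.equivQuotTensor b M) ≪≫ₗ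
  TensorProduct.leftComm R _ _ _ ≪≫ₗ
  TensorProduct.congr (LinearEquiv.refl R _) (QuotSMulTop.equivQuotTensor a M).symm ≪≫ₗ
  (QuotSMulTop.equivQuotTensor b _).symm

lemma not_regular_iff {M : Type u} [AddCommGroup M] [Module R M] [Module.Finite R M] (y : R) :
    ¬ IsSMulRegular M y ↔ ∃ p ∈ associatedPrimes R M, y ∈ p := by
  have h := biUnion_associatedPrimes_eq_zero_divisors R M
  have h' : y ∈ (⋃ p ∈ associatedPrimes R M, (p : Set R)) ↔ y ∈ { r : R | ∃ x : M, x ≠ 0 ∧ r • x = 0 } := by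
    rw [h]
  simp only [Set.mem_iUnion, Set.mem_ofPred_eq, SetLike.mem_coe, exists_prop] at h'
  rw [h', isSMulRegular_iff_right_eq_zero_of_smul]
  push Not
  exact ⟨fun ⟨x, h1, h2⟩ => ⟨x, h2, h1⟩, fun ⟨x, h1, h2⟩ => ⟨x, h2, h1⟩⟩

lemma ass_le {M : Type u} [AddCommGroup M] [Module R M] {p : Ideal R} (hp : p ∈ associatedPrimes R M) :
    ∃ w : M, w ≠ 0 ∧ ∀ r, r ∈ p ↔ r • w = 0 := by
  obtain ⟨h1, w, h2⟩ := isAssociatedPrime_iff.1 hp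
  have h3 : ∀ r, r ∈ p ↔ r • w = 0 := by
    intro r
    rw [h2]
    simp [Submodule.mem_colon_singleton]
  refine ⟨w, fun h => h1.ne_top ?_, h3⟩
  rw [Ideal.eq_top_iff_one, h3, h, smul_zero]

lemma exists_regular {M : Type u} [AddCommGroup M] [Module R M] [Module.Finite R M]
    (h : maximalIdeal R ∉ associatedPrimes R M) : ∀ p ∈ associatedPrimes R M, ¬ maximalIdeal R ≤ p := by
  intro p hp hle
  have := (maximalIdeal.isMaximal R).eq_of_le (hp.1.ne_top) hle
  exact h (this ▸ hp)

lemma max_not_ass {M : Type u} [AddCommGroup M] [Module R M] [Module.Finite R M] {y : R}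
    (hy : y ∈ maximalIdeal R) (hr : IsSMulRegular M y) : maximalIdeal R ∉ associatedPrimes R M := by
  intro h
  exact (not_regular_iff y).2 ⟨_, h, hy⟩ hr

lemma mem_smulTop {M : Type u} [AddCommGroup M] [Module R M] (y : R) (w : M) :
    (Submodule.Quotient.mk w : QuotSMulTop y M) = 0 ↔ ∃ v, y • v = w := by
  rw [Submodule.Quotient.mk_eq_zero, Submodule.mem_smul_pointwise_iff_exists]
  simp

lemma swap_reg {M : Type u} [AddCommGroup M] [Module R M] [Module.Finite R M] {x z : R}
    (hx : x ∈ maximalIdeal R) (hz : z ∈ maximalIdeal R) (h1 : IsSMulRegular M x)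
    (h2 : IsSMulRegular (QuotSMulTop x M) z) : IsSMulRegular (QuotSMulTop z M) x := by
  have : IsWeaklyRegular M [x, z] := by
    rw [isWeaklyRegular_cons_iff, isWeaklyRegular_singleton_iff]; exact ⟨h1, h2⟩
  have := isWeaklyRegular_of_perm_of_subset_maximalIdeal this (List.Perm.swap z x [])
    (by simp; exact ⟨hx, hz⟩)
  rw [isWeaklyRegular_cons_iff, isWeaklyRegular_singleton_iff] at this
  exact this.2

lemma depth_quot (N : ℕ) : ∀ (M : Type u) [AddCommGroup M] [Module R M] [Module.Finite R M] (x : R),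
    x ∈ maximalIdeal R → IsSMulRegular M x → DepthGE (R := R) M (N + 1) →
    DepthGE (R := R) (QuotSMulTop x M) N := by
  induction N with
  | zero => intro M _ _ _ x _ _ _; exact ⟨[], rfl, by simp, IsWeaklyRegular.nil R _⟩
  | succ n ih =>
    intro M _ _ _ x hx hxr ⟨ys, hlen, hym, hyr⟩
    match ys, hlen, hym, hyr with
    | y1 :: y2 :: ys, hlen, hym, hyr =>
      have hy1 : y1 ∈ maximalIdeal R := hym _ (by simp)
      have hy2 : y2 ∈ maximalIdeal R := hym _ (by simp)
      have hr1 := ((isWeaklyRegular_cons_iff M _ _).1 hyr).1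
      have hr1' := ((isWeaklyRegular_cons_iff M _ _).1 hyr).2
      have hr2 := ((isWeaklyRegular_cons_iff _ _ _).1 hr1').1
      have hd1 : DepthGE (R := R) (QuotSMulTop y1 M) (n + 1) :=
        ⟨y2 :: ys, by simpa using hlen, fun y hy => hym y (List.mem_cons_of_mem _ hy), hr1'⟩
      have hA1 := max_not_ass hy1 hr1
      have hA2 := max_not_ass hy2 hr2
      have hA3 : maximalIdeal R ∉ associatedPrimes R (QuotSMulTop x M) := by
        intro hA
        obtain ⟨w, hw0, hw⟩ := ass_le hA
        obtain ⟨w, rfl⟩ := Submodule.Quotient.mk_surjective _ w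
        have e1 := (hw y1).1 hy1
        have e2 := (hw y2).1 hy2
        rw [← Submodule.Quotient.mk_smul, mem_smulTop] at e1 e2
        obtain ⟨v1, e1⟩ := e1
        obtain ⟨v2, e2⟩ := e2
        have e3 : y2 • v1 = y1 • v2 := by
          apply hxr
          show x • y2 • v1 = x • y1 • v2
          rw [smul_comm, e1, smul_comm x, e2, smul_comm]
        have e4 : (Submodule.Quotient.mk v1 : QuotSMulTop y1 M) = 0 := by
          apply hr2.right_eq_zero_of_smul
          rw [← Submodule.Quotient.mk_smul, mem_smulTop]
          exact ⟨v2, e3.symm⟩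
        obtain ⟨v, rfl⟩ := (mem_smulTop _ _).1 e4
        apply hw0
        rw [mem_smulTop]
        refine ⟨v, hr1 ?_⟩
        show y1 • x • v = y1 • w
        rw [← e1, smul_comm]
      have hfin : (associatedPrimes R M ∪ associatedPrimes R (QuotSMulTop y1 M) ∪
        associatedPrimes R (QuotSMulTop x M)).Finite :=
        ((associatedPrimes.finite R M).union (associatedPrimes.finite R _)).union
          (associatedPrimes.finite R _)
      have hav : ¬ ((maximalIdeal R : Set R) ⊆ ⋃ p ∈ (associatedPrimes R M ∪
          associatedPrimes R (QuotSMulTop y1 M) ∪ associatedPrimes R (QuotSMulTop x M)), (p : Set R)) := by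
        intro hsub
        obtain ⟨p, hp, hle⟩ := (Ideal.subset_union_prime_finite hfin (f := fun i => i) ⊥ ⊥
          (by rintro p ((hp | hp) | hp) _ _ <;> exact hp.1)).1 hsub
        rcases hp with (hp | hp) | hp
        · exact exists_regular hA1 p hp hle
        · exact exists_regular hA2 p hp hle
        · exact exists_regular hA3 p hp hle
      obtain ⟨z, hz, hz'⟩ := Set.not_subset.1 hav
      simp only [Set.mem_iUnion, not_exists] at hz'
      have hzM : IsSMulRegular M z := by
        by_contra h
        obtain ⟨p, hp, h⟩ := (not_regular_iff z).1 h
        exact hz' p (Or.inl (Or.inl hp)) h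
      have hz1 : IsSMulRegular (QuotSMulTop y1 M) z := by
        by_contra h
        obtain ⟨p, hp, h⟩ := (not_regular_iff z).1 h
        exact hz' p (Or.inl (Or.inr hp)) h
      have hzx : IsSMulRegular (QuotSMulTop x M) z := by
        by_contra h
        obtain ⟨p, hp, h⟩ := (not_regular_iff z).1 h
        exact hz' p (Or.inr hp) h
      have d1 := ih (QuotSMulTop y1 M) z hz hz1 hd1
      have d2 := (d1.congr (swapQ M z y1)).cons hy1 (swap_reg hy1 hz hr1 hz1)
      have d3 := ih (QuotSMulTop z M) x hx (swap_reg hx hz hxr hzx) d2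
      exact (d3.congr (swapQ M x z)).cons hz hzx

lemma depth_ass (N : ℕ) : ∀ (M : Type u) [AddCommGroup M] [Module R M] [Module.Finite R M] (p : Ideal R),
    p ∈ associatedPrimes R M → DepthGE (R := R) M N → p.height + N ≤ (maximalIdeal R).height := by
  induction N with
  | zero =>
    intro M _ _ _ p hp _
    simpa using Ideal.height_mono (le_maximalIdeal hp.1.ne_top)
  | succ n ih =>
    intro M _ _ _ p hp ⟨ys, hlen, hym, hyr⟩
    match ys, hlen, hym, hyr with
    | y :: ys, hlen, hym, hyr =>
      have hy : y ∈ maximalIdeal R := hym _ (by simp)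
      obtain ⟨hr, hr'⟩ := (isWeaklyRegular_cons_iff M _ _).1 hyr
      obtain ⟨w, hw0, hw⟩ := ass_le hp
      let T : Submodule R M :=
        { carrier := {w | ∀ r ∈ p, r • w = 0}
          add_mem' := fun {a b} ha hb r hr => by rw [smul_add, ha r hr, hb r hr, add_zero]
          zero_mem' := fun r _ => smul_zero r
          smul_mem' := fun c a ha r hr => by rw [smul_comm, ha r hr, smul_zero] }
      have hT : ∃ v ∈ T, ∀ u, y • u ≠ v := by
        by_contra hcon
        push Not at hcon
        have : T ≤ maximalIdeal R • T := by
          intro v hv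
          obtain ⟨u, rfl⟩ := hcon v hv
          refine Submodule.smul_mem_smul hy fun r hr' => ?_
          apply hr.right_eq_zero_of_smul
          rw [smul_comm]; exact hv r hr'
        have h0 := Submodule.eq_bot_of_le_smul_of_le_jacobson_bot _ T (IsNoetherian.noetherian T) this
          (maximalIdeal_le_jacobson _)
        exact hw0 ((Submodule.eq_bot_iff _).1 h0 w fun r hr => (hw r).1 hr)
      obtain ⟨v, hvT, hv⟩ := hT
      have hv0 : (Submodule.Quotient.mk v : QuotSMulTop y M) ≠ 0 := by
        rw [Ne, mem_smulTop]; push Not; exact hv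
      obtain ⟨q, hq, hle⟩ := exists_le_isAssociatedPrime_of_isNoetherianRing R
        (Submodule.Quotient.mk v : QuotSMulTop y M) hv0
      have hmem : ∀ r, r • (Submodule.Quotient.mk v : QuotSMulTop y M) = 0 → r ∈ q := by
        intro r hr
        apply hle
        simpa [Submodule.mem_colon_singleton] using hr
      have hpq : p ≤ q := fun r hr => hmem r (by rw [← Submodule.Quotient.mk_smul, hvT r hr]; rfl)
      have hyq : y ∈ q := hmem y (by
        rw [← Submodule.Quotient.mk_smul, mem_smulTop]; exact ⟨v, rfl⟩)
      have hyp : y ∉ p := fun h => (not_regular_iff y).2 ⟨p, hp, h⟩ hr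
      have hlt : p < q := lt_of_le_of_ne hpq fun h => hyp (h ▸ hyq)
      have := hp.1
      have := hq.1
      have h1 := Ideal.height_add_one_le_of_lt_of_isPrime hlt
      have h2 := ih (QuotSMulTop y M) q hq ⟨ys, by simpa using hlen,
        fun y hy => hym y (List.mem_cons_of_mem _ hy), hr'⟩
      refine le_trans ?_ h2
      push_cast
      rw [add_comm (n : ℕ∞) 1, ← add_assoc]
      gcongr

/-- consequence of Cohen-Macaulayness used throughout -/
def HtReg (R : Type u) [CommRing R] : Prop :=
  ∀ (K : Ideal R) (q : ℕ), (∀ p : Ideal R, p.IsPrime → K ≤ p → (q : ℕ∞) ≤ p.height) →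
    ∃ ys : List R, ys.length = q ∧ (∀ y ∈ ys, y ∈ K) ∧ IsWeaklyRegular R ys

lemma weaklyRegular_subsingleton {M : Type u} [AddCommGroup M] [Module R M] [Subsingleton M]
    (ys : List R) : IsWeaklyRegular M ys := by
  refine ⟨fun i hi => ?_⟩
  intro a b _
  exact Subsingleton.elim a b

lemma depth_build (K : Ideal R) (hK : K ≤ maximalIdeal R) (q D : ℕ)
    (hD : (maximalIdeal R).height = D)
    (hp : ∀ p : Ideal R, p.IsPrime → K ≤ p → (q : ℕ∞) ≤ p.height) (j : ℕ) :
    ∀ (M : Type u) [AddCommGroup M] [Module R M] [Module.Finite R M] (e : ℕ),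
      DepthGE (R := R) M e → D + j ≤ e + q →
      ∃ ys : List R, ys.length = j ∧ (∀ y ∈ ys, y ∈ K) ∧ IsWeaklyRegular M ys := by
  induction j with
  | zero => intro M _ _ _ e _ _; exact ⟨[], rfl, by simp, IsWeaklyRegular.nil R _⟩
  | succ j ih =>
    intro M _ _ _ e hd hle
    have hqD : q ≤ D := by
      have := hp (maximalIdeal R) inferInstance hK
      rw [hD] at this; exact_mod_cast this
    obtain ⟨e, rfl⟩ : ∃ e', e = e' + 1 := ⟨e - 1, by omega⟩
    have hav : ¬ ((K : Set R) ⊆ ⋃ p ∈ (associatedPrimes R M), (p : Set R)) := by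
      intro hsub
      obtain ⟨p, hpp, hle'⟩ := (Ideal.subset_union_prime_finite (associatedPrimes.finite R M)
        (f := fun i => i) ⊥ ⊥ (by rintro p hp _ _; exact hp.1)).1 hsub
      have h1 := depth_ass (e + 1) M p hpp hd
      have h2 := hp p hpp.1 hle'
      rw [hD] at h1
      have h3 : ((q + (e + 1) : ℕ) : ℕ∞) ≤ (D : ℕ∞) := by
        refine le_trans ?_ h1
        push_cast
        gcongr
      have h4 : q + (e + 1) ≤ D := by exact_mod_cast h3
      omega
    obtain ⟨x, hx, hx'⟩ := Set.not_subset.1 hav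
    simp only [Set.mem_iUnion, not_exists] at hx'
    have hxr : IsSMulRegular M x := by
      by_contra h
      obtain ⟨p, hp, h⟩ := (not_regular_iff x).1 h
      exact hx' p hp h
    obtain ⟨ys, h1, h2, h3⟩ := ih (QuotSMulTop x M) e (depth_quot e M x (hK hx) hxr hd) (by omega)
    exact ⟨x :: ys, by simp [h1], by simpa using ⟨hx, h2⟩, h3.cons hxr⟩

lemma htReg_of_CM (h : IsCMLocalRing R) : HtReg R := by
  intro K q hq
  by_cases hK : K = ⊤
  · refine ⟨List.replicate q 1, by simp, by simp [hK], ?_⟩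
    cases q with
    | zero => exact IsWeaklyRegular.nil R _
    | succ q =>
      rw [List.replicate_succ, isWeaklyRegular_cons_iff]
      have : Subsingleton (QuotSMulTop (1 : R) R) := by
        rw [Submodule.Quotient.subsingleton_iff]
        simp
      exact ⟨IsSMulRegular.one R, weaklyRegular_subsingleton _⟩
  · have hK := le_maximalIdeal hK
    have hfin : (maximalIdeal R).height ≠ ⊤ := Ideal.height_ne_top_of_isPrime
    obtain ⟨D, hD⟩ := ENat.ne_top_iff_exists.1 hfin
    unfold IsCMLocalRing rDim at h
    rw [← IsLocalRing.maximalIdeal_height_eq_ringKrullDim, ← hD] at h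
    have h' : (D : ℕ∞) = qDepth R (⊥ : Ideal R) := by exact_mod_cast h
    have hd : DepthGE (R := R) R D := by
      by_cases hD0 : D = 0
      · subst hD0; exact ⟨[], rfl, by simp, IsWeaklyRegular.nil R _⟩
      obtain ⟨D', rfl⟩ := Nat.exists_eq_succ_of_ne_zero hD0
      have hlt : (D' : ℕ∞) < qDepth R (⊥ : Ideal R) := by
        rw [← h']; exact_mod_cast Nat.lt_succ_self _
      unfold qDepth mDepth at hlt
      obtain ⟨b, ⟨rs, hm, hr, rfl⟩, hb⟩ := lt_sSup_iff.1 hlt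
      have hb : D' < rs.length := by exact_mod_cast hb
      have h1 : IsWeaklyRegular R rs :=
        ((Submodule.quotEquivOfEqBot (⊥ : Ideal R) rfl).isWeaklyRegular_congr rs).1 hr.1
      refine ⟨rs.take (D' + 1), by simp; omega, fun y hy => hm y (List.mem_of_mem_take hy), ?_⟩
      rw [← List.take_append_drop (D' + 1) rs] at h1
      exact ((isWeaklyRegular_append_iff _ _ _).1 h1).1
    exact depth_build K hK q D hD.symm hq q R D hd le_rfl

end CM
end

section
open IsLocalRing Polynomial

set_option linter.unusedSectionVars false
section Fib

variable {R : Type u} [CommRing R] [IsNoetherianRing R] [IsLocalRing R]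

lemma avoid (hk : Infinite (ResidueField R)) {M : Type v} [AddCommGroup M] [Module R M] [Module.Finite R M]
    (J : Submodule R M) (s : Set (Submodule R M)) (hs : s.Finite) (h : ∀ N ∈ s, ¬ J ≤ N) :
    ∃ x ∈ J, ∀ N ∈ s, x ∉ N := by
  by_contra hcon
  push Not at hcon
  have hcov : ⋃ N ∈ hs.toFinset, ((N.comap J.subtype : Submodule R J) : Set J) = Set.univ := by
    rw [Set.eq_univ_iff_forall]
    intro x
    obtain ⟨N, hN, hx⟩ := hcon x x.2
    simp only [Set.mem_iUnion]
    exact ⟨N, by simpa using hN, hx⟩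
  obtain ⟨N, hN, hfi⟩ := Submodule.exists_finiteIndex_of_cover hcov
  have hN : N ∈ s := by simpa using hN
  have hfin : Finite (J ⧸ (N.comap J.subtype)) := AddSubgroup.finite_quotient_of_finiteIndex
  have hnt : ∃ q : (J ⧸ (N.comap J.subtype)), q ≠ 0 := by
    by_contra hq
    push Not at hq
    apply h N hN
    intro x hx
    have := hq (Submodule.Quotient.mk ⟨x, hx⟩)
    rw [Submodule.Quotient.mk_eq_zero] at this
    exact this
  obtain ⟨q, hq⟩ := hnt
  obtain ⟨g, hg⟩ := IsLocalRing.residue_surjective.hasRightInverse (f := residue R)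
  have hinj : Function.Injective (fun t : ResidueField R => g t • q) := by
    intro t t' htt
    by_contra hne
    have h1 : (g t - g t') • q = 0 := by rw [sub_smul, sub_eq_zero]; exact htt
    have hu : IsUnit (g t - g t') := by
      rw [← residue_ne_zero_iff_isUnit, map_sub, hg, hg, sub_ne_zero]; exact hne
    obtain ⟨u, hu⟩ := hu
    apply hq
    rw [← hu] at h1
    have := congrArg (fun z => (↑u⁻¹ : R) • z) h1
    simpa [smul_smul] using this
  exact (Infinite.of_injective _ hinj).not_finite hfin

/-- monomials of the Rees algebra -/
noncomputable def monL (I : Ideal R) (i : ℕ) : ↥(I ^ i) →ₗ[R] ↥(reesAlgebra I) :=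
  ((Polynomial.monomial i).comp (I ^ i).subtype).codRestrict (Subalgebra.toSubmodule (reesAlgebra I))
    (fun c => reesAlgebra.monomial_mem.2 c.2)

lemma monL_coe (I : Ideal R) (i : ℕ) (c : ↥(I ^ i)) : (monL I i c : R[X]) = monomial i (c : R) := rfl

/-- ideal defining the fiber ring modulo `A` -/
noncomputable def fI (I A : Ideal R) : Ideal ↥(reesAlgebra I) :=
  Ideal.map (algebraMap R ↥(reesAlgebra I)) (maximalIdeal R) ⊔
    Ideal.span {f | ∃ a ∈ A, (f : R[X]) = monomial 1 a}

lemma fI_bot (I : Ideal R) : fI I ⊥ = Ideal.map (algebraMap R ↥(reesAlgebra I)) (maximalIdeal R) := by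
  unfold fI
  rw [sup_eq_left, Ideal.span_le]
  rintro f ⟨a, ha, hf⟩
  rw [Ideal.mem_bot] at ha
  rw [ha, map_zero] at hf
  have : f = 0 := Subtype.ext hf
  rw [this]; exact zero_mem _

/-- dimension of the fiber ring modulo `A` -/
def FLE (I A : Ideal R) (q : ℕ) : Prop := ringKrullDim (↥(reesAlgebra I) ⧸ fI I A) ≤ q

lemma rees_sum {I : Ideal R} (g : ↥(reesAlgebra I)) :
    g = ∑ i ∈ (g : R[X]).support, monL I i ⟨(g : R[X]).coeff i, g.2 i⟩ := by
  apply Subtype.ext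
  rw [AddSubmonoidClass.coe_finsetSum]
  simp only [monL_coe]
  exact (g : R[X]).as_sum_support

lemma span_coeff {I : Ideal R} (N : ℕ) (T : Ideal R) (s : Set ↥(reesAlgebra I))
    (hs : ∀ f ∈ s, ∀ g : ↥(reesAlgebra I), ((g * f : ↥(reesAlgebra I)) : R[X]).coeff N ∈ T)
    {f : ↥(reesAlgebra I)} (hf : f ∈ Ideal.span s) : (f : R[X]).coeff N ∈ T := by
  have : ∀ g : ↥(reesAlgebra I), ((g * f : ↥(reesAlgebra I)) : R[X]).coeff N ∈ T := by
    induction hf using Submodule.span_induction with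
    | mem x h => exact hs x h
    | zero => intro g; simp
    | add x y _ _ hx hy =>
      intro g
      rw [mul_add, Subalgebra.coe_add, coeff_add]
      exact add_mem (hx g) (hy g)
    | smul a x _ hx =>
      intro g
      rw [smul_eq_mul, ← mul_assoc]; exact hx _
  simpa using this 1

lemma mem_fI_coeff {I A : Ideal R} (N : ℕ) {f : ↥(reesAlgebra I)} (hf : f ∈ fI I A) :
    (f : R[X]).coeff (N + 1) ∈ A * I ^ N ⊔ maximalIdeal R * I ^ (N + 1) := by
  unfold fI at hf
  obtain ⟨y, hy, z, hz, rfl⟩ := Submodule.mem_sup.1 hf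
  rw [Subalgebra.coe_add, coeff_add]
  refine add_mem (Ideal.mem_sup_right ?_) (Ideal.mem_sup_left ?_)
  · refine span_coeff _ _ _ ?_ hy
    rintro _ ⟨c, hc, rfl⟩ g
    have : ((g * algebraMap R ↥(reesAlgebra I) c : ↥(reesAlgebra I)) : R[X]) = g * C c := rfl
    rw [this, coeff_mul_C, mul_comm _ c]
    exact Ideal.mul_mem_mul hc (g.2 _)
  · refine span_coeff _ _ _ ?_ hz
    rintro f ⟨a, ha, hf⟩ g
    rw [Subalgebra.coe_mul, hf, ← C_mul_X_eq_monomial, ← mul_assoc, coeff_mul_X, coeff_mul_C, mul_comm _ a]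
    exact Ideal.mul_mem_mul ha (g.2 _)

lemma red_of_nak {I A : Ideal R} (hA : A ≤ I) (N : ℕ)
    (h : I ^ (N + 1) ≤ A * I ^ N ⊔ maximalIdeal R * I ^ (N + 1)) : IsReduction A I := by
  refine ⟨hA, N, le_antisymm ?_ ?_⟩
  · exact Submodule.le_of_le_smul_of_le_jacobson_bot (IsNoetherian.noetherian _)
      (maximalIdeal_le_jacobson _) h
  · rw [pow_succ']; exact Ideal.mul_mono_left hA

/-- irrelevant part -/
noncomputable def Fplus (I : Ideal R) : Ideal ↥(reesAlgebra I) := Ideal.span (Set.range (monL I 1))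

lemma Fplus_pow_coeff {I : Ideal R} (N : ℕ) : ∀ {f : ↥(reesAlgebra I)}, f ∈ Fplus I ^ N →
    ∀ j < N, (f : R[X]).coeff j = 0 := by
  induction N with
  | zero => intro f _ j hj; omega
  | succ N ih =>
    intro f hf j hj
    rw [pow_succ] at hf
    refine Submodule.mul_induction_on hf ?_ ?_
    · intro a ha b hb
      have hb' : (b : R[X]).coeff 0 = 0 := by
        have := span_coeff 0 ⊥ (Set.range (monL I 1)) (by
          rintro _ ⟨c, rfl⟩ g
          rw [Subalgebra.coe_mul, monL_coe, ← C_mul_X_eq_monomial, ← mul_assoc]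
          simp) hb
        simpa using this
      rw [Subalgebra.coe_mul, coeff_mul]
      apply Finset.sum_eq_zero
      rintro ⟨p, q⟩ hpq
      rw [Finset.HasAntidiagonal.mem_antidiagonal] at hpq
      dsimp only at hpq ⊢
      rcases Nat.eq_zero_or_pos q with h | h
      · rw [h, hb', mul_zero]
      · rw [ih ha p (by omega), zero_mul]
    · intro x y hx hy
      rw [Subalgebra.coe_add, coeff_add, hx, hy, add_zero]

lemma monL_mem_pow {I : Ideal R} (N : ℕ) (c : ↥(I ^ N)) : monL I N c ∈ Fplus I ^ N := by
  obtain ⟨c, hc⟩ := c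
  induction N generalizing c with
  | zero => simp
  | succ N ih =>
    have hc' := hc
    rw [pow_succ] at hc'
    have : ∀ c ∈ I ^ N * I, ∃ h : c ∈ I ^ (N + 1), monL I (N + 1) ⟨c, h⟩ ∈ Fplus I ^ (N + 1) := by
      intro c hc
      refine Submodule.mul_induction_on hc ?_ ?_
      · intro a ha b hb
        refine ⟨by rw [pow_succ]; exact Ideal.mul_mem_mul ha hb, ?_⟩
        have e : monL I (N + 1) ⟨a * b, by rw [pow_succ]; exact Ideal.mul_mem_mul ha hb⟩ =
            monL I N ⟨a, ha⟩ * monL I 1 ⟨b, by simpa using hb⟩ := by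
          apply Subtype.ext
          rw [Subalgebra.coe_mul, monL_coe, monL_coe, monL_coe, monomial_mul_monomial]
        rw [e, pow_succ]
        exact Ideal.mul_mem_mul (ih a ha) (Ideal.subset_span ⟨_, rfl⟩)
      · rintro x y ⟨hx, hx'⟩ ⟨hy, hy'⟩
        refine ⟨add_mem hx hy, ?_⟩
        have : monL I (N + 1) ⟨x + y, add_mem hx hy⟩ = monL I (N + 1) ⟨x, hx⟩ + monL I (N + 1) ⟨y, hy⟩ := by
          rw [← map_add]; rfl
        rw [this]; exact add_mem hx' hy'
    exact (this c hc').2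

lemma red_of_FLE_zero {I A : Ideal R} (hA : A ≤ I) (h : FLE I A 0) : IsReduction A I := by
  have h1 : Ring.KrullDimLE 0 (↥(reesAlgebra I) ⧸ fI I A) := by
    rw [Ring.krullDimLE_iff]; exact_mod_cast h
  have h2 : IsArtinianRing (↥(reesAlgebra I) ⧸ fI I A) :=
    (isArtinianRing_iff_krullDimLE_zero (R := (↥(reesAlgebra I) ⧸ fI I A))).2 h1
  let P : ℕ →o (Ideal (↥(reesAlgebra I) ⧸ fI I A))ᵒᵈ :=
    ⟨fun N => OrderDual.toDual ((Fplus I ^ N).map (Ideal.Quotient.mk (fI I A))), by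
      intro a b hab
      exact Ideal.map_mono (Ideal.pow_le_pow_right hab)⟩
  obtain ⟨N, hN⟩ := IsArtinian.monotone_stabilizes P
  have h3 : (Fplus I ^ (N + 1)).map (Ideal.Quotient.mk (fI I A)) =
      (Fplus I ^ (N + 2)).map (Ideal.Quotient.mk (fI I A)) :=
    (hN (N + 1) (by omega)).symm.trans (hN (N + 2) (by omega))
  apply red_of_nak hA N
  intro c hc
  have h4 : Ideal.Quotient.mk (fI I A) (monL I (N + 1) ⟨c, hc⟩) ∈
      (Fplus I ^ (N + 2)).map (Ideal.Quotient.mk (fI I A)) := by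
    rw [← h3]; exact Ideal.mem_map_of_mem _ (monL_mem_pow _ _)
  rw [Ideal.mem_map_iff_of_surjective _ Ideal.Quotient.mk_surjective] at h4
  obtain ⟨w, hw, hw'⟩ := h4
  rw [Ideal.Quotient.eq] at hw'
  have h5 := mem_fI_coeff N hw'
  have h6 := Fplus_pow_coeff _ hw (N + 1) (by omega)
  rw [Subalgebra.coe_sub, coeff_sub, h6, monL_coe, coeff_monomial_same, zero_sub, neg_mem_iff] at h5
  exact h5

end Fib
end

section
open IsLocalRing Polynomial

set_option linter.style.haveILetI false
set_option linter.unusedSectionVars false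
section Fib

variable {R : Type u} [CommRing R] [IsNoetherianRing R] [IsLocalRing R]

lemma mon_mem_T {I A : Ideal R} {q : ℕ} (w : Fin q → R) (r : ℕ)
    (hr : I ^ (r + 1) = (A ⊔ Ideal.span (Set.range w)) * I ^ r) (T : Submodule R R[X])
    (hT0 : ∀ i ≤ r, ∀ c ∈ I ^ i, monomial i c ∈ T)
    (hTw : ∀ j, ∀ f ∈ T, monomial 1 (w j) * f ∈ T)
    (hTA : ∀ a ∈ A, ∀ f ∈ reesAlgebra I, monomial 1 a * f ∈ T) (i : ℕ) :
    ∀ c ∈ I ^ i, monomial i c ∈ T := by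
  induction i with
  | zero => exact hT0 0 (Nat.zero_le _)
  | succ i ih =>
    by_cases hi : i + 1 ≤ r
    · exact hT0 _ hi
    · have e : I ^ (i + 1) = (A ⊔ Ideal.span (Set.range w)) * I ^ i := by
        obtain ⟨j, rfl⟩ := Nat.exists_eq_add_of_le (show r ≤ i by omega)
        rw [show r + j + 1 = (r + 1) + j by ring, pow_add, hr, mul_assoc, ← pow_add]
      intro c hc
      rw [e] at hc
      refine Submodule.mul_induction_on hc ?_ ?_
      · intro a ha z hz
        rw [show monomial (i + 1) (a * z) = monomial 1 a * monomial i z by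
          rw [monomial_mul_monomial, add_comm]]
        obtain ⟨y, hy, v, hv, rfl⟩ := Submodule.mem_sup.1 ha
        rw [map_add, add_mul]
        refine add_mem (hTA y hy _ (reesAlgebra.monomial_mem.2 hz)) ?_
        refine Submodule.span_induction (p := fun v _ => monomial 1 v * monomial i z ∈ T) ?_ ?_ ?_ ?_ hv
        · rintro _ ⟨j, rfl⟩; exact hTw j _ (ih z hz)
        · simp
        · intro x y _ _ hx hy; rw [map_add, add_mul]; exact add_mem hx hy
        · intro a x _ hx
          rw [← smul_monomial, smul_mul_assoc]; exact T.smul_mem _ hx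
      · intro x y hx hy
        rw [map_add]; exact add_mem hx hy

lemma FLE_of_red_aux {I A : Ideal R} {q : ℕ} (w : Fin q → R)
    (h : IsReduction (A ⊔ Ideal.span (Set.range w)) I) (F : Type u) [CommRing F] [Algebra R F]
    (mk : ↥(reesAlgebra I) →ₐ[R] F) (hmks : Function.Surjective mk) (hmk0 : ∀ x ∈ fI I A, mk x = 0) :
    ringKrullDim F ≤ q := by
  obtain ⟨hle, r, hr⟩ := h
  have hw : ∀ i, w i ∈ I := fun i => hle (Ideal.mem_sup_right (Ideal.subset_span ⟨i, rfl⟩))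
  let P := MvPolynomial (Fin q) R
  let W : Fin q → F := fun i => mk (monL I 1 ⟨w i, by simpa using hw i⟩)
  let g : P →ₐ[R] F := MvPolynomial.aeval W
  let _ : Algebra P F := g.toRingHom.toAlgebra
  have : IsScalarTower R P F := IsScalarTower.of_algebraMap_eq (fun x => (g.commutes x).symm)
  have hfg : ∀ i, ∃ s : Finset R, Ideal.span (s : Set R) = I ^ i := fun i => IsNoetherian.noetherian (I ^ i)
  choose G hG using hfg
  have hGm : ∀ i, ∀ c ∈ G i, c ∈ I ^ i := fun i c hc => by rw [← hG i]; exact Ideal.subset_span hc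
  let gen : Set F := ⋃ i ∈ Finset.range (r + 1), Set.range (fun c : G i => mk (monL I i ⟨c, hGm i c c.2⟩))
  have hgen : gen.Finite := by
    refine Set.Finite.biUnion (Finset.finite_toSet _) fun i _ => Set.finite_range _
  let N : Submodule P F := Submodule.span P gen
  let mkL : ↥(reesAlgebra I) →ₗ[R] F := mk.toLinearMap
  let T : Submodule R R[X] := ((N.restrictScalars R).comap mkL).map (reesAlgebra I).val.toLinearMap
  have memT : ∀ f : R[X], f ∈ T ↔ ∃ h : f ∈ reesAlgebra I, mk ⟨f, h⟩ ∈ N := by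
    intro f
    constructor
    · rintro ⟨x, hx, rfl⟩
      exact ⟨x.2, hx⟩
    · rintro ⟨h, h'⟩
      exact ⟨⟨f, h⟩, h', rfl⟩
  have key : ∀ i, ∀ c ∈ I ^ i, monomial i c ∈ T := by
    apply mon_mem_T w r hr T
    · intro i hi c hc
      rw [← hG i] at hc
      refine Submodule.span_induction (p := fun v _ => monomial i v ∈ T) ?_ ?_ ?_ ?_ hc
      · intro x hx
        rw [memT]
        refine ⟨reesAlgebra.monomial_mem.2 (hGm i x hx), Submodule.subset_span ?_⟩
        exact Set.mem_biUnion (by simp; omega) ⟨⟨x, hx⟩, rfl⟩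
      · simp
      · intro x y _ _ hx hy; rw [map_add]; exact add_mem hx hy
      · intro a x _ hx
        rw [← smul_monomial]; exact T.smul_mem _ hx
    · intro j f hf
      rw [memT] at hf ⊢
      obtain ⟨h1, h2⟩ := hf
      have h3 : monomial 1 (w j) ∈ reesAlgebra I := reesAlgebra.monomial_mem.2 (by simpa using hw j)
      refine ⟨mul_mem h3 h1, ?_⟩
      have := N.smul_mem (MvPolynomial.X j : P) h2
      rw [Algebra.smul_def] at this
      have e : algebraMap P F (MvPolynomial.X j) = W j := MvPolynomial.aeval_X W j
      rw [e] at this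
      have e2 : (⟨monomial 1 (w j) * f, mul_mem h3 h1⟩ : ↥(reesAlgebra I)) =
          monL I 1 ⟨w j, by simpa using hw j⟩ * ⟨f, h1⟩ := Subtype.ext rfl
      rw [e2, map_mul]
      exact this
    · intro a ha f hf
      rw [memT]
      have h3 : monomial 1 a ∈ reesAlgebra I := reesAlgebra.monomial_mem.2 (by
        simpa using hle (Ideal.mem_sup_left ha))
      refine ⟨mul_mem h3 hf, ?_⟩
      have h4 : (⟨monomial 1 a, h3⟩ * ⟨f, hf⟩ : ↥(reesAlgebra I)) ∈ fI I A :=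
        Ideal.mul_mem_right _ _ (Ideal.mem_sup_right (Ideal.subset_span ⟨a, ha, rfl⟩))
      have h5 : mk (⟨monomial 1 a, h3⟩ * ⟨f, hf⟩ : ↥(reesAlgebra I)) = 0 := hmk0 _ h4
      have h6 : mk (⟨monomial 1 a * f, mul_mem h3 hf⟩ : ↥(reesAlgebra I)) = 0 := h5
      rw [h6]; exact zero_mem _
  have htop : N = ⊤ := by
    rw [eq_top_iff]
    rintro x -
    obtain ⟨f, rfl⟩ := hmks x
    have : (f : R[X]) ∈ T := by
      rw [(f : R[X]).as_sum_support]
      exact sum_mem fun i _ => key i _ (f.2 i)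
    exact ((memT _).1 this).2
  have : Module.Finite P F := ⟨⟨hgen.toFinset, by rw [Set.Finite.coe_toFinset]; exact htop⟩⟩
  have hintg : ∀ x : F, IsIntegral P x := fun x => IsIntegral.of_finite P x
  let m' : Ideal P := (maximalIdeal R).map MvPolynomial.C
  have hm' : ∀ p ∈ m', algebraMap P F p = 0 := by
    intro p hp
    have : m' ≤ RingHom.ker (algebraMap P F) := by
      rw [Ideal.map_le_iff_le_comap]
      intro c hc
      have e : algebraMap P F (MvPolynomial.C c) = mk (algebraMap R _ c) := by
        rw [AlgHom.commutes]; exact MvPolynomial.aeval_C W c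
      show algebraMap P F (MvPolynomial.C c) = 0
      rw [e]
      exact hmk0 _ (Ideal.mem_sup_left (Ideal.mem_map_of_mem _ hc))
    exact this hp
  have h1 : ringKrullDim F ≤ ringKrullDim (P ⧸ m') := by
    rw [ringKrullDim_quotient, ringKrullDim]
    let Z : PrimeSpectrum F → PrimeSpectrum.zeroLocus (m' : Set P) := fun p =>
      ⟨PrimeSpectrum.comap (algebraMap P F) p, fun x hx => by
        show algebraMap P F x ∈ p.asIdeal
        rw [hm' x hx]; exact zero_mem _⟩
    refine Order.krullDim_le_of_strictMono Z ?_
    intro p p' hpp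
    have hlt : p.asIdeal < p'.asIdeal := hpp
    obtain ⟨x, hx, hx'⟩ := SetLike.exists_of_lt hlt
    have := Ideal.comap_lt_comap_of_integral_mem_sdiff (R := P) (I := p.asIdeal) (J := p'.asIdeal) hlt.le
      (x := x) ⟨hx, hx'⟩ (hintg x)
    exact this
  have h2 : ringKrullDim (P ⧸ m') = q := by
    rw [← ringKrullDim_eq_of_ringEquiv (MvPolynomial.quotientEquivQuotientMvPolynomial (σ := Fin q) (maximalIdeal R)).toRingEquiv]
    let _ : Field (R ⧸ maximalIdeal R) := Ideal.Quotient.field _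
    rw [MvPolynomial.ringKrullDim_of_isNoetherianRing]
    rw [ringKrullDim_eq_zero_of_field]
    simp
  rw [← h2]; exact h1

lemma FLE_of_red {I A : Ideal R} {q : ℕ} (w : Fin q → R)
    (h : IsReduction (A ⊔ Ideal.span (Set.range w)) I) : FLE I A q := by
  have h0 : ∀ x ∈ fI I A, (Ideal.Quotient.mkₐ R (fI I A)) x = 0 :=
    fun x hx => Ideal.Quotient.eq_zero_iff_mem.2 hx
  have := FLE_of_red_aux w h (↥(reesAlgebra I) ⧸ fI I A) (Ideal.Quotient.mkₐ R (fI I A))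
    (Ideal.Quotient.mkₐ_surjective R _) h0
  exact this

end Fib
end

section
open IsLocalRing Polynomial

set_option linter.unusedSectionVars false
section Fib

variable {R : Type u} [CommRing R] [IsNoetherianRing R] [IsLocalRing R]

/-- degree one part of an ideal of the Rees algebra, as polynomials -/
noncomputable def TP {I : Ideal R} (P : Ideal ↥(reesAlgebra I)) : Submodule R R[X] :=
  (P.restrictScalars R).map (reesAlgebra I).val.toLinearMap

lemma mem_TP {I : Ideal R} (P : Ideal ↥(reesAlgebra I)) (f : R[X]) :
    f ∈ TP P ↔ ∃ h : f ∈ reesAlgebra I, (⟨f, h⟩ : ↥(reesAlgebra I)) ∈ P := by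
  constructor
  · rintro ⟨x, hx, rfl⟩
    exact ⟨x.2, hx⟩
  · rintro ⟨h, h'⟩
    exact ⟨⟨f, h⟩, h', rfl⟩

/-- degree one part -/
noncomputable def NP {I : Ideal R} (P : Ideal ↥(reesAlgebra I)) : Ideal R :=
  (TP P).comap (monomial 1)

lemma mem_NP {I : Ideal R} (P : Ideal ↥(reesAlgebra I)) (b : R) : b ∈ NP P ↔ monomial 1 b ∈ TP P := Iff.rfl

lemma TP_mul {I : Ideal R} (P : Ideal ↥(reesAlgebra I)) {f g : R[X]} (hf : f ∈ TP P)
    (hg : g ∈ reesAlgebra I) : f * g ∈ TP P := by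
  rw [mem_TP] at hf ⊢
  obtain ⟨h, h'⟩ := hf
  refine ⟨mul_mem h hg, ?_⟩
  have e : (⟨f * g, mul_mem h hg⟩ : ↥(reesAlgebra I)) = ⟨f, h⟩ * ⟨g, hg⟩ := Subtype.ext rfl
  rw [e]
  exact Ideal.mul_mem_right _ P h'

lemma NP_red {I : Ideal R} (P : Ideal ↥(reesAlgebra I)) [hP : P.IsPrime] {J0 : Ideal R}
    (hJ : IsReduction J0 I) (h : J0 ≤ NP P) : Fplus I ≤ P := by
  obtain ⟨hle, r, hr⟩ := hJ
  have key : ∀ c ∈ I ^ (r + 1), monomial (r + 1) c ∈ TP P := by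
    intro c hc
    rw [hr] at hc
    refine Submodule.mul_induction_on hc ?_ ?_
    · intro a ha z hz
      rw [show monomial (r + 1) (a * z) = monomial 1 a * monomial r z by
          rw [monomial_mul_monomial, add_comm]]
      exact TP_mul P (h ha) (reesAlgebra.monomial_mem.2 hz)
    · intro x y hx hy
      rw [map_add]; exact add_mem hx hy
  unfold Fplus
  rw [Ideal.span_le]
  rintro _ ⟨⟨y, hy⟩, rfl⟩
  have hy' : y ∈ I := by simpa using hy
  obtain ⟨h1, h2⟩ := (mem_TP _ _).1 (key (y ^ (r + 1)) (Ideal.pow_mem_pow hy' _))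
  have e : (⟨monomial (r + 1) (y ^ (r + 1)), h1⟩ : ↥(reesAlgebra I)) = (monL I 1 ⟨y, hy⟩) ^ (r + 1) := by
    apply Subtype.ext
    rw [SubmonoidClass.coe_pow, monL_coe, monomial_pow, one_mul]
  rw [e] at h2
  exact hP.mem_of_pow_mem _ h2

lemma fI_mono {I A B : Ideal R} (h : A ≤ B) : fI I A ≤ fI I B := by
  unfold fI
  refine sup_le_sup_left (Ideal.span_mono ?_) _
  rintro f ⟨a, ha, hf⟩
  exact ⟨a, h ha, hf⟩

lemma max_of_Fplus {I A : Ideal R} {P Q : Ideal ↥(reesAlgebra I)} [hQ : Q.IsPrime]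
    (hA : fI I A ≤ P) (hF : Fplus I ≤ P) (hPQ : P ≤ Q) : Q ≤ P := by
  intro s hs
  have hmP : ∀ c ∈ maximalIdeal R, algebraMap R ↥(reesAlgebra I) c ∈ P := fun c hc =>
    hA (Ideal.mem_sup_left (Ideal.mem_map_of_mem _ hc))
  have h1 : s - algebraMap R _ ((s : R[X]).coeff 0) ∈ P := by
    have : s - algebraMap R _ ((s : R[X]).coeff 0) =
        ∑ i ∈ (s : R[X]).support.erase 0, monL I i ⟨(s : R[X]).coeff i, s.2 i⟩ := by
      apply Subtype.ext
      rw [AddSubmonoidClass.coe_finsetSum]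
      simp only [monL_coe]
      have e1 : ((s - algebraMap R _ ((s : R[X]).coeff 0) : ↥(reesAlgebra I)) : R[X]) = s - C ((s : R[X]).coeff 0) := rfl
      rw [e1]
      ext n
      rw [coeff_sub, coeff_C, finsetSum_coeff]
      simp only [coeff_monomial]
      rw [Finset.sum_ite_eq']
      by_cases hn : n = 0
      · subst hn; simp
      · simp [hn]
    rw [this]
    refine sum_mem fun i hi => ?_
    have hi : i ≠ 0 := (Finset.mem_erase.1 hi).1
    exact hF (Ideal.pow_le_self hi (monL_mem_pow i _))
  have h2 : algebraMap R _ ((s : R[X]).coeff 0) ∈ Q := by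
    have := Q.sub_mem hs (hPQ h1)
    simpa using this
  have h3 : (s : R[X]).coeff 0 ∈ maximalIdeal R := by
    by_contra hcon
    have hu : IsUnit ((s : R[X]).coeff 0) := by
      by_contra h; exact hcon ((mem_maximalIdeal _).2 h)
    exact hQ.ne_top (Ideal.eq_top_of_isUnit_mem _ h2 (hu.map _))
  have := P.add_mem h1 (hmP _ h3)
  simpa using this

lemma dim_drop_abs {S : Type u} [CommRing S] (K K' : Ideal S) (hK : K ≤ K') (q : ℕ)
    (hq : ringKrullDim (S ⧸ K) ≤ ((q + 1 : ℕ) : WithBot ℕ∞))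
    (h : ∀ P ∈ K.minimalPrimes, ¬ K' ≤ P ∨ ∀ Q : Ideal S, Q.IsPrime → P ≤ Q → Q ≤ P) :
    ringKrullDim (S ⧸ K') ≤ q := by
  rw [ringKrullDim_quotient] at hq ⊢
  unfold Order.krullDim at hq ⊢
  refine iSup_le fun p => ?_
  have h0 : K' ≤ (p.head : PrimeSpectrum S).asIdeal := p.head.2
  obtain ⟨P, hP, hPle⟩ := Ideal.exists_minimalPrimes_le (hK.trans h0)
  let Z : PrimeSpectrum.zeroLocus (K' : Set S) → PrimeSpectrum.zeroLocus (K : Set S) :=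
    fun x => ⟨x.1, fun y hy => x.2 (hK hy)⟩
  have hZ : StrictMono Z := fun x y h => h
  let P' : PrimeSpectrum.zeroLocus (K : Set S) := ⟨⟨P, hP.1.1⟩, hP.1.2⟩
  rcases h P hP with h | h
  · have hlt : P' < (p.map Z hZ).head := by
      rw [LTSeries.head_map]
      show P < p.head.1.asIdeal
      exact lt_of_le_of_ne hPle fun hh => h (hh ▸ h0)
    have h3 := (le_iSup (fun p : LTSeries (PrimeSpectrum.zeroLocus (K : Set S)) =>
      (p.length : WithBot ℕ∞)) ((p.map Z hZ).cons P' hlt)).trans hq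
    have h4 : p.length + 1 ≤ q + 1 := by
      have e : ((p.map Z hZ).cons P' hlt).length = p.length + 1 := by
        rw [RelSeries.cons_length]; rfl
      rw [e] at h3
      exact_mod_cast h3
    have : p.length ≤ q := by omega
    exact_mod_cast this
  · have : p.length = 0 := by
      by_contra hne
      have hlt : p.head < p.last := p.rel_of_lt (i := 0) (j := Fin.last _) (by
        rw [Fin.lt_def]; simp; omega)
      have h5 := h p.last.1.asIdeal p.last.1.2 (hPle.trans (le_of_lt hlt))
      exact absurd hlt (not_lt_of_ge (h5.trans hPle : p.last.1.asIdeal ≤ p.head.1.asIdeal))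
    rw [this]; simp

lemma FLE_drop {I A : Ideal R} (hA : A ≤ I) : ∃ s : Set (Ideal R), s.Finite ∧ (∀ N ∈ s, A ≤ N) ∧
    (∀ N ∈ s, ∀ J0, IsReduction J0 I → ¬ J0 ≤ N) ∧
    ∀ q, FLE I A (q + 1) → ∀ b ∈ I, (∀ N ∈ s, b ∉ N) → FLE I (A ⊔ Ideal.span {b}) q := by
  refine ⟨NP '' {P | P ∈ (fI I A).minimalPrimes ∧ ¬ Fplus I ≤ P}, ?_, ?_, ?_, ?_⟩
  · exact ((Ideal.finite_minimalPrimes_of_isNoetherianRing _ _).subset (fun P hP => hP.1)).image _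
  · rintro _ ⟨P, ⟨hP, -⟩, rfl⟩ a ha
    rw [mem_NP, mem_TP]
    have h : monomial 1 a ∈ reesAlgebra I := reesAlgebra.monomial_mem.2 (by simpa using hA ha)
    exact ⟨h, hP.1.2 (Ideal.mem_sup_right (Ideal.subset_span ⟨a, ha, rfl⟩))⟩
  · rintro _ ⟨P, ⟨hP, hF⟩, rfl⟩ J0 hJ0 hle
    have := hP.1.1
    exact hF (NP_red P hJ0 hle)
  · intro q hq b hb hav
    refine dim_drop_abs (fI I A) _ (fI_mono le_sup_left) q hq fun P hP => ?_
    by_cases hF : Fplus I ≤ P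
    · right
      intro Q hQ hle
      exact max_of_Fplus hP.1.2 hF hle
    · left
      intro hle
      have hbt : monomial 1 b ∈ reesAlgebra I := reesAlgebra.monomial_mem.2 (by simpa using hb)
      refine hav _ ⟨P, ⟨hP, hF⟩, rfl⟩ ((mem_NP _ _).2 ((mem_TP _ _).2 ⟨hbt, hle ?_⟩))
      exact Ideal.mem_sup_right (Ideal.subset_span
          ⟨b, Ideal.mem_sup_right (Ideal.mem_span_singleton_self b), rfl⟩)

end Fib
end

section
open IsLocalRing

set_option linter.unusedSectionVars false
section Fib

variable {R : Type u} [CommRing R] [IsNoetherianRing R] [IsLocalRing R]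

lemma fd_FLE {I : Ideal R} {l : ℕ} (hl : fiberDim I = (l : WithBot ℕ∞)) : FLE I ⊥ l := by
  unfold FLE
  rw [fI_bot]
  exact le_of_eq hl

lemma fd_lower {I : Ideal R} {l : ℕ} (hl : fiberDim I = (l : WithBot ℕ∞)) {q : ℕ} (w : Fin q → R)
    (h : IsReduction (Ideal.span (Set.range w)) I) : l ≤ q := by
  have h1 : FLE I ⊥ q := FLE_of_red w (by rwa [bot_sup_eq])
  unfold FLE at h1
  rw [fI_bot] at h1
  have h2 : (l : WithBot ℕ∞) ≤ q := by rw [← hl]; exact h1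
  exact_mod_cast h2

lemma span_snoc {j : ℕ} (c : Fin j → R) (b : R) :
    Ideal.span (Set.range (Fin.snoc c b : Fin (j + 1) → R)) = Ideal.span (Set.range c) ⊔ Ideal.span {b} := by
  rw [Fin.range_snoc, Ideal.span_insert, sup_comm]

lemma red_contains (hk : Infinite (ResidueField R)) {I : Ideal R} {l : ℕ}
    (hl : fiberDim I = (l : WithBot ℕ∞)) {J0 : Ideal R} (hJ : IsReduction J0 I) :
    ∃ a : Fin l → R, (∀ i, a i ∈ J0) ∧ IsReduction (Ideal.span (Set.range a)) I := by
  have key : ∀ j, j ≤ l → ∃ c : Fin j → R, (∀ i, c i ∈ J0) ∧ FLE I (Ideal.span (Set.range c)) (l - j) := by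
    intro j
    induction j with
    | zero =>
      intro _
      refine ⟨Fin.elim0, fun i => i.elim0, ?_⟩
      simpa using fd_FLE hl
    | succ j ih =>
      intro hj
      obtain ⟨c, hc, hF⟩ := ih (by omega)
      have hcI : Ideal.span (Set.range c) ≤ I := by
        rw [Ideal.span_le]; rintro _ ⟨i, rfl⟩; exact hJ.1 (hc i)
      obtain ⟨s, hs, -, hred, hdrop⟩ := FLE_drop hcI
      obtain ⟨b, hb, hb'⟩ := avoid hk J0 s hs (fun N hN => hred N hN J0 hJ)
      refine ⟨Fin.snoc c b, ?_, ?_⟩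
      · intro i
        refine Fin.lastCases ?_ (fun i => ?_) i
        · simpa using hb
        · simpa using hc i
      · rw [span_snoc]
        exact hdrop _ (by rwa [show l - (j + 1) + 1 = l - j by omega]) b (hJ.1 hb) hb'
  obtain ⟨c, hc, hF⟩ := key l le_rfl
  refine ⟨c, hc, red_of_FLE_zero ?_ (by simpa using hF)⟩
  rw [Ideal.span_le]; rintro _ ⟨i, rfl⟩; exact hJ.1 (hc i)

lemma indep {I : Ideal R} {l : ℕ} (hl : fiberDim I = (l : WithBot ℕ∞)) (a : Fin l → R)
    (h : IsReduction (Ideal.span (Set.range a)) I) (c : Fin l → R)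
    (hc : ∑ i, c i * a i ∈ maximalIdeal R * I) (i : Fin l) : c i ∈ maximalIdeal R := by
  by_contra hcon
  have hu : IsUnit (c i) := by
    by_contra h; exact hcon ((mem_maximalIdeal _).2 h)
  obtain ⟨l', rfl⟩ : ∃ l', l = l' + 1 := ⟨l - 1, by have := i.2; omega⟩
  obtain ⟨u, hu⟩ := hu
  let A := Ideal.span (Set.range (a ∘ i.succAbove))
  have hai : a i ∈ A ⊔ maximalIdeal R * I := by
    rw [Fin.sum_univ_succAbove _ i, ← hu] at hc
    have e : a i = (↑u⁻¹ : R) * (↑u * a i + ∑ j, c (i.succAbove j) * a (i.succAbove j)) -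
        ↑u⁻¹ * ∑ j, c (i.succAbove j) * a (i.succAbove j) := by
      rw [mul_add, ← mul_assoc, Units.inv_mul]; ring
    rw [e]
    refine sub_mem (Ideal.mem_sup_right (Ideal.mul_mem_left _ _ hc)) (Ideal.mem_sup_left ?_)
    refine Ideal.mul_mem_left _ _ (sum_mem fun j _ => Ideal.mul_mem_left _ _ (Ideal.subset_span ⟨j, rfl⟩))
  have hspan : Ideal.span (Set.range a) ≤ A ⊔ maximalIdeal R * I := by
    rw [Ideal.span_le]
    rintro _ ⟨j, rfl⟩
    refine Fin.succAboveCases i hai (fun j => ?_) j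
    exact Ideal.mem_sup_left (Ideal.subset_span ⟨j, rfl⟩)
  obtain ⟨hle, r, hr⟩ := h
  have hA : A ≤ I := by
    refine le_trans (Ideal.span_mono ?_) hle
    rintro _ ⟨j, rfl⟩; exact ⟨_, rfl⟩
  have : IsReduction A I := by
    apply red_of_nak hA r
    calc I ^ (r + 1) = Ideal.span (Set.range a) * I ^ r := hr
      _ ≤ (A ⊔ maximalIdeal R * I) * I ^ r := Ideal.mul_mono_left hspan
      _ = _ := by rw [Ideal.sup_mul, mul_assoc, ← pow_succ']
  have := fd_lower hl _ this
  omega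

lemma span_eq_of_le {I : Ideal R} {l : ℕ} (hl : fiberDim I = (l : WithBot ℕ∞)) (a a' : Fin l → R)
    (h : IsReduction (Ideal.span (Set.range a)) I) (h' : IsReduction (Ideal.span (Set.range a')) I)
    (hle : Ideal.span (Set.range a') ≤ Ideal.span (Set.range a)) :
    Ideal.span (Set.range a') = Ideal.span (Set.range a) := by
  have hU : ∀ i, ∃ c : Fin l → R, ∑ j, c j * a j = a' i := by
    intro i
    have := hle (Ideal.subset_span ⟨i, rfl⟩)
    exact (Ideal.mem_span_range_iff_exists_fun).1 this
  choose U hU using hU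
  let UM : Matrix (Fin l) (Fin l) R := Matrix.of U
  have hdet : IsUnit UM.det := by
    rw [← residue_ne_zero_iff_isUnit, RingHom.map_det]
    intro h0
    obtain ⟨v, hv, hv'⟩ := Matrix.exists_vecMul_eq_zero_iff.2 h0
    obtain ⟨g, hg⟩ := IsLocalRing.residue_surjective.hasRightInverse (f := residue R)
    have hmem : ∀ j, ∑ i, g (v i) * U i j ∈ maximalIdeal R := by
      intro j
      rw [← IsLocalRing.residue_eq_zero_iff, map_sum]
      have := congrFun hv' j
      simp only [Matrix.vecMul, dotProduct] at this
      simp only [map_mul, hg (_)]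
      exact this
    apply hv
    funext i
    have h1 : ∑ i, g (v i) * a' i ∈ maximalIdeal R * I := by
      have e : ∑ i, g (v i) * a' i = ∑ j, (∑ i, g (v i) * U i j) * a j := by
        simp only [← hU, Finset.mul_sum, Finset.sum_mul]
        rw [Finset.sum_comm]
        simp only [mul_assoc]
      rw [e]
      exact sum_mem fun j _ => Ideal.mul_mem_mul (hmem j) (h.1 (Ideal.subset_span ⟨j, rfl⟩))
    have := indep hl a' h' _ h1 i
    rw [← IsLocalRing.residue_eq_zero_iff, hg] at this
    exact this
  apply le_antisymm hle
  rw [Ideal.span_le]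
  rintro _ ⟨i, rfl⟩
  have e : a' = UM.mulVec a := by
    funext i; rw [← hU]; rfl
  have e2 : a = (UM⁻¹).mulVec a' := by
    rw [e, Matrix.mulVec_mulVec, Matrix.nonsing_inv_mul _ hdet, Matrix.one_mulVec]
  have e3 : a i = ∑ j, (UM⁻¹) i j * a' j := congrFun e2 i
  rw [e3]
  exact sum_mem fun j _ => Ideal.mul_mem_left _ _ (Ideal.subset_span ⟨j, rfl⟩)

lemma min_of_red (hk : Infinite (ResidueField R)) {I : Ideal R} {l : ℕ}
    (hl : fiberDim I = (l : WithBot ℕ∞)) (a : Fin l → R)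
    (h : IsReduction (Ideal.span (Set.range a)) I) : IsMinimalReduction (Ideal.span (Set.range a)) I := by
  refine ⟨h, fun J' hJ' hle => le_antisymm hle ?_⟩
  obtain ⟨a', ha', hr⟩ := red_contains hk hl hJ'
  have h1 : Ideal.span (Set.range a') ≤ J' := by
    rw [Ideal.span_le]; rintro _ ⟨i, rfl⟩; exact ha' i
  rw [← span_eq_of_le hl a a' h hr (h1.trans hle)]
  exact h1

lemma exists_gens (hk : Infinite (ResidueField R)) {I : Ideal R} {l : ℕ}
    (hl : fiberDim I = (l : WithBot ℕ∞)) {J : Ideal R} (hJ : IsMinimalReduction J I) :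
    ∃ a : Fin l → R, Ideal.span (Set.range a) = J := by
  obtain ⟨a, ha, hr⟩ := red_contains hk hl hJ.1
  refine ⟨a, hJ.2 _ hr ?_⟩
  rw [Ideal.span_le]; rintro _ ⟨i, rfl⟩; exact ha i

lemma exch {I A : Ideal R} {w : R} (h : IsReduction (A ⊔ Ideal.span {w}) I) :
    ∃ s : Set (Ideal R), s.Finite ∧ (∀ N ∈ s, A ≤ N) ∧ (∀ N ∈ s, ∀ J0, IsReduction J0 I → ¬ J0 ≤ N) ∧
      ∀ b ∈ I, (∀ N ∈ s, b ∉ N) → IsReduction (A ⊔ Ideal.span {b}) I := by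
  have hA : A ≤ I := le_sup_left.trans h.1
  obtain ⟨s, h1, h2, h3, h4⟩ := FLE_drop hA
  refine ⟨s, h1, h2, h3, fun b hb hav => red_of_FLE_zero ?_ (h4 0 ?_ b hb hav)⟩
  · exact sup_le hA ((Ideal.span_singleton_le_iff_mem _).2 hb)
  · refine FLE_of_red (fun _ : Fin 1 => w) ?_
    simpa using h

/-- a basis of `I` all of whose subsets of size `l` generate reductions -/
lemma gen_basis (hk : Infinite (ResidueField R)) {I : Ideal R} {l n : ℕ}
    (hl : fiberDim I = (l : WithBot ℕ∞)) (hmu : muE I = (n : ℕ∞)) (y : Fin n → R)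
    (hy : Ideal.span (Set.range y) = I) :
    ∃ x : Fin n → R, Ideal.span (Set.range x) = I ∧
      ∀ t : Finset (Fin n), t.card = l → IsReduction (Ideal.span (x '' t)) I := by
  classical
  have key : ∀ j, j ≤ n → ∃ x : Fin n → R, Ideal.span (Set.range x) = I ∧
      ∀ t : Finset (Fin n), (∀ i ∈ t, (i : ℕ) < j) → t.card ≤ l → FLE I (Ideal.span (x '' t)) (l - t.card) := by
    intro j
    induction j with
    | zero =>
      intro _
      refine ⟨y, hy, fun t ht _ => ?_⟩
      have : t = ∅ := Finset.eq_empty_of_forall_notMem fun i hi => by simpa using ht i hi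
      subst this
      simpa using fd_FLE hl
    | succ j ih =>
      intro hj
      obtain ⟨x, hx, hF⟩ := ih (by omega)
      have hxI : ∀ i, x i ∈ I := fun i => hx ▸ Ideal.subset_span ⟨i, rfl⟩
      let j0 : Fin n := ⟨j, by omega⟩
      have hxt : ∀ t : Finset (Fin n), Ideal.span (x '' t) ≤ I := by
        intro t
        rw [Ideal.span_le]; rintro _ ⟨i, -, rfl⟩; exact hxI i
      choose S hS1 hS2 hS3 hS4 using fun t : Finset (Fin n) => FLE_drop (hxt t)
      let N0 : Ideal R := maximalIdeal R * I ⊔ Ideal.span (x '' {i | i ≠ j0})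
      have hN0 : ¬ I ≤ N0 := by
        intro hle
        have h1 : I ≤ Ideal.span (x '' {i | i ≠ j0}) := by
          refine Submodule.le_of_le_smul_of_le_jacobson_bot (IsNoetherian.noetherian _)
            (maximalIdeal_le_jacobson _) (I := maximalIdeal R) ?_
          rw [sup_comm]; exact hle
        have h2 : Ideal.span (x '' {i | i ≠ j0}) = I := le_antisymm (by
          rw [Ideal.span_le]; rintro _ ⟨i, -, rfl⟩; exact hxI i) h1
        have h3 : muE I ≤ (((Finset.univ.erase j0).image x).card : ℕ∞) := by
          refine sInf_le ⟨_, rfl, ?_⟩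
          rw [Finset.coe_image, Finset.coe_erase, Finset.coe_univ, ← h2]
          congr 2
          ext; simp
        rw [hmu] at h3
        have h4 : n ≤ ((Finset.univ.erase j0).image x).card := by exact_mod_cast h3
        have h5 := Finset.card_image_le (s := Finset.univ.erase j0) (f := x)
        rw [Finset.card_erase_of_mem (Finset.mem_univ _), Finset.card_univ, Fintype.card_fin] at h5
        omega
      obtain ⟨b, hb, hb'⟩ := avoid hk I ((⋃ t : Finset (Fin n), S t) ∪ {N0})
        ((Set.finite_iUnion hS1).union (Set.finite_singleton _)) (by
          rintro N (hN | hN)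
          · obtain ⟨t, ht⟩ := Set.mem_iUnion.1 hN
            exact hS3 t N ht I ⟨le_rfl, 0, by simp⟩
          · rw [Set.mem_singleton_iff] at hN; rw [hN]; exact hN0)
      have hbN0 : b ∉ N0 := hb' N0 (Or.inr rfl)
      refine ⟨Function.update x j0 b, ?_, ?_⟩
      · apply le_antisymm
        · rw [Ideal.span_le]
          rintro _ ⟨i, rfl⟩
          by_cases hi : i = j0
          · rw [hi, Function.update_self]; exact hb
          · rw [Function.update_of_ne hi]; exact hxI i
        · have hsub : ∀ i ≠ j0, x i ∈ Ideal.span (Set.range (Function.update x j0 b)) := fun i hi =>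
            Ideal.subset_span ⟨i, Function.update_of_ne hi _ _⟩
          rw [← hx, Ideal.span_le]
          rintro _ ⟨i, rfl⟩
          by_cases hi : i = j0
          · obtain ⟨c, hc⟩ := (Ideal.mem_span_range_iff_exists_fun).1 (hx.symm ▸ hb : b ∈ Ideal.span (Set.range x))
            rw [← Finset.add_sum_erase _ _ (Finset.mem_univ j0)] at hc
            have hu : IsUnit (c j0) := by
              by_contra hu
              apply hbN0
              rw [← hc]
              refine add_mem (Ideal.mem_sup_left (Ideal.mul_mem_mul ((mem_maximalIdeal _).2 hu) (hxI _)))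
                (Ideal.mem_sup_right (sum_mem fun i hi => Ideal.mul_mem_left _ _ (Ideal.subset_span ⟨i, ?_, rfl⟩)))
              exact (Finset.mem_erase.1 hi).1
            obtain ⟨u, hu⟩ := hu
            rw [hi]
            have e : x j0 = ↑u⁻¹ * b - ↑u⁻¹ * ∑ i ∈ Finset.univ.erase j0, c i * x i := by
              rw [← hc, ← hu, mul_add, ← mul_assoc, Units.inv_mul]; ring
            rw [e]
            refine sub_mem (Ideal.mul_mem_left _ _ (Ideal.subset_span ⟨j0, Function.update_self _ _ _⟩))
              (Ideal.mul_mem_left _ _ (sum_mem fun i hi => Ideal.mul_mem_left _ _ (hsub i ?_)))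
            exact (Finset.mem_erase.1 hi).1
          · exact hsub i hi
      · intro t ht htl
        by_cases hjt : j0 ∈ t
        · have e : Function.update x j0 b '' t = insert b (x '' (t.erase j0)) := by
            conv_lhs => rw [← Finset.insert_erase hjt, Finset.coe_insert, Set.image_insert_eq, Function.update_self]
            congr 1
            apply Set.image_congr
            intro i hi
            exact Function.update_of_ne (Finset.mem_erase.1 hi).1 _ _
          have hcard := Finset.card_erase_of_mem hjt
          have hpos := Finset.card_pos.2 ⟨j0, hjt⟩
          rw [e, Ideal.span_insert, sup_comm]
          refine hS4 (t.erase j0) _ ?_ b hb (fun N hN => hb' N (Or.inl (Set.mem_iUnion.2 ⟨_, hN⟩)))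
          have := hF (t.erase j0) (fun i hi => by
            have h1 := ht i (Finset.mem_of_mem_erase hi)
            have h2 : (i : ℕ) ≠ j := fun h => (Finset.mem_erase.1 hi).1 (Fin.ext h)
            omega) (by omega)
          rwa [show l - t.card + 1 = l - (t.erase j0).card by omega]
        · have e : Function.update x j0 b '' t = x '' t := by
            apply Set.image_congr
            intro i hi
            exact Function.update_of_ne (fun h => hjt (by rw [← h]; exact Finset.mem_coe.1 hi)) _ _
          rw [e]
          refine hF t (fun i hi => ?_) htl
          have h1 := ht i hi
          have h2 : (i : ℕ) ≠ j := fun h => hjt ((Fin.ext h : i = j0) ▸ hi)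
          omega
  obtain ⟨x, hx, hF⟩ := key n le_rfl
  refine ⟨x, hx, fun t ht => red_of_FLE_zero ?_ ?_⟩
  · rw [Ideal.span_le]; rintro _ ⟨i, -, rfl⟩; exact hx ▸ Ideal.subset_span ⟨i, rfl⟩
  · have := hF t (fun i _ => i.2) ht.le
    rwa [ht, Nat.sub_self] at this

end Fib
end

section
open IsLocalRing

set_option linter.unusedSectionVars false
section Syz

variable {R : Type u} [CommRing R]

/-- syzygies of a tuple -/
noncomputable def Syz {ι : Type} [Fintype ι] (y : ι → R) : Submodule R (ι → R) :=
  LinearMap.ker (Fintype.linearCombination R y)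

lemma mem_Syz {ι : Type} [Fintype ι] (y : ι → R) (v : ι → R) : v ∈ Syz y ↔ ∑ i, v i * y i = 0 := by
  simp [Syz, Fintype.linearCombination_apply]

/-- the ideal has a free resolution of length one (as a module) -/
def Pres (I : Ideal R) : Prop :=
  ∃ (n : ℕ) (x : Fin (n + 1) → R) (b : Fin n → Fin (n + 1) → R),
    Ideal.span (Set.range x) = I ∧ LinearIndependent R b ∧ Submodule.span R (Set.range b) = Syz x

lemma exists_lift {ι κ : Type} [Fintype ι] [Fintype κ] [DecidableEq κ] (x : ι → R) (y : κ → R)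
    (h : Ideal.span (Set.range y) ≤ Ideal.span (Set.range x)) :
    ∃ A : (κ → R) →ₗ[R] (ι → R), ∀ v, ∑ i, A v i * x i = ∑ k, v k * y k := by
  have : ∀ k, ∃ c : ι → R, ∑ i, c i * x i = y k := fun k =>
    (Ideal.mem_span_range_iff_exists_fun).1 (h (Ideal.subset_span ⟨k, rfl⟩))
  choose c hc using this
  refine ⟨Fintype.linearCombination R c, fun v => ?_⟩
  simp only [Fintype.linearCombination_apply, Finset.sum_apply, Pi.smul_apply, smul_eq_mul, ← hc,
    Finset.mul_sum, Finset.sum_mul]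
  rw [Finset.sum_comm]
  simp only [mul_assoc]

lemma schanuel {ι κ : Type} [Fintype ι] [Fintype κ] [DecidableEq κ] [DecidableEq ι] (x : ι → R) (y : κ → R)
    (h : Ideal.span (Set.range y) = Ideal.span (Set.range x)) :
    Nonempty ((Syz y × (ι → R)) ≃ₗ[R] (Syz x × (κ → R))) := by
  obtain ⟨A, hA⟩ := exists_lift x y h.le
  obtain ⟨B, hB⟩ := exists_lift y x h.ge
  refine ⟨LinearEquiv.ofLinearMap
    (LinearMap.prod (LinearMap.codRestrict (Syz x)
      (LinearMap.snd R _ _ - A ∘ₗ ((Syz y).subtype ∘ₗ LinearMap.fst R _ _ + B ∘ₗ LinearMap.snd R _ _)) ?_)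
      ((Syz y).subtype ∘ₗ LinearMap.fst R _ _ + B ∘ₗ LinearMap.snd R _ _))
    (LinearMap.prod (LinearMap.codRestrict (Syz y)
      (LinearMap.snd R _ _ - B ∘ₗ ((Syz x).subtype ∘ₗ LinearMap.fst R _ _ + A ∘ₗ LinearMap.snd R _ _)) ?_)
      ((Syz x).subtype ∘ₗ LinearMap.fst R _ _ + A ∘ₗ LinearMap.snd R _ _)) ?_ ?_⟩
  · rintro ⟨⟨w, hw⟩, u⟩
    rw [mem_Syz] at hw ⊢
    simp [sub_mul, add_mul, Finset.sum_add_distrib, hA, hB, hw]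
  · rintro ⟨⟨w, hw⟩, u⟩
    rw [mem_Syz] at hw ⊢
    simp [sub_mul, add_mul, Finset.sum_add_distrib, hA, hB, hw]
  · apply LinearMap.ext
    rintro ⟨⟨w, hw⟩, u⟩
    refine Prod.ext (Subtype.ext ?_) ?_
    · simp
    · simp
  · apply LinearMap.ext
    rintro ⟨⟨w, hw⟩, u⟩
    refine Prod.ext (Subtype.ext ?_) ?_
    · simp
    · simp

lemma syz_basis [IsNoetherianRing R] [IsLocalRing R] {I : Ideal R} (hI : Pres I) {t : ℕ} (y : Fin (t + 1) → R)
    (hy : Ideal.span (Set.range y) = I) : ∃ b : Fin t → Fin (t + 1) → R, LinearIndependent R b ∧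
      Submodule.span R (Set.range b) = Syz y := by
  obtain ⟨n, x, b, hx, hb, hb'⟩ := hI
  obtain ⟨e⟩ := schanuel x y (hy.trans hx.symm)
  have hbas : Module.Basis (Fin n) R (Syz x) := (Module.Basis.span hb).map (LinearEquiv.ofEq _ _ hb')
  have : Module.Free R (Syz x) := Module.Free.of_basis hbas
  have : Module.Free R (Syz y × (Fin (n + 1) → R)) := Module.Free.of_equiv e.symm
  have : Module.Projective R (Syz y) := Module.Projective.of_split
    (LinearMap.inl R (Syz y) (Fin (n + 1) → R)) (LinearMap.fst R _ _) (LinearMap.fst_comp_inl _ _ _)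
  have : Module.Free R (Syz y) := Module.free_of_flat_of_isLocalRing
  have hr : Module.finrank R (Syz y) = t := by
    have h1 := e.finrank_eq
    rw [Module.finrank_prod, Module.finrank_prod, Module.finrank_eq_card_basis hbas] at h1
    simp at h1
    omega
  let B : Module.Basis (Fin t) R (Syz y) := (Module.finBasis R (Syz y)).reindex (finCongr hr)
  refine ⟨fun j => (B j : Fin (t + 1) → R), ?_, ?_⟩
  · exact B.linearIndependent.map' (Syz y).subtype (by simp)
  · have := B.span_eq
    have h2 := congrArg (Submodule.map (Syz y).subtype) this
    rw [Submodule.map_span, Submodule.map_subtype_top, ← Set.range_comp] at h2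
    exact h2

lemma Pres.loc {I : Ideal R} (hI : Pres I) (S : Submonoid R) (A : Type u) [CommRing A] [Algebra R A]
    [IsLocalization S A] : Pres (I.map (algebraMap R A)) := by
  obtain ⟨n, x, b, hx, hb, hb'⟩ := hI
  let F : (Fin (n + 1) → R) →ₗ[R] (Fin (n + 1) → A) :=
    LinearMap.pi fun i => (Algebra.linearMap R A) ∘ₗ LinearMap.proj i
  have hF : ∀ v i, F v i = algebraMap R A (v i) := fun v i => rfl
  have : IsLocalizedModule S F := IsLocalizedModule.pi S (fun _ : Fin (n + 1) => Algebra.linearMap R A)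
  refine ⟨n, algebraMap R A ∘ x, F ∘ b, ?_, hb.of_isLocalizedModule A S F, ?_⟩
  · rw [← hx, Ideal.map_span, Set.range_comp]
  · apply le_antisymm
    · rw [Submodule.span_le]
      rintro _ ⟨j, rfl⟩
      have : b j ∈ Syz x := hb' ▸ Submodule.subset_span ⟨j, rfl⟩
      rw [mem_Syz] at this
      have := congrArg (algebraMap R A) this
      rw [map_sum, map_zero] at this
      rw [SetLike.mem_coe, mem_Syz]
      simp only [map_mul] at this
      exact this
    · intro v hv
      obtain ⟨⟨w, s⟩, hw⟩ := IsLocalizedModule.surj S F v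
      rw [mem_Syz] at hv
      have h1 : algebraMap R A (∑ i, w i * x i) = 0 := by
        rw [map_sum]
        have : ∀ i, algebraMap R A (w i * x i) = algebraMap R A s * (v i * algebraMap R A (x i)) := by
          intro i
          have := congrFun hw i
          rw [hF] at this
          rw [map_mul, ← this]
          simp only [Pi.smul_apply, Submonoid.smul_def, Algebra.smul_def]
          ring
        simp only [this, ← Finset.mul_sum]
        simp only [Function.comp_apply] at hv
        rw [hv, mul_zero]
      obtain ⟨c, hc⟩ := (IsLocalization.map_eq_zero_iff S A _).1 h1
      have h2 : (c : R) • w ∈ Syz x := by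
        rw [mem_Syz]
        simpa [Finset.mul_sum, mul_assoc] using hc
      rw [← hb'] at h2
      have h3 : F ((c : R) • w) ∈ Submodule.span A (Set.range (F ∘ b)) := by
        rw [Set.range_comp]
        apply Submodule.span_subset_span R A
        rw [← Submodule.map_span]
        exact Submodule.mem_map_of_mem h2
      have h4 : F ((c : R) • w) = algebraMap R A (c * s) • v := by
        rw [map_smul, ← hw, map_mul, mul_smul]
        simp only [Submonoid.smul_def, algebraMap_smul]
      rw [h4] at h3
      have hu : IsUnit (algebraMap R A (c * s)) := IsLocalization.map_units A (c * s)
      exact (Submodule.smul_mem_iff_of_isUnit _ hu).1 h3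

/-- local generation by at most `height` elements -/
def LGen (I p : Ideal R) : Prop := ∃ t : ℕ, (t : ℕ∞) ≤ p.height ∧ ∃ y : Fin t → R, (∀ i, y i ∈ I) ∧
  ∃ s ∉ p, ∀ z ∈ I, s * z ∈ Ideal.span (Set.range y)

lemma LGen.loc {I : Ideal R} (S : Submonoid R) (A : Type u) [CommRing A] [Algebra R A]
    [IsLocalization S A] (q : Ideal A) (h : LGen I (q.comap (algebraMap R A))) :
    LGen (I.map (algebraMap R A)) q := by
  obtain ⟨t, ht, y, hy, s, hs, hz⟩ := h
  refine ⟨t, ?_, algebraMap R A ∘ y, fun i => Ideal.mem_map_of_mem _ (hy i), algebraMap R A s, hs, ?_⟩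
  · have h := IsLocalization.height_under S q
    rw [← h]; exact ht
  · intro z hzI
    have : I.map (algebraMap R A) ≤ Submodule.comap
        (LinearMap.mulLeft A (algebraMap R A s)) (Ideal.span (Set.range (algebraMap R A ∘ y))) := by
      rw [Ideal.map_le_iff_le_comap]
      intro w hw
      show algebraMap R A s * algebraMap R A w ∈ Ideal.span (Set.range (algebraMap R A ∘ y))
      rw [Set.range_comp, ← Ideal.map_span, ← map_mul]
      exact Ideal.mem_map_of_mem _ (hz w hw)
    exact this hzI

lemma IsReduction.mapp {J I : Ideal R} (h : IsReduction J I) {A : Type u} [CommRing A] (F : R →+* A) :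
    IsReduction (J.map F) (I.map F) := by
  obtain ⟨h1, r, hr⟩ := h
  refine ⟨Ideal.map_mono h1, r, ?_⟩
  rw [← Ideal.map_pow, hr, Ideal.map_mul, Ideal.map_pow]

end Syz
end

section
open IsLocalRing

set_option linter.unusedSectionVars false
section NN

lemma colon_like {R : Type u} [CommRing R] {J I K : Ideal R} (hJ : IsReduction J I) (q : Ideal R) [q.IsPrime]
    (hK : K ≤ q) (h : ∀ r, (∀ z ∈ I, r * z ∈ J) → r ∈ K) : I ≤ q := by
  intro b hb
  obtain ⟨h1, r, hr⟩ := hJ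
  have h2 : b ^ (r + 1) ∈ J := by
    have : b ^ (r + 1) ∈ I ^ (r + 1) := Ideal.pow_mem_pow hb _
    rw [hr] at this
    have h3 : J * I ^ r ≤ J := Ideal.mul_le_left
    exact h3 this
  exact Ideal.IsPrime.mem_of_pow_mem ‹q.IsPrime› (r + 1) (hK (h _ fun z _ => Ideal.mul_mem_right _ _ h2))

/-- local version: no proper reductions -/
lemma no_red_local (s : ℕ) : ∀ (R : Type u) [CommRing R] [IsNoetherianRing R] [IsLocalRing R] (I : Ideal R),
    (maximalIdeal R).height = s → I ≤ maximalIdeal R → Pres I →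
    (∀ q : Ideal R, q.IsPrime → I ≤ q → LGen I q) → ∀ J, IsReduction J I → J = I := by
  induction s using Nat.strong_induction_on with
  | _ s ih =>
  intro R _ _ _ I hs hIm hP hG J hJ
  by_contra hne
  have hlt : J < I := lt_of_le_of_ne hJ.1 hne
  obtain ⟨N, ⟨hJN, hNI⟩, hmax⟩ := (wellFounded_gt (α := Ideal R)).has_min {N | J ≤ N ∧ N < I} ⟨J, le_rfl, hlt⟩
  obtain ⟨t, ht, y, hyI, u, hu, hz⟩ := hG (maximalIdeal R) inferInstance hIm
  have hu' : IsUnit u := by simpa using hu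
  have hy : Ideal.span (Set.range y) = I := by
    apply le_antisymm
    · rw [Ideal.span_le]; rintro _ ⟨i, rfl⟩; exact hyI i
    · intro z hzI
      exact (Ideal.unit_mul_mem_iff_mem _ hu').1 (hz z hzI)
  obtain ⟨i0, hi0⟩ : ∃ i, y i ∉ N := by
    by_contra hcon
    push Not at hcon
    apply hNI.not_ge
    rw [← hy, Ideal.span_le]; rintro _ ⟨i, rfl⟩; exact hcon i
  have hNi : N ⊔ Ideal.span {y i0} = I := by
    by_contra hcon
    refine hmax (N ⊔ Ideal.span {y i0}) ⟨hJN.trans le_sup_left, lt_of_le_of_ne (sup_le hNI.le ?_) hcon⟩ ?_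
    · rw [Ideal.span_singleton_le_iff_mem]; exact hyI i0
    · refine lt_of_le_of_ne le_sup_left fun h => hi0 ?_
      rw [h]
      exact Ideal.mem_sup_right (Ideal.mem_span_singleton_self _)
  have hr : ∀ i, ∃ r, y i - r * y i0 ∈ N := by
    intro i
    have : y i ∈ N ⊔ Ideal.span {y i0} := hNi ▸ hyI i
    obtain ⟨a, ha, b, hb, hab⟩ := Submodule.mem_sup.1 this
    obtain ⟨r, rfl⟩ := Ideal.mem_span_singleton'.1 hb
    exact ⟨r, by rw [← hab]; simpa using ha⟩
  choose r hr using hr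
  let w : Fin t → R := fun i => if i = i0 then y i0 else y i - r i * y i0
  have hw0 : w i0 = y i0 := if_pos rfl
  have hw1 : ∀ i, i ≠ i0 → w i = y i - r i * y i0 := fun i hi => if_neg hi
  have hw : Ideal.span (Set.range w) = I := by
    apply le_antisymm
    · rw [Ideal.span_le]; rintro _ ⟨i, rfl⟩
      by_cases hi : i = i0
      · subst hi; rw [hw0]; exact hyI i
      · rw [hw1 i hi]; exact sub_mem (hyI i) (Ideal.mul_mem_left _ _ (hyI i0))
    · rw [← hy, Ideal.span_le]; rintro _ ⟨i, rfl⟩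
      have h0 : y i0 ∈ Ideal.span (Set.range w) := hw0 ▸ Ideal.subset_span ⟨i0, rfl⟩
      by_cases hi : i = i0
      · subst hi; exact h0
      · have h1 : w i ∈ Ideal.span (Set.range w) := Ideal.subset_span ⟨i, rfl⟩
        rw [hw1 i hi] at h1
        have := add_mem h1 (Ideal.mul_mem_left _ (r i) h0)
        simpa using this
  let c : Ideal R := Ideal.span (w '' {i | i ≠ i0})
  have hcN : c ≤ N := by
    rw [Ideal.span_le]; rintro _ ⟨i, hi, rfl⟩
    rw [SetLike.mem_coe, hw1 i hi]; exact hr i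
  have hcI : c ≤ I := hcN.trans hNI.le
  have hNc : N ≤ c ⊔ maximalIdeal R * I := by
    intro z hzN
    have hzI := hNI.le hzN
    rw [← hw] at hzI
    obtain ⟨e, he⟩ := (Ideal.mem_span_range_iff_exists_fun).1 hzI
    have h1 : ∑ i ∈ Finset.univ.erase i0, e i * w i ∈ c :=
      sum_mem fun i hi => Ideal.mul_mem_left _ _ (Ideal.subset_span ⟨i, (Finset.mem_erase.1 hi).1, rfl⟩)
    rw [← Finset.add_sum_erase _ _ (Finset.mem_univ i0)] at he
    have h2 : e i0 ∈ maximalIdeal R := by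
      rw [mem_maximalIdeal, mem_nonunits_iff]
      intro hun
      have : e i0 * w i0 ∈ N := by
        have := sub_mem hzN (hcN h1)
        rw [← he] at this
        simpa using this
      rw [hw0] at this
      exact hi0 ((Ideal.unit_mul_mem_iff_mem _ hun).1 this)
    rw [← he, add_comm]
    exact Submodule.add_mem_sup h1 (Ideal.mul_mem_mul h2 (hw0 ▸ hyI i0))
  have hcr : IsReduction c I := by
    obtain ⟨_, r, hr⟩ := hJ
    refine red_of_nak hcI r ?_
    calc I ^ (r + 1) = J * I ^ r := hr
      _ ≤ (c ⊔ maximalIdeal R * I) * I ^ r := Ideal.mul_mono_left (hJN.trans hNc)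
      _ = _ := by rw [Ideal.sup_mul, mul_assoc, ← pow_succ']
  obtain ⟨t, rfl⟩ : ∃ t', t = t' + 1 := ⟨t - 1, by have := i0.2; omega⟩
  obtain ⟨b, hb, hbs⟩ := syz_basis hP w hw
  let K : Ideal R := Ideal.span (Set.range fun j => b j i0)
  have hKc : ∀ k ∈ K, ∀ z ∈ I, k * z ∈ c := by
    have h1 : ∀ j, b j i0 * w i0 ∈ c := by
      intro j
      have h : b j ∈ Syz w := hbs ▸ Submodule.subset_span ⟨j, rfl⟩
      rw [mem_Syz, ← Finset.add_sum_erase _ _ (Finset.mem_univ i0)] at h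
      rw [eq_neg_of_add_eq_zero_left h]
      exact neg_mem (sum_mem fun i hi => Ideal.mul_mem_left _ _ (Ideal.subset_span ⟨i, (Finset.mem_erase.1 hi).1, rfl⟩))
    intro k hk z hzI
    have h2 : k * w i0 ∈ c := by
      obtain ⟨e, he⟩ := (Ideal.mem_span_range_iff_exists_fun).1 hk
      rw [← he, Finset.sum_mul]
      exact sum_mem fun i hi => by rw [mul_assoc]; exact Ideal.mul_mem_left _ _ (h1 i)
    rw [← hw] at hzI
    obtain ⟨e, he⟩ := (Ideal.mem_span_range_iff_exists_fun).1 hzI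
    rw [← he, Finset.mul_sum]
    refine sum_mem fun i _ => ?_
    by_cases hi : i = i0
    · subst hi; rw [mul_left_comm]; exact Ideal.mul_mem_left _ _ h2
    · exact Ideal.mul_mem_left _ _ (Ideal.mul_mem_left _ _ (Ideal.subset_span ⟨i, hi, rfl⟩))
  have hcK : ∀ k, (∀ z ∈ I, k * z ∈ c) → k ∈ K := by
    intro k hk
    have h1 := hk (w i0) (hw0 ▸ hyI i0)
    obtain ⟨e, he⟩ : ∃ e : Fin (t + 1) → R, e i0 = 0 ∧ ∑ i, e i * w i = k * w i0 := by
      have : ∀ z ∈ c, ∃ e : Fin (t + 1) → R, e i0 = 0 ∧ ∑ i, e i * w i = z := by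
        intro z hz
        induction hz using Submodule.span_induction with
        | mem z hz =>
          obtain ⟨i, hi, rfl⟩ := hz
          exact ⟨Pi.single i 1, Pi.single_eq_of_ne (Ne.symm hi) _, by simp [Pi.single_apply]⟩
        | zero => exact ⟨0, rfl, by simp⟩
        | add a b _ _ ha hb =>
          obtain ⟨e, h1, h2⟩ := ha
          obtain ⟨e', h1', h2'⟩ := hb
          exact ⟨e + e', by simp [h1, h1'], by simp [add_mul, Finset.sum_add_distrib, h2, h2']⟩
        | smul a b _ ha =>
          obtain ⟨e, h1, h2⟩ := ha
          exact ⟨a • e, by simp [h1], by simp [mul_assoc, ← Finset.mul_sum, h2]⟩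
      exact this _ h1
    have h2 : (Pi.single i0 k - e : Fin (t + 1) → R) ∈ Syz w := by
      rw [mem_Syz]
      simp [sub_mul, Finset.sum_sub_distrib, he.2, Pi.single_apply]
    rw [← hbs] at h2
    have h3 : ∀ v ∈ Submodule.span R (Set.range b), v i0 ∈ K := by
      intro v hv
      induction hv using Submodule.span_induction with
      | mem v hv => obtain ⟨j, rfl⟩ := hv; exact Ideal.subset_span ⟨j, rfl⟩
      | zero => exact zero_mem _
      | add a b _ _ ha hb => exact add_mem ha hb
      | smul a b _ ha => exact Ideal.mul_mem_left _ _ ha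
    have := h3 _ h2
    simpa [he.1] using this
  have hK : K ≠ ⊤ := by
    intro h
    apply hi0
    apply hcN
    have := hKc 1 (h ▸ Submodule.mem_top) (y i0) (hyI i0)
    simpa using this
  obtain ⟨q, hq⟩ := Ideal.nonempty_minimalPrimes hK
  have hqp : q.IsPrime := hq.1.1
  have hIq : I ≤ q := colon_like hcr q hq.1.2 hcK
  have hqh : q.height ≤ t := by
    classical
    have := Ideal.height_le_card_of_mem_minimalPrimes_span_finset (p := q)
      (s := Finset.univ.image fun j => b j i0) (by simpa using hq)
    exact this.trans (by exact_mod_cast Finset.card_image_le.trans (by simp))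
  have hts : t < s := by
    rw [hs] at ht
    have : t + 1 ≤ s := by exact_mod_cast ht
    omega
  have hfin : q.height ≠ ⊤ := ne_top_of_le_ne_top (ENat.natCast_ne_top t) hqh
  obtain ⟨h, hh⟩ := ENat.ne_top_iff_exists.1 hfin
  have hht : h ≤ t := by rw [← hh] at hqh; exact_mod_cast hqh
  let A := Localization.AtPrime q
  have := ih h (by omega) A (I.map (algebraMap R A)) ?_ ?_ (hP.loc q.primeCompl A) ?_
    (c.map (algebraMap R A)) (hcr.mapp _)
  · have h1 : algebraMap R A (w i0) ∈ c.map (algebraMap R A) := by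
      rw [this]; exact Ideal.mem_map_of_mem _ (hw0 ▸ hyI i0)
    obtain ⟨m, hm, h2⟩ := (IsLocalization.algebraMap_mem_map_algebraMap_iff q.primeCompl A _ _).1 h1
    apply hm
    apply hq.1.2
    apply hcK
    intro z hzI
    rw [← hw] at hzI
    obtain ⟨e, he⟩ := (Ideal.mem_span_range_iff_exists_fun).1 hzI
    rw [← he, Finset.mul_sum]
    refine sum_mem fun i _ => ?_
    by_cases hi : i = i0
    · subst hi; rw [mul_left_comm]; exact Ideal.mul_mem_left _ _ h2
    · exact Ideal.mul_mem_left _ _ (Ideal.mul_mem_left _ _ (Ideal.subset_span ⟨i, hi, rfl⟩))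
  · rw [← IsLocalization.height_under q.primeCompl, Localization.AtPrime.under_maximalIdeal, hh]
  · rw [Ideal.map_le_iff_le_comap]
    have := Localization.AtPrime.under_maximalIdeal (I := q)
    rw [Ideal.under_def] at this
    rw [this]; exact hIq
  · intro Q hQ hIQ
    apply LGen.loc q.primeCompl
    exact hG _ (Ideal.comap_isPrime _ _) (Ideal.map_le_iff_le_comap.1 hIQ)

/-- (N1) -/
lemma N1 {R : Type u} [CommRing R] [IsNoetherianRing R] {I : Ideal R} (hP : Pres I) (p : Ideal R)
    [hp : p.IsPrime] (hIp : I ≤ p) (hG : ∀ q : Ideal R, q.IsPrime → I ≤ q → q ≤ p → LGen I q)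
    {J : Ideal R} (hJ : IsReduction J I) : ∃ s ∉ p, ∀ z ∈ I, s * z ∈ J := by
  let A := Localization.AtPrime p
  have hun : (maximalIdeal A).comap (algebraMap R A) = p := by
    have := Localization.AtPrime.under_maximalIdeal (I := p)
    rwa [Ideal.under_def] at this
  obtain ⟨h, hh⟩ := ENat.ne_top_iff_exists.1 (Ideal.height_ne_top_of_isPrime (I := p))
  have := no_red_local h A (I.map (algebraMap R A)) ?_ ?_ (hP.loc p.primeCompl A) ?_
    (J.map (algebraMap R A)) (hJ.mapp _)
  · obtain ⟨S, hS⟩ := (IsNoetherian.noetherian I : I.FG)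
    have h1 : ∀ z ∈ I, ∃ s ∉ p, s * z ∈ J := by
      intro z hz
      have h1 : algebraMap R A z ∈ J.map (algebraMap R A) := by
        rw [this]; exact Ideal.mem_map_of_mem _ hz
      obtain ⟨m, hm, h2⟩ := (IsLocalization.algebraMap_mem_map_algebraMap_iff p.primeCompl A _ _).1 h1
      exact ⟨m, hm, h2⟩
    choose! s hs hs' using h1
    have hSI : ∀ z ∈ S, z ∈ I := fun z hz => hS ▸ Submodule.subset_span hz
    refine ⟨∏ z ∈ S, s z, ?_, ?_⟩
    · intro hmem
      obtain ⟨z, hz, hz'⟩ := (Ideal.IsPrime.prod_mem_iff (p := p)).1 hmem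
      exact hs z (hSI z hz) hz'
    · intro z hz
      rw [← hS] at hz
      induction hz using Submodule.span_induction with
      | mem z hz =>
        obtain ⟨c, hc⟩ := Finset.dvd_prod_of_mem s hz
        rw [hc, mul_comm (s z), mul_assoc]
        exact Ideal.mul_mem_left _ _ (hs' z (hSI z hz))
      | zero => rw [mul_zero]; exact zero_mem _
      | add a b _ _ ha hb => rw [mul_add]; exact add_mem ha hb
      | smul a b _ ha => rw [smul_eq_mul, mul_left_comm]; exact Ideal.mul_mem_left _ _ ha
  · rw [← IsLocalization.height_under p.primeCompl, Localization.AtPrime.under_maximalIdeal, hh]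
  · rw [Ideal.map_le_iff_le_comap, hun]; exact hIp
  · intro Q hQ hIQ
    apply LGen.loc p.primeCompl
    refine hG _ (Ideal.comap_isPrime _ _) (Ideal.map_le_iff_le_comap.1 hIQ) ?_
    conv_rhs => rw [← hun]
    exact Ideal.comap_mono (le_maximalIdeal hQ.ne_top)

end NN
end

section
open IsLocalRing

set_option linter.unusedSectionVars false
section Gen

variable {R : Type u} [CommRing R] [IsNoetherianRing R]

lemma clear_fg {p : Ideal R} [p.IsPrime] {I J : Ideal R} (h1 : ∀ z ∈ I, ∃ s ∉ p, s * z ∈ J) :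
    ∃ s ∉ p, ∀ z ∈ I, s * z ∈ J := by
  obtain ⟨S, hS⟩ := (IsNoetherian.noetherian I : I.FG)
  choose! s hs hs' using h1
  have hSI : ∀ z ∈ S, z ∈ I := fun z hz => hS ▸ Submodule.subset_span hz
  refine ⟨∏ z ∈ S, s z, ?_, ?_⟩
  · intro hmem
    obtain ⟨z, hz, hz'⟩ := (Ideal.IsPrime.prod_mem_iff (p := p)).1 hmem
    exact hs z (hSI z hz) hz'
  · intro z hz
    rw [← hS] at hz
    induction hz using Submodule.span_induction with
    | mem z hz =>
      obtain ⟨c, hc⟩ := Finset.dvd_prod_of_mem s hz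
      rw [hc, mul_comm (s z), mul_assoc]
      exact Ideal.mul_mem_left _ _ (hs' z (hSI z hz))
    | zero => rw [mul_zero]; exact zero_mem _
    | add a b _ _ ha hb => rw [mul_add]; exact add_mem ha hb
    | smul a b _ ha => rw [smul_eq_mul, mul_left_comm]; exact Ideal.mul_mem_left _ _ ha

/-- the bad submodule at `p` -/
noncomputable def Dp (I c p : Ideal R) [p.IsPrime] : Ideal R :=
  ((c ⊔ p * I).map (algebraMap R (Localization.AtPrime p))).comap (algebraMap R (Localization.AtPrime p))

lemma mem_Dp (I c p : Ideal R) [p.IsPrime] (b : R) : b ∈ Dp I c p ↔ ∃ u ∉ p, u * b ∈ c ⊔ p * I := by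
  unfold Dp
  rw [Ideal.mem_comap, IsLocalization.algebraMap_mem_map_algebraMap_iff p.primeCompl]
  rfl

lemma le_Dp (I c p : Ideal R) [hp : p.IsPrime] : c ≤ Dp I c p := fun z hz =>
  (mem_Dp I c p z).2 ⟨1, (Ideal.ne_top_iff_one p).1 hp.ne_top, by rw [one_mul]; exact Ideal.mem_sup_left hz⟩

lemma not_le_Dp {I c p : Ideal R} [hp : p.IsPrime] {J : Ideal R} (hJ : ∃ s ∉ p, ∀ z ∈ I, s * z ∈ J)
    (h : J ≤ Dp I c p) : ∃ s ∉ p, ∀ z ∈ I, s * z ∈ c := by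
  let A := Localization.AtPrime p
  obtain ⟨s, hs, hs'⟩ := hJ
  have h1 : I ≤ Dp I c p := by
    intro z hz
    obtain ⟨u, hu, hu'⟩ := (mem_Dp _ _ _ _).1 (h (hs' z hz))
    exact (mem_Dp _ _ _ _).2 ⟨u * s, fun hus => (hp.mem_or_mem hus).elim hu hs, by rwa [mul_assoc]⟩
  have h2 : I.map (algebraMap R A) ≤ c.map (algebraMap R A) ⊔ maximalIdeal A • I.map (algebraMap R A) := by
    rw [← Localization.AtPrime.map_eq_maximalIdeal, smul_eq_mul, ← Ideal.map_mul, ← Ideal.map_sup]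
    exact Ideal.map_le_iff_le_comap.2 h1
  have h3 : I.map (algebraMap R A) ≤ c.map (algebraMap R A) :=
    Submodule.le_of_le_smul_of_le_jacobson_bot (IsNoetherian.noetherian _) (maximalIdeal_le_jacobson _) h2
  apply clear_fg
  intro z hz
  obtain ⟨m, hm, h⟩ := (IsLocalization.algebraMap_mem_map_algebraMap_iff p.primeCompl A _ _).1
    (h3 (Ideal.mem_map_of_mem _ hz))
  exact ⟨m, hm, h⟩

/-- partially good ideals -/
def PG (I : Ideal R) (l s : ℕ) (c : Ideal R) : Prop :=
  c ≤ I ∧ (∀ p : Ideal R, p.IsPrime → I ≤ p → p.height < l → ∃ t : ℕ, (t = 0 ∨ ((t + s : ℕ) : ℕ∞) ≤ p.height) ∧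
    ∃ y : Fin t → R, (∀ i, y i ∈ I) ∧ ∃ u ∉ p, ∀ z ∈ I, u * z ∈ c ⊔ Ideal.span (Set.range y)) ∧
  ∀ p : Ideal R, p.IsPrime → c ≤ p → ¬ I ≤ p → (s : ℕ∞) ≤ p.height

/-- generator ideal -/
def fitg (I c : Ideal R) (j : ℕ) : Ideal R :=
  Ideal.span {u | ∃ y : Fin j → R, (∀ i, y i ∈ I) ∧ ∀ z ∈ I, u * z ∈ c ⊔ Ideal.span (Set.range y)}

lemma PG_lgen {I : Ideal R} {l : ℕ} (h : PG I l 0 ⊥) (p : Ideal R) (hp : p.IsPrime) (hI : I ≤ p)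
    (hpl : p.height < l) : LGen I p := by
  obtain ⟨t, ht, y, hy, u, hu, hz⟩ := h.2.1 p hp hI hpl
  refine ⟨t, ?_, y, hy, u, hu, fun z hzI => by simpa using hz z hzI⟩
  rcases ht with rfl | ht
  · simp
  · simpa using ht

lemma N1' {I : Ideal R} {l : ℕ} (hP : Pres I) (h : PG I l 0 ⊥) {J : Ideal R} (hJ : IsReduction J I)
    (p : Ideal R) [hp : p.IsPrime] (hI : I ≤ p) (hpl : p.height < l) : ∃ s ∉ p, ∀ z ∈ I, s * z ∈ J :=
  N1 hP p hI (fun q hq hIq hqp => PG_lgen h q hq hIq (lt_of_le_of_lt (Ideal.height_mono hqp) hpl)) hJ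

lemma not_le_prime {I J : Ideal R} (hJ : IsReduction J I) (p : Ideal R) [hp : p.IsPrime] (h : J ≤ p) : I ≤ p := by
  intro b hb
  obtain ⟨h1, r, hr⟩ := hJ
  have h2 : b ^ (r + 1) ∈ I ^ (r + 1) := Ideal.pow_mem_pow hb _
  rw [hr] at h2
  have h3 : J * I ^ r ≤ J := Ideal.mul_le_left
  exact hp.mem_of_pow_mem (r + 1) (h (h3 h2))

lemma fitg_mono (I c : Ideal R) {i j : ℕ} (h : i ≤ j) : fitg I c i ≤ fitg I c j := by
  apply Ideal.span_le.2
  rintro u ⟨y, hy, hz⟩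
  apply Ideal.subset_span
  refine ⟨fun k => if hk : (k : ℕ) < i then y ⟨k, hk⟩ else 0, fun k => ?_, fun z hzI => ?_⟩
  · dsimp only
    split_ifs
    · exact hy _
    · exact zero_mem _
  · refine (sup_le_sup_left (Ideal.span_le.2 ?_) c : _ ≤ _) (hz z hzI)
    rintro _ ⟨k, rfl⟩
    apply Ideal.subset_span
    exact ⟨⟨k, by omega⟩, by simp⟩

lemma elim_one {I c p : Ideal R} [hp : p.IsPrime] {m : ℕ} (y : Fin (m + 1) → R) (hy : ∀ i, y i ∈ I) {u : R} (hu : u ∉ p)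
    (hz : ∀ z ∈ I, u * z ∈ c ⊔ Ideal.span (Set.range y)) {b : R} (hb : b ∈ I) (hbD : b ∉ Dp I c p) :
    ∃ y' : Fin m → R, (∀ i, y' i ∈ I) ∧ ∃ u ∉ p, ∀ z ∈ I, u * z ∈ (c ⊔ Ideal.span {b}) ⊔ Ideal.span (Set.range y') := by
  obtain ⟨c0, hc0, w, hw, hcw⟩ := Submodule.mem_sup.1 (hz b hb)
  obtain ⟨r, hr⟩ := (Ideal.mem_span_range_iff_exists_fun).1 hw
  obtain ⟨i0, hi0⟩ : ∃ i, r i ∉ p := by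
    by_contra hcon
    push Not at hcon
    apply hbD
    rw [mem_Dp]
    refine ⟨u, hu, ?_⟩
    rw [← hcw, ← hr]
    exact Submodule.add_mem_sup hc0 (sum_mem fun i _ => Ideal.mul_mem_mul (hcon i) (hy i))
  set T := (c ⊔ Ideal.span {b}) ⊔ Ideal.span (Set.range (y ∘ i0.succAbove)) with hT
  have hcT : c ≤ T := le_sup_left.trans le_sup_left
  have hbT : b ∈ T := le_sup_left (b := Ideal.span (Set.range (y ∘ i0.succAbove)))
    (Ideal.mem_sup_right (Ideal.mem_span_singleton_self b))
  have hyT : ∀ i, i ≠ i0 → y i ∈ T := by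
    intro i hi
    obtain ⟨j, rfl⟩ := Fin.exists_succAbove_eq hi
    exact Ideal.mem_sup_right (Ideal.subset_span ⟨j, rfl⟩)
  have h0 : r i0 * y i0 ∈ T := by
    have : r i0 * y i0 = u * b - c0 - ∑ i ∈ Finset.univ.erase i0, r i * y i := by
      rw [← hcw, ← hr, ← Finset.add_sum_erase _ _ (Finset.mem_univ i0)]; ring
    rw [this]
    exact sub_mem (sub_mem (Ideal.mul_mem_left _ _ hbT) (hcT hc0))
      (sum_mem fun i hi => Ideal.mul_mem_left _ _ (hyT i (Finset.mem_erase.1 hi).1))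
  refine ⟨y ∘ i0.succAbove, fun i => hy _, r i0 * u, fun h => (hp.mem_or_mem h).elim hi0 hu, fun z hzI => ?_⟩
  obtain ⟨c1, hc1, w1, hw1, hcw1⟩ := Submodule.mem_sup.1 (hz z hzI)
  obtain ⟨e, he⟩ := (Ideal.mem_span_range_iff_exists_fun).1 hw1
  rw [mul_assoc, ← hcw1, mul_add, ← he, Finset.mul_sum]
  refine add_mem (Ideal.mul_mem_left _ _ (hcT hc1)) (sum_mem fun i _ => ?_)
  by_cases hi : i = i0
  · subst hi; rw [mul_left_comm]; exact Ideal.mul_mem_left _ _ h0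
  · exact Ideal.mul_mem_left _ _ (Ideal.mul_mem_left _ _ (hyT i hi))

open Classical in
lemma PG_step {I : Ideal R} {l s : ℕ} {c : Ideal R} (hP : Pres I) (h0 : PG I l 0 ⊥) (h : PG I l s c) :
    ∃ S : Set (Ideal R), S.Finite ∧ (∀ N ∈ S, c ≤ N) ∧ (∀ N ∈ S, ∀ J0, IsReduction J0 I → ¬ J0 ≤ N) ∧
      ∀ b ∈ I, (∀ N ∈ S, b ∉ N) → PG I l (s + 1) (c ⊔ Ideal.span {b}) := by
  let S1 : Set (Ideal R) := {p | p ∈ c.minimalPrimes ∧ ¬ I ≤ p}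
  let T : Set (Ideal R) := ⋃ j : Fin l, (I ⊔ fitg I c j).minimalPrimes
  let T' : Set (Ideal R) := {p | p ∈ T ∧ p.height < l ∧ ¬ ∃ u ∉ p, ∀ z ∈ I, u * z ∈ c}
  let F : Ideal R → Ideal R := fun p => if hp : p.IsPrime then Dp I c p else ⊤
  have hTp : ∀ p ∈ T, p.IsPrime ∧ I ≤ p := by
    intro p hp
    obtain ⟨j, hj⟩ := Set.mem_iUnion.1 hp
    exact ⟨hj.1.1, le_sup_left.trans hj.1.2⟩
  refine ⟨S1 ∪ F '' T', Set.Finite.union ?_ (Set.Finite.image _ ?_), ?_, ?_, ?_⟩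
  · exact (Ideal.finite_minimalPrimes_of_isNoetherianRing R c).subset fun p hp => hp.1
  · exact (Set.finite_iUnion fun j => Ideal.finite_minimalPrimes_of_isNoetherianRing R _).subset fun p hp => hp.1
  · rintro N (hN | ⟨p, hp, rfl⟩)
    · exact hN.1.1.2
    · have := (hTp p hp.1).1
      simp only [F, dif_pos this]
      exact le_Dp I c p
  · rintro N (hN | ⟨p, hp, rfl⟩) J0 hJ0 hle
    · have := hN.1.1.1
      exact hN.2 (not_le_prime hJ0 N hle)
    · have := (hTp p hp.1).1
      simp only [F, dif_pos this] at hle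
      exact hp.2.2 (not_le_Dp (N1' hP h0 hJ0 p (hTp p hp.1).2 hp.2.1) hle)
  · intro b hb hbS
    refine ⟨sup_le h.1 ((Ideal.span_singleton_le_iff_mem _).2 hb), ?_, ?_⟩
    · intro p hp hIp hpl
      obtain ⟨t0, ht0, y0, hy0, u0, hu0, hz0⟩ := h.2.1 p hp hIp hpl
      have hex : ∃ t, ∃ y : Fin t → R, (∀ i, y i ∈ I) ∧ ∃ u ∉ p, ∀ z ∈ I, u * z ∈ c ⊔ Ideal.span (Set.range y) :=
        ⟨t0, y0, hy0, u0, hu0, hz0⟩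
      obtain ⟨y, hy, u, hu, hz⟩ := Nat.find_spec hex
      have hmin := fun k => Nat.find_min hex (m := k)
      have hle := Nat.find_min' hex ⟨y0, hy0, u0, hu0, hz0⟩
      generalize Nat.find hex = m at *
      have hcb : c ≤ c ⊔ Ideal.span {b} := le_sup_left
      obtain ⟨k, hk⟩ := ENat.ne_top_iff_exists.1 (Ideal.height_ne_top_of_isPrime (I := p))
      rw [← hk] at ht0 hpl ⊢
      have ht0' : t0 = 0 ∨ t0 + s ≤ k := ht0.imp id fun h => by exact_mod_cast h
      have hpl' : k < l := by exact_mod_cast hpl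
      by_cases hm : m = 0 ∨ m + (s + 1) ≤ k
      · exact ⟨m, hm.imp id fun h => by exact_mod_cast h, y, hy, u, hu, fun z hzI => sup_le_sup_right hcb _ (hz z hzI)⟩
      · obtain ⟨m, rfl⟩ : ∃ m', m = m' + 1 := ⟨m - 1, by omega⟩
        have hbD : b ∉ Dp I c p := by
          have hpT : p ∈ T := by
            refine Set.mem_iUnion.2 ⟨⟨m, by omega⟩, ⟨hp, sup_le hIp ?_⟩, ?_⟩
            · apply Ideal.span_le.2
              rintro v ⟨y', hy', hz'⟩
              by_contra hv
              exact hmin m (by omega) ⟨y', hy', v, hv, hz'⟩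
            · rintro q ⟨hq, hq'⟩ hqp
              by_contra hne
              have hlt : q.height < p.height :=
                Ideal.height_strict_mono_of_isPrime (lt_of_le_not_ge hqp hne)
              rw [← hk] at hlt
              obtain ⟨t1, ht1, y1, hy1, u1, hu1, hz1⟩ := h.2.1 q hq (le_sup_left.trans hq') (lt_trans hlt hpl)
              apply hu1
              apply hq'
              apply Ideal.mem_sup_right
              refine fitg_mono I c (i := t1) ?_ (Ideal.subset_span ⟨y1, hy1, hz1⟩)
              show t1 ≤ m
              rcases ht1 with rfl | ht1
              · omega
              · have := lt_of_le_of_lt ht1 hlt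
                have : t1 + s < k := by exact_mod_cast this
                omega
          have := hbS (F p) (Or.inr ⟨p, ⟨hpT, by rw [← hk]; exact hpl, fun ⟨v, hv, hv'⟩ => ?_⟩, rfl⟩)
          · simpa only [F, dif_pos hp] using this
          · exact hmin 0 (by omega) ⟨Fin.elim0, fun i => i.elim0, v, hv, fun z hzI => Ideal.mem_sup_left (hv' z hzI)⟩
        obtain ⟨y', hy', hu'⟩ := elim_one y hy hu hz hb hbD
        refine ⟨m, Or.inr ?_, y', hy', hu'⟩
        have : m + (s + 1) ≤ k := by omega
        exact_mod_cast this
    · intro p hp hcp hIp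
      have hcp' : c ≤ p := le_sup_left.trans hcp
      have h1 := h.2.2 p hp hcp' hIp
      push_cast
      by_contra hcon
      have h2 : p.height = s := by
        obtain ⟨k, hk⟩ := ENat.ne_top_iff_exists.1 (Ideal.height_ne_top_of_isPrime (I := p))
        rw [← hk] at h1 hcon ⊢
        have h1' : s ≤ k := by exact_mod_cast h1
        have : ¬ s + 1 ≤ k := by exact_mod_cast hcon
        have : k = s := by omega
        rw [this]
      refine hbS p (Or.inl ⟨⟨⟨hp, hcp'⟩, ?_⟩, hIp⟩) (hcp (Ideal.mem_sup_right (Ideal.mem_span_singleton_self b)))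
      rintro q ⟨hq, hq'⟩ hqp
      by_contra hne
      have hlt : q.height < p.height :=
        Ideal.height_strict_mono_of_isPrime (lt_of_le_not_ge hqp hne)
      rw [h2] at hlt
      exact absurd (h.2.2 q hq hq' (fun h => hIp (h.trans hqp))) (not_le.2 hlt)

end Gen

section Ext

variable {R : Type u} [CommRing R] [IsNoetherianRing R] [IsLocalRing R]

lemma gen_ext (hk : Infinite (ResidueField R)) {I : Ideal R} {l k L : ℕ} (hkL : k ≤ L) (hP : Pres I) (h0 : PG I l 0 ⊥)
    {J : Ideal R} (hJ : IsReduction J I) (E : ∀ s, (Fin s → R) → Prop) (c0 : Fin k → R) (hc0 : ∀ i, c0 i ∈ J)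
    (hPG : PG I l k (Ideal.span (Set.range c0))) (hE0 : E k c0)
    (hE : ∀ s, k ≤ s → s + 1 ≤ L → ∀ c : Fin s → R, (∀ i, c i ∈ J) → E s c →
      ∃ S : Set (Ideal R), S.Finite ∧ (∀ N ∈ S, ¬ J ≤ N) ∧
        ∀ b ∈ J, (∀ N ∈ S, b ∉ N) → E (s + 1) (Fin.snoc c b)) :
    ∃ c : Fin L → R, (∀ i, c i ∈ J) ∧ PG I l L (Ideal.span (Set.range c)) ∧ E L c := by
  induction L, hkL using Nat.le_induction with
  | base => exact ⟨c0, hc0, hPG, hE0⟩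
  | succ s hs ih =>
    obtain ⟨c, hc, h1, h2⟩ := ih fun s' h h' => hE s' h (by omega)
    obtain ⟨S, hS, hSJ, hSE⟩ := hE s hs le_rfl c hc h2
    obtain ⟨S', hS', -, hSJ', hSE'⟩ := PG_step hP h0 h1
    obtain ⟨b, hb, hb'⟩ := avoid hk J (S ∪ S') (hS.union hS') (by
      rintro N (hN | hN)
      · exact hSJ N hN
      · exact hSJ' N hN J hJ)
    refine ⟨Fin.snoc c b, ?_, ?_, hSE b hb fun N hN => hb' N (Or.inl hN)⟩
    · intro i
      refine Fin.lastCases ?_ (fun i => ?_) i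
      · simpa using hb
      · simpa using hc i
    · rw [span_snoc]
      exact hSE' b (hJ.1 hb) fun N hN => hb' N (Or.inr hN)

end Ext
end

section
open MvPolynomial RingTheory.Sequence IsLocalRing

set_option linter.unusedSectionVars false
section Res

variable {R : Type u} [CommRing R] {f : ℕ} {σ : Type} [Fintype σ] [DecidableEq σ]
  {ρ τ : Type} [Fintype ρ] [DecidableEq ρ] [Fintype τ] [DecidableEq τ]

/-- the rows of a presentation of the ideal generated by `x` -/
def Res (x : σ → R) (φ : σ → Module.Dual R (Fin f → R)) : Prop :=
  (∀ u, ∑ k, φ k u * x k = 0) ∧ ∀ v : σ → R, ∑ k, v k * x k = 0 → ∃ u, ∀ k, v k = φ k u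

lemma hom_scale {p : MvPolynomial σ R} {m : ℕ} (hp : p.IsHomogeneous m) {B : Type*} [CommRing B] [Algebra R B]
    (c : B) (y : σ → B) : aeval (fun k => c * y k) p = c ^ m * aeval y p := by
  rw [aeval_def, aeval_def, eval₂_eq', eval₂_eq', Finset.mul_sum]
  refine Finset.sum_congr rfl fun e he => ?_
  have hd : ∑ i, e i = m := by
    have := hp (mem_support_iff.1 he)
    rwa [Finsupp.weight_apply, Finsupp.sum_fintype _ _ (by simp), show (∑ i, e i • (1 : σ → ℕ) i) = ∑ i, e i by simp] at this
  simp only [mul_pow]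
  rw [Finset.prod_mul_distrib, Finset.prod_pow_eq_pow_sum, hd]
  ring

lemma mem_pow_iff {m : ℕ} (x : σ → R) (y : R) : y ∈ Ideal.span (Set.range x) ^ m ↔
    ∃ p : MvPolynomial σ R, p.IsHomogeneous m ∧ aeval x p = y := by
  rw [Ideal.mem_span_pow_iff_exists_isHomogeneous]
  simp [coe_aeval_eq_eval]

lemma lift_u {x : ρ ⊕ τ → R} {φ : ρ ⊕ τ → Module.Dual R (Fin f → R)} (hres : Res x φ) {u : R}
    (hu : ∀ z ∈ Ideal.span (Set.range x), u * z ∈ Ideal.span (Set.range fun j => x (Sum.inr j))) (k : ρ) :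
    ∃ w, ∀ r, φ (Sum.inl r) w = if r = k then u else 0 := by
  obtain ⟨c, hc⟩ := Ideal.mem_span_range_iff_exists_fun.1 (hu (x (Sum.inl k)) (Ideal.subset_span ⟨_, rfl⟩))
  obtain ⟨w, hw⟩ := hres.2 (Sum.elim (fun r => if r = k then u else 0) (fun j => - c j)) (by
    rw [Fintype.sum_sum_type]
    simp [hc])
  exact ⟨w, fun r => by rw [← hw]; rfl⟩

lemma pow_mem_hid {x : ρ ⊕ τ → R} {φ : ρ ⊕ τ → Module.Dual R (Fin f → R)} (hres : Res x φ) {u : R}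
    (hu : ∀ z ∈ Ideal.span (Set.range x), u * z ∈ Ideal.span (Set.range fun j => x (Sum.inr j))) :
    u ^ Fintype.card ρ ∈ hid (fun r => φ (Sum.inl r)) := by
  choose w hw using lift_u hres hu
  exact Ideal.subset_span ⟨u, w, fun k r => hw r k, rfl⟩

lemma CmulX_mem {x : ρ ⊕ τ → R} {φ : ρ ⊕ τ → Module.Dual R (Fin f → R)} (hres : Res x φ) {u : R}
    (hu : ∀ z ∈ Ideal.span (Set.range x), u * z ∈ Ideal.span (Set.range fun j => x (Sum.inr j)))
    {h : MvPolynomial ρ R} {m : ℕ} (hh : h.IsHomogeneous m) (hm : m ≠ 0) :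
    C u * h ∈ gI (fun r => φ (Sum.inl r)) := by
  have hX : ∀ k : ρ, C u * X k ∈ gI (fun r => φ (Sum.inl r)) := by
    intro k
    obtain ⟨w, hw⟩ := lift_u hres hu k
    refine Ideal.subset_span ⟨w, ?_⟩
    simp [gform, hw, smul_eq_C_mul]
  rw [h.as_sum, Finset.mul_sum]
  refine Ideal.sum_mem _ fun e he => ?_
  have hd : ∃ k, e k ≠ 0 := by
    by_contra! h0
    have := hh (mem_support_iff.1 he)
    rw [Finsupp.weight_apply, Finsupp.sum_fintype _ _ (by simp)] at this
    simp [h0] at this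
    exact hm this.symm
  obtain ⟨k, hk⟩ := hd
  obtain ⟨e', rfl⟩ : ∃ e', e = e' + Finsupp.single k 1 :=
    ⟨e - Finsupp.single k 1, (tsub_add_cancel_of_le (by
      rw [Finsupp.single_le_iff]; omega)).symm⟩
  have : (monomial (e' + Finsupp.single k 1) (coeff (e' + Finsupp.single k 1) h) : MvPolynomial ρ R) =
      monomial e' (coeff (e' + Finsupp.single k 1) h) * X k := by
    rw [X, monomial_mul, mul_one]
  rw [this, mul_left_comm]
  exact Ideal.mul_mem_left _ _ (hX k)

lemma syz_pow {x : σ → R} {φ : σ → Module.Dual R (Fin f → R)} (hres : Res x φ) {H : MvPolynomial σ R} {m : ℕ}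
    (hH : H.IsHomogeneous m) (h0 : aeval x H = 0) {b : R} (hb : b ∈ Ideal.span (Set.range x)) :
    C (b ^ m) * H ∈ gI φ := by
  obtain ⟨c, hc⟩ := Ideal.mem_span_range_iff_exists_fun.1 hb
  set lam : MvPolynomial σ R := ∑ i, c i • X i with hlam
  have h1 : ∀ k, C b * X k - C (x k) * lam ∈ gI φ := by
    intro k
    obtain ⟨u, hu⟩ := hres.2 (fun i => (if i = k then b else 0) - x k * c i) (by
      simp only [sub_mul, Finset.sum_sub_distrib, ite_mul, zero_mul, Finset.sum_ite_eq', Finset.mem_univ, if_true]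
      rw [← hc]
      simp only [mul_assoc]
      rw [← Finset.mul_sum, mul_comm, sub_self])
    refine Ideal.subset_span ⟨u, ?_⟩
    simp only [gform, ← hu, sub_smul, Finset.sum_sub_distrib, ite_smul, zero_smul, Finset.sum_ite_eq', Finset.mem_univ,
      if_true, hlam, Finset.mul_sum, smul_eq_C_mul, C_mul, mul_assoc]
  have e1 : aeval (fun k => (C b : MvPolynomial σ R) * X k) H = C (b ^ m) * H := by
    rw [hom_scale hH]
    simp [aeval_X_left]
  have e2 : aeval (fun k => lam * C (x k)) H = 0 := by
    rw [hom_scale hH]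
    have : aeval (fun k => (C (x k) : MvPolynomial σ R)) H = C (aeval x H) := by
      exact aeval_algebraMap_apply (MvPolynomial σ R) x H
    rw [this, h0, C_0, mul_zero]
  rw [← e1, ← Ideal.Quotient.eq_zero_iff_mem, ← Ideal.Quotient.mkₐ_eq_mk R, comp_aeval_apply]
  have e3 : ((Ideal.Quotient.mkₐ R (gI φ)) ∘ fun k => (C b : MvPolynomial σ R) * X k) =
      ((Ideal.Quotient.mkₐ R (gI φ)) ∘ fun k => lam * C (x k)) := by
    funext k
    simp only [Function.comp, Ideal.Quotient.mkₐ_eq_mk]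
    rw [Ideal.Quotient.eq, mul_comm lam]
    exact h1 k
  rw [show (fun i => (Ideal.Quotient.mkₐ R (gI φ)) ((C b : MvPolynomial σ R) * X i)) =
    fun k => Ideal.Quotient.mkₐ R (gI φ) (lam * C (x k)) from e3, ← comp_aeval_apply, e2, map_zero]

lemma qp_gI (φ : ρ ⊕ τ → Module.Dual R (Fin f → R)) {p : MvPolynomial (ρ ⊕ τ) R} (hp : p ∈ gI φ) :
    qp p ∈ gI (fun r => φ (Sum.inl r)) := by
  have : gI φ ≤ Ideal.comap (qp (R := R) (ρ := ρ) (τ := τ)) (gI (fun r => φ (Sum.inl r))) := by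
    refine Ideal.span_le.2 ?_
    rintro _ ⟨v, rfl⟩
    refine Ideal.subset_span ⟨v, ?_⟩
    simp only [gform, RingHom.coe_coe, Fintype.sum_sum_type]
    rw [map_add, map_sum, map_sum]
    simp only [map_smul, qp_inl, qp_inr, smul_zero, Finset.sum_const_zero, add_zero]
  exact this hp

lemma gI_eval {x : ρ ⊕ τ → R} {φ : ρ ⊕ τ → Module.Dual R (Fin f → R)} (hres : Res x φ)
    {h : MvPolynomial ρ R} {m : ℕ} (hh : h.IsHomogeneous (m + 1)) (hg : h ∈ gI (fun r => φ (Sum.inl r))) :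
    aeval (fun r => x (Sum.inl r)) h ∈ Ideal.span (Set.range fun j => x (Sum.inr j)) * Ideal.span (Set.range x) ^ m := by
  suffices H : ∀ q : MvPolynomial ρ R, aeval (fun r => x (Sum.inl r)) (homogeneousComponent (m + 1) (q * h)) ∈
      Ideal.span (Set.range fun j => x (Sum.inr j)) * Ideal.span (Set.range x) ^ m by
    have := H 1
    rwa [one_mul, homogeneousComponent_of_mem hh, if_pos rfl] at this
  clear hh
  induction hg using Submodule.span_induction with
  | zero => intro q; simp
  | add a b _ _ ha hb => intro q; rw [mul_add, map_add, map_add]; exact Ideal.add_mem _ (ha q) (hb q)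
  | smul c a _ ha => intro q; rw [smul_eq_mul, ← mul_assoc]; exact ha _
  | mem a ha =>
    obtain ⟨v, rfl⟩ := ha
    intro q
    rw [homComp_mul (gform_hom _ v), if_pos (by omega), map_mul, mul_comm (aeval _ _)]
    refine Ideal.mul_mem_mul ?_ ?_
    · have := hres.1 v
      rw [Fintype.sum_sum_type] at this
      have e : aeval (fun r => x (Sum.inl r)) (gform (fun r => φ (Sum.inl r)) v) = ∑ k, φ (Sum.inl k) v * x (Sum.inl k) := by
        simp [gform]
      rw [e, eq_neg_of_add_eq_zero_left this]
      exact neg_mem (Ideal.sum_mem _ fun j _ => Ideal.mul_mem_left _ _ (Ideal.subset_span ⟨j, rfl⟩))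
    · have : Ideal.span (Set.range fun r => x (Sum.inl r)) ≤ Ideal.span (Set.range x) := Ideal.span_mono (by
        rintro _ ⟨r, rfl⟩; exact ⟨_, rfl⟩)
      refine Ideal.pow_right_mono this m ?_
      rw [mem_pow_iff]
      exact ⟨homogeneousComponent (m + 1 - 1) q, homogeneousComponent_isHomogeneous _ _, rfl⟩

end Res
end

section
open MvPolynomial RingTheory.Sequence IsLocalRing

set_option linter.unusedSectionVars false
section Ctx

variable {R : Type u} [CommRing R] [IsNoetherianRing R] [IsLocalRing R]

/-- standing assumptions -/
structure Ctx (I : Ideal R) (N d : ℕ) : Prop where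
  hk : Infinite (ResidueField R)
  hl : fiberDim I = ((N + 2 : ℕ) : WithBot ℕ∞)
  hP : Pres I
  h0 : PG I (N + 2) 0 ⊥
  hH : HtReg R
  hm : I ≤ maximalIdeal R
  hmu : muE I = ((d + (N + 2) : ℕ) : ℕ∞)

lemma muE_le_of_span {I : Ideal R} (s : Finset R) (hs : Ideal.span (s : Set R) = I) : muE I ≤ s.card :=
  sInf_le ⟨s, rfl, hs⟩

lemma exists_of_muE {I : Ideal R} {n : ℕ} (h : muE I = (n : ℕ∞)) :
    ∃ y : Fin n → R, Ideal.span (Set.range y) = I := by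
  have hne : {n : ℕ∞ | ∃ s : Finset R, (s.card : ℕ∞) = n ∧ Submodule.span R (s : Set R) = I}.Nonempty := by
    obtain ⟨S, hS⟩ := (IsNoetherian.noetherian I : I.FG)
    exact ⟨_, S, rfl, hS⟩
  have := csInf_mem hne
  obtain ⟨s, hs, hs'⟩ := this
  have hc : s.card = n := by
    have h2 : (s.card : ℕ∞) = n := hs.trans h
    exact_mod_cast h2
  refine ⟨fun i => s.equivFinOfCardEq hc |>.symm i, ?_⟩
  rw [← hs']
  congr 1
  ext r
  constructor
  · rintro ⟨i, rfl⟩; exact Subtype.coe_prop _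
  · intro hr
    exact ⟨s.equivFinOfCardEq hc ⟨r, hr⟩, by simp⟩

lemma Ctx.hy {I : Ideal R} {N d : ℕ} (hC : Ctx I N d) : ∃ y : Fin (d + (N + 2)) → R, Ideal.span (Set.range y) = I :=
  exists_of_muE hC.hmu

lemma muE_min {I : Ideal R} {n : ℕ} (h : muE I = (n : ℕ∞)) (x : Fin n → R) (hx : Ideal.span (Set.range x) = I)
    (c : Fin n → R) (hc : ∑ i, c i * x i = 0) (i : Fin n) : c i ∈ maximalIdeal R := by
  classical
  by_contra hcon
  obtain ⟨u, hu⟩ := (by simpa using hcon : IsUnit (c i))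
  let s : Finset R := (Finset.univ.erase i).image x
  have hs : Ideal.span (s : Set R) = I := by
    refine le_antisymm ?_ ?_
    · rw [← hx]
      refine Ideal.span_mono ?_
      intro r hr
      simp only [s, Finset.coe_image, Set.mem_image] at hr
      obtain ⟨j, -, rfl⟩ := hr
      exact ⟨j, rfl⟩
    · have hmem : ∀ j ≠ i, x j ∈ Ideal.span (s : Set R) := fun j hj =>
        Ideal.subset_span (Finset.mem_coe.2 (Finset.mem_image_of_mem _ (Finset.mem_erase.2 ⟨hj, Finset.mem_univ _⟩)))
      rw [← hx, Ideal.span_le]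
      rintro _ ⟨j, rfl⟩
      by_cases hj : j = i
      · subst hj
        rw [← Finset.add_sum_erase _ _ (Finset.mem_univ j)] at hc
        have : x j = - ↑u⁻¹ * ∑ k ∈ Finset.univ.erase j, c k * x k := by
          have h1 : (u⁻¹ : Rˣ) * (u : R) = 1 := by simp
          rw [← hu] at hc
          linear_combination (- x j) * h1 + ↑u⁻¹ * hc
        rw [this]
        exact Ideal.mul_mem_left _ _ (Ideal.sum_mem _ fun k hk => Ideal.mul_mem_left _ _ (hmem k (Finset.ne_of_mem_erase hk)))
      · exact hmem j hj
  have h1 := muE_le_of_span s hs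
  rw [h] at h1
  have h2 : n ≤ s.card := by exact_mod_cast h1
  have h3 : s.card ≤ (Finset.univ.erase i).card := Finset.card_image_le
  rw [Finset.card_erase_of_mem (Finset.mem_univ _), Finset.card_univ, Fintype.card_fin] at h3
  have := i.2
  omega

lemma extend_basis {I : Ideal R} : ∀ (k d : ℕ) (a : Fin k → R), (∀ i, a i ∈ I) →
    (∀ c : Fin k → R, ∑ i, c i * a i ∈ maximalIdeal R * I → ∀ i, c i ∈ maximalIdeal R) →
    (∃ y : Fin (d + k) → R, Ideal.span (Set.range y) = I) →
    ∃ b : Fin d → R, Ideal.span (Set.range b) ⊔ Ideal.span (Set.range a) = I := by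
  intro k
  induction k with
  | zero =>
    rintro d a ha hi ⟨y, hy⟩
    refine ⟨y, ?_⟩
    rw [Set.range_eq_empty a]
    simpa using hy
  | succ k ih =>
    rintro d a ha hi ⟨y, hy⟩
    obtain ⟨b, hb⟩ := ih (d + 1) (fun i => a i.castSucc) (fun i => ha _) (by
      intro c hc i
      have := hi (Fin.snoc c 0) (by rw [Fin.sum_univ_castSucc]; simpa using hc) i.castSucc
      simpa using this) (by
        refine ⟨y ∘ finCongr (by omega : d + 1 + k = d + (k + 1)), ?_⟩
        rw [(finCongr (by omega : d + 1 + k = d + (k + 1))).surjective.range_comp y]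
        exact hy)
    have hlast := ha (Fin.last k)
    rw [← hb] at hlast
    obtain ⟨p, hp, q, hq, hpq⟩ := Submodule.mem_sup.1 hlast
    obtain ⟨e, rfl⟩ := Ideal.mem_span_range_iff_exists_fun.1 hp
    obtain ⟨e', rfl⟩ := Ideal.mem_span_range_iff_exists_fun.1 hq
    have hbI : ∀ j, b j ∈ I := fun j => hb ▸ Ideal.mem_sup_left (Ideal.subset_span ⟨j, rfl⟩)
    have hj : ∃ j, e j ∉ maximalIdeal R := by
      by_contra! hall
      have := hi (Fin.snoc (fun i => - e' i) 1) (by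
        rw [Fin.sum_univ_castSucc]
        simp only [Fin.snoc_castSucc, Fin.snoc_last, one_mul, neg_mul, Finset.sum_neg_distrib]
        rw [← hpq]
        have : -∑ i, e' i * a i.castSucc + (∑ i, e i * b i + ∑ i, e' i * a i.castSucc) = ∑ i, e i * b i := by ring
        rw [this]
        exact Ideal.sum_mem _ fun i _ => Ideal.mul_mem_mul (hall i) (hbI i)) (Fin.last k)
      simp only [Fin.snoc_last] at this
      exact (maximalIdeal.isMaximal R).ne_top ((Ideal.eq_top_iff_one _).2 this)
    obtain ⟨j, hj⟩ := hj
    refine ⟨fun i => b (j.succAbove i), le_antisymm ?_ ?_⟩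
    · refine sup_le (Ideal.span_le.2 ?_) (Ideal.span_le.2 ?_)
      · rintro _ ⟨i, rfl⟩; exact hbI _
      · rintro _ ⟨i, rfl⟩; exact ha _
    · conv_lhs => rw [← hb]
      set T := Ideal.span (Set.range fun i => b (j.succAbove i)) ⊔ Ideal.span (Set.range a) with hT
      have haT : ∀ i, a i ∈ T := fun i => Ideal.mem_sup_right (Ideal.subset_span ⟨i, rfl⟩)
      have hbT : ∀ i, b (j.succAbove i) ∈ T := fun i => Ideal.mem_sup_left (Ideal.subset_span ⟨i, rfl⟩)
      have hbj : b j ∈ T := by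
        obtain ⟨u, hu⟩ := (by simpa using hj : IsUnit (e j))
        rw [Fin.sum_univ_succAbove _ j] at hpq
        have : b j = ↑u⁻¹ * (a (Fin.last k) - ∑ i, e (j.succAbove i) * b (j.succAbove i)
            - ∑ i, e' i * a i.castSucc) := by
          rw [← hpq, ← hu]
          have : (u⁻¹ : Rˣ) * (u : R) = 1 := by simp
          linear_combination (- b j) * this
        rw [this]
        refine Ideal.mul_mem_left _ _ (Ideal.sub_mem _ (Ideal.sub_mem _ (haT _) ?_) ?_)
        · exact Ideal.sum_mem _ fun i _ => Ideal.mul_mem_left _ _ (hbT _)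
        · exact Ideal.sum_mem _ fun i _ => Ideal.mul_mem_left _ _ (haT _)
      refine sup_le (Ideal.span_le.2 ?_) (Ideal.span_le.2 ?_)
      · rintro _ ⟨i, rfl⟩
        rcases Fin.eq_self_or_eq_succAbove j i with h | ⟨i', h⟩
        · rw [h]; exact hbj
        · rw [h]; exact hbT _
      · rintro _ ⟨i, rfl⟩; exact haT _

/-- index type for generators -/
abbrev Ix (N d : ℕ) := (Fin d ⊕ Unit) ⊕ Fin (N + 1)

/-- the generators -/
def gx {N d : ℕ} (b : Fin d → R) (a : R) (a' : Fin (N + 1) → R) : Ix N d → R :=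
  Sum.elim (Sum.elim b (fun _ => a)) a'

lemma exists_res' {I : Ideal R} {t : ℕ} (hP : Pres I) {κ : Type} [Fintype κ] [DecidableEq κ] (hcard : Fintype.card κ = t + 1)
    (x : κ → R) (hx : Ideal.span (Set.range x) = I) : ∃ φ : κ → Module.Dual R (Fin t → R), Res x φ := by
  obtain ⟨e⟩ := Fintype.truncEquivFinOfCardEq hcard
  obtain ⟨b, -, hb⟩ := syz_basis hP (x ∘ e.symm) (by rw [e.symm.surjective.range_comp]; exact hx)
  have key : ∀ u : Fin t → R, ∀ k, (∑ j, u j • b j) k = ∑ j, u j * b j k := by intro u k; simp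
  refine ⟨fun k => ∑ j, b j (e k) • LinearMap.proj j, ?_, ?_⟩
  · intro u
    have : ∑ j, u j • b j ∈ Syz (x ∘ e.symm) := by
      rw [← hb]
      exact Submodule.sum_mem _ fun j _ => Submodule.smul_mem _ _ (Submodule.subset_span ⟨j, rfl⟩)
    rw [mem_Syz] at this
    rw [← this, ← e.sum_comp]
    refine Finset.sum_congr rfl fun k _ => ?_
    simp [mul_comm]
  · intro v hv
    have : (v ∘ e.symm) ∈ Syz (x ∘ e.symm) := by
      rw [mem_Syz, ← hv, ← e.symm.sum_comp]; rfl
    rw [← hb, Submodule.mem_span_range_iff_exists_fun] at this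
    obtain ⟨c, hc⟩ := this
    refine ⟨c, fun k => ?_⟩
    have := congrFun hc (e k)
    rw [key] at this
    simp only [Function.comp, Equiv.symm_apply_apply] at this
    rw [← this]
    simp [mul_comm]

lemma span_gx {N d : ℕ} (b : Fin d → R) (a : R) (a' : Fin (N + 1) → R) :
    Ideal.span (Set.range (gx b a a')) = Ideal.span (Set.range b) ⊔ (Ideal.span (Set.range a') ⊔ Ideal.span {a}) := by
  unfold gx
  rw [Set.Sum.elim_range, Set.Sum.elim_range, Ideal.span_union, Ideal.span_union, Set.range_const, sup_assoc,
    sup_comm (Ideal.span {a})]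

lemma exists_res {I : Ideal R} {N d : ℕ} (hC : Ctx I N d) {a' : Fin (N + 1) → R} {a : R}
    (h : IsReduction (Ideal.span (Set.range a') ⊔ Ideal.span {a}) I) :
    ∃ (b : Fin d → R) (φ : Ix N d → Module.Dual R (Fin (d + N + 1) → R)),
      Ideal.span (Set.range (gx b a a')) = I ∧ Res (gx b a a') φ := by
  have h' := h
  rw [← span_snoc] at h'
  obtain ⟨b, hb⟩ := extend_basis (N + 2) d (Fin.snoc a' a : Fin (N + 2) → R) (fun i => h'.1 (Ideal.subset_span ⟨i, rfl⟩))
    (indep hC.hl _ h') hC.hy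
  rw [span_snoc] at hb
  have hx := (span_gx b a a').trans hb
  obtain ⟨φ, hφ⟩ := exists_res' (t := d + N + 1) hC.hP (by simp; omega) _ hx
  exact ⟨b, φ, hx, hφ⟩

end Ctx
end

section
open MvPolynomial RingTheory.Sequence IsLocalRing

set_option linter.unusedSectionVars false
section TF

variable {R : Type u} [CommRing R] [IsNoetherianRing R] [IsLocalRing R] {I : Ideal R} {N d : ℕ}
  {b : Fin d → R} {a : R} {a' : Fin (N + 1) → R} {φ : Ix N d → Module.Dual R (Fin (d + N + 1) → R)}

lemma PG_loc (hg : PG I (N + 2) (N + 1) (Ideal.span (Set.range a'))) (p : Ideal R) (hp : p.IsPrime) (hI : I ≤ p)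
    (hpl : p.height < ((N + 2 : ℕ) : ℕ∞)) : ∃ u ∉ p, ∀ z ∈ I, u * z ∈ Ideal.span (Set.range a') := by
  obtain ⟨t, ht, y, hy, u, hu, hz⟩ := hg.2.1 p hp hI hpl
  have h0 : t = 0 := by
    rcases ht with h | h
    · exact h
    · have := lt_of_le_of_lt h hpl
      have h2 : t + (N + 1) < N + 2 := by exact_mod_cast this
      omega
  subst h0
  refine ⟨u, hu, fun z hzI => ?_⟩
  have := hz z hzI
  rwa [Set.range_eq_empty y, Ideal.span_empty, sup_bot_eq] at this

lemma gx_inr : (fun j => gx b a a' (Sum.inr j)) = a' := rfl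

lemma hidA (hg : PG I (N + 2) (N + 1) (Ideal.span (Set.range a'))) (hx : Ideal.span (Set.range (gx b a a')) = I)
    (hres : Res (gx b a a') φ) (p : Ideal R) (hp : p.IsPrime) (hle : hid (fun r => φ (Sum.inl r)) ≤ p) :
    ((N + 1 : ℕ) : ℕ∞) ≤ p.height := by
  have key : ∀ u, (∀ z ∈ I, u * z ∈ Ideal.span (Set.range a')) → u ∈ p := by
    intro u hu
    refine hp.mem_of_pow_mem _ (hle (pow_mem_hid hres (u := u) ?_))
    rw [hx]; exact hu
  by_cases hI : I ≤ p
  · by_contra hcon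
    obtain ⟨u, hu, h⟩ := PG_loc hg p hp hI (lt_trans (not_le.1 hcon) (by exact_mod_cast Nat.lt_succ_self _))
    exact hu (key u h)
  · exact hg.2.2 p hp (fun u hu => key u fun z _ => Ideal.mul_mem_right _ _ hu) hI

lemma TF (hC : Ctx I N d) (hg : PG I (N + 2) (N + 1) (Ideal.span (Set.range a')))
    (hx : Ideal.span (Set.range (gx b a a')) = I) (hres : Res (gx b a a') φ)
    {h : MvPolynomial (Fin d ⊕ Unit) R} (hh : h.IsHomogeneous (N + 1))
    (hb : ∀ z ∈ I, C z * h ∈ gI (fun r => φ (Sum.inl r))) : h ∈ gI (fun r => φ (Sum.inl r)) := by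
  obtain ⟨ys, hyl, hym, hys⟩ := hC.hH _ (N + 1) (hidA hg hx hres)
  let 𝔞 : Ideal R := Ideal.comap (C : R →+* MvPolynomial (Fin d ⊕ Unit) R)
    (Submodule.colon (gI (fun r => φ (Sum.inl r))) {h})
  have mem𝔞 : ∀ r, r ∈ 𝔞 ↔ C r * h ∈ gI (fun r => φ (Sum.inl r)) := by
    intro r
    simp [𝔞, Ideal.mem_comap, Submodule.mem_colon_singleton]
  obtain ⟨zs, hzl, hzm, hzs⟩ := hC.hH 𝔞 (N + 2) (by
    intro p hp hle
    by_contra hcon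
    have hI : I ≤ p := fun z hz => hle ((mem𝔞 z).2 (hb z hz))
    obtain ⟨u, hu, h'⟩ := PG_loc hg p hp hI (not_le.1 hcon)
    refine hu (hle ((mem𝔞 u).2 (CmulX_mem hres (u := u) ?_ hh (by omega))))
    rw [hx]; exact h')
  exact K1 _ (N + 1) (by simp; omega) ys hys hym hyl.ge zs hzs (by omega) h hh fun z hz => (mem𝔞 z).1 (hzm z hz)

lemma TFp (hC : Ctx I N d) (hg : PG I (N + 2) (N + 1) (Ideal.span (Set.range a')))
    (hx : Ideal.span (Set.range (gx b a a')) = I) (hres : Res (gx b a a') φ)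
    {h : MvPolynomial (Fin d ⊕ Unit) R} (hh : h.IsHomogeneous (N + 1)) (M : ℕ)
    (hb : ∀ z ∈ I ^ M, C z * h ∈ gI (fun r => φ (Sum.inl r))) : h ∈ gI (fun r => φ (Sum.inl r)) := by
  induction M with
  | zero => simpa using hb 1 (by simp)
  | succ M ih =>
    refine ih fun z hz => TF hC hg hx hres (hh.C_mul z) fun w hw => ?_
    rw [← mul_assoc, ← C_mul]
    exact hb _ (by rw [pow_succ']; exact Ideal.mul_mem_mul hw hz)

lemma EQ0 (hC : Ctx I N d) (hg : PG I (N + 2) (N + 1) (Ideal.span (Set.range a')))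
    (hx : Ideal.span (Set.range (gx b a a')) = I) (hres : Res (gx b a a') φ)
    {H : MvPolynomial (Ix N d) R} (hH : H.IsHomogeneous (N + 1)) (h0 : aeval (gx b a a') H = 0) :
    qp H ∈ gI (fun r => φ (Sum.inl r)) := by
  let 𝔞 : Ideal R := Ideal.comap (C : R →+* MvPolynomial (Ix N d) R)
    (Submodule.colon (gI φ) {H})
  have mem𝔞 : ∀ r, r ∈ 𝔞 ↔ C r * H ∈ gI φ := by
    intro r
    simp [𝔞, Ideal.mem_comap, Submodule.mem_colon_singleton]
  have hrad : I ≤ 𝔞.radical := fun z hz => ⟨N + 1, (mem𝔞 _).2 (syz_pow hres hH h0 (by rw [hx]; exact hz))⟩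
  obtain ⟨M, hM⟩ := Ideal.exists_pow_le_of_le_radical_of_fg hrad (IsNoetherian.noetherian I)
  refine TFp hC hg hx hres (qp_hom hH) M fun z hz => ?_
  have := qp_gI φ ((mem𝔞 z).1 (hM hz))
  rw [map_mul] at this
  rwa [show qp (C z : MvPolynomial (Ix N d) R) = C z from (qp (R := R)).commutes z] at this

lemma aeval_rename_inl (h : MvPolynomial (Fin d ⊕ Unit) R) :
    aeval (gx b a a') (rename Sum.inl h) = aeval (fun r => gx b a a' (Sum.inl r)) h := by
  rw [aeval_rename]; rfl

lemma qp_rename {ρ τ : Type} [Fintype ρ] [DecidableEq ρ] [Fintype τ] [DecidableEq τ] (h : MvPolynomial ρ R) : qp (rename (Sum.inl : ρ → ρ ⊕ τ) h) = h := by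
  have : (qp (R := R) (ρ := ρ) (τ := τ)).comp (rename Sum.inl) = AlgHom.id R _ := by
    ext i; simp [qp_inl]
  exact DFunLike.congr_fun this h

/-- elements of `K * I ^ N` with `K` generated by some of the variables -/
lemma mul_pow_form {σ ι : Type} [Fintype σ] [DecidableEq σ] [Fintype ι] (x : σ → R) (g : ι → σ) {m : ℕ} {z : R}
    (hz : z ∈ Ideal.span (Set.range (x ∘ g)) * Ideal.span (Set.range x) ^ m) :
    ∃ G : ι → MvPolynomial σ R, (∀ i, (G i).IsHomogeneous m) ∧ aeval x (∑ i, X (g i) * G i) = z := by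
  induction hz using Submodule.mul_induction_on' with
  | mem_mul_mem p hp q hq =>
    obtain ⟨c, rfl⟩ := Ideal.mem_span_range_iff_exists_fun.1 hp
    obtain ⟨P, hP, rfl⟩ := (mem_pow_iff x q).1 hq
    refine ⟨fun i => C (c i) * P, fun i => hP.C_mul _, ?_⟩
    simp only [map_sum, map_mul, aeval_X, algHom_C, Finset.sum_mul, Function.comp, Algebra.algebraMap_self, RingHom.id_apply]
    refine Finset.sum_congr rfl fun i _ => by ring
  | add p _ q _ hp hq =>
    obtain ⟨G, hG, rfl⟩ := hp
    obtain ⟨G', hG', rfl⟩ := hq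
    exact ⟨fun i => G i + G' i, fun i => (hG i).add (hG' i), by simp [mul_add, Finset.sum_add_distrib]⟩

lemma EQ (hC : Ctx I N d) (hg : PG I (N + 2) (N + 1) (Ideal.span (Set.range a')))
    (hx : Ideal.span (Set.range (gx b a a')) = I) (hres : Res (gx b a a') φ)
    {h : MvPolynomial (Fin d ⊕ Unit) R} (hh : h.IsHomogeneous (N + 1)) :
    aeval (fun r => gx b a a' (Sum.inl r)) h ∈ Ideal.span (Set.range a') * I ^ N ↔
      h ∈ gI (fun r => φ (Sum.inl r)) := by
  constructor
  · intro hz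
    rw [← hx] at hz
    obtain ⟨G, hG, hG'⟩ := mul_pow_form (gx b a a') Sum.inr hz
    have := EQ0 hC hg hx hres (H := rename Sum.inl h - ∑ i, X (Sum.inr i) * G i)
      ((hh.rename_isHomogeneous).sub (IsHomogeneous.sum _ _ _ fun i _ => by
        rw [mul_comm]; exact (hG i).mul (isHomogeneous_X _ _)))
      (by rw [map_sub, hG', aeval_rename_inl, sub_self])
    rw [map_sub, qp_rename, map_sum] at this
    simpa [qp_inr] using this
  · intro hz
    have := gI_eval hres hh hz
    rwa [hx, gx_inr] at this

lemma pow_form (hx : Ideal.span (Set.range (gx b a a')) = I) {z : R} {m : ℕ} (hz : z ∈ I ^ (m + 1)) :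
    ∃ h : MvPolynomial (Fin d ⊕ Unit) R, h.IsHomogeneous (m + 1) ∧
      z - aeval (fun r => gx b a a' (Sum.inl r)) h ∈ Ideal.span (Set.range a') * I ^ m := by
  have h1 : I = Ideal.span (Set.range fun r => gx b a a' (Sum.inl r)) ⊔ Ideal.span (Set.range a') := by
    rw [← hx, ← Ideal.span_union, ← Set.Sum.elim_range]
    congr 2
  have h2 : ∀ m, I ^ (m + 1) ≤ Ideal.span (Set.range fun r => gx b a a' (Sum.inl r)) ^ (m + 1) ⊔
      Ideal.span (Set.range a') * I ^ m := by
    intro m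
    induction m with
    | zero => simp [← h1]
    | succ m ih =>
      rw [pow_succ I (m + 1)]
      refine (Ideal.mul_mono_left ih).trans ?_
      rw [Ideal.sup_mul]
      refine sup_le ?_ (le_sup_of_le_right ?_)
      · conv_lhs => rw [h1]
        rw [Ideal.mul_sup, ← pow_succ]
        refine sup_le le_sup_left (le_sup_of_le_right ?_)
        rw [mul_comm]
        refine Ideal.mul_mono_right (Ideal.pow_right_mono ?_ _)
        rw [h1]; exact le_sup_left
      · rw [mul_assoc, ← pow_succ]
  obtain ⟨p, hp, q, hq, rfl⟩ := Submodule.mem_sup.1 (h2 m hz)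
  obtain ⟨P, hP, rfl⟩ := (mem_pow_iff _ _).1 hp
  exact ⟨P, hP, by simpa using hq⟩

lemma TF_pow' (hC : Ctx I N d) (hg : PG I (N + 2) (N + 1) (Ideal.span (Set.range a')))
    (hx : Ideal.span (Set.range (gx b a a')) = I) (hres : Res (gx b a a') φ) {z : R} (hz : z ∈ I ^ (N + 1))
    (hIz : ∀ w ∈ I, w * z ∈ Ideal.span (Set.range a') * I ^ N) : z ∈ Ideal.span (Set.range a') * I ^ N := by
  obtain ⟨h, hh, hzh⟩ := pow_form hx hz
  have : h ∈ gI (fun r => φ (Sum.inl r)) := by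
    refine TF hC hg hx hres hh fun w hw => ?_
    rw [← EQ hC hg hx hres (hh.C_mul w), map_mul, algHom_C]
    have := Ideal.sub_mem _ (hIz w hw) (Ideal.mul_mem_left _ w hzh)
    simpa [mul_sub] using this
  rw [← EQ hC hg hx hres hh] at this
  simpa using Ideal.add_mem _ hzh this

lemma SYM (hC : Ctx I N d) (hg : PG I (N + 2) (N + 1) (Ideal.span (Set.range a')))
    (hx : Ideal.span (Set.range (gx b a a')) = I) (hres : Res (gx b a a') φ)
    {h : MvPolynomial (Fin d) R} (hh : h.IsHomogeneous (N + 1))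
    (hz : aeval b h ∈ (Ideal.span (Set.range a') ⊔ Ideal.span {a}) * I ^ N) :
    h ∈ gI (fun r => φ (Sum.inl (Sum.inl r))) := by
  rw [← hx] at hz
  have hz' : aeval b h ∈ Ideal.span (Set.range (gx b a a' ∘ (Sum.elim (fun _ : Unit => Sum.inl (Sum.inr ())) Sum.inr : Unit ⊕ Fin (N + 1) → Ix N d))) * Ideal.span (Set.range (gx b a a')) ^ N := by
    convert hz using 2
    rw [Sum.comp_elim, Set.Sum.elim_range, Ideal.span_union, sup_comm]
    congr 2
    ext r
    simp [gx, eq_comm]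
  obtain ⟨G, hG, hG'⟩ := mul_pow_form (gx b a a') _ hz'
  have := EQ0 hC hg hx hres (H := rename Sum.inl (rename Sum.inl h) - ∑ i, X (Sum.elim (fun _ : Unit => Sum.inl (Sum.inr ())) Sum.inr i) * G i)
      ((hh.rename_isHomogeneous.rename_isHomogeneous).sub (IsHomogeneous.sum _ _ _ fun i _ => by
        rw [mul_comm]; exact (hG i).mul (isHomogeneous_X _ _)))
      (by
        rw [map_sub, hG', aeval_rename_inl, aeval_rename, sub_eq_zero]; rfl)
  have := qp_gI _ this
  rw [map_sub, qp_rename, map_sum, map_sub, qp_rename, map_sum] at this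
  simpa [qp_inr, qp_inl] using this

end TF
end

section
open MvPolynomial RingTheory.Sequence IsLocalRing

set_option linter.unusedSectionVars false
section Ind

variable {R : Type u} [CommRing R] [IsNoetherianRing R] [IsLocalRing R] {I : Ideal R} {N d : ℕ}

/-- linear independence modulo `m I` -/
def Ind (I : Ideal R) {k : ℕ} (c : Fin k → R) : Prop :=
  ∀ e : Fin k → R, ∑ i, e i * c i ∈ maximalIdeal R * I → ∀ i, e i ∈ maximalIdeal R

lemma not_le_small (hC : Ctx I N d) {J : Ideal R} (hJ : IsReduction J I) {q : ℕ} (c : Fin q → R) (hc : ∀ i, c i ∈ I)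
    (hq : q < N + 2) : ¬ J ≤ Ideal.span (Set.range c) ⊔ maximalIdeal R * I := by
  intro h
  obtain ⟨h1, r, hr⟩ := hJ
  have := red_of_nak (I := I) (A := Ideal.span (Set.range c)) (Ideal.span_le.2 (by rintro _ ⟨i, rfl⟩; exact hc i)) r (by
    rw [pow_succ' I r, ← mul_assoc, ← Ideal.sup_mul, ← pow_succ', hr]
    exact Ideal.mul_mono_left h)
  have := fd_lower hC.hl c this
  omega

lemma Ind_snoc {k : ℕ} {c : Fin k → R} {b : R} (hc : Ind I c) (hbI : b ∈ I)
    (hb : b ∉ Ideal.span (Set.range c) ⊔ maximalIdeal R * I) : Ind I (Fin.snoc c b : Fin (k + 1) → R) := by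
  intro e he
  rw [Fin.sum_univ_castSucc] at he
  simp only [Fin.snoc_castSucc, Fin.snoc_last] at he
  have hlast : e (Fin.last k) ∈ maximalIdeal R := by
    by_contra hcon
    obtain ⟨u, hu⟩ := (by simpa using hcon : IsUnit (e (Fin.last k)))
    refine hb ?_
    have h1 : (u⁻¹ : Rˣ) * (u : R) = 1 := by simp
    have : b = ↑u⁻¹ * (∑ i : Fin k, e i.castSucc * c i + e (Fin.last k) * b) - ↑u⁻¹ * ∑ i : Fin k, e i.castSucc * c i := by
      rw [← hu]; linear_combination (-b) * h1
    rw [this]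
    exact Ideal.sub_mem _ (Ideal.mul_mem_left _ _ (Ideal.mem_sup_right he)) (Ideal.mul_mem_left _ _ (Ideal.mem_sup_left
      (Ideal.sum_mem _ fun i _ => Ideal.mul_mem_left _ _ (Ideal.subset_span ⟨i, rfl⟩))))
  have h2 := hc (fun i => e i.castSucc) (by
    have := Ideal.sub_mem _ he (Ideal.mul_mem_mul hlast hbI)
    simpa using this)
  intro i
  exact Fin.lastCases hlast (fun i => h2 i) i

lemma exch_mem {k : ℕ} {c : Fin k → R} {b w : R} (hbI : b ∈ I)
    (hw : w ∉ Ideal.span (Set.range c) ⊔ maximalIdeal R * I)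
    (hb : b ∉ Ideal.span (Set.range c) ⊔ maximalIdeal R * I ⊔ Ideal.span {w}) :
    w ∉ Ideal.span (Set.range (Fin.snoc c b : Fin (k + 1) → R)) ⊔ maximalIdeal R * I := by
  intro h
  rw [span_snoc, sup_assoc, sup_comm (Ideal.span {b}), ← sup_assoc] at h
  obtain ⟨p, hp, q, hq, hpq⟩ := Submodule.mem_sup.1 h
  obtain ⟨e, rfl⟩ := Ideal.mem_span_singleton'.1 hq
  by_cases he : e ∈ maximalIdeal R
  · refine hw ?_
    rw [← hpq]
    exact Ideal.add_mem _ hp (Ideal.mem_sup_right (Ideal.mul_mem_mul he hbI))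
  · obtain ⟨u, hu⟩ := (by simpa using he : IsUnit e)
    refine hb ?_
    have h1 : (u⁻¹ : Rˣ) * (u : R) = 1 := by simp
    have : b = ↑u⁻¹ * w - ↑u⁻¹ * p := by
      rw [← hpq, ← hu]; linear_combination (-b) * h1
    rw [this]
    exact Ideal.sub_mem _ (Ideal.mem_sup_right (Ideal.mul_mem_left _ _ (Ideal.mem_span_singleton_self _)))
      (Ideal.mem_sup_left (Ideal.mul_mem_left _ _ hp))

lemma min_eq_span (hC : Ctx I N d) {J : Ideal R} (hJ : IsMinimalReduction J I) (c : Fin (N + 2) → R) (hcJ : ∀ i, c i ∈ J)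
    (hc : Ind I c) : Ideal.span (Set.range c) = J := by
  obtain ⟨a, ha⟩ := exists_gens hC.hk hC.hl hJ
  obtain ⟨b, hb⟩ := extend_basis (I := J) (N + 2) 0 c hcJ
    (fun e he => hc e (Ideal.mul_mono_right hJ.1.1 he)) ⟨a ∘ finCongr (by omega), by
      rw [(finCongr (by omega : 0 + (N + 2) = N + 2)).surjective.range_comp]; exact ha⟩
  rw [Set.range_eq_empty b] at hb
  simpa using hb

lemma good_ext' (hC : Ctx I N d) {J : Ideal R} (hJ : IsMinimalReduction J I) {k : ℕ} (hk : k ≤ N + 1) {w : R} (hw : w ∈ J)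
    (c0 : Fin k → R) (hc0 : ∀ i, c0 i ∈ J) (hPG : PG I (N + 2) k (Ideal.span (Set.range c0))) (hi : Ind I c0)
    (hw0 : w ∉ Ideal.span (Set.range c0) ⊔ maximalIdeal R * I)
    (E : ∀ s, (Fin s → R) → Prop) (hE0 : E k c0)
    (hE : ∀ s, k ≤ s → s ≤ N → ∀ c : Fin s → R, (∀ i, c i ∈ J) → Ind I c → 
      w ∉ Ideal.span (Set.range c) ⊔ maximalIdeal R * I → E s c →
      ∃ S : Set (Ideal R), S.Finite ∧ (∀ N ∈ S, ¬ J ≤ N) ∧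
        ∀ b ∈ J, (∀ N ∈ S, b ∉ N) → E (s + 1) (Fin.snoc c b)) :
    ∃ c : Fin (N + 1) → R, (∀ i, c i ∈ J) ∧ PG I (N + 2) (N + 1) (Ideal.span (Set.range c)) ∧
      Ideal.span (Set.range c) ⊔ Ideal.span {w} = J ∧ E (N + 1) c ∧ Ideal.span (Set.range c0) ≤ Ideal.span (Set.range c) := by
  obtain ⟨c, hc, h1, h2, h3, h4, h5⟩ := gen_ext hC.hk hk hC.hP hC.h0 hJ.1
    (fun s c => Ind I c ∧ w ∉ Ideal.span (Set.range c) ⊔ maximalIdeal R * I ∧ E s c ∧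
      Ideal.span (Set.range c0) ≤ Ideal.span (Set.range c)) c0 hc0 hPG ⟨hi, hw0, hE0, le_rfl⟩ (by
    rintro s hks hsL c hc ⟨h1, h2, h3, h4⟩
    obtain ⟨S, hS, hSJ, hSE⟩ := hE s hks (by omega) c hc h1 h2 h3
    refine ⟨insert (Ideal.span (Set.range c) ⊔ maximalIdeal R * I ⊔ Ideal.span {w}) S, hS.insert _, ?_, ?_⟩
    · rintro K (rfl | hK)
      · rw [sup_assoc, sup_comm (maximalIdeal R * I), ← sup_assoc, ← span_snoc]
        refine not_le_small hC hJ.1 _ (fun i => hJ.1.1 ?_) (by omega)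
        exact Fin.lastCases (by simpa using hw) (fun i => by simpa using hc i) i
      · exact hSJ K hK
    · intro b hb hbK
      have hb1 := hbK _ (Set.mem_insert _ _)
      refine ⟨Ind_snoc h1 (hJ.1.1 hb) fun h => hb1 (Ideal.mem_sup_left h), exch_mem (hJ.1.1 hb) h2 hb1,
        hSE b hb fun K hK => hbK K (Set.mem_insert_of_mem _ hK), ?_⟩
      rw [span_snoc]
      exact h4.trans le_sup_left)
  refine ⟨c, hc, h1, ?_, h4, h5⟩
  rw [← span_snoc]
  refine min_eq_span hC hJ _ (fun i => ?_) (Ind_snoc h2 (hJ.1.1 hw) h3)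
  exact Fin.lastCases (by simpa using hw) (fun i => by simpa using hc i) i

lemma Ind_empty (c : Fin 0 → R) : Ind I c := fun _ _ i => i.elim0

lemma PG_empty (hC : Ctx I N d) (c : Fin 0 → R) : PG I (N + 2) 0 (Ideal.span (Set.range c)) := by
  rw [Set.range_eq_empty c, Ideal.span_empty]
  exact hC.h0

lemma good_w (hC : Ctx I N d) {J : Ideal R} (hJ : IsMinimalReduction J I) {w : R} (hw : w ∈ J) (hw' : w ∉ maximalIdeal R * I) :
    ∃ c : Fin (N + 1) → R, PG I (N + 2) (N + 1) (Ideal.span (Set.range c)) ∧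
      Ideal.span (Set.range c) ⊔ Ideal.span {w} = J := by
  obtain ⟨c, -, h1, h2, -⟩ := good_ext' hC hJ (Nat.zero_le _) hw Fin.elim0 (fun i => i.elim0) (PG_empty hC _) (Ind_empty _)
    (by rw [Set.range_eq_empty]; simpa using hw') (fun _ _ => True) trivial
    (fun s _ _ c _ _ _ _ => ⟨∅, Set.finite_empty, by simp, fun _ _ _ => trivial⟩)
  exact ⟨c, h1, h2⟩

lemma exists_w (hC : Ctx I N d) {J : Ideal R} (hJ : IsReduction J I) {k : ℕ} (c : Fin k → R) (hc : ∀ i, c i ∈ I)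
    (hk : k < N + 2) : ∃ w ∈ J, w ∉ Ideal.span (Set.range c) ⊔ maximalIdeal R * I := by
  by_contra! h
  exact not_le_small hC hJ c hc hk h

lemma exists_good (hC : Ctx I N d) {J : Ideal R} (hJ : IsMinimalReduction J I) :
    ∃ (c : Fin (N + 1) → R) (w : R), PG I (N + 2) (N + 1) (Ideal.span (Set.range c)) ∧
      Ideal.span (Set.range c) ⊔ Ideal.span {w} = J := by
  obtain ⟨w, hw, hw'⟩ := exists_w hC hJ.1 (Fin.elim0 : Fin 0 → R) (fun i => i.elim0) (by omega)
  obtain ⟨c, h⟩ := good_w hC hJ hw (fun h => hw' (Ideal.mem_sup_right h))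
  exact ⟨c, w, h⟩

end Ind
end

section
open MvPolynomial RingTheory.Sequence IsLocalRing

set_option linter.unusedSectionVars false
section Ko

variable {R : Type u} [CommRing R] [IsNoetherianRing R] [IsLocalRing R] {I : Ideal R} {N d : ℕ}
  {b : Fin d → R} {a : R} {a' : Fin (N + 1) → R} {φ : Ix N d → Module.Dual R (Fin (d + N + 1) → R)}

/-- colon ideal -/
def cln (P Q : Ideal R) : Ideal R where
  carrier := {r | ∀ z ∈ Q, r * z ∈ P}
  add_mem' := fun {x y} hx hy z hz => by rw [add_mul]; exact P.add_mem (hx z hz) (hy z hz)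
  zero_mem' := fun z _ => by simp
  smul_mem' := fun c x hx z hz => by
    rw [smul_eq_mul, mul_assoc]; exact P.mul_mem_left _ (hx z hz)

lemma mem_cln {P Q : Ideal R} {r : R} : r ∈ cln P Q ↔ ∀ z ∈ Q, r * z ∈ P := Iff.rfl

lemma le_cln {P Q K : Ideal R} : K ≤ cln P Q ↔ K * Q ≤ P := by
  constructor
  · intro h; rw [Ideal.mul_le]; exact fun r hr z hz => h hr z hz
  · intro h r hr z hz; exact h (Ideal.mul_mem_mul hr hz)

lemma cln_le_Ko (J : Ideal R) (M : ℕ) : cln J I ≤ cln (J * I ^ M) (I ^ (M + 1)) := by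
  rw [le_cln, pow_succ' I M, ← mul_assoc]
  exact Ideal.mul_mono_left (le_cln.1 le_rfl)

/-- Fitting ideal -/
def Fi (I : Ideal R) (n d : ℕ) : Ideal R :=
  Ideal.span {δ | ∃ x : Fin n → R, Ideal.span (Set.range x) = I ∧ ∃ (v : Fin d → Fin n → R)
    (lam : Fin d → Module.Dual R (Fin n → R)), (∀ j, ∑ k, v j k * x k = 0) ∧
      δ = (Matrix.of fun i j => lam i (v j)).det}

lemma mem_Fi {κ : Type} [Fintype κ] [DecidableEq κ] {n : ℕ} (hcard : Fintype.card κ = n) (x : κ → R)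
    (hx : Ideal.span (Set.range x) = I) (v : Fin d → κ → R) (hv : ∀ j, ∑ k, v j k * x k = 0) (r : Fin d → κ) :
    (Matrix.of fun i j => v j (r i)).det ∈ Fi I n d := by
  obtain ⟨e⟩ := Fintype.truncEquivFinOfCardEq hcard
  refine Ideal.subset_span ⟨x ∘ e.symm, by rw [e.symm.surjective.range_comp]; exact hx, fun j => v j ∘ e.symm,
    fun i => LinearMap.proj (e (r i)), fun j => ?_, ?_⟩
  · rw [← hv j, ← e.symm.sum_comp]; rfl
  · congr 1
    ext i j
    simp

lemma det_expand {n : ℕ} (K : Ideal R) (v : Fin d → Fin n → R) (h : ∀ r : Fin d → Fin n, (Matrix.of fun i j => v j (r i)).det ∈ K)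
    (lam : Fin d → Module.Dual R (Fin n → R)) : (Matrix.of fun i j => lam i (v j)).det ∈ K := by
  have e : (Matrix.of fun i j => lam i (v j)) =
      fun i => ∑ k, lam i (Pi.single k 1) • (fun j => v j k) := by
    funext i j
    have : v j = ∑ k, v j k • Pi.single k (1 : R) := by
      ext m; simp [Finset.sum_apply, Pi.single_apply]
    simp only [Matrix.of_apply, Finset.sum_apply, Pi.smul_apply, smul_eq_mul]
    conv_lhs => rw [this]
    simp [mul_comm]
  rw [e]
  change (Matrix.detRowAlternating (R := R) (n := Fin d)).toMultilinearMap
    (fun i => ∑ k, lam i (Pi.single k 1) • fun j => v j k) ∈ K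
  rw [MultilinearMap.map_sum]
  refine Ideal.sum_mem _ fun r _ => ?_
  rw [MultilinearMap.map_smul_univ, smul_eq_mul]
  exact Ideal.mul_mem_left _ _ (h r)

lemma Fi_le (hC : Ctx I N d) (x : Fin (d + (N + 2)) → R) (hx : Ideal.span (Set.range x) = I) (K : Ideal R) {t : ℕ}
    (hK : ∀ (v : Fin t → Fin (d + (N + 2)) → R), (∀ j, ∑ k, v j k * x k = 0) → ∀ r : Fin t → Fin (d + (N + 2)),
      (Matrix.of fun i j => v j (r i)).det ∈ K) : Fi I (d + (N + 2)) t ≤ K := by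
  refine Ideal.span_le.2 ?_
  rintro _ ⟨x', hx', v, lam, hv, rfl⟩
  have hP : ∀ i, ∃ c : Fin (d + (N + 2)) → R, ∑ j, c j * x j = x' i := fun i =>
    Ideal.mem_span_range_iff_exists_fun.1 (by rw [hx, ← hx']; exact Ideal.subset_span ⟨i, rfl⟩)
  have hQ : ∀ i, ∃ c : Fin (d + (N + 2)) → R, ∑ j, c j * x' j = x i := fun i =>
    Ideal.mem_span_range_iff_exists_fun.1 (by rw [hx', ← hx]; exact Ideal.subset_span ⟨i, rfl⟩)
  choose P hP using hP
  choose Q hQ using hQ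
  let PM : Matrix (Fin (d + (N + 2))) (Fin (d + (N + 2))) R := Matrix.of P
  let QM : Matrix (Fin (d + (N + 2))) (Fin (d + (N + 2))) R := Matrix.of Q
  have hPx : PM.mulVec x = x' := by ext i; exact hP i
  have hQx : QM.mulVec x' = x := by ext i; exact hQ i
  have hmod : (PM * QM).map (residue R) = 1 := by
    ext i k
    have h1 : ∑ k, (PM * QM - 1) i k * x' k = 0 := by
      have : ((PM * QM - 1).mulVec x') i = 0 := by
        rw [Matrix.sub_mulVec, ← Matrix.mulVec_mulVec, hQx, hPx, Matrix.one_mulVec, sub_self]; rfl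
      exact this
    have h2 := muE_min hC.hmu x' hx' _ h1 k
    rw [← residue_eq_zero_iff, Matrix.sub_apply, map_sub, sub_eq_zero] at h2
    rw [Matrix.map_apply, h2, Matrix.one_apply, Matrix.one_apply]
    split_ifs <;> simp
  have hunit : IsUnit (PM * QM).det := by
    have : residue R (PM * QM).det = 1 := by
      rw [RingHom.map_det, RingHom.mapMatrix_apply, hmod, Matrix.det_one]
    by_contra hcon
    have h3 : (PM * QM).det ∈ maximalIdeal R := hcon
    rw [← residue_eq_zero_iff, this] at h3
    exact one_ne_zero h3
  have hPu : IsUnit PM.det := by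
    rw [Matrix.det_mul] at hunit
    exact isUnit_of_mul_isUnit_left hunit
  have hw : ∀ j, ∑ k, (Matrix.vecMul (v j) PM) k * x k = 0 := by
    intro j
    have : dotProduct (Matrix.vecMul (v j) PM) x = 0 := by
      rw [← Matrix.dotProduct_mulVec, hPx]; exact hv j
    exact this
  have := det_expand K (fun j => Matrix.vecMul (v j) PM) (hK _ hw) (fun i => lam i ∘ₗ (Matrix.vecMulLinear PM⁻¹))
  have e : (Matrix.of fun i j => lam i (v j)) =
      Matrix.of fun i j => (lam i ∘ₗ (Matrix.vecMulLinear PM⁻¹)) (Matrix.vecMul (v j) PM) := by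
    ext i j
    simp only [LinearMap.comp_apply, Matrix.vecMulLinear_apply, Matrix.of_apply]
    rw [Matrix.vecMul_vecMul, Matrix.mul_nonsing_inv _ hPu, Matrix.vecMul_one]
  rw [SetLike.mem_coe, e]
  exact this

lemma cramer_mem (hx : Ideal.span (Set.range (gx b a a')) = I) (hres : Res (gx b a a') φ) (c : Fin d → Fin (d + N + 1)) :
    (Matrix.of fun i j => φ (Sum.inl (Sum.inl i)) (Pi.single (c j) 1)).det ∈
      cln (Ideal.span (Set.range a') ⊔ Ideal.span {a}) I := by
  set M : Matrix (Fin d) (Fin d) R := Matrix.of fun i j => φ (Sum.inl (Sum.inl i)) (Pi.single (c j) 1) with hM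
  set J := Ideal.span (Set.range a') ⊔ Ideal.span {a} with hJ
  have ha : a ∈ J := Ideal.mem_sup_right (Ideal.mem_span_singleton_self a)
  have ha' : ∀ i, a' i ∈ J := fun i => Ideal.mem_sup_left (Ideal.subset_span ⟨i, rfl⟩)
  have key : ∀ r, M.det * b r ∈ J := by
    intro r
    have h1 := hres.1 (∑ j, M.adjugate j r • Pi.single (c j) (1 : R))
    have h2 : ∀ i, φ (Sum.inl (Sum.inl i)) (∑ j, M.adjugate j r • Pi.single (c j) (1 : R)) = if i = r then M.det else 0 := by
      intro i
      have := congrFun (congrFun (Matrix.mul_adjugate M) i) r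
      rw [Matrix.mul_apply, Matrix.smul_apply, Matrix.one_apply] at this
      rw [map_sum]
      simp only [map_smul, smul_eq_mul]
      simp only [smul_eq_mul, mul_ite, mul_one, mul_zero] at this
      rw [← this]
      exact Finset.sum_congr rfl fun j _ => mul_comm _ _
    rw [Fintype.sum_sum_type, Fintype.sum_sum_type] at h1
    simp only [h2, gx, Sum.elim_inl, Sum.elim_inr, ite_mul, zero_mul, Finset.sum_ite_eq', Finset.mem_univ, if_true] at h1
    rw [add_assoc] at h1
    rw [eq_neg_of_add_eq_zero_left h1]
    refine neg_mem (Ideal.add_mem _ (Ideal.sum_mem _ fun i _ => Ideal.mul_mem_left _ _ ha)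
      (Ideal.sum_mem _ fun i _ => Ideal.mul_mem_left _ _ (ha' i)))
  have : Ideal.span (Set.range (gx b a a')) ≤ cln J (Ideal.span {M.det}) := by
    refine Ideal.span_le.2 ?_
    rintro _ ⟨k, rfl⟩ z hz
    obtain ⟨s, rfl⟩ := Ideal.mem_span_singleton'.1 hz
    have h3 : gx b a a' k * M.det ∈ J := by
      rw [mul_comm]
      rcases k with (k | k) | k
      · exact key k
      · exact Ideal.mul_mem_left _ _ ha
      · exact Ideal.mul_mem_left _ _ (ha' k)
    rw [mul_left_comm]
    exact Ideal.mul_mem_left _ _ h3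
  rw [hx] at this
  intro z hz
  rw [mul_comm]
  exact this hz _ (Ideal.mem_span_singleton_self _)

lemma hidJ (hC : Ctx I N d) (hx : Ideal.span (Set.range (gx b a a')) = I) (hres : Res (gx b a a') φ)
    (hred : IsReduction (Ideal.span (Set.range a') ⊔ Ideal.span {a}) I) (p : Ideal R) (hp : p.IsPrime)
    (hle : hid (fun r => φ (Sum.inl (Sum.inl r))) ≤ p) : ((N + 2 : ℕ) : ℕ∞) ≤ p.height := by
  set J := Ideal.span (Set.range a') ⊔ Ideal.span {a} with hJ
  have key : ∀ u, (∀ z ∈ I, u * z ∈ J) → u ∈ p := by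
    intro u hu
    have hw : ∀ k, ∃ w, ∀ r, φ (Sum.inl (Sum.inl r)) w = if r = k then u else 0 := by
      intro k
      have hbI : b k ∈ I := hx ▸ Ideal.subset_span ⟨Sum.inl (Sum.inl k), rfl⟩
      obtain ⟨y, hy, z, hz, hyz⟩ := Submodule.mem_sup.1 (hu _ hbI)
      obtain ⟨c, rfl⟩ := Ideal.mem_span_range_iff_exists_fun.1 hy
      obtain ⟨s, rfl⟩ := Ideal.mem_span_singleton'.1 hz
      obtain ⟨w, hw⟩ := hres.2 (Sum.elim (Sum.elim (fun r => if r = k then u else 0) (fun _ => -s)) (fun j => - c j)) (by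
        rw [Fintype.sum_sum_type, Fintype.sum_sum_type]
        simp [gx, ← hyz])
      exact ⟨w, fun r => by rw [← hw]; rfl⟩
    choose w hw using hw
    exact hp.mem_of_pow_mem _ (hle (Ideal.subset_span ⟨u, w, fun k r => hw r k, rfl⟩))
  by_contra hcon
  have hI : I ≤ p := not_le_prime hred p fun u hu => key u fun z _ => Ideal.mul_mem_right _ _ hu
  obtain ⟨u, hu, h⟩ := N1' hC.hP hC.h0 hred p hI (not_le.1 hcon)
  exact hu (key u h)

lemma Ko_Psi (hC : Ctx I N d) (hg : PG I (N + 2) (N + 1) (Ideal.span (Set.range a')))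
    (hx : Ideal.span (Set.range (gx b a a')) = I) (hres : Res (gx b a a') φ)
    (hred : IsReduction (Ideal.span (Set.range a') ⊔ Ideal.span {a}) I) {r : R}
    (hr : r ∈ cln ((Ideal.span (Set.range a') ⊔ Ideal.span {a}) * I ^ N) (I ^ (N + 1))) :
    ∃ s : Lam R (d + N + 1) →ₗ[R] R, r = s (Psi (fun r => φ (Sum.inl (Sum.inl r))) (List.finRange d)) := by
  obtain ⟨ys, hyl, hym, hys⟩ := hC.hH _ (N + 2) (hidJ hC hx hres hred)
  refine Kstar (fun r => φ (Sum.inl (Sum.inl r))) (List.finRange d) (List.nodup_finRange d) (List.mem_finRange) (N + 1)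
    (by simp; omega) (by omega) ys hys hym hyl.ge r fun p hp => ?_
  refine SYM hC hg hx hres (hp.C_mul r) ?_
  rw [map_mul, algHom_C]
  refine hr _ ?_
  have : Ideal.span (Set.range b) ≤ I := by
    rw [← hx]
    refine Ideal.span_mono ?_
    rintro _ ⟨i, rfl⟩
    exact ⟨Sum.inl (Sum.inl i), rfl⟩
  exact Ideal.pow_right_mono this _ ((mem_pow_iff _ _).2 ⟨p, hp, rfl⟩)

lemma Psi_mem_of_minors (ψ : Fin d → Module.Dual R (Fin (d + N + 1) → R)) (K : Ideal R)
    (hK : ∀ c : Fin d → Fin (d + N + 1), (Matrix.of fun i j => ψ i (Pi.single (c j) 1)).det ∈ K)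
    (s : Lam R (d + N + 1) →ₗ[R] R) : s (Psi ψ (List.finRange d)) ∈ K := by
  have : (List.finRange d).map ψ = List.ofFn ψ := by rw [List.ofFn_eq_map]
  rw [Psi, this]
  exact DL_minor ψ _ s K hK

lemma Ko_eq_aux (hC : Ctx I N d) (hg : PG I (N + 2) (N + 1) (Ideal.span (Set.range a')))
    (hred : IsReduction (Ideal.span (Set.range a') ⊔ Ideal.span {a}) I) :
    cln ((Ideal.span (Set.range a') ⊔ Ideal.span {a}) * I ^ N) (I ^ (N + 1)) ≤
      cln (Ideal.span (Set.range a') ⊔ Ideal.span {a}) I ⊓ Fi I (d + (N + 2)) d := by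
  obtain ⟨b, φ, hx, hres⟩ := exists_res hC hred
  intro r hr
  obtain ⟨s, rfl⟩ := Ko_Psi hC hg hx hres hred hr
  refine Psi_mem_of_minors (fun r => φ (Sum.inl (Sum.inl r))) _ (fun c => Submodule.mem_inf.2 ⟨cramer_mem hx hres c, ?_⟩) s
  exact mem_Fi (by simp; omega) (gx b a a') hx (fun j k => φ k (Pi.single (c j) 1)) (fun j => hres.1 _)
    (fun i => Sum.inl (Sum.inl i))

lemma Ko_eq (hC : Ctx I N d) {J : Ideal R} (hJ : IsMinimalReduction J I) :
    cln (J * I ^ N) (I ^ (N + 1)) = cln J I := by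
  obtain ⟨c, w, hg, rfl⟩ := exists_good hC hJ
  exact le_antisymm ((Ko_eq_aux hC hg hJ.1).trans inf_le_left) (cln_le_Ko _ _)

lemma Ko_le_Fi (hC : Ctx I N d) {J : Ideal R} (hJ : IsMinimalReduction J I) :
    cln J I ≤ Fi I (d + (N + 2)) d := by
  rw [← Ko_eq hC hJ]
  obtain ⟨c, w, hg, rfl⟩ := exists_good hC hJ
  exact (Ko_eq_aux hC hg hJ.1).trans inf_le_right

end Ko
end

section
open MvPolynomial RingTheory.Sequence IsLocalRing

set_option linter.unusedSectionVars false
section Ab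

variable {T : Type*} [CommRing T]

lemma pair_pow_le (a b : T) (n : ℕ) : ∀ K : Ideal T, (∀ i j, i + j = n → b ^ i * a ^ j ∈ K) →
    Ideal.span {a, b} ^ n ≤ K := by
  induction n with
  | zero =>
    intro K h
    have := h 0 0 rfl
    simp only [pow_zero, mul_one] at this
    rw [(Ideal.eq_top_iff_one K).2 this]; exact le_top
  | succ n ih =>
    intro K h
    have h1 : ∀ r ∈ Ideal.span {a, b} ^ n, r * a ∈ K ∧ r * b ∈ K := by
      have := ih (K.colon {a, b}) (fun i j hij => by
        rw [Submodule.mem_colon]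
        rintro z (rfl | rfl)
        · rw [smul_eq_mul, mul_assoc, ← pow_succ]; exact h _ _ (by omega)
        · rw [smul_eq_mul, mul_right_comm, ← pow_succ]; exact h _ _ (by omega))
      intro r hr
      have h2 := Submodule.mem_colon.1 (this hr)
      exact ⟨h2 a (by simp), h2 b (by simp)⟩
    rw [pow_succ, Ideal.mul_le]
    intro r hr z hz
    obtain ⟨c, e, rfl⟩ := Ideal.mem_span_pair.1 hz
    rw [mul_add, mul_left_comm, mul_left_comm r]
    exact K.add_mem (K.mul_mem_left _ (h1 r hr).1) (K.mul_mem_left _ (h1 r hr).2)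

lemma interp {ι : Type*} [DecidableEq ι] (a b r : T) (u : ι → T) (n : ℕ) : ∀ S : Finset ι, S.card = n →
    (∀ i ∈ S, ∀ j ∈ S, i ≠ j → IsUnit (u i - u j)) → (∀ i ∈ S, (a + u i * b) ∣ r * a) →
    ∀ k < n, (∏ i ∈ S, (a + u i * b)) ∣ r * (b ^ k * a ^ (n - k)) := by
  induction n with
  | zero => intro S _ _ _ k hk; omega
  | succ n ih =>
    intro S hS hu hs k hk
    rcases Nat.eq_zero_or_pos n with rfl | hn
    · obtain ⟨i, rfl⟩ := Finset.card_eq_one.1 hS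
      obtain rfl : k = 0 := by omega
      simpa using hs i (by simp)
    have hc2 : 1 < S.card := by omega
    obtain ⟨i, hi, j, hj, hij⟩ := Finset.one_lt_card.1 hc2
    have hI : ∀ l ∈ S, ∀ k < n, (∏ i ∈ S, (a + u i * b)) ∣ r * (b ^ k * a ^ (n - k)) * (a + u l * b) := by
      intro l hl k hk
      have := ih (S.erase l) (by rw [Finset.card_erase_of_mem hl, hS]; rfl)
        (fun x hx y hy => hu x (Finset.mem_of_mem_erase hx) y (Finset.mem_of_mem_erase hy))
        (fun x hx => hs x (Finset.mem_of_mem_erase hx)) k hk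
      rw [← Finset.prod_erase_mul _ _ hl]
      exact mul_dvd_mul_right this _
    have hun := hu i hi j hj hij
    have A : ∀ k < n, (∏ i ∈ S, (a + u i * b)) ∣ r * (b ^ (k + 1) * a ^ (n - k)) := by
      intro k hk
      have h1 := dvd_sub (hI i hi k hk) (hI j hj k hk)
      have e : r * (b ^ k * a ^ (n - k)) * (a + u i * b) - r * (b ^ k * a ^ (n - k)) * (a + u j * b)
        = (u i - u j) * (r * (b ^ (k + 1) * a ^ (n - k))) := by ring
      rw [e, hun.dvd_mul_left] at h1
      exact h1
    rcases k with _ | k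
    · have h1 := dvd_sub ((hI j hj 0 hn).mul_left (u i)) ((hI i hi 0 hn).mul_left (u j))
      have e : u i * (r * (b ^ 0 * a ^ (n - 0)) * (a + u j * b)) - u j * (r * (b ^ 0 * a ^ (n - 0)) * (a + u i * b))
        = (u i - u j) * (r * (b ^ 0 * a ^ (n + 1 - 0))) := by simp only [Nat.sub_zero]; ring
      rw [e, hun.dvd_mul_left] at h1
      exact h1
    · have := A k (by omega)
      rwa [show n + 1 - (k + 1) = n - k by omega]

lemma intercancel {ι : Type*} [DecidableEq ι] (a b r : T) (u : ι → T) (S : Finset ι)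
    (hu : ∀ i ∈ S, ∀ j ∈ S, i ≠ j → IsUnit (u i - u j)) (hs : ∀ i ∈ S, (a + u i * b) ∣ r * a)
    (hreg : ∀ i ∈ S, ∀ z, (a + u i * b) * z = 0 → z = 0) (D : ℕ) (hD : D ≤ S.card) (c : ℕ → T)
    (hintg : b ^ D = ∑ k ∈ Finset.range D, c k * (a ^ (D - k) * b ^ k)) : a ∣ r * b := by
  set n := S.card with hn
  set P := ∏ i ∈ S, (a + u i * b) with hP
  have h1 := interp a b r u n S rfl hu hs
  -- all monomials of degree n
  have h2 : ∀ i j, i + j = n → P ∣ r * (b ^ i * a ^ j) := by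
    intro i j hij
    rcases lt_or_ge i n with hi | hi
    · have := h1 i hi; rwa [show n - i = j by omega] at this
    · have hi' : i = n := by omega
      have hj : j = 0 := by omega
      subst hj
      have : b ^ i = b ^ (n - D) * b ^ D := by rw [← pow_add]; congr 1; omega
      rw [this, hintg, pow_zero, mul_one, Finset.mul_sum, Finset.mul_sum]
      refine Finset.dvd_sum fun k hk => ?_
      have hk' := Finset.mem_range.1 hk
      have := (h1 (n - D + k) (by omega)).mul_left (c k)
      refine this.trans (dvd_of_eq ?_)
      rw [show n - (n - D + k) = D - k by omega, pow_add]; ring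
  have h3 : ∀ i j, i + j = n + 1 → a * P ∣ r * (b ^ i * a ^ j) := by
    intro i j hij
    rcases j with _ | j
    · have : b ^ i = b ^ (n + 1 - D) * b ^ D := by rw [← pow_add]; congr 1; omega
      rw [this, hintg, pow_zero, mul_one, Finset.mul_sum, Finset.mul_sum]
      refine Finset.dvd_sum fun k hk => ?_
      have hk' := Finset.mem_range.1 hk
      have := (mul_dvd_mul_left a (h2 (n + 1 - D + k) (D - k - 1) (by omega))).mul_left (c k)
      refine this.trans (dvd_of_eq ?_)
      have e : a ^ (D - k) = a * a ^ (D - k - 1) := by rw [← pow_succ']; congr 1; omega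
      rw [e, pow_add]; ring
    · refine (mul_dvd_mul_left a (h2 i j (by omega))).trans (dvd_of_eq ?_)
      rw [pow_succ]; ring
  have h4 : P * b ∈ Ideal.span {a, b} ^ (n + 1) := by
    rw [pow_succ]
    refine Ideal.mul_mem_mul ?_ (Ideal.subset_span (by simp))
    have : ∀ S' : Finset ι, ∏ i ∈ S', (a + u i * b) ∈ Ideal.span {a, b} ^ S'.card := by
      intro S'
      rw [← Finset.prod_const]
      refine Ideal.prod_mem_prod fun i _ => Ideal.add_mem _ (Ideal.subset_span (by simp))
        (Ideal.mul_mem_left _ _ (Ideal.subset_span (by simp)))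
    exact this S
  have h5 := pair_pow_le a b (n + 1) ((Ideal.span {a * P}).colon {r}) (fun i j hij => by
    rw [Submodule.mem_colon_singleton, smul_eq_mul, mul_comm _ r, Ideal.mem_span_singleton]
    exact h3 i j hij) h4
  rw [Submodule.mem_colon_singleton, smul_eq_mul, Ideal.mem_span_singleton] at h5
  obtain ⟨q, hq⟩ := h5
  refine ⟨q, ?_⟩
  have hPreg : ∀ S' ⊆ S, ∀ z, (∏ i ∈ S', (a + u i * b)) * z = 0 → z = 0 := by
    intro S'
    induction S' using Finset.induction_on with
    | empty => intro _ z hz; simpa using hz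
    | insert i S' hi ih =>
      intro hS z hz
      rw [Finset.prod_insert hi, mul_assoc] at hz
      exact ih (fun x hx => hS (Finset.mem_insert_of_mem hx)) z (hreg i (hS (Finset.mem_insert_self _ _)) _ hz)
  rw [← sub_eq_zero]
  refine hPreg S subset_rfl _ ?_
  rw [mul_sub, sub_eq_zero]
  linear_combination hq

lemma int_eq [IsNoetherianRing T] (Q : Ideal T) (M : ℕ) (a b : T) (ha : a ∈ Q) (hb : b ∈ Q)
    (hQ : Q ^ (M + 1) ≤ Ideal.span {a} * Q ^ M) (hreg : ∀ z, a * z = 0 → z = 0) :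
    ∃ D, ∃ c : ℕ → T, b ^ D = ∑ k ∈ Finset.range D, c k * (a ^ (D - k) * b ^ k) := by
  have h1 : ∀ k, ∀ z ∈ Q ^ M, ∃ e ∈ Q ^ M, b ^ k * z = a ^ k * e := by
    intro k
    induction k with
    | zero => intro z hz; exact ⟨z, hz, by simp⟩
    | succ k ih =>
      intro z hz
      obtain ⟨e, he, h⟩ := ih z hz
      have : b * e ∈ Q ^ (M + 1) := by rw [pow_succ']; exact Ideal.mul_mem_mul hb he
      obtain ⟨e', he', h'⟩ := Ideal.mem_span_singleton_mul.1 (hQ this)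
      refine ⟨e', he', ?_⟩
      rw [pow_succ', mul_assoc, h, pow_succ, mul_assoc, h']; ring
  have h2 : ∀ k, ∃ e, b ^ k * a ^ M = a ^ k * e := fun k => by
    obtain ⟨e, _, h⟩ := h1 k (a ^ M) (Ideal.pow_mem_pow ha M)
    exact ⟨e, h⟩
  choose e he using h2
  let F : ℕ →o Ideal T := ⟨fun n => Ideal.span (e '' Set.Iio n), fun m n h =>
    Ideal.span_mono (Set.image_mono (Set.Iio_subset_Iio h))⟩
  obtain ⟨D, hD⟩ := monotone_stabilizes_iff_noetherian.2 (inferInstance : IsNoetherian T T) F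
  have h3 : e D ∈ F D := by
    rw [hD (D + 1) (by omega)]
    exact Ideal.subset_span ⟨D, by simp, rfl⟩
  have h4 : ∃ c : ℕ → T, e D = ∑ k ∈ Finset.range D, c k * e k := by
    have h5 : e D ∈ Ideal.span (e '' (Finset.range D : Set ℕ)) := by
      rw [Finset.coe_range]; exact h3
    obtain ⟨c, hc⟩ := (Submodule.mem_span_image_finset_iff_exists_fun T).1 h5
    refine ⟨fun k => if h : k ∈ Finset.range D then c ⟨k, h⟩ else 0, ?_⟩
    rw [← hc, ← Finset.sum_attach (Finset.range D)]
    refine Finset.sum_congr rfl fun k _ => ?_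
    have hk := k.2
    simp only [hk, dif_pos, smul_eq_mul, Subtype.coe_eta]
  obtain ⟨c, hc⟩ := h4
  have hregM : ∀ n, ∀ z, a ^ n * z = 0 → z = 0 := by
    intro n
    induction n with
    | zero => intro z hz; simpa using hz
    | succ n ih => intro z hz; rw [pow_succ, mul_assoc] at hz; exact hreg _ (ih _ hz)
  refine ⟨D, c, ?_⟩
  rw [← sub_eq_zero]
  refine hregM M _ ?_
  rw [mul_sub, sub_eq_zero, mul_comm, he, hc, Finset.mul_sum, Finset.mul_sum]
  refine Finset.sum_congr rfl fun k hk => ?_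
  have hk' := Finset.mem_range.1 hk
  have e1 : a ^ D = a ^ (D - k) * a ^ k := by rw [← pow_add]; congr 1; omega
  rw [e1]
  linear_combination (-(c k * a ^ (D - k))) * he k

end Ab
end

section
open MvPolynomial RingTheory.Sequence IsLocalRing

set_option linter.unusedSectionVars false
section F6

variable {R : Type u} [CommRing R] [IsNoetherianRing R] [IsLocalRing R] {I : Ideal R} {N d : ℕ}
  {b : Fin d → R} {a : R} {a' : Fin (N + 1) → R}

lemma TFm (hC : Ctx I N d) (hg : PG I (N + 2) (N + 1) (Ideal.span (Set.range a')))
    (hred : IsReduction (Ideal.span (Set.range a') ⊔ Ideal.span {a}) I) {z : R} (hz : z ∈ I ^ (N + 1))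
    (hIz : ∀ w ∈ I, w * z ∈ Ideal.span (Set.range a') * I ^ N) : z ∈ Ideal.span (Set.range a') * I ^ N := by
  obtain ⟨b, φ, hx, hres⟩ := exists_res hC hred
  exact TF_pow' hC hg hx hres hz hIz

lemma red_large {J : Ideal R} (hJ : IsReduction J I) : ∃ M0, ∀ M, M0 ≤ M → I ^ (M + 1) = J * I ^ M := by
  obtain ⟨_, r, hr⟩ := hJ
  refine ⟨r, fun M hM => ?_⟩
  obtain ⟨k, rfl⟩ := Nat.exists_eq_add_of_le hM
  rw [show r + k + 1 = (r + 1) + k by omega, pow_add, hr, pow_add, mul_assoc]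

lemma nreg (hC : Ctx I N d) (hg : PG I (N + 2) (N + 1) (Ideal.span (Set.range a')))
    (hred : IsReduction (Ideal.span (Set.range a') ⊔ Ideal.span {a}) I) {s : R}
    (hs : a * s ∈ cln (Ideal.span (Set.range a') * I ^ N) (I ^ (N + 1))) :
    s ∈ cln (Ideal.span (Set.range a') * I ^ N) (I ^ (N + 1)) := by
  set A := Ideal.span (Set.range a') with hA
  obtain ⟨M0, hM0⟩ := red_large hred
  have down : ∀ k, s ∈ cln (A * I ^ N) (I ^ (N + 1 + k)) → s ∈ cln (A * I ^ N) (I ^ (N + 1)) := by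
    intro k
    induction k with
    | zero => exact id
    | succ k ih =>
      intro h
      refine ih fun z hz => TFm hC hg hred (Ideal.mul_mem_left _ _ (Ideal.pow_le_pow_right (by omega) hz)) fun w hw => ?_
      rw [mul_left_comm]
      exact h _ (by rw [← add_assoc, pow_succ']; exact Ideal.mul_mem_mul hw hz)
  refine down (M0 + 1) ?_
  have e : I ^ (N + 1 + (M0 + 1)) = (A ⊔ Ideal.span {a}) * I ^ (N + 1 + M0) := by
    rw [← add_assoc]; exact hM0 _ (by omega)
  rw [e, ← Ideal.span_singleton_le_iff_mem, le_cln, Ideal.sup_mul, Ideal.mul_sup]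
  refine sup_le ?_ ?_
  · exact Ideal.mul_le_right.trans (Ideal.mul_mono_right (Ideal.pow_le_pow_right (by omega)))
  · rw [← Ideal.span_singleton_le_iff_mem, le_cln] at hs
    rw [← mul_assoc, Ideal.span_singleton_mul_span_singleton, mul_comm s a, pow_add I (N + 1), ← mul_assoc]
    exact Ideal.mul_le_left.trans hs

lemma min_of_split (hC : Ctx I N d) (hred : IsReduction (Ideal.span (Set.range a') ⊔ Ideal.span {a}) I) :
    IsMinimalReduction (Ideal.span (Set.range a') ⊔ Ideal.span {a}) I := by
  rw [← span_snoc] at hred ⊢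
  exact min_of_red hC.hk hC.hl _ hred

lemma core_coef (hC : Ctx I N d) (hg : PG I (N + 2) (N + 1) (Ideal.span (Set.range a')))
    (hred : IsReduction (Ideal.span (Set.range a') ⊔ Ideal.span {a}) I) {x α r : R} (hx : x ∈ core I)
    (hα : α ∈ Ideal.span (Set.range a')) (hxr : x = α + r * a) {b : R} (hb : b ∈ I) :
    ∃ t, r * b - t * a ∈ cln (Ideal.span (Set.range a') * I ^ N) (I ^ (N + 1)) := by
  classical
  set A := Ideal.span (Set.range a') with hA
  set 𝔫 := cln (A * I ^ N) (I ^ (N + 1)) with h𝔫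
  have hA𝔫 : A ≤ 𝔫 := by
    rw [le_cln]; exact Ideal.mul_mono_right (Ideal.pow_le_pow_right (by omega))
  have haI : a ∈ I := hred.1 (Ideal.mem_sup_right (Ideal.mem_span_singleton_self a))
  let π := Ideal.Quotient.mk 𝔫
  have hreg : ∀ a2, IsReduction (A ⊔ Ideal.span {a2}) I → ∀ z, π a2 * z = 0 → z = 0 := by
    intro a2 h2 z hz
    obtain ⟨z, rfl⟩ := Ideal.Quotient.mk_surjective z
    rw [← map_mul, Ideal.Quotient.eq_zero_iff_mem] at hz
    exact Ideal.Quotient.eq_zero_iff_mem.2 (nreg hC hg h2 hz)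
  obtain ⟨M, hM⟩ := hred.2
  obtain ⟨D, c, hintg⟩ := int_eq (I.map π) M (π a) (π b) (Ideal.mem_map_of_mem _ haI) (Ideal.mem_map_of_mem _ hb)
    (by
      rw [← Ideal.map_pow, hM, Ideal.map_mul, Ideal.map_sup, Ideal.map_pow, Ideal.map_span π {a}, Set.image_singleton]
      have : A.map π = ⊥ := by
        rw [eq_bot_iff, Ideal.map_le_iff_le_comap]
        intro z hz
        exact Ideal.Quotient.eq_zero_iff_mem.2 (hA𝔫 hz)
      rw [this, bot_sup_eq]) (hreg a hred)
  obtain ⟨s, hsf, hsA, hs, hsr⟩ := exch hred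
  have := hC.hk
  let σ : ResidueField R → R := Function.surjInv residue_surjective
  have hσ : ∀ k, residue R (σ k) = k := Function.surjInv_eq residue_surjective
  have hun : ∀ k k', k ≠ k' → IsUnit (σ k - σ k') := by
    intro k k' hkk
    by_contra h
    have : σ k - σ k' ∈ maximalIdeal R := h
    rw [← residue_eq_zero_iff, map_sub, hσ, hσ, sub_eq_zero] at this
    exact hkk this
  have hbad : (⋃ P ∈ s, {k | a + σ k * b ∈ P}).Finite := by
    refine hsf.biUnion fun P hP => Set.Subsingleton.finite ?_
    intro k hk k' hk'
    by_contra hne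
    have h1 : (σ k - σ k') * b ∈ P := by
      have := P.sub_mem hk hk'
      have e : a + σ k * b - (a + σ k' * b) = (σ k - σ k') * b := by ring
      rwa [e] at this
    have h2 : b ∈ P := (Ideal.unit_mul_mem_iff_mem P (hun _ _ hne)).1 h1
    have h3 : a ∈ P := (Ideal.add_mem_iff_left _ (Ideal.mul_mem_left _ _ h2)).1 hk
    exact hs P hP _ hred (sup_le (hsA P hP) ((Ideal.span_singleton_le_iff_mem P).2 h3))
  obtain ⟨S, hS, hcard⟩ := hbad.infinite_compl.exists_subset_card_eq D
  have hgood : ∀ k ∈ S, IsReduction (A ⊔ Ideal.span {a + σ k * b}) I := by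
    intro k hk
    refine hsr _ (I.add_mem haI (I.mul_mem_left _ hb)) fun P hP hmem => hS hk ?_
    exact Set.mem_biUnion hP hmem
  obtain ⟨t, ht⟩ := intercancel (π a) (π b) (π r) (fun k => π (σ k)) S
    (fun i _ j _ hij => by rw [← map_sub]; exact (hun _ _ hij).map π)
    (fun k hk => by
      have hx2 : x ∈ A ⊔ Ideal.span {a + σ k * b} := (Submodule.mem_sInf.1 hx) _ (min_of_split hC (hgood k hk))
      obtain ⟨y, hy, z, hz, hyz⟩ := Submodule.mem_sup.1 hx2
      obtain ⟨q, rfl⟩ := Ideal.mem_span_singleton'.1 hz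
      refine ⟨π q, ?_⟩
      rw [← map_mul, ← map_mul, ← map_add, ← map_mul, ← sub_eq_zero, ← map_sub, Ideal.Quotient.eq_zero_iff_mem]
      have e : r * a - (a + σ k * b) * q = y - α := by linear_combination - hxr - hyz
      rw [e]
      exact hA𝔫 (A.sub_mem hy hα))
    (fun k hk => by
      have := hreg _ (hgood k hk)
      rwa [map_add, map_mul] at this) D hcard.ge c hintg
  obtain ⟨t, rfl⟩ := Ideal.Quotient.mk_surjective t
  refine ⟨t, ?_⟩
  rw [← Ideal.Quotient.eq_zero_iff_mem, map_sub, sub_eq_zero, map_mul, map_mul]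
  rw [mul_comm _ ((Ideal.Quotient.mk 𝔫) a)]
  exact ht

lemma core_coef' (hC : Ctx I N d) (hg : PG I (N + 2) (N + 1) (Ideal.span (Set.range a')))
    (hred : IsReduction (Ideal.span (Set.range a') ⊔ Ideal.span {a}) I) {x α r : R} (hx : x ∈ core I)
    (hα : α ∈ Ideal.span (Set.range a')) (hxr : x = α + r * a) :
    r ∈ cln (Ideal.span (Set.range a') ⊔ Ideal.span {a}) I := by
  rw [← Ko_eq hC (min_of_split hC hred), ← Ideal.span_singleton_le_iff_mem, le_cln, pow_succ', ← mul_assoc]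
  rw [Ideal.mul_le]
  intro y hy z hz
  have : ∀ y ∈ Ideal.span {r} * I, y * z ∈ (Ideal.span (Set.range a') ⊔ Ideal.span {a}) * I ^ N := by
    intro y hy
    obtain ⟨b, hb, rfl⟩ := Ideal.mem_span_singleton_mul.1 hy
    obtain ⟨t, ht⟩ := core_coef hC hg hred hx hα hxr hb
    have haI : a ∈ I := hred.1 (Ideal.mem_sup_right (Ideal.mem_span_singleton_self a))
    have h1 : (r * b - t * a) * z ∈ Ideal.span (Set.range a') * I ^ N := by
      refine TFm hC hg hred ?_ fun w hw => ?_
      · rw [pow_succ']; exact Ideal.mul_mem_mul (I.sub_mem (I.mul_mem_left _ hb) (I.mul_mem_left _ haI)) hz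
      · rw [mul_left_comm]; exact ht _ (by rw [pow_succ']; exact Ideal.mul_mem_mul hw hz)
    have e : r * b * z = (r * b - t * a) * z + t * (a * z) := by ring
    rw [e]
    refine Ideal.add_mem _ (Ideal.mul_mono_left le_sup_left h1) (Ideal.mul_mem_left _ _
      (Ideal.mul_mem_mul (Ideal.mem_sup_right (Ideal.mem_span_singleton_self a)) hz))
  exact this y hy

lemma core_le (hC : Ctx I N d) {J : Ideal R} (hJ : IsMinimalReduction J I) : core I ≤ cln J I * J := by
  intro x hx
  obtain ⟨g, hg⟩ := exists_gens hC.hk hC.hl hJ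
  have hxJ : x ∈ J := Submodule.mem_sInf.1 hx _ hJ
  rw [← hg] at hxJ
  obtain ⟨v, hv⟩ := Ideal.mem_span_range_iff_exists_fun.1 hxJ
  have hgJ : ∀ i, g i ∈ J := fun i => hg ▸ Ideal.subset_span ⟨i, rfl⟩
  let f : (Fin (N + 2) → R) →ₗ[R] R := ∑ i, v i • LinearMap.proj i
  have hf : ∀ lam, f lam = ∑ i, v i * lam i := fun lam => by simp [f]
  let L : Submodule R (Fin (N + 2) → R) := Submodule.comap f (cln J I)
  suffices hL : L = ⊤ by
    rw [← hv]
    refine Ideal.sum_mem _ fun i _ => Ideal.mul_mem_mul ?_ (hgJ i)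
    have : Pi.single i (1 : R) ∈ L := by rw [hL]; trivial
    have h2 : f (Pi.single i 1) ∈ cln J I := this
    rw [hf] at h2
    simpa [Pi.single_apply] using h2
  let k := ResidueField R
  let π : (Fin (N + 2) → R) → (Fin (N + 2) → k) := fun y i => residue R (y i)
  have htop : Submodule.span k (π '' L) = ⊤ := by
    by_contra hne
    obtain ⟨q, hq0, hq⟩ := Submodule.exists_le_ker_of_lt_top _ (lt_top_iff_ne_top.2 hne)
    have hW : ∀ i, ∃ W : R, residue R W = q (Pi.single i 1) := fun i => residue_surjective _
    choose W hW using hW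
    have hqv : ∀ y : Fin (N + 2) → R, q (π y) = residue R (∑ i, y i * W i) := by
      intro y
      conv_lhs => rw [pi_eq_sum_univ' (π y)]
      simp [π, hW]
    have hne : ∃ i, W i ∉ maximalIdeal R := by
      by_contra! hcon
      refine hq0 (LinearMap.pi_ext' fun i => LinearMap.ext_ring ?_)
      have := (residue_eq_zero_iff _).2 (hcon i)
      rw [hW] at this
      simpa using this
    obtain ⟨i0, hi0⟩ := hne
    let w := ∑ i, W i * g i
    have hw : w ∈ J := J.sum_mem fun i _ => J.mul_mem_left _ (hgJ i)
    have hw' : w ∉ maximalIdeal R * I := fun h => hi0 (indep hC.hl g (hg ▸ hJ.1) W h i0)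
    obtain ⟨c, hPG, hcw⟩ := good_w hC hJ hw hw'
    have hdec : ∀ i, ∃ lam, ∃ y ∈ Ideal.span (Set.range c), g i = y + lam * w := by
      intro i
      have := hgJ i
      rw [← hcw] at this
      obtain ⟨y, hy, z, hz, hyz⟩ := Submodule.mem_sup.1 this
      obtain ⟨q, rfl⟩ := Ideal.mem_span_singleton'.1 hz
      exact ⟨q, y, hy, hyz.symm⟩
    choose lam y hy hgy using hdec
    have hlin : ∀ e : Fin (N + 2) → R, ∑ i, e i * g i = ∑ i, e i * y i + (∑ i, e i * lam i) * w := by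
      intro e
      rw [Finset.sum_mul, ← Finset.sum_add_distrib]
      refine Finset.sum_congr rfl fun i _ => ?_
      rw [hgy]; ring
    have hred : IsReduction (Ideal.span (Set.range c) ⊔ Ideal.span {w}) I := hcw ▸ hJ.1
    have hmem := core_coef' hC hPG hred hx (Ideal.sum_mem _ fun i _ => Ideal.mul_mem_left _ (v i) (hy i))
      (hv.symm.trans (hlin v))
    rw [hcw, ← hf] at hmem
    have h0 := hq (Submodule.subset_span ⟨lam, hmem, rfl⟩)
    rw [LinearMap.mem_ker, hqv, residue_eq_zero_iff] at h0
    have hww : w = ∑ i, W i * y i + (∑ i, W i * lam i) * w := hlin W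
    have hu : IsUnit (1 - ∑ i, lam i * W i) := by
      by_contra h
      have h' : 1 - ∑ i, lam i * W i ∈ maximalIdeal R := h
      have := (maximalIdeal R).add_mem h' h0
      rw [sub_add_cancel] at this
      exact (Ideal.ne_top_iff_one _).1 (maximalIdeal.isMaximal R).ne_top this
    have hwc : w ∈ Ideal.span (Set.range c) := by
      rw [← Ideal.unit_mul_mem_iff_mem _ hu]
      have e : (1 - ∑ i, lam i * W i) * w = ∑ i, W i * y i := by
        have e2 : ∑ i, lam i * W i = ∑ i, W i * lam i := Finset.sum_congr rfl fun i _ => mul_comm _ _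
        rw [e2]; linear_combination hww
      rw [e]
      exact Ideal.sum_mem _ fun i _ => Ideal.mul_mem_left _ _ (hy i)
    have hred2 : IsReduction (Ideal.span (Set.range c)) I := by
      have e : Ideal.span (Set.range c) ⊔ Ideal.span {w} = Ideal.span (Set.range c) :=
        sup_eq_left.2 ((Ideal.span_singleton_le_iff_mem _).2 hwc)
      rwa [e] at hred
    have := fd_lower hC.hl c hred2
    omega
  have hsurj : ∀ y ∈ Submodule.span k (π '' L), ∃ lam ∈ L, π lam = y := by
    intro y hy
    induction hy using Submodule.span_induction with
    | mem y h => obtain ⟨l, hl, rfl⟩ := h; exact ⟨l, hl, rfl⟩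
    | zero => exact ⟨0, L.zero_mem, by ext; simp [π]⟩
    | add y z _ _ h1 h2 =>
      obtain ⟨l, hl, rfl⟩ := h1
      obtain ⟨l', hl', rfl⟩ := h2
      exact ⟨l + l', L.add_mem hl hl', by ext; simp [π]⟩
    | smul c y _ h =>
      obtain ⟨l, hl, rfl⟩ := h
      obtain ⟨c, rfl⟩ := residue_surjective c
      exact ⟨c • l, L.smul_mem _ hl, by ext; simp [π]⟩
  rw [eq_top_iff]
  refine Submodule.le_of_le_smul_of_le_jacobson_bot (I := maximalIdeal R) Module.Finite.fg_top
    (maximalIdeal_le_jacobson ⊥) ?_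
  intro z _
  obtain ⟨lam, hlam, h⟩ := hsurj (π z) (by rw [htop]; trivial)
  rw [← add_sub_cancel lam z]
  refine Submodule.add_mem_sup hlam ?_
  rw [pi_eq_sum_univ' (z - lam)]
  refine Submodule.sum_mem _ fun i _ => Submodule.smul_mem_smul ?_ trivial
  rw [← residue_eq_zero_iff, Pi.sub_apply, map_sub, sub_eq_zero]
  exact (congrFun h i).symm

end F6
end

section
open MvPolynomial RingTheory.Sequence IsLocalRing

set_option linter.unusedSectionVars false
section EX

variable {R : Type u} [CommRing R] [IsNoetherianRing R] [IsLocalRing R] {I : Ideal R} {N d : ℕ}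
  {a a2 : R} {a' : Fin (N + 1) → R}

lemma areg (hC : Ctx I N d) (hg : PG I (N + 2) (N + 1) (Ideal.span (Set.range a')))
    (hred : IsReduction (Ideal.span (Set.range a') ⊔ Ideal.span {a}) I) {y : R} (hy : y ∈ I ^ (N + 1))
    (h : a * y ∈ Ideal.span (Set.range a') * I ^ N) : y ∈ Ideal.span (Set.range a') * I ^ N := by
  set A := Ideal.span (Set.range a') with hA
  obtain ⟨M, hM⟩ := hred.2
  have down : ∀ k, y ∈ cln (A * I ^ N) (I ^ k) → y ∈ A * I ^ N := by
    intro k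
    induction k with
    | zero =>
      intro h
      have := h 1 (by simp)
      rwa [mul_one] at this
    | succ k ih =>
      intro h
      refine ih fun z hz => TFm hC hg hred (Ideal.mul_mem_right _ _ hy) fun w hw => ?_
      rw [mul_left_comm]
      exact h _ (by rw [pow_succ']; exact Ideal.mul_mem_mul hw hz)
  refine down (M + 1) ?_
  rw [hM, ← Ideal.span_singleton_le_iff_mem, le_cln, Ideal.sup_mul, Ideal.mul_sup]
  refine sup_le ?_ ?_
  · rw [mul_left_comm]
    refine Ideal.mul_mono_right (Ideal.mul_le_left.trans ?_)
    rw [Ideal.span_singleton_le_iff_mem]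
    exact Ideal.pow_le_pow_right (by omega) hy
  · rw [← mul_assoc, Ideal.span_singleton_mul_span_singleton, mul_comm y a]
    exact Ideal.mul_le_left.trans ((Ideal.span_singleton_le_iff_mem _).2 h)

lemma areg_pow (hC : Ctx I N d) (hg : PG I (N + 2) (N + 1) (Ideal.span (Set.range a')))
    (hred : IsReduction (Ideal.span (Set.range a') ⊔ Ideal.span {a}) I) {y : R} (hy : y ∈ I ^ (N + 1)) (k : ℕ)
    (h : a ^ k * y ∈ Ideal.span (Set.range a') * I ^ N) : y ∈ Ideal.span (Set.range a') * I ^ N := by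
  induction k with
  | zero => simpa using h
  | succ k ih =>
    refine ih (areg hC hg hred (Ideal.mul_mem_left _ _ hy) ?_)
    rwa [← mul_assoc, ← pow_succ']

lemma EX1 (hC : Ctx I N d) (hg : PG I (N + 2) (N + 1) (Ideal.span (Set.range a')))
    (hred : IsReduction (Ideal.span (Set.range a') ⊔ Ideal.span {a}) I)
    (hred2 : IsReduction (Ideal.span (Set.range a') ⊔ Ideal.span {a2}) I)
    (h : I ^ (N + 2) = (Ideal.span (Set.range a') ⊔ Ideal.span {a}) * I ^ (N + 1)) :
    I ^ (N + 2) = (Ideal.span (Set.range a') ⊔ Ideal.span {a2}) * I ^ (N + 1) := by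
  set A := Ideal.span (Set.range a') with hA
  have haI : a ∈ I := hred.1 (Ideal.mem_sup_right (Ideal.mem_span_singleton_self a))
  have ha2I : a2 ∈ I := hred2.1 (Ideal.mem_sup_right (Ideal.mem_span_singleton_self a2))
  have hAN : A * I ^ (N + 1) ≤ A * I ^ N := Ideal.mul_mono_right (Ideal.pow_le_pow_right (by omega))
  have hpow : ∀ k, I ^ (k + (N + 1)) ≤ A * I ^ N ⊔ Ideal.span {a ^ k} * I ^ (N + 1) := by
    intro k
    induction k with
    | zero => simp
    | succ k ih =>
      have e : I ^ (k + 1 + (N + 1)) = I ^ (k + (N + 1)) * I := by rw [← pow_succ]; congr 1; omega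
      rw [e]
      refine (Ideal.mul_mono_left ih).trans ?_
      rw [Ideal.sup_mul, mul_assoc (Ideal.span {a ^ k}), ← pow_succ, h, Ideal.sup_mul, Ideal.mul_sup]
      refine sup_le (Ideal.mul_le_left.trans le_sup_left) (sup_le ?_ ?_)
      · exact (Ideal.mul_le_right.trans hAN).trans le_sup_left
      · rw [← mul_assoc, Ideal.span_singleton_mul_span_singleton, ← pow_succ]
        exact le_sup_right
  have hcap : ∀ z ∈ I ^ (N + 2), z ∈ A * I ^ N → z ∈ A * I ^ (N + 1) := by
    intro z hz hzA
    rw [h, Ideal.sup_mul] at hz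
    obtain ⟨α, hα, w, hw, rfl⟩ := Submodule.mem_sup.1 hz
    obtain ⟨y, hy, rfl⟩ := Ideal.mem_span_singleton_mul.1 hw
    have h1 : a * y ∈ A * I ^ N := (Ideal.add_mem_iff_right _ (hAN hα)).1 hzA
    have h2 := areg hC hg hred hy h1
    refine Ideal.add_mem _ hα ?_
    rw [mul_comm a y, pow_succ, ← mul_assoc]
    exact Ideal.mul_mem_mul h2 haI
  obtain ⟨M0, hM0⟩ := red_large hred2
  refine le_antisymm ?_ (by rw [pow_succ' I (N + 1)]; exact Ideal.mul_mono_left hred2.1)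
  rw [h, Ideal.sup_mul, Ideal.sup_mul]
  refine sup_le le_sup_left ?_
  intro w hw
  obtain ⟨z, hz, rfl⟩ := Ideal.mem_span_singleton_mul.1 hw
  have h1 : a ^ (M0 + 1) * z ∈ (A ⊔ Ideal.span {a2}) * I ^ (M0 + (N + 1)) := by
    rw [← hM0 _ (by omega), show M0 + (N + 1) + 1 = (M0 + 1) + (N + 1) by omega, pow_add I (M0 + 1)]
    exact Ideal.mul_mem_mul (Ideal.pow_mem_pow haI _) hz
  rw [Ideal.sup_mul] at h1
  obtain ⟨α, hα, w, hw, hαw⟩ := Submodule.mem_sup.1 h1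
  obtain ⟨t, ht, rfl⟩ := Ideal.mem_span_singleton_mul.1 hw
  obtain ⟨β, hβ, s, hs, rfl⟩ := Submodule.mem_sup.1 (hpow M0 ht)
  obtain ⟨y, hy, rfl⟩ := Ideal.mem_span_singleton_mul.1 hs
  have hay : a * z - a2 * y ∈ I ^ (N + 2) := by
    rw [pow_succ' I (N + 1)]
    exact Ideal.sub_mem _ (Ideal.mul_mem_mul haI hz) (Ideal.mul_mem_mul ha2I hy)
  have h3 : a * z - a2 * y ∈ A * I ^ N := by
    refine areg_pow hC hg hred (Ideal.pow_le_pow_right (by omega) hay) M0 ?_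
    have e : a ^ M0 * (a * z - a2 * y) = α + a2 * β := by
      rw [pow_succ] at hαw
      linear_combination -hαw
    rw [e]
    exact Ideal.add_mem _ (Ideal.mul_mono_right (Ideal.pow_le_pow_right (by omega)) hα) (Ideal.mul_mem_left _ _ hβ)
  have e : a * z = (a * z - a2 * y) + a2 * y := by ring
  rw [e]
  exact Submodule.add_mem_sup (hcap _ hay h3) (Ideal.mul_mem_mul (Ideal.mem_span_singleton_self a2) hy)

lemma EX2 (hC : Ctx I N d) (hg : PG I (N + 2) (N + 1) (Ideal.span (Set.range a')))
    (hred : IsReduction (Ideal.span (Set.range a') ⊔ Ideal.span {a}) I)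
    (hred2 : IsReduction (Ideal.span (Set.range a') ⊔ Ideal.span {a2}) I)
    (h : I ^ (N + 2) = (Ideal.span (Set.range a') ⊔ Ideal.span {a2}) * I ^ (N + 1)) :
    cln (Ideal.span (Set.range a') ⊔ Ideal.span {a}) I ≤ cln (Ideal.span (Set.range a') ⊔ Ideal.span {a2}) I := by
  rw [← Ko_eq hC (min_of_split hC hred), ← Ko_eq hC (min_of_split hC hred2)]
  set A := Ideal.span (Set.range a') with hA
  have haI : a ∈ I := hred.1 (Ideal.mem_sup_right (Ideal.mem_span_singleton_self a))
  have ha2I : a2 ∈ I := hred2.1 (Ideal.mem_sup_right (Ideal.mem_span_singleton_self a2))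
  have hAN : A * I ^ (N + 1) ≤ A * I ^ N := Ideal.mul_mono_right (Ideal.pow_le_pow_right (by omega))
  intro r hr z hz
  have h1 : a * z ∈ I ^ (N + 2) := by rw [pow_succ' I (N + 1)]; exact Ideal.mul_mem_mul haI hz
  rw [h, Ideal.sup_mul] at h1
  obtain ⟨α, hα, w, hw, hαw⟩ := Submodule.mem_sup.1 h1
  obtain ⟨y, hy, rfl⟩ := Ideal.mem_span_singleton_mul.1 hw
  have h2 := hr y hy
  rw [Ideal.sup_mul] at h2
  obtain ⟨β, hβ, w, hw, hβw⟩ := Submodule.mem_sup.1 h2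
  obtain ⟨t, ht, rfl⟩ := Ideal.mem_span_singleton_mul.1 hw
  have h3 : r * z - a2 * t ∈ A * I ^ N := by
    refine areg hC hg hred (Ideal.sub_mem _ (Ideal.mul_mem_left _ _ hz) ?_) ?_
    · rw [pow_succ']; exact Ideal.mul_mem_mul ha2I ht
    · have e : a * (r * z - a2 * t) = r * α + a2 * β := by
        linear_combination (-r) * hαw - a2 * hβw
      rw [e]
      exact Ideal.add_mem _ (Ideal.mul_mem_left _ _ (hAN hα)) (Ideal.mul_mem_left _ _ hβ)
  have e : r * z = (r * z - a2 * t) + a2 * t := by ring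
  rw [e, Ideal.sup_mul]
  exact Submodule.add_mem_sup h3 (Ideal.mul_mem_mul (Ideal.mem_span_singleton_self a2) ht)

lemma chain (hC : Ctx I N d) {J J0 : Ideal R} (hJ : IsMinimalReduction J I) (hJ0 : IsMinimalReduction J0 I)
    (h : I ^ (N + 2) = J * I ^ (N + 1)) : I ^ (N + 2) = J0 * I ^ (N + 1) ∧ cln J I = cln J0 I := by
  have key : ∀ k, k ≤ N + 2 → ∃ Jk, IsMinimalReduction Jk I ∧ I ^ (N + 2) = Jk * I ^ (N + 1) ∧ cln J I = cln Jk I ∧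
      ∃ b : Fin k → R, (∀ i, b i ∈ J0) ∧ (∀ i, b i ∈ Jk) ∧ PG I (N + 2) k (Ideal.span (Set.range b)) ∧ Ind I b := by
    intro k
    induction k with
    | zero =>
      intro _
      exact ⟨J, hJ, h, rfl, Fin.elim0, fun i => i.elim0, fun i => i.elim0, PG_empty hC _, Ind_empty _⟩
    | succ k ih =>
      intro hk
      obtain ⟨Jk, hJk, h1, h2, b, hb0, hbk, hPG, hind⟩ := ih (by omega)
      have hbI : ∀ i, b i ∈ I := fun i => hJ0.1.1 (hb0 i)
      obtain ⟨w, hw, hw'⟩ := exists_w hC hJk.1 b hbI (by omega)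
      obtain ⟨c, hcJ, hcPG, hcw, -, hbc⟩ := good_ext' hC hJk (by omega) hw b hbk hPG hind hw' (fun _ _ => True) trivial
        (fun s _ _ c _ _ _ _ => ⟨∅, Set.finite_empty, by simp, fun _ _ _ => trivial⟩)
      subst hcw
      obtain ⟨s, hsf, hsA, hs, hsr⟩ := exch hJk.1
      obtain ⟨s', hsf', hsA', hs', hsr'⟩ := PG_step hC.hP hC.h0 hPG
      obtain ⟨x, hx, hxs⟩ := avoid hC.hk J0 (s ∪ s' ∪ {Ideal.span (Set.range b) ⊔ maximalIdeal R * I})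
        ((hsf.union hsf').union (Set.finite_singleton _)) (by
          rintro P ((hP | hP) | rfl)
          · exact hs P hP _ hJ0.1
          · exact hs' P hP _ hJ0.1
          · exact not_le_small hC hJ0.1 b hbI (by omega))
      have hxI := hJ0.1.1 hx
      have hred2 := hsr x hxI fun P hP => hxs P (Or.inl (Or.inl hP))
      have hE1 := EX1 hC hcPG hJk.1 hred2 h1
      refine ⟨_, min_of_split hC hred2, hE1, h2.trans (le_antisymm (EX2 hC hcPG hJk.1 hred2 hE1)
        (EX2 hC hcPG hred2 hJk.1 h1)), Fin.snoc b x, ?_, ?_, ?_, ?_⟩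
      · intro i
        refine Fin.lastCases ?_ (fun i => ?_) i
        · simpa using hx
        · simpa using hb0 i
      · intro i
        refine Fin.lastCases ?_ (fun i => ?_) i
        · simpa using Ideal.mem_sup_right (Ideal.mem_span_singleton_self x)
        · simpa using Ideal.mem_sup_left (hbc (Ideal.subset_span ⟨i, rfl⟩))
      · rw [span_snoc]
        exact hsr' x hxI fun P hP => hxs P (Or.inl (Or.inr hP))
      · exact Ind_snoc hind hxI (hxs _ (Or.inr rfl))
  obtain ⟨Jk, hJk, h1, h2, b, hb0, hbk, -, hind⟩ := key _ le_rfl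
  have e1 := min_eq_span hC hJ0 b hb0 hind
  have e2 := min_eq_span hC hJk b hbk hind
  rw [← e1, e2]
  exact ⟨h1, h2⟩

lemma cramer_gen {n : ℕ} (x : Fin n → R) (hx : Ideal.span (Set.range x) = I) (t : Finset (Fin n)) (v : Fin d → Fin n → R)
    (hv : ∀ j, ∑ k, v j k * x k = 0) (r : Fin d → Fin n) (hr : Function.Injective r) (ht : ∀ k, k ∈ t ∨ ∃ i, r i = k)
    (hrt : ∀ i, r i ∉ t) :
    (Matrix.of fun i j => v j (r i)).det ∈ cln (Ideal.span (x '' t)) I := by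
  set M : Matrix (Fin d) (Fin d) R := Matrix.of fun i j => v j (r i) with hM
  have key : ∀ k, x k * M.det ∈ Ideal.span (x '' t) := by
    intro k
    rcases ht k with hk | ⟨i0, rfl⟩
    · exact Ideal.mul_mem_right _ _ (Ideal.subset_span ⟨k, hk, rfl⟩)
    have h1 : ∑ k, (∑ j, M.adjugate j i0 * v j k) * x k = 0 := by
      simp only [Finset.sum_mul]
      rw [Finset.sum_comm]
      refine Finset.sum_eq_zero fun j _ => ?_
      simp only [mul_assoc]
      rw [← Finset.mul_sum, hv, mul_zero]
    have h2 : ∀ i, ∑ j, M.adjugate j i0 * v j (r i) = if i = i0 then M.det else 0 := by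
      intro i
      have := congrFun (congrFun (Matrix.mul_adjugate M) i) i0
      rw [Matrix.mul_apply, Matrix.smul_apply, Matrix.one_apply] at this
      simp only [smul_eq_mul, mul_ite, mul_one, mul_zero] at this
      rw [← this]
      exact Finset.sum_congr rfl fun j _ => mul_comm _ _
    rw [← Finset.add_sum_erase _ _ (Finset.mem_univ (r i0)), h2, if_pos rfl] at h1
    rw [mul_comm, eq_neg_of_add_eq_zero_left h1]
    refine neg_mem (Ideal.sum_mem _ fun k hk => ?_)
    rcases ht k with hk' | ⟨i, rfl⟩
    · exact Ideal.mul_mem_left _ _ (Ideal.subset_span ⟨k, hk', rfl⟩)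
    · have hne : i ≠ i0 := fun h => (Finset.mem_erase.1 hk).1 (by rw [h])
      rw [h2, if_neg hne, zero_mul]; exact Ideal.zero_mem _
  intro z hz
  rw [← hx] at hz
  obtain ⟨c, rfl⟩ := Ideal.mem_span_range_iff_exists_fun.1 hz
  rw [Finset.mul_sum]
  refine Ideal.sum_mem _ fun k _ => ?_
  have := Ideal.mul_mem_left _ (c k) (key k)
  convert this using 1
  ring

lemma min_of_finset (hC : Ctx I N d) {n : ℕ} (x : Fin n → R) (t : Finset (Fin n)) (ht : t.card = N + 2)
    (h : IsReduction (Ideal.span (x '' t)) I) : IsMinimalReduction (Ideal.span (x '' t)) I := by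
  have e : x '' t = Set.range (fun i => x (t.equivFinOfCardEq ht |>.symm i)) := by
    ext y
    constructor
    · rintro ⟨k, hk, rfl⟩
      exact ⟨t.equivFinOfCardEq ht ⟨k, hk⟩, by simp⟩
    · rintro ⟨i, rfl⟩
      exact ⟨_, ((t.equivFinOfCardEq ht).symm i).2, rfl⟩
  rw [e] at h ⊢
  exact min_of_red hC.hk hC.hl _ h

lemma Fi_le_cln (hC : Ctx I N d) {J : Ideal R} (hJ : IsMinimalReduction J I) (h : I ^ (N + 2) = J * I ^ (N + 1)) :
    Fi I (d + (N + 2)) d ≤ cln J I := by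
  obtain ⟨y, hy⟩ := hC.hy
  obtain ⟨x, hx, hxt⟩ := gen_basis hC.hk hC.hl hC.hmu y hy
  refine Fi_le hC x hx _ fun v hv r => ?_
  by_cases hr : Function.Injective r
  · set t : Finset (Fin (d + (N + 2))) := (Finset.univ.image r)ᶜ with ht
    have hcard : t.card = N + 2 := by
      rw [ht, Finset.card_compl, Finset.card_image_of_injective _ hr]; simp
    rw [(chain hC hJ (min_of_finset hC x t hcard (hxt t hcard)) h).2]
    refine cramer_gen x hx t v hv r hr (fun k => ?_) (fun i => by simp [ht])
    by_cases hk : k ∈ t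
    · exact Or.inl hk
    · right
      simpa [ht] using hk
  · obtain ⟨i, j, hij, hne⟩ := Function.not_injective_iff.1 hr
    have : (Matrix.of fun i j => v j (r i)).det = 0 := Matrix.det_zero_of_row_eq hne (by ext k; simp [hij])
    rw [this]
    exact Ideal.zero_mem _

lemma core_eq_of_red (hC : Ctx I N d) {J : Ideal R} (hJ : IsMinimalReduction J I) (h : I ^ (N + 2) = J * I ^ (N + 1)) :
    core I = Fi I (d + (N + 2)) d * I := by
  refine le_antisymm ((core_le hC hJ).trans (Ideal.mul_mono (Ko_le_Fi hC hJ) hJ.1.1)) (le_sInf fun J0 hJ0 => ?_)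
  rw [← le_cln]
  exact Fi_le_cln hC hJ0 (chain hC hJ hJ0 h).1

end EX
end

section
open MvPolynomial RingTheory.Sequence IsLocalRing ExteriorAlgebra

set_option linter.unusedSectionVars false
section CV

lemma qp_diff {R : Type u} [CommRing R] {ρ τ : Type} [Fintype ρ] [DecidableEq ρ] [Fintype τ] [DecidableEq τ]
    (x : ρ ⊕ τ → R) {P : MvPolynomial (ρ ⊕ τ) R} {m : ℕ} (hP : P.IsHomogeneous (m + 1)) :
    aeval x P - aeval (fun r => x (Sum.inl r)) (qp P) ∈
      Ideal.span (Set.range fun j => x (Sum.inr j)) * Ideal.span (Set.range x) ^ m := by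
  have h1 : ∀ s : ρ ⊕ τ →₀ ℕ, ∀ c : R, s.degree = m + 1 →
      aeval x (monomial s c) - aeval (fun r => x (Sum.inl r)) (qp (monomial s c)) ∈
      Ideal.span (Set.range fun j => x (Sum.inr j)) * Ideal.span (Set.range x) ^ m := by
    intro s c hs
    by_cases h : ∃ j, s (Sum.inr j) ≠ 0
    · obtain ⟨j, hj⟩ := h
      have e : s = Finsupp.single (Sum.inr j) 1 + (s - Finsupp.single (Sum.inr j) 1) :=
        (add_tsub_cancel_of_le (by
          rw [Finsupp.single_le_iff]
          omega)).symm
      have hd : (s - Finsupp.single (Sum.inr j) 1).degree = m := by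
        have : s.degree = 1 + (s - Finsupp.single (Sum.inr j) 1).degree := by
          conv_lhs => rw [e]
          rw [map_add, Finsupp.degree_single]
        omega
      have e2 : monomial s c = X (Sum.inr j) * monomial (s - Finsupp.single (Sum.inr j) 1) c := by
        rw [X, monomial_mul, one_mul, ← e]
      rw [e2, map_mul, map_mul, map_mul, qp_inr, map_zero, zero_mul, sub_zero, aeval_X]
      exact Ideal.mul_mem_mul (Ideal.subset_span ⟨j, rfl⟩)
        ((mem_pow_iff x _).2 ⟨_, isHomogeneous_monomial _ hd, rfl⟩)
    · push Not at h
      have : aeval (fun r => x (Sum.inl r)) (qp (monomial s c)) = aeval x (monomial s c) := by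
        rw [qp, aeval_monomial, aeval_monomial, map_mul, AlgHom.commutes, Finsupp.prod_fintype _ _ (by simp),
          Finsupp.prod_fintype _ _ (by simp), map_prod]
        congr 1
        refine Finset.prod_congr rfl fun k _ => ?_
        rcases k with k | k
        · simp
        · simp [h]
      rw [this, sub_self]
      exact Ideal.zero_mem _
  rw [P.as_sum, map_sum, map_sum, map_sum, ← Finset.sum_sub_distrib]
  refine Ideal.sum_mem _ fun s hs => h1 s _ ?_
  have := hP (mem_support_iff.1 hs)
  rw [Finsupp.degree_eq_weight_one]; exact this

variable {R : Type u} [CommRing R] [IsNoetherianRing R] [IsLocalRing R] {I : Ideal R} {N d : ℕ}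

lemma reix {b : Fin d → R} {a : R} {a' : Fin (N + 1) → R} {φ : Ix N d → Module.Dual R (Fin (d + N + 1) → R)}
    (hx : Ideal.span (Set.range (gx b a a')) = I) (hres : Res (gx b a a') φ) :
    ∃ (x' : Fin d ⊕ (Unit ⊕ Fin (N + 1)) → R) (φ' : Fin d ⊕ (Unit ⊕ Fin (N + 1)) → Module.Dual R (Fin (d + N + 1) → R)),
      Res x' φ' ∧ Ideal.span (Set.range x') = I ∧
      Ideal.span (Set.range fun j => x' (Sum.inr j)) = Ideal.span (Set.range a') ⊔ Ideal.span {a} ∧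
      (fun r => x' (Sum.inl r)) = b ∧ (fun r => φ' (Sum.inl r)) = fun r => φ (Sum.inl (Sum.inl r)) := by
  set J := Ideal.span (Set.range a') ⊔ Ideal.span {a} with hJd
  set E := Equiv.sumAssoc (Fin d) Unit (Fin (N + 1)) with hE
  set x' : Fin d ⊕ (Unit ⊕ Fin (N + 1)) → R := fun k => gx b a a' (E.symm k) with hx'
  set φ' : Fin d ⊕ (Unit ⊕ Fin (N + 1)) → Module.Dual R (Fin (d + N + 1) → R) := fun k => φ (E.symm k) with hφ'
  have hres' : Res x' φ' := by
    refine ⟨fun u => by rw [← hres.1 u]; exact E.symm.sum_comp fun k => φ k u * gx b a a' k, fun v hv => ?_⟩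
    obtain ⟨u, hu⟩ := hres.2 (fun k => v (E k)) (by
      rw [← hv, ← E.symm.sum_comp]
      exact Finset.sum_congr rfl fun k _ => by simp [hx'])
    exact ⟨u, fun k => by rw [hφ', ← hu]; simp⟩
  have hxI : Ideal.span (Set.range x') = I := by
    rw [← hx]
    congr 1
    exact E.symm.surjective.range_comp (gx b a a')
  have hJ' : Ideal.span (Set.range fun j => x' (Sum.inr j)) = J := by
    rw [hJd, sup_comm, ← Ideal.span_union]
    congr 1
    ext r
    constructor
    · rintro ⟨j | j, rfl⟩
      · exact Or.inl rfl
      · exact Or.inr ⟨j, rfl⟩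
    · rintro (h | ⟨j, rfl⟩)
      · exact ⟨Sum.inl (), h.symm⟩
      · exact ⟨Sum.inr j, rfl⟩
  exact ⟨x', φ', hres', hxI, hJ', rfl, rfl⟩

lemma gI_evalJ {b : Fin d → R} {a : R} {a' : Fin (N + 1) → R} {φ : Ix N d → Module.Dual R (Fin (d + N + 1) → R)}
    (hx : Ideal.span (Set.range (gx b a a')) = I) (hres : Res (gx b a a') φ) {h : MvPolynomial (Fin d) R} {m : ℕ}
    (hh : h.IsHomogeneous (m + 1)) (hg : h ∈ gI (fun r => φ (Sum.inl (Sum.inl r)))) :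
    aeval b h ∈ (Ideal.span (Set.range a') ⊔ Ideal.span {a}) * I ^ m := by
  obtain ⟨x', φ', hres', hxI, hJ', hb, hφ⟩ := reix hx hres
  have := gI_eval hres' hh (hφ ▸ hg)
  rwa [hJ', hxI, hb] at this

lemma sup_pow_le {I B J : Ideal R} (hIb : I = B ⊔ J) (m : ℕ) : I ^ m ≤ B ^ m ⊔ J * I ^ (m - 1) := by
  rcases m with _ | m
  · simp
  induction m with
  | zero => simpa using hIb.le
  | succ m ih =>
    rw [pow_succ' I (m + 1)]
    refine (Ideal.mul_mono_right ih).trans ?_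
    rw [Ideal.mul_sup]
    refine sup_le ?_ (le_sup_of_le_right ?_)
    · conv_lhs => rw [hIb]
      rw [Ideal.sup_mul]
      refine sup_le (le_sup_of_le_left (pow_succ' _ _).ge) (le_sup_of_le_right (Ideal.mul_mono_right ?_))
      exact Ideal.pow_right_mono (hIb.ge.trans' le_sup_left) _
    · rw [mul_left_comm, ← pow_succ']
      simp

lemma red_of_core (hC : Ctx I N d) {J : Ideal R} (hJ : IsMinimalReduction J I)
    (h : core I = Fi I (d + (N + 2)) d * I) : I ^ (N + 2) = J * I ^ (N + 1) := by
  have hFJ : Fi I (d + (N + 2)) d ≤ cln J I := by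
    rw [le_cln, ← h]
    exact sInf_le hJ
  obtain ⟨a', a, hg, rfl⟩ := exists_good hC hJ
  obtain ⟨b, φ, hx, hres⟩ := exists_res hC hJ.1
  set J := Ideal.span (Set.range a') ⊔ Ideal.span {a} with hJd
  obtain ⟨x', φ', hres', hxI, hJ', hxb, hφb⟩ := reix hx hres
  obtain ⟨ys, hyl, hym, hys⟩ := hC.hH _ (N + 2) (hidJ hC hx hres hJ.1)
  rw [← hφb] at hym
  have hb : ∀ i : Fin d, ∀ h : MvPolynomial (Fin d) R, h.IsHomogeneous (N + 1) → b i * aeval b h ∈ J * I ^ (N + 1) := by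
    intro i h hh
    obtain ⟨P, hP, hP0, hPg⟩ := KB0 φ' (List.finRange d) (List.nodup_finRange d) (List.mem_finRange) (N + 1)
      (by simp; omega) ys hys hym hyl.ge i (fun j s => by
        have hr : s (Dc (φ' (Sum.inr j)) (DL (((List.finRange d).erase i).map fun r => φ' (Sum.inl r)) (om R (d + N + 1)))) ∈
            Fi I (d + (N + 2)) d := by
          set l : List (Fin d ⊕ (Unit ⊕ Fin (N + 1))) := Sum.inr j :: ((List.finRange d).erase i).map Sum.inl with hl
          have hlen : l.length = d := by
            have := i.2
            rw [hl, List.length_cons, List.length_map, List.length_erase_of_mem (List.mem_finRange i)]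
            simp
            omega
          have e : Dc (φ' (Sum.inr j)) (DL (((List.finRange d).erase i).map fun r => φ' (Sum.inl r)) (om R (d + N + 1))) =
              DL (l.map φ') (om R (d + N + 1)) := by
            rw [hl, List.map_cons, DL_cons, List.map_map]; rfl
          have e2 : l.map φ' = List.ofFn fun k : Fin d => φ' (l.get (k.cast hlen.symm)) := by
            refine List.ext_get (by simp [hlen]) fun n h1 h2 => by simp
          rw [e, e2]
          refine DL_minor _ _ s _ fun c => ?_
          exact mem_Fi (by simp; omega) x' hxI (fun j k => φ' k (Pi.single (c j) 1)) (fun j => hres'.1 _)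
            (fun k => l.get (k.cast hlen.symm))
        rw [hφb] at hr ⊢
        exact Ko_Psi hC hg hx hres hJ.1 (cln_le_Ko _ _ (hFJ hr))) x' hres'.1 h hh
    have hh' : (X i * h).IsHomogeneous (N + 1 + 1) := by
      rw [mul_comm]; exact hh.mul (isHomogeneous_X _ _)
    have h1 := gI_eval hres' (hh'.sub (qp_hom hP)) hPg
    have h2 := qp_diff x' hP
    rw [hP0, zero_sub, hJ', hxI, hxb] at h2
    rw [hJ', hxI, map_sub, map_mul, aeval_X, hxb] at h1
    have := sub_mem h1 h2
    rw [sub_neg_eq_add, sub_add_cancel] at this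
    rw [← congrFun hxb]; exact this
  have hIb : I = Ideal.span (Set.range b) ⊔ J := hx.symm.trans (span_gx b a a')
  have hpow := sup_pow_le hIb
  refine le_antisymm ((hpow (N + 2)).trans (sup_le ?_ le_rfl)) ?_
  · rw [pow_succ', Ideal.mul_le]
    intro y hy z hz
    obtain ⟨p, hp, rfl⟩ := (mem_pow_iff b z).1 hz
    obtain ⟨c, rfl⟩ := Ideal.mem_span_range_iff_exists_fun.1 hy
    rw [Finset.sum_mul]
    refine Ideal.sum_mem _ fun k _ => ?_
    rw [mul_assoc]
    exact Ideal.mul_mem_left _ _ (hb k p hp)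
  · rw [pow_succ' I (N + 1)]
    exact Ideal.mul_mono_left hJ.1.1
end CV
end

section
open MvPolynomial RingTheory.Sequence IsLocalRing ExteriorAlgebra

set_option linter.unusedSectionVars false
section F1
variable {R : Type u} [CommRing R] [IsNoetherianRing R] [IsLocalRing R] {I : Ideal R} {N d : ℕ}

/-- associated primes of `I ^ (N+1) / J I ^ N` have height at most `N + 2` -/
lemma ass_height (hC : Ctx I N d) {J : Ideal R} (hJ : IsMinimalReduction J I) {z : R} (hz : z ∈ I ^ (N + 1))
    (hz' : z ∉ J * I ^ N) (p : Ideal R) [hp : p.IsPrime] (hpz : ∀ r ∈ p, r * z ∈ J * I ^ N) :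
    p.height ≤ ((N + 2 : ℕ) : ℕ∞) := by
  by_contra hcon
  have hcon : ((N + 3 : ℕ) : ℕ∞) ≤ p.height := by
    have := Order.add_one_le_of_lt (not_le.1 hcon)
    exact_mod_cast this
  obtain ⟨zs, hzl, hzm, hzs⟩ := hC.hH p (N + 3) fun q _ hle => hcon.trans (Ideal.height_mono hle)
  obtain ⟨a', a, hg, rfl⟩ := exists_good hC hJ
  obtain ⟨b, φ, hx, hres⟩ := exists_res hC hJ.1
  obtain ⟨ys, hyl, hym, hys⟩ := hC.hH _ (N + 2) (hidJ hC hx hres hJ.1)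
  obtain ⟨z1, hz1, j, hj, rfl⟩ := Submodule.mem_sup.1 (sup_pow_le (hx.symm.trans (span_gx b a a')) _ hz)
  obtain ⟨h, hh, rfl⟩ := (mem_pow_iff b _).1 hz1
  refine hz' (Ideal.add_mem _ (gI_evalJ hx hres hh ?_) hj)
  refine K2 (fun r => φ (Sum.inl (Sum.inl r))) (N + 1) (by simp; omega) (by omega) ys hys hym hyl.ge zs hzs (by omega) h hh
    fun r hr => SYM hC hg hx hres (hh.C_mul r) ?_
  rw [map_mul, algHom_C]
  have := sub_mem (hpz r (hzm r hr)) (Ideal.mul_mem_left _ r hj)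
  rw [← mul_sub, add_sub_cancel_right] at this
  exact this

lemma mem_of_mul (hC : Ctx I N d) {J : Ideal R} (hJ : IsMinimalReduction J I) {y : R} (hy : y ∈ I)
    (h : ∀ z ∈ I ^ N, y * z ∈ J * I ^ N) : y ∈ J := by
  obtain ⟨a', a, hg, rfl⟩ := exists_good hC hJ
  obtain ⟨b, φ, hx, hres⟩ := exists_res hC hJ.1
  obtain ⟨ys, hyl, hym, hys⟩ := hC.hH _ (N + 2) (hidJ hC hx hres hJ.1)
  have hIb := hx.symm.trans (span_gx b a a')
  obtain ⟨x', φ', hres', hxI, hJ', hxb, hφb⟩ := reix hx hres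
  rw [hIb] at hy
  obtain ⟨y1, hy1, j, hj, rfl⟩ := Submodule.mem_sup.1 hy
  obtain ⟨c, rfl⟩ := Ideal.mem_span_range_iff_exists_fun.1 hy1
  obtain ⟨v, hv⟩ := Kylem (fun r => φ (Sum.inl (Sum.inl r))) N (by simp; omega) ys hys hym hyl.ge c fun p hp => by
    refine SYM hC hg hx hres ?_ ?_
    · rw [mul_comm]
      refine hp.mul (IsHomogeneous.sum _ _ _ fun k _ => ?_)
      rw [smul_eq_C_mul]
      exact (isHomogeneous_X _ _).C_mul _
    · have hpI : aeval b p ∈ I ^ N := Ideal.pow_right_mono (hIb.ge.trans' le_sup_left) _ ((mem_pow_iff b _).2 ⟨p, hp, rfl⟩)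
      have := sub_mem (h _ hpI) (Ideal.mul_mem_mul hj hpI)
      rw [← sub_mul, add_sub_cancel_right] at this
      rw [map_mul, map_sum]
      simpa using this
  refine Ideal.add_mem _ ?_ hj
  have h0 := hres'.1 v
  rw [Fintype.sum_sum_type] at h0
  have e : ∑ i, c i * b i = ∑ i, φ' (Sum.inl i) v * x' (Sum.inl i) := by
    refine Finset.sum_congr rfl fun i _ => ?_
    rw [hv, ← hxb, ← congrFun hφb]
  rw [e, eq_neg_of_add_eq_zero_left h0, ← hJ']
  exact neg_mem (Ideal.sum_mem _ fun i _ => Ideal.mul_mem_left _ _ (Ideal.subset_span ⟨i, rfl⟩))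

end F1
end

section
open MvPolynomial RingTheory.Sequence IsLocalRing

set_option linter.unusedSectionVars false
section F2
variable {R : Type u} [CommRing R] [IsNoetherianRing R] [IsLocalRing R] {I : Ideal R} {N d : ℕ}

/-- evaluation of linear forms at the generators -/
noncomputable def Lg {n : ℕ} (g : Fin n → R) : (Fin n → R) →ₗ[R] R := ∑ j, g j • LinearMap.proj j

lemma Lg_apply {n : ℕ} (g l : Fin n → R) : Lg g l = ∑ j, l j * g j := by
  simp [Lg, mul_comm]

lemma nakg (hC : Ctx I N d) (g : Fin (N + 2) → R) (hg : IsReduction (Ideal.span (Set.range g)) I)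
    (P : Submodule R (Fin (N + 2) → R)) (h : ∀ j, g j ∈ P.map (Lg g)) : P = ⊤ := by
  refine top_le_iff.1 (Submodule.le_of_le_smul_of_le_jacobson_bot (I := maximalIdeal R)
    (Module.Finite.fg_top) (maximalIdeal_le_jacobson _) ?_)
  have hm : ∀ x : Fin (N + 2) → R, (∀ i, x i ∈ maximalIdeal R) → x ∈ maximalIdeal R • (⊤ : Submodule R (Fin (N + 2) → R)) := by
    intro x hx
    rw [pi_eq_sum_univ' x]
    exact Submodule.sum_mem _ fun i _ => Submodule.smul_mem_smul (hx i) trivial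
  have hs : ∀ j, Pi.single j (1 : R) ∈ P ⊔ maximalIdeal R • (⊤ : Submodule R (Fin (N + 2) → R)) := by
    intro j
    obtain ⟨l, hl, hlj⟩ := h j
    rw [← add_sub_cancel l (Pi.single j (1 : R))]
    refine Submodule.add_mem_sup hl (hm _ fun i => ?_)
    refine indep hC.hl g hg _ ?_ i
    have : ∑ i, ((Pi.single j (1 : R) - l : Fin (N + 2) → R) i) * g i = 0 := by
      rw [← Lg_apply, map_sub, hlj, Lg_apply]
      simp [Pi.single_apply]
    rw [this]
    exact Ideal.zero_mem _
  intro x _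
  rw [pi_eq_sum_univ' x]
  exact Submodule.sum_mem _ fun i _ => Submodule.smul_mem _ _ (hs i)

lemma spec (hC : Ctx I N d) {J : Ideal R} (hJ : IsMinimalReduction J I) (g : Fin (N + 2) → R)
    (hgJ : Ideal.span (Set.range g) = J) (p : Ideal R) [hp : p.IsPrime] (G : MvPolynomial (Fin (N + 2)) R) {M : ℕ}
    (hG : G.IsHomogeneous M) (hGp : map (algebraMap R p.ResidueField) G ≠ 0) :
    ∃ (c : Fin (N + 1) → R) (w : R), PG I (N + 2) (N + 1) (Ideal.span (Set.range c)) ∧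
      Ideal.span (Set.range c) ⊔ Ideal.span {w} = J ∧ ∃ μ : Fin (N + 2) → R,
        (∀ j, g j - μ j * w ∈ Ideal.span (Set.range c)) ∧ eval μ G ∉ p := by
  classical
  set κ := p.ResidueField with hκ
  have hker : ∀ r : R, algebraMap R κ r = 0 ↔ r ∈ p := fun r => by
    exact Ideal.algebraMap_residueField_eq_zero
  have hinf : Infinite κ := by
    have := hC.hk
    refine Infinite.of_injective (fun k : ResidueField R => algebraMap R κ (Function.surjInv residue_surjective k)) ?_
    intro k k' h
    have h : algebraMap R κ (Function.surjInv residue_surjective k) = algebraMap R κ (Function.surjInv residue_surjective k') := h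
    rw [← sub_eq_zero, ← map_sub, hker] at h
    have := (residue_eq_zero_iff _).2 (le_maximalIdeal hp.ne_top h)
    rwa [map_sub, Function.surjInv_eq residue_surjective, Function.surjInv_eq residue_surjective, sub_eq_zero] at this
  set Gk := map (algebraMap R κ) G with hGk
  have hgI : IsReduction (Ideal.span (Set.range g)) I := hgJ ▸ hJ.1
  obtain ⟨v0, hv0⟩ : ∃ v, eval v Gk ≠ 0 := by
    by_contra! h
    exact hGp (funext fun v => by rw [h v, map_zero])
  let ev : (Fin (N + 2) → κ) → (Fin (N + 2) → R) →ₗ[R] κ := fun v => ∑ j, (LinearMap.toSpanSingleton R κ (v j)) ∘ₗ LinearMap.proj j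
  have hev : ∀ v l, ev v l = ∑ j, algebraMap R κ (l j) * v j := by
    intro v l
    simp [ev, Algebra.smul_def]
  have hsurj : ∀ b ∈ J, ∃ l, b = Lg g l := by
    intro b hb
    rw [← hgJ] at hb
    obtain ⟨l, hl⟩ := Ideal.mem_span_range_iff_exists_fun.1 hb
    exact ⟨l, by rw [Lg_apply, hl]⟩
  have hprop : ∀ e : Fin (N + 2) → κ, e ≠ 0 → ¬ J ≤ (LinearMap.ker (ev e)).map (Lg g) := by
    intro e he hle
    have := nakg hC g hgI _ fun j => hle (hgJ ▸ Ideal.subset_span ⟨j, rfl⟩)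
    refine he (_root_.funext fun j => ?_)
    have h1 : Pi.single j (1 : R) ∈ LinearMap.ker (ev e) := by rw [this]; trivial
    rw [LinearMap.mem_ker, hev] at h1
    rw [Finset.sum_eq_single j (fun i _ hi => by simp [hi]) (by simp)] at h1
    simpa using h1
  obtain ⟨w, hwJ, hw⟩ := exists_w hC hJ.1 (Fin.elim0 : Fin 0 → R) (fun i => i.elim0) (by omega)
  obtain ⟨c, -, hPG, hcw, ⟨lin, hlin, v, hv, hvG⟩, -⟩ := good_ext' hC hJ (Nat.zero_le _) hwJ Fin.elim0 (fun i => i.elim0) (PG_empty hC _) (Ind_empty _) hw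
    (fun s c => ∃ lin : Fin s → Fin (N + 2) → R, (∀ i, c i = Lg g (lin i)) ∧ ∃ v : Fin (N + 2) → κ,
      (∀ i, ev v (lin i) = 0) ∧ eval v Gk ≠ 0) ⟨Fin.elim0, fun i => i.elim0, v0, fun i => i.elim0, hv0⟩ (by
    rintro s - hsN c hc - - ⟨lin, hlin, v, hv, hvG⟩
    obtain ⟨u, hu, huv⟩ : ∃ u, (∀ i, ev u (lin i) = 0) ∧ u ∉ Submodule.span κ {v} := by
      let T : (Fin (N + 2) → κ) →ₗ[κ] (Fin s → κ) := Matrix.toLin' (Matrix.of fun i j => algebraMap R κ (lin i j))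
      have hT : ∀ u i, T u i = ev u (lin i) := by
        intro u i
        rw [hev, Matrix.toLin'_apply]; rfl
      by_contra! hcon
      have h1 : LinearMap.ker T ≤ Submodule.span κ {v} := fun u hu => hcon u fun i => by
        rw [← hT, LinearMap.mem_ker.1 hu]; rfl
      have h2 := Submodule.finrank_mono h1
      have h3 := LinearMap.finrank_range_add_finrank_ker T
      have h4 := (LinearMap.range T).finrank_le
      have h5 := finrank_span_le_card (R := κ) {v}
      simp at h3 h4 h5
      omega
    set H : Polynomial κ := aeval (fun j => Polynomial.C (v j) - Polynomial.X * Polynomial.C (u j)) Gk with hH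
    have hHe : ∀ y, H.eval y = eval (v - y • u) Gk := by
      intro y
      rw [hH, ← Polynomial.coe_aeval_eq_eval, comp_aeval_apply, ← coe_aeval_eq_eval]
      have e : (fun j => (Polynomial.aeval y) (Polynomial.C (v j) - Polynomial.X * Polynomial.C (u j))) = v - y • u := by
        ext j
        simp
        ring
      rw [e]
      rfl
    have hH0 : H ≠ 0 := by
      intro h
      have := hHe 0
      rw [h] at this
      simp at this
      exact hvG this.symm
    refine ⟨insert ((LinearMap.ker (ev u)).map (Lg g)) ((fun y => (LinearMap.ker (ev (v - y • u))).map (Lg g)) '' (H.roots.toFinset : Set κ)),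
      ((Finset.finite_toSet _).image _).insert _, ?_, ?_⟩
    · rintro K (rfl | ⟨y, hy, rfl⟩)
      · exact hprop u fun h => huv (h ▸ zero_mem _)
      · refine hprop _ fun h => ?_
        have hy : H.eval y = 0 := by simpa [hH0] using hy
        rw [sub_eq_zero] at h
        rcases eq_or_ne y 0 with rfl | hy0
        · rw [hHe] at hy
          simp at hy
          exact hvG hy
        · exact huv (Submodule.mem_span_singleton.2 ⟨y⁻¹, by rw [h, smul_smul, inv_mul_cancel₀ hy0, one_smul]⟩)
    · intro b hb hbS
      obtain ⟨l, rfl⟩ := hsurj b hb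
      have hlu : ev u l ≠ 0 := fun h => hbS _ (Set.mem_insert _ _) ⟨l, h, rfl⟩
      have hlin' : ∀ y x, ev (v - y • u) x = ev v x - y * ev u x := by
        intro y x
        rw [hev, hev, hev, Finset.mul_sum, ← Finset.sum_sub_distrib]
        refine Finset.sum_congr rfl fun j _ => ?_
        simp
        ring
      set y := ev v l / ev u l with hy
      have hly : ev (v - y • u) l = 0 := by rw [hlin', hy, div_mul_cancel₀ _ hlu, sub_self]
      refine ⟨Fin.snoc lin l, fun i => ?_, v - y • u, fun i => ?_, fun h => ?_⟩
      · refine Fin.lastCases ?_ (fun i => ?_) i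
        · simp
        · simp [hlin]
      · refine Fin.lastCases ?_ (fun i => ?_) i
        · rw [Fin.snoc_last]; exact hly
        · rw [Fin.snoc_castSucc, hlin', hv, hu, mul_zero, sub_zero]
      · refine hbS _ (Set.mem_insert_of_mem _ ⟨y, ?_, rfl⟩) ⟨l, hly, rfl⟩
        simp [hH0, hHe, h])
  obtain ⟨ω, rfl⟩ := hsurj w hwJ
  have htop := nakg hC g hgI (Submodule.span R (Set.range lin) ⊔ Submodule.span R {ω}) fun j => by
    have : g j ∈ Ideal.span (Set.range c) ⊔ Ideal.span {Lg g ω} := by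
      rw [hcw, ← hgJ]; exact Ideal.subset_span ⟨j, rfl⟩
    rw [Submodule.map_sup, Submodule.map_span, Submodule.map_span, Set.image_singleton, ← Set.range_comp]
    convert this using 3
    congr 1
    ext i
    exact (hlin i).symm
  have hμ : ∀ j, ∃ μ : R, g j - μ * Lg g ω ∈ Ideal.span (Set.range c) ∧ v j = algebraMap R κ μ * ev v ω := by
    intro j
    have : Pi.single j (1 : R) ∈ Submodule.span R (Set.range lin) ⊔ Submodule.span R {ω} := by rw [htop]; trivial
    obtain ⟨x, hx, y, hy, hxy⟩ := Submodule.mem_sup.1 this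
    obtain ⟨μ, rfl⟩ := Submodule.mem_span_singleton.1 hy
    refine ⟨μ, ?_, ?_⟩
    · have e : g j = Lg g (Pi.single j 1) := by rw [Lg_apply]; simp [Pi.single_apply]
      rw [e, ← hxy, map_add, map_smul, smul_eq_mul, add_sub_cancel_right]
      have hc : Ideal.span (Set.range c) = (Submodule.span R (Set.range lin)).map (Lg g) := by
        rw [Submodule.map_span, ← Set.range_comp]
        congr 2
        ext i
        exact hlin i
      rw [hc]
      exact ⟨x, hx, rfl⟩
    · have e : v j = ev v (Pi.single j 1) := by
        rw [hev, Finset.sum_eq_single j (fun i _ hi => by simp [hi]) (by simp)]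
        simp
      have hx0 : ev v x = 0 := by
        have : Submodule.span R (Set.range lin) ≤ LinearMap.ker (ev v) :=
          Submodule.span_le.2 (by rintro _ ⟨i, rfl⟩; exact hv i)
        exact this hx
      rw [e, ← hxy, map_add, hx0, zero_add, map_smul, Algebra.smul_def]
  choose μ hμ1 hμ2 using hμ
  refine ⟨c, _, hPG, hcw, μ, hμ1, fun h => hvG ?_⟩
  have e : v = fun j => ev v ω * algebraMap R κ (μ j) := by
    ext j
    rw [mul_comm]
    exact hμ2 j
  have h3 := hom_scale (hG.map (algebraMap R κ)) (ev v ω) (fun j => algebraMap R κ (μ j))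
  have h4 : aeval (fun j => algebraMap R κ (μ j)) Gk = 0 := by
    rw [hGk, aeval_map_algebraMap]
    have := aeval_algebraMap_apply κ μ G
    rw [Function.comp_def] at this
    rw [this]
    exact (hker _).2 h
  rw [e]
  change aeval (fun j => ev v ω * algebraMap R κ (μ j)) Gk = 0
  rw [hGk, h3, ← hGk, h4, mul_zero]

end F2
end

section
open MvPolynomial RingTheory.Sequence IsLocalRing

set_option linter.unusedSectionVars false
section F3
variable {R : Type u} [CommRing R] [IsNoetherianRing R]

lemma height_map {n : ℕ} (p : Ideal R) [hp : p.IsPrime] :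
    (RingHom.ker (map (σ := Fin n) (algebraMap R p.ResidueField))).height ≤ p.height := by
  classical
  obtain ⟨s, hs, hsc⟩ := Ideal.exists_finset_card_eq_height_of_isNoetherianRing p
  have hker : RingHom.ker (algebraMap R p.ResidueField) = p := Ideal.ker_algebraMap_residueField p
  set P := RingHom.ker (map (σ := Fin n) (algebraMap R p.ResidueField)) with hP
  have hPm : P = p.map C := by rw [hP, ker_map, hker]
  have hPp : P.IsPrime := RingHom.ker_isPrime _
  have hPc : ∀ r, C r ∈ P → r ∈ p := fun r hr => by
    rw [hP, RingHom.mem_ker, map_C, map_eq_zero_iff _ (C_injective _ _)] at hr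
    rwa [← RingHom.mem_ker, hker] at hr
  have hmin : P ∈ (Ideal.span ((s.image (C : R → MvPolynomial (Fin n) R) : Finset _) : Set (MvPolynomial (Fin n) R))).minimalPrimes := by
    refine ⟨⟨hPp, ?_⟩, ?_⟩
    · rw [Finset.coe_image, Ideal.span_le]
      rintro _ ⟨r, hr, rfl⟩
      rw [hPm]
      exact Ideal.mem_map_of_mem _ (hs.1.2 (Ideal.subset_span hr))
    · rintro Q ⟨hQp, hQ⟩ hQP
      rw [hPm, Ideal.map_le_iff_le_comap]
      refine hs.2 ⟨hQp.comap _, ?_⟩ fun r hr => hPc r (hQP hr)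
      rw [Ideal.span_le]
      intro r hr
      exact hQ (Ideal.subset_span (Finset.mem_coe.2 (Finset.mem_image_of_mem _ hr)))
  refine (Ideal.height_le_card_of_mem_minimalPrimes_span_finset hmin).trans ?_
  rw [← hsc]
  exact_mod_cast Finset.card_image_le

lemma height_ker {n : ℕ} [IsDomain R] (a0 : R) (ha : a0 ≠ 0) (a : Fin n → R) :
    (n : ℕ∞) ≤ (RingHom.ker (aeval (R := R) (fun i => algebraMap R (FractionRing R) (a i) / algebraMap R (FractionRing R) a0))).height := by
  set K := FractionRing R
  have ha' : algebraMap R K a0 ≠ 0 := by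
    rwa [Ne, map_eq_zero_iff _ (IsFractionRing.injective R K)]
  let t : Fin n → K := fun i => algebraMap R K (a i) / algebraMap R K a0
  let E : ℕ → MvPolynomial (Fin n) R →ₐ[R] MvPolynomial (Fin n) K := fun i => aeval fun j => if (j : ℕ) < i then C (t j) else X j
  have hE : ∀ i j, E i (X j) = if (j : ℕ) < i then C (t j) else X j := fun i j => aeval_X _ _
  have hmain : ∀ i ≤ n, (i : ℕ∞) ≤ (RingHom.ker (E i)).height := by
    intro i
    induction i with
    | zero => intro _; simp
    | succ i ih =>
      intro hi
      have h1 := ih (by omega)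
      have hlt : RingHom.ker (E i) < RingHom.ker (E (i + 1)) := by
        let F : MvPolynomial (Fin n) K →ₐ[K] MvPolynomial (Fin n) K := aeval fun j => if (j : ℕ) < i + 1 then C (t j) else X j
        have hF : ∀ x, F (E i x) = E (i + 1) x := by
          intro x
          have : (F.restrictScalars R).comp (E i) = E (i + 1) := by
            refine algHom_ext fun j => ?_
            rw [AlgHom.comp_apply, hE, hE, AlgHom.restrictScalars_apply]
            by_cases h : (j : ℕ) < i
            · rw [if_pos h, if_pos (by omega)]
              exact algHom_C _ _
            · rw [if_neg h]
              exact aeval_X _ _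
          rw [← this]; rfl
        refine lt_of_le_of_ne (fun x hx => ?_) fun h => ?_
        · rw [RingHom.mem_ker] at hx ⊢
          rw [← hF, hx, map_zero]
        · have h2 : C a0 * X ⟨i, by omega⟩ - C (a ⟨i, by omega⟩) ∈ RingHom.ker (E (i + 1)) := by
            rw [RingHom.mem_ker, map_sub, map_mul, hE, if_pos (by simp), algHom_C, algHom_C,
              MvPolynomial.algebraMap_apply, MvPolynomial.algebraMap_apply, ← C_mul, ← C_sub, mul_div_cancel₀ _ ha', sub_self, C_0]
          rw [← h, RingHom.mem_ker, map_sub, map_mul, hE, if_neg (by simp), algHom_C, algHom_C,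
              MvPolynomial.algebraMap_apply, MvPolynomial.algebraMap_apply] at h2
          have h3 := congrArg (coeff (Finsupp.single ⟨i, by omega⟩ 1)) h2
          rw [coeff_sub, coeff_C_mul, coeff_X, if_pos rfl, coeff_C, if_neg (fun h => by simpa using DFunLike.congr_fun h (⟨i, by omega⟩ : Fin n))] at h3
          simp at h3
          exact ha h3
      have : (RingHom.ker (E i)).IsPrime := RingHom.ker_isPrime _
      have h2 := Ideal.height_strict_mono_of_isPrime hlt
      have : ((i + 1 : ℕ) : ℕ∞) = (i : ℕ∞) + 1 := by push_cast; rfl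
      rw [this]
      exact Order.add_one_le_of_lt (h1.trans_lt h2)
  refine (hmain n le_rfl).trans (Ideal.height_mono fun x hx => ?_)
  rw [RingHom.mem_ker] at hx ⊢
  have : E n x = C (aeval t x) := by
    have : E n = ((Algebra.ofId K (MvPolynomial (Fin n) K)).restrictScalars R).comp (aeval t) := by
      refine algHom_ext fun j => ?_
      rw [hE, if_pos j.2, AlgHom.comp_apply, aeval_X]
      rfl
    rw [this]; rfl
  rw [this] at hx
  exact C_injective _ _ (hx.trans C_0.symm)

/-- homogenization -/
lemma hgz {n : ℕ} {K : Type u} [Field K] [Algebra R K] (a : Fin (n + 1) → R) (ha : algebraMap R K (a 0) ≠ 0) (s : MvPolynomial (Fin n) R) :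
    ∃ M, ∃ G : MvPolynomial (Fin (n + 1)) R, G.IsHomogeneous M ∧
      algebraMap R K (aeval a G) = algebraMap R K (a 0) ^ M * aeval (fun i : Fin n => algebraMap R K (a i.succ) / algebraMap R K (a 0)) s ∧
      aeval (Fin.cons 1 X : Fin (n + 1) → MvPolynomial (Fin n) R) G = s := by
  set M := s.totalDegree
  refine ⟨M, ∑ j ∈ Finset.range (M + 1), X 0 ^ (M - j) * rename Fin.succ (homogeneousComponent j s), ?_, ?_, ?_⟩
  · refine IsHomogeneous.sum _ _ _ fun j hj => ?_
    have := (isHomogeneous_X_pow (R := R) (0 : Fin (n + 1)) (M - j)).mul ((homogeneousComponent_isHomogeneous j s).rename_isHomogeneous (f := Fin.succ))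
    rwa [show M - j + j = M by have := Finset.mem_range.1 hj; omega] at this
  · conv_rhs => rw [← sum_homogeneousComponent s]
    rw [map_sum, map_sum, map_sum, Finset.mul_sum]
    refine Finset.sum_congr rfl fun j hj => ?_
    rw [map_mul, map_mul, map_pow, map_pow, aeval_X, aeval_rename]
    have h := hom_scale (B := K) ((homogeneousComponent_isHomogeneous j s)) (algebraMap R K (a 0)) (fun i : Fin n => algebraMap R K (a i.succ) / algebraMap R K (a 0))
    have e : (fun i : Fin n => algebraMap R K (a 0) * (algebraMap R K (a i.succ) / algebraMap R K (a 0))) = algebraMap R K ∘ (a ∘ Fin.succ) := by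
      ext i
      exact mul_div_cancel₀ _ ha
    rw [e, aeval_algebraMap_apply] at h
    rw [h, ← mul_assoc, ← pow_add, show M - j + j = M by have := Finset.mem_range.1 hj; omega]
  · conv_rhs => rw [← sum_homogeneousComponent s]
    rw [map_sum]
    refine Finset.sum_congr rfl fun j hj => ?_
    rw [map_mul, map_pow, aeval_X, aeval_rename, Fin.cons_zero, one_pow, one_mul]
    exact aeval_X_left_apply _

lemma red_adj [IsLocalRing R] {B : Ideal R} {x : R} {n : ℕ} (h : x ^ (n + 1) ∈ B * (B ⊔ Ideal.span {x}) ^ n) : IsReduction B (B ⊔ Ideal.span {x}) := by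
  refine ⟨le_sup_left, n, le_antisymm ?_ ?_⟩
  · refine (sup_pow_le (sup_comm _ _) (n + 1)).trans (sup_le ?_ le_rfl)
    rw [Ideal.span_singleton_pow, Ideal.span_singleton_le_iff_mem]
    exact h
  · rw [pow_succ']
    exact Ideal.mul_mono_left le_sup_left

/-- cancellation in Dedekind domains -/
lemma ded_cancel {D K : Type u} [CommRing D] [IsDomain D] [Ring.DimensionLEOne D] [Field K] [Algebra D K] [IsFractionRing D K]
    (hN : IsNoetherianRing (integralClosure D K)) (Q L : Ideal (integralClosure D K)) (k : ℕ) (hle : Q ≤ L) (h : L ^ (k + 1) = Q * L ^ k) : L = Q := by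
  have h1 : IsIntegrallyClosed (integralClosure D K) := integralClosure.isIntegrallyClosedOfFiniteExtension K
  have : IsFractionRing (integralClosure D K) K := integralClosure.isFractionRing_of_finite_extension K K
  have : IsDedekindRing (integralClosure D K) := (isDedekindRing_iff _ K).2 ⟨hN, inferInstance, (isIntegrallyClosed_iff K).1 h1⟩
  have : IsDedekindDomain (integralClosure D K) := {}
  by_cases hL : L = 0
  · subst hL
    exact (le_bot_iff.1 hle).symm
  · rw [pow_succ'] at h
    exact mul_right_cancel₀ (pow_ne_zero _ hL) h

end F3
end

section
open MvPolynomial RingTheory.Sequence IsLocalRing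

set_option linter.unusedSectionVars false
section F4
variable {R : Type u} [CommRing R] [IsNoetherianRing R] [IsLocalRing R] [IsDomain R]

/-- the affine chart of the blowup map -/
noncomputable def tht {n : ℕ} (a : Fin (n + 1) → R) : MvPolynomial (Fin n) R →ₐ[R] FractionRing R :=
  aeval (fun i : Fin n => algebraMap R (FractionRing R) (a i.succ) / algebraMap R (FractionRing R) (a 0))

lemma alg_ne {r : R} (h : r ≠ 0) : algebraMap R (FractionRing R) r ≠ 0 := by
  rwa [Ne, map_eq_zero_iff _ (IsFractionRing.injective R (FractionRing R))]

lemma tht_mem {n : ℕ} {a : Fin (n + 1) → R} (ha : a 0 ≠ 0) {x : FractionRing R} (hx : x ∈ (tht a).range) :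
    ∃ k, ∃ y ∈ Ideal.span (Set.range a) ^ k, algebraMap R (FractionRing R) y = algebraMap R (FractionRing R) (a 0) ^ k * x := by
  obtain ⟨s, rfl⟩ := (AlgHom.mem_range _).1 hx
  obtain ⟨M, G, hG, h1, -⟩ := hgz (K := FractionRing R) a (alg_ne ha) s
  exact ⟨M, _, (mem_pow_iff a _).2 ⟨G, hG, rfl⟩, h1⟩

lemma mem_tht {n : ℕ} {a : Fin (n + 1) → R} (ha : a 0 ≠ 0) {k : ℕ} {y : R} (hy : y ∈ Ideal.span (Set.range a) ^ k) :
    algebraMap R (FractionRing R) y / algebraMap R (FractionRing R) (a 0) ^ k ∈ (tht a).range := by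
  obtain ⟨p, hp, rfl⟩ := (mem_pow_iff a _).1 hy
  rw [← aeval_algebraMap_apply]
  have h := hom_scale hp (algebraMap R (FractionRing R) (a 0)) (fun i => algebraMap R (FractionRing R) (a i) / algebraMap R (FractionRing R) (a 0))
  have e : (fun i => algebraMap R (FractionRing R) (a 0) * (algebraMap R (FractionRing R) (a i) / algebraMap R (FractionRing R) (a 0))) = algebraMap R (FractionRing R) ∘ a := by
    ext i
    exact mul_div_cancel₀ _ (alg_ne ha)
  rw [e] at h
  rw [h, mul_div_cancel_left₀ _ (pow_ne_zero _ (alg_ne ha))]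
  have : ∀ i, algebraMap R (FractionRing R) (a i) / algebraMap R (FractionRing R) (a 0) ∈ (tht a).range := by
    intro i
    refine Fin.cases ?_ (fun i => ?_) i
    · rw [div_self (alg_ne ha)]; exact one_mem _
    · exact (AlgHom.mem_range _).2 ⟨X i, aeval_X _ _⟩
  exact (AlgHom.mem_range _).2 (by
    choose g hg using fun i => (AlgHom.mem_range _).1 (this i)
    exact ⟨aeval g p, by rw [comp_aeval_apply]; simp only [hg]⟩)

lemma int_mem [IsIntegrallyClosed R] {n : ℕ} {a : Fin (n + 1) → R} (ha : a 0 ≠ 0) {I : Ideal R} (haI : ∀ i, a i ∈ I) (hI : IsNormalIdeal I)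
    {x : FractionRing R} (hx : IsIntegral (tht a).range x) :
    ∃ k, ∃ y ∈ I ^ k, algebraMap R (FractionRing R) y = algebraMap R (FractionRing R) (a 0) ^ k * x := by
  have hJI : Ideal.span (Set.range a) ≤ I := Ideal.span_le.2 (by rintro _ ⟨i, rfl⟩; exact haI i)
  obtain ⟨f, hf, hfx⟩ := hx
  set A := algebraMap R (FractionRing R) with hA
  choose Ms js hjs hjs' using fun i => tht_mem ha (f.coeff i).2
  set n := f.natDegree with hn
  set k := ∑ i ∈ Finset.range n, Ms i with hk
  have hc : ∀ i, ∃ j : R, i < n → j ∈ I ^ k ∧ A j = A (a 0) ^ k * (f.coeff i : FractionRing R) := by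
    intro i
    refine ⟨a 0 ^ (k - Ms i) * js i, fun hi => ?_⟩
    have hle : Ms i ≤ k := Finset.single_le_sum (f := Ms) (fun _ _ => Nat.zero_le _) (Finset.mem_range.2 hi)
    constructor
    · have := Ideal.mul_mem_mul (Ideal.pow_mem_pow (haI 0) (k - Ms i)) (Ideal.pow_right_mono hJI _ (hjs i))
      rwa [← pow_add, Nat.sub_add_cancel hle] at this
    · rw [map_mul, hjs', map_pow, ← mul_assoc, ← pow_add, Nat.sub_add_cancel hle]
  choose c hc using hc
  set v := A (a 0) ^ k * x with hv
  have hx0 : x ^ n + ∑ i ∈ Finset.range n, (f.coeff i : FractionRing R) * x ^ i = 0 := by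
    rw [Polynomial.eval₂_eq_sum_range, Finset.sum_range_succ, ← hn] at hfx
    have : f.coeff n = 1 := hf
    rw [this, map_one, one_mul, add_comm] at hfx
    exact hfx
  have hv0 : v ^ n + ∑ i ∈ Finset.range n, A (c i * (a 0 ^ k) ^ (n - 1 - i)) * v ^ i = 0 := by
    have : (A (a 0) ^ k) ^ n * (x ^ n + ∑ i ∈ Finset.range n, (f.coeff i : FractionRing R) * x ^ i) = 0 := by rw [hx0, mul_zero]
    rw [← this, mul_add, Finset.mul_sum, hv, mul_pow]
    congr 1
    refine Finset.sum_congr rfl fun i hi => ?_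
    have hi := Finset.mem_range.1 hi
    rw [map_mul, (hc i hi).2, map_pow, map_pow, mul_pow]
    have : (A (a 0) ^ k) ^ n = (A (a 0) ^ k) * (A (a 0) ^ k) ^ (n - 1 - i) * (A (a 0) ^ k) ^ i := by
      rw [← pow_succ', ← pow_add]
      congr 1
      omega
    rw [this]
    ring
  have hvi : IsIntegral R v := by
    refine ⟨Polynomial.X ^ n + ∑ i ∈ Finset.range n, Polynomial.C (c i * (a 0 ^ k) ^ (n - 1 - i)) * Polynomial.X ^ i, Polynomial.monic_X_pow_add ?_, ?_⟩
    · rw [Polynomial.degree_lt_iff_coeff_zero]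
      intro m hm
      rw [Polynomial.finsetSum_coeff]
      refine Finset.sum_eq_zero fun i hi => ?_
      rw [Polynomial.coeff_C_mul_X_pow, if_neg]
      have := Finset.mem_range.1 hi
      omega
    · rw [Polynomial.eval₂_add, Polynomial.eval₂_finsetSum]
      simpa using hv0
  obtain ⟨y, hy⟩ := (IsIntegrallyClosed.isIntegral_iff).1 hvi
  refine ⟨k, y, ?_, hy⟩
  have hy0 : y ^ n = - ∑ i ∈ Finset.range n, c i * (a 0 ^ k) ^ (n - 1 - i) * y ^ i := by
    refine IsFractionRing.injective R (FractionRing R) ?_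
    rw [map_neg, map_sum, map_pow, eq_neg_iff_add_eq_zero, ← hv0, hy]
    congr 1
    refine Finset.sum_congr rfl fun i hi => ?_
    rw [map_mul _ _ (y ^ i), map_pow, hy]
  have hn0 : n ≠ 0 := by
    intro h
    rw [h] at hv0
    simp at hv0
  obtain ⟨m, hm⟩ := Nat.exists_eq_succ_of_ne_zero hn0
  have := hI k _ (red_adj (B := I ^ k) (x := y) (n := m) (by
    rw [show m + 1 = n from hm.symm, hy0]
    refine neg_mem (Ideal.sum_mem _ fun i hi => ?_)
    rw [mul_assoc]
    have hi := Finset.mem_range.1 hi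
    refine Ideal.mul_mem_mul (hc i hi).1 ?_
    rw [show m = (n - 1 - i) + i by omega, pow_add]
    exact Ideal.mul_mem_mul (Ideal.pow_mem_pow (le_sup_left (a := I ^ k) (Ideal.pow_mem_pow (haI 0) k)) _)
      (Ideal.pow_mem_pow (le_sup_right (a := I ^ k) (Ideal.mem_span_singleton_self y)) _)))
  rw [← this]
  exact le_sup_right (a := I ^ k) (Ideal.mem_span_singleton_self y)

end F4
end

section
open MvPolynomial RingTheory.Sequence IsLocalRing

set_option linter.unusedSectionVars false
section F5
variable {R : Type u} [CommRing R] [IsNoetherianRing R] [IsLocalRing R] [IsDomain R]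

lemma hgz_ne {n : ℕ} {k : Type u} [Field k] [Algebra R k] {G : MvPolynomial (Fin (n + 1)) R} {s : MvPolynomial (Fin n) R}
    (h : aeval (Fin.cons 1 X : Fin (n + 1) → MvPolynomial (Fin n) R) G = s) (hs : map (algebraMap R k) s ≠ 0) : map (algebraMap R k) G ≠ 0 := by
  intro h0
  refine hs ?_
  rw [← h]

  have h2 : map (algebraMap R k) (aeval (Fin.cons 1 X : Fin (n + 1) → MvPolynomial (Fin n) R) G) =
      aeval (fun i => map (algebraMap R k) ((Fin.cons 1 X : Fin (n + 1) → MvPolynomial (Fin n) R) i)) (map (algebraMap R k) G) := by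
    rw [aeval_map_algebraMap]
    exact comp_aeval_apply (φ := mapAlgHom (σ := Fin n) (Algebra.ofId R k)) _ _
  rw [h2, h0, map_zero]

lemma dim_one {A D : Type u} [CommRing A] [IsDomain A] {S : Type u} [CommRing S] [IsNoetherianRing S] [CommRing D] [IsDomain D] [Algebra A D]
    (π : S →+* A) (hπ : Function.Surjective π) (P : Ideal S) [P.IsPrime] (PA : Ideal A) [hPA : PA.IsPrime]
    (hPP : PA.comap π = P) [IsLocalization.AtPrime D PA] (n : ℕ) (h1 : (n : ℕ∞) ≤ (RingHom.ker π).height) (h2 : P.height ≤ ((n + 1 : ℕ) : ℕ∞)) :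
    Ring.DimensionLEOne D := by
  refine ⟨fun {Q} hQ hQp => ?_⟩
  have hloc := IsLocalization.AtPrime.isLocalRing D PA
  have hdis := (IsLocalization.isPrime_iff_isPrime_disjoint PA.primeCompl D Q).1 hQp
  have hQA : Q.comap (algebraMap A D) ≤ PA := fun x hx => by
    by_contra h
    exact Set.disjoint_left.1 hdis.2 h hx
  have hpr := hdis.1
  have hpr2 : ((Q.comap (algebraMap A D)).comap π).IsPrime := inferInstance
  have hker : RingHom.ker π < (Q.comap (algebraMap A D)).comap π := by
    refine lt_of_le_of_ne (fun x hx => ?_) fun h => ?_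
    · rw [RingHom.mem_ker] at hx
      rw [Ideal.mem_comap, hx]
      exact zero_mem _
    · refine hQ (le_bot_iff.1 ?_)
      rw [← IsLocalization.map_under PA.primeCompl D Q, Ideal.map_le_iff_le_comap]
      intro x hx
      obtain ⟨s, rfl⟩ := hπ x
      have : s ∈ RingHom.ker π := h ▸ hx
      rw [RingHom.mem_ker.1 this]
      exact zero_mem _
  have hk : (RingHom.ker π).IsPrime := RingHom.ker_isPrime _
  have h3 := Ideal.height_strict_mono_of_isPrime hker
  have heq : (Q.comap (algebraMap A D)).comap π = P := by
    by_contra hne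
    have h4 := Ideal.height_strict_mono_of_isPrime (lt_of_le_of_ne (hPP ▸ Ideal.comap_mono hQA) hne)
    have h5 : ((n + 1 : ℕ) : ℕ∞) ≤ ((Q.comap (algebraMap A D)).comap π).height := by
      push_cast
      exact Order.add_one_le_of_lt (h1.trans_lt h3)
    exact absurd (h5.trans_lt (h4.trans_le h2)) (lt_irrefl _)
  have heq2 : Q.comap (algebraMap A D) = PA := Ideal.comap_injective_of_surjective π hπ (heq.trans hPP.symm)
  have : Q = maximalIdeal D := by
    rw [← IsLocalization.map_under PA.primeCompl D Q, ← IsLocalization.AtPrime.map_eq_maximalIdeal PA D]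
    exact congrArg _ heq2
  rw [this]
  infer_instance

end F5
end

section
open MvPolynomial RingTheory.Sequence IsLocalRing

set_option linter.unusedSectionVars false
section F6
variable {R : Type u} [CommRing R] [IsNoetherianRing R] [IsLocalRing R] [IsDomain R]

lemma fld {F : Type*} [Field F] {w b : F} (hw : w ≠ 0) (hb : b ≠ 0) (k M : ℕ) (x : F) : x = w⁻¹ * (b ^ k * (w * x) * b ^ M / (b ^ k * b ^ M)) := by
  field_simp

lemma P2D [IsIntegrallyClosed R] {n : ℕ} (a : Fin (n + 1) → R) (ha : a 0 ≠ 0) {I J : Ideal R} (haJ : Ideal.span (Set.range a) = J)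
    (hred : IsReduction J I) (hI : IsNormalIdeal I) (K0 L : Ideal R) (hL : IsReduction (K0 * I) L) {q : R} (hq : q ∈ L)
    (PA : Ideal (tht a).range) [hPAp : PA.IsPrime] (D : Type u) [CommRing D] [IsDomain D] [Algebra (tht a).range D] [Algebra D (FractionRing R)]
    [IsScalarTower (tht a).range D (FractionRing R)] [IsLocalization.AtPrime D PA] [IsFractionRing D (FractionRing R)] [IsNoetherianRing D]
    [Ring.DimensionLEOne D] :
    ∃ w : (tht a).range, w ∉ PA ∧ ∃ t, ∃ j ∈ K0 * I ^ (t + 1), algebraMap R (FractionRing R) j =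
      algebraMap R (FractionRing R) (a 0) ^ t * (w * algebraMap R (FractionRing R) q) := by
  set K := FractionRing R with hKdef
  set al := algebraMap R K with hal
  have ha' : al (a 0) ≠ 0 := alg_ne ha
  have haI : ∀ i, a i ∈ I := fun i => hred.1 (haJ ▸ Ideal.subset_span ⟨i, rfl⟩)
  let A := (tht a).range
  have hw0 : ∀ w : A, w ∉ PA → (w : K) ≠ 0 := by
    intro w hw h
    exact hw (by rw [show w = 0 from Subtype.ext h]; exact zero_mem _)
  have hAD : ∀ w : A, algebraMap D K (algebraMap A D w) = w := fun w => (IsScalarTower.algebraMap_apply A D K w).symm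
  have hwD : ∀ w : A, w ∉ PA → ∃ e : D, algebraMap D K e = (w : K)⁻¹ := by
    intro w hw
    refine ⟨IsLocalization.mk' D 1 (⟨w, hw⟩ : PA.primeCompl), ?_⟩
    have := congrArg (algebraMap D K) (IsLocalization.mk'_spec D (1 : A) (⟨w, hw⟩ : PA.primeCompl))
    rw [map_mul, hAD, map_one, map_one] at this
    exact eq_inv_of_mul_eq_one_left this
  let Cl := integralClosure D K
  have hCx : ∀ x ∈ Cl, ∃ w : A, w ∉ PA ∧ ∃ k, ∃ y ∈ I ^ k, al y = al (a 0) ^ k * (w * x) := by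
    intro x hx
    obtain ⟨⟨w, hw⟩, hwx⟩ := IsIntegral.exists_multiple_integral_of_isLocalization (R := (tht a).range) (S := FractionRing R) (Rₘ := D) PA.primeCompl x hx
    exact ⟨w, hw, int_mem ha haI hI hwx⟩
  have hCN : IsNoetherianRing Cl := by
    obtain ⟨-, M, hM⟩ := hred
    have hpow : ∀ k, I ^ (k + M) = J ^ k * I ^ M := by
      intro k
      induction k with
      | zero => simp
      | succ k ih => rw [pow_succ', mul_assoc, ← ih, show k + 1 + M = M + 1 + k by ring, pow_add, hM, mul_assoc, ← pow_add, add_comm k]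
    obtain ⟨S, hS⟩ := IsNoetherian.noetherian (I ^ M)
    let V : Submodule D K := Submodule.span D ((fun z => al z / al (a 0) ^ M) '' (S : Set R))
    have hVI : ∀ z ∈ I ^ M, al z / al (a 0) ^ M ∈ V := by
      intro z hz
      rw [← hS] at hz
      induction hz using Submodule.span_induction with
      | mem x hx => exact Submodule.subset_span ⟨x, hx, rfl⟩
      | zero => simp
      | add x y _ _ hx hy => rw [map_add, add_div]; exact add_mem hx hy
      | smul r x _ hx =>
        have : al (r • x) / al (a 0) ^ M = algebraMap A D ⟨al r, A.algebraMap_mem r⟩ • (al x / al (a 0) ^ M) := by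
          rw [smul_eq_mul, map_mul, mul_div_assoc, Algebra.smul_def, hAD]
        rw [this]
        exact V.smul_mem _ hx
    have hVk : ∀ k, ∀ y ∈ I ^ (k + M), al y / al (a 0) ^ (k + M) ∈ V := by
      intro k y hy
      rw [hpow] at hy
      refine Submodule.mul_induction_on hy (fun j hj z hz => ?_) fun x y hx hy => by rw [map_add, add_div]; exact add_mem hx hy
      have hj' : al j / al (a 0) ^ k ∈ A := mem_tht ha (haJ ▸ hj)
      have : al (j * z) / al (a 0) ^ (k + M) = algebraMap A D ⟨_, hj'⟩ • (al z / al (a 0) ^ M) := by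
        rw [map_mul, pow_add, mul_div_mul_comm, Algebra.smul_def, hAD]
      rw [this]
      exact V.smul_mem _ (hVI z hz)
    have hle : Subalgebra.toSubmodule Cl ≤ V := by
      intro x hx
      obtain ⟨w, hw, k, y, hy, hxy⟩ := hCx x hx
      have h1 := hVk k (y * a 0 ^ M) (by rw [pow_add]; exact Ideal.mul_mem_mul hy (Ideal.pow_mem_pow (haI 0) _))
      obtain ⟨e, he⟩ := hwD w hw
      have h2 : x = e • (al (y * a 0 ^ M) / al (a 0) ^ (k + M)) := by
        rw [Algebra.smul_def, he, map_mul, hxy, map_pow, pow_add]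
        exact fld (hw0 w hw) ha' k M x
      rw [h2]
      exact V.smul_mem _ h1
    have hVN : IsNoetherian D V := isNoetherian_span_of_finite D (S.finite_toSet.image _)
    have : IsNoetherian D (Subalgebra.toSubmodule Cl) := isNoetherian_of_le hle
    have : IsNoetherian D Cl := this
    exact isNoetherian_of_tower D this
  let ι : R →+* Cl := (algebraMap D Cl).comp ((algebraMap A D).comp (algebraMap R A))
  have hι : ∀ r, ((ι r : Cl) : K) = al r := fun r => hAD (algebraMap R A r)
  obtain ⟨hLle, k0, hk0⟩ := hL
  have hLQ := ded_cancel hCN ((K0 * I).map ι) (L.map ι) k0 (Ideal.map_mono hLle) (by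
    rw [← Ideal.map_pow, ← Ideal.map_pow, ← Ideal.map_mul, hk0])
  have hqm : ι q ∈ (K0 * I).map ι := hLQ ▸ Ideal.mem_map_of_mem _ hq
  have key : ∀ x ∈ (K0 * I).map ι, ∃ w : A, w ∉ PA ∧ ∃ t, ∃ j ∈ K0 * I ^ (t + 1), al j = al (a 0) ^ t * (w * (x : K)) := by
    intro x hx
    induction hx using Submodule.span_induction with
    | mem x hx =>
      obtain ⟨r, hr, rfl⟩ := hx
      exact ⟨1, fun h => hPAp.ne_top ((Ideal.eq_top_iff_one _).2 h), 0, r, by simpa using hr, by simp [hι]⟩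
    | zero => exact ⟨1, fun h => hPAp.ne_top ((Ideal.eq_top_iff_one _).2 h), 0, 0, zero_mem _, by simp⟩
    | add x y _ _ hx hy =>
      obtain ⟨w1, hw1, t1, j1, hj1, h1⟩ := hx
      obtain ⟨w2, hw2, t2, j2, hj2, h2⟩ := hy
      obtain ⟨s1, y1, hy1, e1⟩ := tht_mem ha w1.2
      obtain ⟨s2, y2, hy2, e2⟩ := tht_mem ha w2.2
      have hy1 := Ideal.pow_right_mono (haJ.le.trans hred.1) _ hy1
      have hy2 := Ideal.pow_right_mono (haJ.le.trans hred.1) _ hy2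
      refine ⟨w1 * w2, fun h => (hPAp.mem_or_mem h).elim hw1 hw2, t1 + t2 + s1 + s2,
        j1 * (y2 * a 0 ^ (t2 + s1)) + j2 * (y1 * a 0 ^ (t1 + s2)), add_mem ?_ ?_, ?_⟩
      · have := Ideal.mul_mem_mul hj1 (Ideal.mul_mem_mul hy2 (Ideal.pow_mem_pow (haI 0) (t2 + s1)))
        rw [mul_assoc, ← pow_add, ← pow_add] at this
        convert this using 3
        ring
      · have := Ideal.mul_mem_mul hj2 (Ideal.mul_mem_mul hy1 (Ideal.pow_mem_pow (haI 0) (t1 + s2)))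
        rw [mul_assoc, ← pow_add, ← pow_add] at this
        convert this using 3
        ring
      · simp only [map_add, map_mul, map_pow, h1, h2]
        rw [show al y1 = _ from e1, show al y2 = _ from e2]
        push_cast
        ring
    | smul c x _ hx =>
      obtain ⟨w1, hw1, t1, j1, hj1, h1⟩ := hx
      obtain ⟨w2, hw2, k, y, hy, h2⟩ := hCx c c.2
      refine ⟨w1 * w2, fun h => (hPAp.mem_or_mem h).elim hw1 hw2, t1 + k, j1 * y, ?_, ?_⟩
      · have := Ideal.mul_mem_mul hj1 hy
        rw [mul_assoc, ← pow_add] at this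
        convert this using 3
        ring
      · rw [map_mul, h1, h2, smul_eq_mul]
        push_cast
        ring
  exact hι q ▸ key _ hqm

lemma P2 [IsIntegrallyClosed R] {n : ℕ} (a : Fin (n + 1) → R) (ha : a 0 ≠ 0) {I J : Ideal R} (haJ : Ideal.span (Set.range a) = J)
    (hred : IsReduction J I) (hI : IsNormalIdeal I) (p : Ideal R) [hp : p.IsPrime] (hph : p.height ≤ ((n + 1 : ℕ) : ℕ∞))
    (K0 L : Ideal R) (hK : ∀ t, K0 * I ^ t ≤ J ^ t) (hL : IsReduction (K0 * I) L) {q : R} (hq : q ∈ L) :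
    ∃ M, ∃ G : MvPolynomial (Fin (n + 1)) R, G.IsHomogeneous M ∧ map (algebraMap R p.ResidueField) G ≠ 0 ∧ aeval a G * q ∈ J ^ (M + 1) := by
  set K := FractionRing R with hKdef
  set al := algebraMap R K with hal
  have ha' : al (a 0) ≠ 0 := alg_ne ha
  have haJ' : ∀ i, a i ∈ J := fun i => haJ ▸ Ideal.subset_span ⟨i, rfl⟩
  set P := RingHom.ker (map (σ := Fin n) (algebraMap R p.ResidueField)) with hP
  have hPp : P.IsPrime := RingHom.ker_isPrime _
  by_cases hkP : RingHom.ker (tht a) ≤ P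
  swap
  · obtain ⟨s, hs, hsP⟩ := SetLike.not_le_iff_exists.1 hkP
    obtain ⟨M, G, hG, h1, h2⟩ := hgz (K := K) a ha' s
    refine ⟨M, G, hG, hgz_ne h2 hsP, ?_⟩
    have h3 : aeval (fun i : Fin n => algebraMap R K (a i.succ) / algebraMap R K (a 0)) s = 0 := hs
    rw [h3, mul_zero] at h1
    rw [IsFractionRing.injective R K (h1.trans (map_zero _).symm), zero_mul]
    exact zero_mem _
  let A := (tht a).range
  let π : MvPolynomial (Fin n) R →+* A := (tht a).rangeRestrict
  have hπ : Function.Surjective π := (tht a).rangeRestrict_surjective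
  have hker : RingHom.ker π = RingHom.ker (tht a) := by
    ext x
    rw [RingHom.mem_ker, RingHom.mem_ker]
    exact Subtype.ext_iff
  set PA := P.map π with hPA
  have hPAp : PA.IsPrime := Ideal.map_isPrime_of_surjective hπ (hker.le.trans hkP)
  have hPP : PA.comap π = P := by
    rw [hPA, Ideal.comap_map_of_surjective _ hπ]
    refine sup_eq_left.2 ?_
    exact hker.le.trans hkP
  have hnd : PA.primeCompl ≤ nonZeroDivisors A := PA.primeCompl_le_nonZeroDivisors
  let D := Localization.subalgebra.ofField K PA.primeCompl hnd
  have : IsLocalization.AtPrime D PA := Localization.subalgebra.isLocalization_ofField K PA.primeCompl hnd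
  have hAN : IsNoetherianRing A := isNoetherianRing_of_surjective _ _ π hπ
  have hDN : IsNoetherianRing D := IsLocalization.isNoetherianRing PA.primeCompl D hAN
  have hD1 : Ring.DimensionLEOne D := dim_one (D := D) π hπ P PA hPP n
    (hker ▸ height_ker (a 0) ha (fun i => a i.succ)) ((height_map p).trans hph)
  have hst : IsScalarTower (tht a).range D (FractionRing R) := IsScalarTower.of_algebraMap_eq fun _ => rfl
  obtain ⟨w, hw, t, j, hj, hjq⟩ := P2D a ha haJ hred hI K0 L hL hq PA D
  obtain ⟨s, hs⟩ := hπ w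
  have hsP : s ∉ P := fun h => hw (hs ▸ Ideal.mem_map_of_mem π h)
  obtain ⟨M, G, hG, h1, h2⟩ := hgz (K := K) a ha' s
  refine ⟨t + M, X 0 ^ t * G, (isHomogeneous_X_pow _ _).mul hG, ?_, ?_⟩
  · rw [map_mul, map_pow, map_X]
    exact mul_ne_zero (pow_ne_zero _ (X_ne_zero _)) (hgz_ne h2 hsP)
  · have : aeval a (X 0 ^ t * G) * q = a 0 ^ M * j := by
      refine IsFractionRing.injective R K ?_
      rw [map_mul, map_mul, map_pow, aeval_X, map_mul, map_mul, map_pow, map_pow]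
      change al (a 0) ^ t * al (aeval a G) * al q = al (a 0) ^ M * al j
      have hws : aeval (fun i : Fin n => algebraMap R K (a i.succ) / algebraMap R K (a 0)) s = (w : K) := by
        rw [← hs]; rfl
      rw [h1, hws, hjq]
      ring
    rw [this, show t + M + 1 = M + (t + 1) by ring, pow_add]
    exact Ideal.mul_mem_mul (Ideal.pow_mem_pow (haJ' 0) _) (hK _ hj)

end F6
end

section
open MvPolynomial RingTheory.Sequence IsLocalRing

set_option linter.unusedSectionVars false
section F7
variable {R : Type u} [CommRing R] [IsNoetherianRing R] [IsLocalRing R] {I : Ideal R} {N d : ℕ}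

lemma ass_ex {T : Ideal R} {z : R} (hz : z ∉ T) : ∃ r, r * z ∉ T ∧ ∃ p : Ideal R, p.IsPrime ∧ ∀ s, s ∈ p ↔ s * (r * z) ∈ T := by
  have hne : {K : Ideal R | ∃ r, r * z ∉ T ∧ K = cln T (Ideal.span {r * z})}.Nonempty := ⟨_, 1, by simpa using hz, rfl⟩
  obtain ⟨K, ⟨r, hr, rfl⟩, hmax⟩ := set_has_maximal_iff_noetherian.2 ‹IsNoetherianRing R› _ hne
  have hm : ∀ r s, s ∈ cln T (Ideal.span {r * z}) ↔ s * (r * z) ∈ T := by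
    intro r s
    rw [mem_cln]
    refine ⟨fun h => h _ (Ideal.mem_span_singleton_self _), fun h y hy => ?_⟩
    obtain ⟨e, rfl⟩ := Ideal.mem_span_singleton'.1 hy
    rw [mul_left_comm]
    exact Ideal.mul_mem_left _ _ h
  refine ⟨r, hr, _, ⟨fun h => ?_, fun {x y} hxy => ?_⟩, hm r⟩
  · have : (1 : R) ∈ cln T (Ideal.span {r * z}) := h ▸ trivial
    rw [hm, one_mul] at this
    exact hr this
  · by_contra! hcon
    rw [hm] at hxy
    have hy : y * r * z ∉ T := by
      intro h
      exact hcon.2 ((hm _ _).2 (by rwa [← mul_assoc]))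
    refine hmax (cln T (Ideal.span {y * r * z})) ⟨y * r, hy, rfl⟩ (SetLike.lt_iff_le_and_exists.2 ⟨fun s hs => ?_, x, ?_, hcon.1⟩)
    · rw [hm] at hs ⊢
      have := T.mul_mem_left y hs
      convert this using 1
      ring
    · rw [hm]
      convert hxy using 1
      ring

lemma le_of_red {A B L : Ideal R} (hA : IsIntClosedIdeal A) (hB : B ≤ A) (h : IsReduction B L) : L ≤ A := by
  obtain ⟨-, k, hk⟩ := h
  have : A ⊔ L = A := hA _ ⟨le_sup_left, k, le_antisymm ?_ ?_⟩
  · exact this ▸ le_sup_right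
  · refine (sup_pow_le (sup_comm _ _) (k + 1)).trans (sup_le ?_ le_rfl)
    rw [hk]
    exact Ideal.mul_mono hB (Ideal.pow_right_mono le_sup_right _)
  · rw [pow_succ']
    exact Ideal.mul_mono_left le_sup_left

lemma eval_mod {N' M : ℕ} {A : Ideal R} {a μ : Fin N' → R} {w : R} {G : MvPolynomial (Fin N') R} (hG : G.IsHomogeneous M)
    (hμ : ∀ j, a j - μ j * w ∈ A) : aeval a G - w ^ M * eval μ G ∈ A := by
  have e : w ^ M * eval μ G = aeval (fun j => w * μ j) G := (hom_scale hG w μ).symm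
  rw [e, ← Ideal.Quotient.eq, ← Ideal.Quotient.mkₐ_eq_mk R, comp_aeval_apply, comp_aeval_apply]
  congr 2
  ext j
  rw [Ideal.Quotient.mkₐ_eq_mk, Ideal.Quotient.eq, mul_comm]
  exact hμ j


lemma norm_mem [IsDomain R] [IsIntegrallyClosed R] (hC : Ctx I N d) (hI : IsNormalIdeal I) {J : Ideal R} (hJ : IsMinimalReduction J I)
    {K0 L : Ideal R} (hK : ∀ t, K0 * I ^ t ≤ J ^ t) (hL : IsReduction (K0 * I) L) {q ξ : R} (hq : q ∈ L) (hξ : ξ ∈ I ^ N) :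
    q * ξ ∈ J * I ^ N := by
  have hI1 : IsIntClosedIdeal I := by simpa using hI 1
  have hqI : q ∈ I := le_of_red hI1 Ideal.mul_le_right hL hq
  have hqξ : q * ξ ∈ I ^ (N + 1) := by rw [pow_succ']; exact Ideal.mul_mem_mul hqI hξ
  by_contra hcon
  obtain ⟨r, hr, p, hp, hps⟩ := ass_ex hcon
  have hph := ass_height hC hJ (Ideal.mul_mem_left _ r hqξ) hr p fun s hs => (hps s).1 hs
  obtain ⟨a, ha⟩ := exists_gens hC.hk hC.hl hJ
  have ha0 : a 0 ≠ 0 := by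
    intro h0
    have := indep hC.hl a (ha ▸ hJ.1) (Pi.single 0 1) (by simp [Pi.single_apply, h0]) 0
    rw [Pi.single_eq_same] at this
    exact (maximalIdeal R).ne_top_iff_one.1 (Ideal.IsPrime.ne_top inferInstance) this
  obtain ⟨M, G, hG, hGp, hGq⟩ := P2 (n := N + 1) a ha0 ha hJ.1 hI p hph K0 L hK hL hq
  obtain ⟨c, w, hg, hcw, μ, hμ, hGμ⟩ := spec hC hJ a ha p G hG hGp
  refine hGμ ((hps _).2 ?_)
  rw [mul_left_comm]
  refine Ideal.mul_mem_left _ _ ?_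
  set A := Ideal.span (Set.range c) with hA
  have hwJ : w ∈ J := hcw ▸ le_sup_right (a := A) (Ideal.mem_span_singleton_self w)
  have h1 : aeval a G - w ^ M * eval μ G ∈ A := eval_mod hG hμ
  have h2 : ∃ s, aeval a G * q - w ^ (M + 1) * s ∈ A := by
    have : J ^ (M + 1) ≤ Ideal.span {w} ^ (M + 1) ⊔ A := by
      refine (sup_pow_le (hcw.symm.trans (sup_comm _ _)) (M + 1)).trans (sup_le_sup_left Ideal.mul_le_left _)
    obtain ⟨x, hx, y, hy, hxy⟩ := Submodule.mem_sup.1 (this hGq)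
    rw [Ideal.span_singleton_pow] at hx
    obtain ⟨s, rfl⟩ := Ideal.mem_span_singleton'.1 hx
    exact ⟨s, by rw [← hxy, mul_comm s, add_sub_cancel_left]; exact hy⟩
  obtain ⟨s, hs⟩ := h2
  have h3 : w ^ M * (eval μ G * (q * ξ) - w * (s * ξ)) ∈ A * I ^ N := by
    have e1 := Ideal.mul_mem_mul hs hξ
    have e2 := Ideal.mul_mem_mul h1 (Ideal.mul_mem_left _ q hξ)
    convert sub_mem e1 e2 using 1
    ring
  have h4 := areg_pow hC hg (hcw.symm ▸ hJ.1) (sub_mem (Ideal.mul_mem_left _ _ hqξ) (by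
    rw [pow_succ']; exact Ideal.mul_mem_mul (hJ.1.1 hwJ) (Ideal.mul_mem_left _ _ hξ))) M h3
  have h5 : A * I ^ N ≤ J * I ^ N := Ideal.mul_mono_left (hcw ▸ le_sup_left)
  rw [← sub_add_cancel (eval μ G * (q * ξ)) (w * (s * ξ))]
  exact add_mem (h5 h4) (Ideal.mul_mem_mul hwJ (Ideal.mul_mem_left _ _ hξ))

lemma exists_min (hC : Ctx I N d) : ∃ J, IsMinimalReduction J I := by
  obtain ⟨a, -, h⟩ := red_contains hC.hk hC.hl (J0 := I) (I := I) ⟨le_rfl, 0, by simp⟩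
  exact ⟨_, min_of_red hC.hk hC.hl a h⟩

lemma normality [IsDomain R] [IsIntegrallyClosed R] (hC : Ctx I N d) (hI : IsNormalIdeal I) (h : core I = Fi I (d + (N + 2)) d * I) :
    IsIntClosedIdeal (Fi I (d + (N + 2)) d) ∧ IsIntClosedIdeal (core I) := by
  have hI1 : IsIntClosedIdeal I := by simpa using hI 1
  set K0 := Fi I (d + (N + 2)) d with hK0
  have hKJ : ∀ J, IsMinimalReduction J I → K0 = cln J I := fun J hJ =>
    le_antisymm (le_cln.2 (h ▸ sInf_le hJ)) (Ko_le_Fi hC hJ)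
  have hKt : ∀ J, IsMinimalReduction J I → ∀ t, K0 * I ^ t ≤ J ^ t := by
    intro J hJ t
    have h1 : K0 * I ≤ K0 * J := by
      rw [← h, hKJ J hJ]
      exact core_le hC hJ
    have h2 : K0 * I ^ t ≤ K0 * J ^ t := by
      induction t with
      | zero => simp
      | succ t ih =>
        calc K0 * I ^ (t + 1) = K0 * I ^ t * I := by rw [pow_succ, mul_assoc]
          _ ≤ K0 * J ^ t * I := Ideal.mul_mono_left ih
          _ = K0 * I * J ^ t := by ring
          _ ≤ K0 * J * J ^ t := Ideal.mul_mono_left h1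
          _ = K0 * J ^ (t + 1) := by ring
    exact h2.trans Ideal.mul_le_right
  constructor
  · intro L hL
    obtain ⟨J, hJ⟩ := exists_min hC
    refine le_antisymm ?_ hL.1
    have hLI : IsReduction (K0 * I) (L * I) := by
      obtain ⟨hle, k, hk⟩ := hL
      refine ⟨Ideal.mul_mono_left hle, k, ?_⟩
      rw [mul_pow, mul_pow, hk]
      ring
    have hle : L * I * I ^ N ≤ J * I ^ N := Ideal.mul_le.2 fun q hq ξ hξ => norm_mem hC hI hJ (hKt J hJ) hLI hq hξ
    rw [hKJ J hJ, ← Ko_eq hC hJ, le_cln, pow_succ', ← mul_assoc]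
    exact hle
  · intro L hL
    refine le_antisymm (le_sInf fun J hJ q hq => ?_) hL.1
    rw [h] at hL
    exact mem_of_mul hC hJ (le_of_red hI1 Ideal.mul_le_right hL hq) fun ξ hξ => norm_mem hC hI hJ (hKt J hJ) hL hq hξ

end F7
end

section
open RingTheory.Sequence IsLocalRing

set_option linter.unusedSectionVars false
section G1
variable {R : Type u} [CommRing R]

open CategoryTheory in
lemma pd_cat : ∀ (n : ℕ) (M : Type u) [AddCommGroup M] [Module R M], ProjDimLE R n M →
    HasProjectiveDimensionLT (ModuleCat.of R M) (n + 1)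
  | 0, M, _, _, h => projective_iff_hasProjectiveDimensionLT_one.1 ((IsProjective.iff_projective M).1 h)
  | n + 1, M, _, _, ⟨k, f, hf, h⟩ => by
    have : Projective (ModuleCat.of R (Fin k → R)) := (IsProjective.iff_projective _).1 inferInstance
    exact (LinearMap.shortExact_shortComplexKer hf).hasProjectiveDimensionLT_X₃ (n + 1) (pd_cat n _ h)
      (inferInstanceAs (HasProjectiveDimensionLT (ModuleCat.of R (Fin k → R)) _))

open CategoryTheory in
lemma syz_proj {I : Ideal R} (h : ProjDimLE R 2 (R ⧸ I)) {n : ℕ} (x : Fin n → R) (hx : Ideal.span (Set.range x) = I) :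
    Module.Projective R (Syz x) := by
  have h1 := pd_cat _ _ h
  have : Projective (ModuleCat.of R R) := (IsProjective.iff_projective _).1 inferInstance
  have : Projective (ModuleCat.of R (Fin n → R)) := (IsProjective.iff_projective _).1 inferInstance
  have h2 := (LinearMap.shortExact_shortComplexKer (Submodule.mkQ_surjective I)).hasProjectiveDimensionLT_X₁ 2
    (inferInstanceAs (HasProjectiveDimensionLT (ModuleCat.of R R) (1 + 1))) h1
  let f : (Fin n → R) →ₗ[R] LinearMap.ker (Submodule.mkQ I) :=
    LinearMap.codRestrict _ (Fintype.linearCombination R x) (fun v => by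
      rw [Submodule.ker_mkQ, ← hx, Fintype.linearCombination_apply]
      exact Ideal.sum_mem _ fun i _ => Ideal.mul_mem_left _ _ (Ideal.subset_span ⟨i, rfl⟩))
  have hf : Function.Surjective f := by
    rintro ⟨z, hz⟩
    rw [Submodule.ker_mkQ, ← hx] at hz
    obtain ⟨c, hc⟩ := Ideal.mem_span_range_iff_exists_fun.1 hz
    exact ⟨c, Subtype.ext (by simpa [f, Fintype.linearCombination_apply] using hc)⟩
  have h3 := (LinearMap.shortExact_shortComplexKer hf).hasProjectiveDimensionLT_X₁ 1
    (inferInstanceAs (HasProjectiveDimensionLT (ModuleCat.of R (Fin n → R)) 1)) h2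
  have h4 : Module.Projective R (LinearMap.ker f) :=
    (IsProjective.iff_projective _).2 (projective_iff_hasProjectiveDimensionLT_one.2 h3)
  rwa [LinearMap.ker_codRestrict] at h4

variable [IsNoetherianRing R]

lemma len_le {rs : List R} (h : IsRegular R rs) (p : Ideal R) [p.IsPrime] (hp : ∀ x ∈ rs, x ∈ p) :
    (rs.length : ℕ∞) ≤ p.height := by
  have h1 := h.1.isRegular_of_isLocalization_of_mem (Localization.AtPrime p) p hp
  have h2 := ringKrullDim_add_length_eq_ringKrullDim_of_isRegular _ h1
  rw [IsLocalization.AtPrime.ringKrullDim_eq_height p (Localization.AtPrime p), List.length_map] at h2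
  have h3 : (0 : WithBot ℕ∞) ≤ ringKrullDim (Localization.AtPrime p ⧸ Ideal.ofList (rs.map (algebraMap R (Localization.AtPrime p)))) := by
    have : Nontrivial (Localization.AtPrime p ⧸ Ideal.ofList (rs.map (algebraMap R (Localization.AtPrime p)))) :=
      Ideal.Quotient.nontrivial_iff.2 fun e => h1.2 (by simp [e])
    exact ringKrullDim_nonneg_of_nontrivial
  have h4 := add_le_add_left h3 ((rs.length : ℕ) : WithBot ℕ∞)
  rw [h2, zero_add] at h4
  exact_mod_cast h4

lemma ht_le {I : Ideal R} (hht : ht I = ((2 : ℕ) : WithBot ℕ∞)) (p : Ideal R) (hp : p.IsPrime) (h : I ≤ p) :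
    ((2 : ℕ) : ℕ∞) ≤ p.height := by
  have h1 : ht I ≤ _ := iInf₂_le (⟨p, hp⟩ : PrimeSpectrum R) h
  rw [hht, rDim, IsLocalization.AtPrime.ringKrullDim_eq_height p (Localization.AtPrime p)] at h1
  exact WithBot.coe_le_coe.1 h1

lemma ht_ex {I : Ideal R} (hht : ht I = ((2 : ℕ) : WithBot ℕ∞)) : ∃ p : Ideal R, p.IsPrime ∧ I ≤ p ∧ p.height ≤ ((2 : ℕ) : ℕ∞) := by
  by_contra! hcon
  have h1 : ((3 : ℕ) : WithBot ℕ∞) ≤ ht I := by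
    refine le_iInf₂ fun p hp => ?_
    rw [rDim, IsLocalization.AtPrime.ringKrullDim_eq_height p.asIdeal (Localization.AtPrime p.asIdeal)]
    have : ((3 : ℕ) : ℕ∞) ≤ p.asIdeal.height := Order.add_one_le_of_lt (hcon p.asIdeal p.2 hp)
    exact WithBot.coe_le_coe.2 this
  rw [hht] at h1
  exact absurd (Nat.cast_le.1 h1) (by norm_num)

variable [IsLocalRing R]

lemma pd_two {I : Ideal R} (hP : IsPerfectIdeal I) (hht : ht I = ((2 : ℕ) : WithBot ℕ∞)) {y1 y2 : R} (hm : I ≤ maximalIdeal R)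
    (h1 : y1 ∈ I) (h2 : y2 ∈ I) (hy : IsWeaklyRegular R [y1, y2]) : ProjDimLE R 2 (R ⧸ I) := by
  obtain ⟨g, hg, hpd, -⟩ := hP
  obtain ⟨p, hp, hIp, hp2⟩ := ht_ex hht
  have e1 : grade I ≤ ((2 : ℕ) : ℕ∞) := sSup_le (by
    rintro _ ⟨rs, hrs, hreg, rfl⟩
    exact (len_le hreg p fun x hx => hIp (hrs x hx)).trans hp2)
  have e2 : ((2 : ℕ) : ℕ∞) ≤ grade I := le_sSup ⟨[y1, y2], by simp [h1, h2],
    IsRegular.of_isWeaklyRegular_of_mem_maximalIdeal _ (fun r hr => hm (by rcases List.mem_pair.1 hr with rfl | rfl <;> assumption)) hy, rfl⟩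
  rw [hg, Nat.cast_le] at e1 e2
  exact le_antisymm e1 e2 ▸ hpd

lemma pres_of {I : Ideal R} (h : ProjDimLE R 2 (R ⧸ I)) {n : ℕ} (x : Fin n → R) (hx : Ideal.span (Set.range x) = I)
    {a : R} (ha : a ∈ I) (hreg : IsSMulRegular R a) : Pres I := by
  have := syz_proj h x hx
  have : Module.Free R (Syz x) := Module.free_of_flat_of_isLocalRing
  obtain ⟨v0, hv0⟩ := Ideal.mem_span_range_iff_exists_fun.1 (hx ▸ ha : a ∈ Ideal.span (Set.range x))
  let π := Fintype.linearCombination R x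
  have hπ : π v0 = a := by simpa [π, Fintype.linearCombination_apply] using hv0
  have l1 : Module.finrank R (Syz x × R) ≤ Module.finrank R (Fin n → R) := by
    refine LinearMap.finrank_le_finrank_of_injective
      (f := (Syz x).subtype.coprod (LinearMap.toSpanSingleton R _ v0)) ((injective_iff_map_eq_zero _).2 ?_)
    rintro ⟨⟨s, hs⟩, c⟩ h0
    simp at h0
    have hc := congrArg π h0
    rw [map_add, map_smul, hπ, (hs : π s = 0), zero_add, map_zero, smul_eq_mul, mul_comm] at hc
    obtain rfl : c = 0 := hreg (by simpa using hc)
    rw [zero_smul, add_zero] at h0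
    simp [h0]
  have l2 : Module.finrank R (Fin n → R) ≤ Module.finrank R (Syz x × R) := by
    refine LinearMap.finrank_le_finrank_of_injective
      (f := (LinearMap.codRestrict (Syz x) (a • LinearMap.id - (LinearMap.toSpanSingleton R _ v0).comp π) (fun v => by
        change π _ = 0
        simp [hπ, mul_comm])).prod π) ((injective_iff_map_eq_zero _).2 fun v hv => ?_)
    have e1 := congrArg Prod.snd hv
    have e2 := congrArg (fun z => ((z.1 : Syz x) : Fin n → R)) hv
    change π v = 0 at e1
    change a • v - π v • v0 = 0 at e2
    rw [e1, zero_smul, sub_zero] at e2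
    ext i
    exact hreg (by simpa using congrFun e2 i)
  have hr := le_antisymm l1 l2
  rw [Module.finrank_prod, Module.finrank_self, Module.finrank_fin_fun] at hr
  obtain ⟨t, rfl⟩ : ∃ t, n = t + 1 := ⟨_, hr.symm⟩
  have B := (Module.finBasis R (Syz x)).reindex (finCongr (Nat.succ_injective hr))
  refine ⟨_, x, fun j => B j, hx, B.linearIndependent.map' (Syz x).subtype (by simp), ?_⟩
  have h2 := congrArg (Submodule.map (Syz x).subtype) B.span_eq
  rw [Submodule.map_span, Submodule.map_subtype_top, ← Set.range_comp] at h2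
  exact h2

lemma PG_of {I : Ideal R} {l : ℕ} (hG : Gcond I l) : PG I l 0 ⊥ := by
  refine ⟨bot_le, fun p hp hIp hpl => ?_, fun p _ _ _ => by simp⟩
  have h1 := hG ⟨p, hp⟩ hIp
  dsimp only at h1
  set A := Localization.AtPrime p with hA
  rw [rDim, IsLocalization.AtPrime.ringKrullDim_eq_height p A] at h1
  have h2 : muE (I.map (algebraMap R A)) ≤ p.height := by exact_mod_cast h1 (by exact_mod_cast hpl)
  obtain ⟨t, ht⟩ := ENat.ne_top_iff_exists.1 (ne_top_of_le_ne_top (Ideal.height_ne_top_of_isPrime) h2)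
  have hN : IsNoetherianRing A := IsLocalization.isNoetherianRing p.primeCompl A inferInstance
  obtain ⟨y', hy'⟩ := exists_of_muE ht.symm
  have h3 : ∀ i, ∃ z : I × p.primeCompl, y' i * algebraMap R A z.2 = algebraMap R A z.1 := fun i =>
    (IsLocalization.mem_map_algebraMap_iff p.primeCompl A).1 (hy' ▸ Ideal.subset_span ⟨i, rfl⟩)
  choose z hz using h3
  refine ⟨t, Or.inr (by rw [add_zero, ht]; exact h2), fun i => (z i).1, fun i => (z i).1.2, clear_fg fun w hw => ?_⟩
  rw [bot_sup_eq]
  have h4 : I.map (algebraMap R A) ≤ (Ideal.span (Set.range fun i => ((z i).1 : R))).map (algebraMap R A) := by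
    rw [← hy', Ideal.span_le]
    rintro _ ⟨i, rfl⟩
    refine ((Ideal.mul_unit_mem_iff_mem _ (IsLocalization.map_units A (z i).2))).1 ?_
    rw [hz]
    exact Ideal.mem_map_of_mem _ (Ideal.subset_span ⟨i, rfl⟩)
  obtain ⟨m, hm, h⟩ := (IsLocalization.algebraMap_mem_map_algebraMap_iff p.primeCompl A _ _).1 (h4 (Ideal.mem_map_of_mem _ hw))
  exact ⟨m, hm, h⟩

lemma two_le {I : Ideal R} (hk : Infinite (ResidueField R)) (hht : ht I = ((2 : ℕ) : WithBot ℕ∞)) {l : ℕ}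
    (hl : fiberDim I = (l : WithBot ℕ∞)) (hm : I ≤ maximalIdeal R) : 2 ≤ l := by
  obtain ⟨a, -, ha⟩ := red_contains hk hl (J0 := I) (I := I) ⟨le_rfl, 0, by simp⟩
  obtain ⟨p, hp, -⟩ := Ideal.exists_minimalPrimes_le (ha.1.trans hm)
  have := hp.1.1
  have h1 := ht_le hht p hp.1.1 (not_le_prime ha p hp.1.2)
  have h2 : p.height ≤ (l : ℕ∞) := by
    classical
    have e : Set.range a = (Finset.univ.image a : Finset R) := by simp
    rw [e] at hp
    refine (Ideal.height_le_card_of_mem_minimalPrimes_span_finset hp).trans ?_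
    exact_mod_cast (Finset.card_image_le).trans (by simp)
  exact_mod_cast h1.trans h2

lemma minors_eq {I : Ideal R} {N d m : ℕ} (hC : Ctx I N d) (φ : Matrix (Fin (d + (N + 2))) (Fin m) R)
    (hφ : Presents φ I) : minorsIdeal d φ = Fi I (d + (N + 2)) d := by
  obtain ⟨-, π, hπ, hker⟩ := hφ
  have hπx : ∀ v, π v = ∑ k, v k * π (Pi.single k 1) := fun v => by
    conv_lhs => rw [pi_eq_sum_univ' v]
    simp
  have hx : Ideal.span (Set.range fun k => π (Pi.single k 1)) = I := by
    rw [← hπ]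
    ext z
    rw [Ideal.mem_span_range_iff_exists_fun, LinearMap.mem_range]
    simp only [← hπx]
  apply le_antisymm
  · refine Ideal.span_le.2 ?_
    rintro _ ⟨r, c, rfl⟩
    refine mem_Fi (by simp) _ hx (fun j k => φ k (c j)) (fun j => ?_) r
    rw [← hπx, ← LinearMap.mem_ker, ← hker]
    exact ⟨Pi.single (c j) 1, by ext; simp⟩
  · refine Fi_le hC _ hx _ fun v hv r => ?_
    have h1 : ∀ j, ∃ u, Matrix.toLin' φ u = v j := fun j => by
      rw [← LinearMap.mem_range, hker, LinearMap.mem_ker, hπx, hv]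
    choose u hu using h1
    have := det_expand (minorsIdeal d φ) (fun i k => φ (r i) k) (fun s => by
      rw [← Matrix.det_transpose]
      exact Ideal.subset_span ⟨r, s, rfl⟩) (fun j => Fintype.linearCombination R (u j))
    rw [← Matrix.det_transpose] at this
    convert this using 2
    ext i j
    simp only [Matrix.of_apply, Matrix.transpose_apply, ← hu]
    simp [Fintype.linearCombination_apply, Matrix.mulVec, dotProduct]

lemma rn_iff {I : Ideal R} {N d : ℕ} (hC : Ctx I N d) : reductionNumber I ≤ ((N + 1 : ℕ) : ℕ∞) ↔
    core I = Fi I (d + (N + 2)) d * I := by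
  constructor
  · intro h
    have hne : {n : ℕ∞ | ∃ r : ℕ, (r : ℕ∞) = n ∧ ∃ J : Ideal R, IsMinimalReduction J I ∧ I ^ (r + 1) = J * I ^ r}.Nonempty := by
      obtain ⟨J, hJ⟩ := exists_min hC
      obtain ⟨r, hr⟩ := hJ.1.2
      exact ⟨r, r, rfl, J, hJ, hr⟩
    obtain ⟨r, hr, J, hJ, he⟩ := csInf_mem hne
    change (r : ℕ∞) = reductionNumber I at hr
    rw [← hr, Nat.cast_le] at h
    obtain ⟨k, hk⟩ := Nat.exists_eq_add_of_le h
    refine core_eq_of_red hC hJ ?_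
    rw [hk, show N + 2 = r + 1 + k by omega, pow_add, he, pow_add, mul_assoc]
  · intro h
    obtain ⟨J, hJ⟩ := exists_min hC
    exact sInf_le ⟨N + 1, rfl, J, hJ, red_of_core hC hJ h⟩

lemma main (hGor : IsGorensteinLocalRing R) (hres : Infinite (ResidueField R))
    (I : Ideal R) (hperf : IsPerfectIdeal I) (hht : ht I = ((2 : ℕ) : WithBot ℕ∞))
    (l : ℕ) (hl : fiberDim I = (l : WithBot ℕ∞)) (hG : Gcond I l)
    {n m : ℕ} (φ : Matrix (Fin n) (Fin m) R) (hφ : Presents φ I) :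
    (reductionNumber I ≤ ((l - 1 : ℕ) : ℕ∞) ↔ core I = minorsIdeal (n - l) φ * I) ∧
    (core I = minorsIdeal (n - l) φ * I →
      IsDomain R → IsIntegrallyClosed R → IsNormalIdeal I →
      IsIntClosedIdeal (minorsIdeal (n - l) φ) ∧ IsIntClosedIdeal (core I)) := by
  have hm : I ≤ maximalIdeal R := by
    obtain ⟨p, hp, hIp, -⟩ := ht_ex hht
    exact hIp.trans (le_maximalIdeal hp.ne_top)
  have hH := htReg_of_CM hGor.1
  obtain ⟨ys, hlen, hys, hreg⟩ := hH I 2 (ht_le hht)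
  obtain ⟨y1, y2, rfl⟩ := List.length_eq_two.1 hlen
  obtain ⟨x, hx⟩ := exists_of_muE hφ.1
  have hP : Pres I := pres_of (pd_two hperf hht hm (hys _ (by simp)) (hys _ (by simp)) hreg) x hx (hys y1 (by simp))
    ((isWeaklyRegular_cons_iff R y1 _).1 hreg).1
  obtain ⟨N, rfl⟩ := Nat.exists_eq_add_of_le' (two_le hres hht hl hm)
  obtain ⟨d, rfl⟩ := Nat.exists_eq_add_of_le' (fd_lower hl x ⟨hx.le, 0, by simp [hx]⟩)
  have hC : Ctx I N d := ⟨hres, hl, hP, PG_of hG, hH, hm, hφ.1⟩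
  rw [Nat.add_sub_cancel, minors_eq hC φ hφ]
  exact ⟨rn_iff hC, fun h _ _ hI => normality hC hI h⟩

end G1
end

/-- Corollary 3.4: for a perfect ideal of height two with `G_ℓ` in a local Gorenstein
ring with infinite residue field, the reduction number is at most `ℓ - 1` iff
`core I = I_{n-ℓ}(φ)·I`; and under normality the relevant ideals are integrally
closed. -/
theorem statement10 {R : Type u} [CommRing R] [IsNoetherianRing R] [IsLocalRing R]
    (hGor : IsGorensteinLocalRing R) (hres : Infinite (ResidueField R))
    (I : Ideal R) (hperf : IsPerfectIdeal I) (hht : ht I = ((2 : ℕ) : WithBot ℕ∞))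
    (l : ℕ) (hl : fiberDim I = (l : WithBot ℕ∞)) (hG : Gcond I l)
    {n m : ℕ} (φ : Matrix (Fin n) (Fin m) R) (hφ : Presents φ I) :
    (reductionNumber I ≤ ((l - 1 : ℕ) : ℕ∞) ↔ core I = minorsIdeal (n - l) φ * I) ∧
    (core I = minorsIdeal (n - l) φ * I →
      IsDomain R → IsIntegrallyClosed R → IsNormalIdeal I →
      IsIntClosedIdeal (minorsIdeal (n - l) φ) ∧ IsIntClosedIdeal (core I)) := by
  exact main hGor hres I hperf hht l hl hG φ hφ

end CPU
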